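/- If a connected closed 3-manifold M admits a quasi-filling Dehn surface Σ that is an embedded surface (has no singular points), then Σ is homeomorphic to the 2-sphere or the projective plane, and correspondingly M is homeomorphic to S³ or to RP³. -/

import Mathlib

open Set Topology unitInterval

noncomputable section

/-! ### Basic model spaces -/

abbrev R3 : Type := Fin 3 → ℝ
abbrev R2 : Type := Fin 2 → ℝ
abbrev EuclSp (n : ℕ) : Type := EuclideanSpace ℝ (Fin n)

/-- The union of the first `k` coordinate planes in `ℝ³`:
the local models for simple (`k = 1`), double (`k = 2`) and triple (`k = 3`) points. -/
def coordPlanes (k : ℕ) : Set R3 := {x | ∃ i : Fin 3, (i : ℕ) < k ∧ x i = 0}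

abbrev Sphere3 : Type := ↥(Metric.sphere (0 : EuclSp 4) 1)
abbrev Sphere2 : Type := ↥(Metric.sphere (0 : EuclSp 3) 1)
abbrev Circle1 : Type := ↥(Metric.sphere (0 : EuclSp 2) 1)

/-- The antipodal relation on the `n`-sphere. -/
def antipodalRel (n : ℕ) (x y : Metric.sphere (0 : EuclSp (n + 1)) 1) : Prop :=
  (y : EuclSp (n + 1)) = -(x : EuclSp (n + 1))

/-- Real projective `n`-space, as the quotient of the `n`-sphere by the antipodal map. -/
abbrev RP (n : ℕ) : Type := Quot (antipodalRel n)

/-- The unit sphere of `ℂ²`, i.e. the 3-sphere. -/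
abbrev SphereC : Type := Metric.sphere (0 : EuclideanSpace ℂ (Fin 2)) 1

/-- The relation on `S³ ⊆ ℂ²` generating the lens space `L(p,q)`:
`(z₀, z₁) ∼ (ζ z₀, ζ^q z₁)` for `ζ` a `p`-th root of unity. -/
def lensRel (p q : ℕ) (x y : SphereC) : Prop :=
  ∃ k : ℕ,
    (y : EuclideanSpace ℂ (Fin 2)) 0 =
      Complex.exp (2 * Real.pi * Complex.I * k / p) * (x : EuclideanSpace ℂ (Fin 2)) 0 ∧
    (y : EuclideanSpace ℂ (Fin 2)) 1 =
      Complex.exp (2 * Real.pi * Complex.I * (k * q) / p) * (x : EuclideanSpace ℂ (Fin 2)) 1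

/-- The lens space `L(p,q)`. -/
abbrev Lens (p q : ℕ) : Type := Quot (lensRel p q)

/-- The relation generating the twisted bundle `S² ×~ S¹` as a mapping torus of the
antipodal map of `S²`. -/
def twistRel (a b : ↥(Metric.sphere (0 : EuclSp 3) 1) × ℝ) : Prop :=
  ((b.1 : EuclSp 3) = -(a.1 : EuclSp 3)) ∧ b.2 = a.2 + 1

/-- The twisted 2-sphere bundle over the circle, `S² ×~ S¹`. -/
abbrev TwistedS2S1 : Type := Quot twistRel

/-! ### Dehn surfaces -/

/-- `x` has a neighbourhood `U` in `M` in which `Sg` looks like the union of the first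
`k` coordinate planes of `ℝ³`, with `x` corresponding to the origin.  This is the local
model of a point of a Dehn surface with `k` sheets (transversality). -/
def LocalSheets (M : Type) [TopologicalSpace M] (Sg : Set M) (k : ℕ) (x : M) : Prop :=
  ∃ (U : Set M) (_ : IsOpen U) (hx : x ∈ U) (φ : ↥U ≃ₜ R3),
    φ ⟨x, hx⟩ = 0 ∧ (Subtype.val ⁻¹' Sg : Set U) = ⇑φ ⁻¹' coordPlanes k

/-- A Dehn surface in `M`: the image of a transverse immersion of a (possibly disconnected)
closed surface, described via its local models: every point is simple, double or triple. -/
def IsDehnSurface (M : Type) [TopologicalSpace M] (Sg : Set M) : Prop :=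
  IsClosed Sg ∧ Sg.Nonempty ∧ ∀ x ∈ Sg, ∃ k, 1 ≤ k ∧ k ≤ 3 ∧ LocalSheets M Sg k x

/-- The set of triple points of a Dehn surface. -/
def triplePoints (M : Type) [TopologicalSpace M] (Sg : Set M) : Set M :=
  {x | x ∈ Sg ∧ LocalSheets M Sg 3 x}

/-- The set of simple (non-singular) points of a Dehn surface. -/
def simplePoints (M : Type) [TopologicalSpace M] (Sg : Set M) : Set M :=
  {x | x ∈ Sg ∧ LocalSheets M Sg 1 x}

/-- The singular set `S(Σ)` of a Dehn surface: its non-simple points. -/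
def singularSet (M : Type) [TopologicalSpace M] (Sg : Set M) : Set M :=
  Sg \ simplePoints M Sg

/-- Every connected component of `s` is homeomorphic to the model space `T`. -/
def ComponentsHomeo (M : Type) [TopologicalSpace M] (s : Set M) (T : Type)
    [TopologicalSpace T] : Prop :=
  ∀ x ∈ s, Nonempty (↥(connectedComponentIn s x) ≃ₜ T)

/-- A quasi-filling Dehn surface: a Dehn surface whose complement is made up of
(open) balls. -/
def QuasiFilling (M : Type) [TopologicalSpace M] (Sg : Set M) : Prop :=
  IsDehnSurface M Sg ∧ ComponentsHomeo M Sgᶜ R3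

/-- A filling Dehn surface: its singularities induce a cell decomposition of `M`. -/
def Filling (M : Type) [TopologicalSpace M] (Sg : Set M) : Prop :=
  QuasiFilling M Sg ∧ (triplePoints M Sg).Nonempty ∧
  ComponentsHomeo M (singularSet M Sg \ triplePoints M Sg) ℝ ∧
  ComponentsHomeo M (Sg \ singularSet M Sg) R2

/-- The surface-complexity: the minimal number of triple points of a quasi-filling
Dehn surface of `M`. -/
def sc (M : Type) [TopologicalSpace M] : ℕ :=
  sInf {n | ∃ Sg : Set M, QuasiFilling M Sg ∧ (triplePoints M Sg).ncard = n}

/-! ### Embedded surfaces and `P²`-irreducibility -/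

/-- An embedded closed surface in `M` (a Dehn surface all of whose points are simple). -/
def IsEmbeddedClosedSurface (M : Type) [TopologicalSpace M] (F : Set M) : Prop :=
  IsClosed F ∧ F.Nonempty ∧ ∀ x ∈ F, LocalSheets M F 1 x

/-- The surface `F` bounds a ball in `M`. -/
def BoundsABall (M : Type) [TopologicalSpace M] (F : Set M) : Prop :=
  ∃ B : Set M, IsClosed B ∧ frontier B = F ∧
    Nonempty (↥B ≃ₜ ↥(Metric.closedBall (0 : EuclSp 3) 1))

/-- The surface `F` is two-sided in `M` (it has a product neighbourhood). -/
def TwoSided (M : Type) [TopologicalSpace M] (F : Set M) : Prop :=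
  ∃ U : Set M, IsOpen U ∧ F ⊆ U ∧ Nonempty (↥U ≃ₜ ↥F × ℝ)

/-- `M` is `P²`-irreducible: every embedded 2-sphere bounds a ball and `M` contains no
two-sided embedded projective plane. -/
def P2Irreducible (M : Type) [TopologicalSpace M] : Prop :=
  (∀ F : Set M, IsEmbeddedClosedSurface M F → Nonempty (↥F ≃ₜ Sphere2) → BoundsABall M F) ∧
  (∀ F : Set M, IsEmbeddedClosedSurface M F → TwoSided M F → ¬ Nonempty (↥F ≃ₜ RP 2))

end
/-! ### Bubble moves -/

noncomputable section

/-- The local model of the result of a bubble-move: a plane together with a small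
sphere centred at one of its points, meeting it in one circle. -/
def bubbleModel : Set R3 := coordPlanes 1 ∪ Metric.sphere (0 : R3) 1

/-- `Sg'` is obtained from `Sg` by a bubble-move performed inside the open set `U`:
inside `U` a small disc around a simple point is replaced by the bubble model, and
nothing changes outside `U`. -/
def BubbleMoveIn (M : Type) [TopologicalSpace M] (U : Set M) (Sg Sg' : Set M) : Prop :=
  ∃ (_ : IsOpen U) (φ : ↥U ≃ₜ R3),
    (Subtype.val ⁻¹' Sg : Set U) = ⇑φ ⁻¹' coordPlanes 1 ∧
    (Subtype.val ⁻¹' Sg' : Set U) = ⇑φ ⁻¹' bubbleModel ∧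
    Sg' \ U = Sg \ U

/-- `Sg'` is obtained from `Sg` by one bubble-move. -/
def BubbleMove (M : Type) [TopologicalSpace M] (Sg Sg' : Set M) : Prop :=
  ∃ U : Set M, BubbleMoveIn M U Sg Sg'

/-- `Sg` is derived from `Sg₀` by a finite sequence of bubble-moves. -/
def DerivedFrom (M : Type) [TopologicalSpace M] (Sg₀ Sg : Set M) : Prop :=
  Relation.ReflTransGen (BubbleMove M) Sg₀ Sg

/-- A bubble-move avoiding (not involving) the set `D`. -/
def BubbleMoveAvoiding (M : Type) [TopologicalSpace M] (D : Set M) (Sg Sg' : Set M) : Prop :=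
  ∃ U : Set M, Disjoint U D ∧ BubbleMoveIn M U Sg Sg'

/-- `Sg` is derived from `Sg₀` by finitely many bubble-moves, none of which involves `D`. -/
def DerivedFromAvoiding (M : Type) [TopologicalSpace M] (D Sg₀ Sg : Set M) : Prop :=
  Relation.ReflTransGen (BubbleMoveAvoiding M D) Sg₀ Sg

/-! ### Connected sums -/

/-- `N` is a connected sum of `M₁` and `M₂`: it is covered by two closed pieces, glued
along a 2-sphere, respectively homeomorphic to the complements of open balls in `M₁`
and in `M₂`. -/
def IsConnSum (N : Type) [TopologicalSpace N] (M₁ : Type) [TopologicalSpace M₁]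
    (M₂ : Type) [TopologicalSpace M₂] : Prop :=
  ∃ (B₁ : Set M₁) (B₂ : Set M₂) (A₁ A₂ : Set N),
    Nonempty (↥B₁ ≃ₜ ↥(Metric.closedBall (0 : EuclSp 3) 1)) ∧
    Nonempty (↥B₂ ≃ₜ ↥(Metric.closedBall (0 : EuclSp 3) 1)) ∧
    IsClosed A₁ ∧ IsClosed A₂ ∧ A₁ ∪ A₂ = Set.univ ∧
    A₁ ∩ A₂ = frontier A₁ ∧ A₁ ∩ A₂ = frontier A₂ ∧
    Nonempty (↥(A₁ ∩ A₂) ≃ₜ Sphere2) ∧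
    Nonempty (↥A₁ ≃ₜ ↥((interior B₁)ᶜ : Set M₁)) ∧
    Nonempty (↥A₂ ≃ₜ ↥((interior B₂)ᶜ : Set M₂))

/-- `N` is the connected sum of the manifolds `Ms 0, …, Ms n`. -/
def IsConnSumMulti : (n : ℕ) → (Ms : Fin (n + 1) → Type) →
    (tms : ∀ i, TopologicalSpace (Ms i)) → (N : Type) → TopologicalSpace N → Prop
  | 0, Ms, tms, N, tN => Nonempty (@Homeomorph N (Ms 0) tN (tms 0))
  | (n + 1), Ms, tms, N, tN =>
    ∃ (P : Type) (tP : TopologicalSpace P),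
      IsConnSumMulti n (fun i => Ms i.castSucc) (fun i => tms i.castSucc) P tP ∧
      @IsConnSum N tN P tP (Ms (Fin.last (n + 1))) (tms (Fin.last (n + 1)))

end
/-! ### Cubulations and triangulations -/

noncomputable section

abbrev ICube : Type := Fin 3 → ↥unitInterval
abbrev ISquare : Type := Fin 2 → ↥unitInterval
abbrev ISeg : Type := Fin 1 → ↥unitInterval

/-- The open `n`-cube inside the closed one. -/
def openCell (n : ℕ) : Set (Fin n → ↥unitInterval) := {x | ∀ i, x i ≠ 0 ∧ x i ≠ 1}

/-- A cubulation of `M`: a cell decomposition whose 3-cells are cubes, each glued along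
6 faces arranged like the boundary of a cube, each face being glued along 4 edges
(self-adjacencies and multiple adjacencies are allowed).  Cells are given by
characteristic maps which are injective on the open cells, the open cells partition `M`,
and the boundary of every cell is attached through cells of lower dimension. -/
structure Cubulation (M : Type) [TopologicalSpace M] where
  nc : ℕ
  nf : ℕ
  ne : ℕ
  nv : ℕ
  cmap : Fin nc → C(ICube, M)
  fmap : Fin nf → C(ISquare, M)
  emap : Fin ne → C(ISeg, M)
  vmap : Fin nv → M
  cube_injOn : ∀ i, Set.InjOn (cmap i) (openCell 3)
  face_injOn : ∀ i, Set.InjOn (fmap i) (openCell 2)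
  edge_injOn : ∀ i, Set.InjOn (emap i) (openCell 1)
  vert_inj : Function.Injective vmap
  cells_cover : ∀ x : M, (∃ i, x ∈ cmap i '' openCell 3) ∨ (∃ i, x ∈ fmap i '' openCell 2) ∨
      (∃ i, x ∈ emap i '' openCell 1) ∨ (∃ i, x = vmap i)
  cube_disj : ∀ i j, i ≠ j → Disjoint (cmap i '' openCell 3) (cmap j '' openCell 3)
  face_disj : ∀ i j, i ≠ j → Disjoint (fmap i '' openCell 2) (fmap j '' openCell 2)
  edge_disj : ∀ i j, i ≠ j → Disjoint (emap i '' openCell 1) (emap j '' openCell 1)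
  cube_face_disj : ∀ i j, Disjoint (cmap i '' openCell 3) (fmap j '' openCell 2)
  cube_edge_disj : ∀ i j, Disjoint (cmap i '' openCell 3) (emap j '' openCell 1)
  cube_vert_disj : ∀ i j, vmap j ∉ cmap i '' openCell 3
  face_edge_disj : ∀ i j, Disjoint (fmap i '' openCell 2) (emap j '' openCell 1)
  face_vert_disj : ∀ i j, vmap j ∉ fmap i '' openCell 2
  edge_vert_disj : ∀ i j, vmap j ∉ emap i '' openCell 1
  cube_open : ∀ i, IsOpen (cmap i '' openCell 3)
  face_of_cube : ∀ (i : Fin nc) (d : Fin 3) (ε : Bool),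
      ∃ (j : Fin nf) (h : ISquare ≃ₜ ISquare),
        ∀ x : ISquare, cmap i (d.insertNth (if ε then 1 else 0) x) = fmap j (h x)
  edge_of_face : ∀ (i : Fin nf) (d : Fin 2) (ε : Bool),
      ∃ (j : Fin ne) (h : ISeg ≃ₜ ISeg),
        ∀ x : ISeg, fmap i (d.insertNth (if ε then 1 else 0) x) = emap j (h x)
  vert_of_edge : ∀ (i : Fin ne) (ε : Bool), ∃ j : Fin nv,
      emap i (fun _ => if ε then 1 else 0) = vmap j

/-- The interior of the standard simplex. -/
def simplexInt (n : ℕ) : Set ↥(stdSimplex ℝ (Fin n)) := {x | ∀ i, (x : Fin n → ℝ) i ≠ 0}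

/-- A triangulation of a closed 3-manifold `M`, by characteristic maps of tetrahedra,
triangles, edges and vertices: maps are injective on open cells, open cells partition `M`,
and each face of each cell is a cell of lower dimension. -/
structure Triangulation (M : Type) [TopologicalSpace M] where
  nt : ℕ
  nf : ℕ
  ne : ℕ
  nv : ℕ
  tmap : Fin nt → C(↥(stdSimplex ℝ (Fin 4)), M)
  fmap : Fin nf → C(↥(stdSimplex ℝ (Fin 3)), M)
  emap : Fin ne → C(↥(stdSimplex ℝ (Fin 2)), M)
  vmap : Fin nv → M
  t_injOn : ∀ i, Set.InjOn (tmap i) (simplexInt 4)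
  f_injOn : ∀ i, Set.InjOn (fmap i) (simplexInt 3)
  e_injOn : ∀ i, Set.InjOn (emap i) (simplexInt 2)
  v_inj : Function.Injective vmap
  cells_cover : ∀ x : M, (∃ i, x ∈ tmap i '' simplexInt 4) ∨ (∃ i, x ∈ fmap i '' simplexInt 3) ∨
      (∃ i, x ∈ emap i '' simplexInt 2) ∨ (∃ i, x = vmap i)
  t_disj : ∀ i j, i ≠ j → Disjoint (tmap i '' simplexInt 4) (tmap j '' simplexInt 4)
  f_disj : ∀ i j, i ≠ j → Disjoint (fmap i '' simplexInt 3) (fmap j '' simplexInt 3)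
  e_disj : ∀ i j, i ≠ j → Disjoint (emap i '' simplexInt 2) (emap j '' simplexInt 2)
  tf_disj : ∀ i j, Disjoint (tmap i '' simplexInt 4) (fmap j '' simplexInt 3)
  te_disj : ∀ i j, Disjoint (tmap i '' simplexInt 4) (emap j '' simplexInt 2)
  tv_disj : ∀ i j, vmap j ∉ tmap i '' simplexInt 4
  fe_disj : ∀ i j, Disjoint (fmap i '' simplexInt 3) (emap j '' simplexInt 2)
  fv_disj : ∀ i j, vmap j ∉ fmap i '' simplexInt 3
  ev_disj : ∀ i j, vmap j ∉ emap i '' simplexInt 2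
  t_open : ∀ i, IsOpen (tmap i '' simplexInt 4)
  face_t : ∀ (i : Fin nt) (d : Fin 4), ∃ j : Fin nf,
      tmap i '' {x | (x : Fin 4 → ℝ) d = 0} = Set.range (fmap j)
  face_f : ∀ (i : Fin nf) (d : Fin 3), ∃ j : Fin ne,
      fmap i '' {x | (x : Fin 3 → ℝ) d = 0} = Set.range (emap j)
  face_e : ∀ (i : Fin ne) (d : Fin 2), ∃ j : Fin nv,
      emap i '' {x | (x : Fin 2 → ℝ) d = 0} = {vmap j}

end
/-! ### Simple spines and Matveev complexity -/

noncomputable section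

/-- Local model: a plane. -/
def planeModel : Set R3 := {x | x 0 = 0}

/-- Local model: a line. -/
def lineModel : Set R3 := {x | x 0 = 0 ∧ x 1 = 0}

/-- Local model: a point. -/
def pointModel : Set R3 := {(0 : R3)}

/-- Local model: a triple line (three half-planes meeting along a line). -/
def tripleLineModel : Set R3 :=
  {x | (0 ≤ x 0 ∧ x 1 = 0) ∨ (x 0 ≤ 0 ∧ x 1 = x 0) ∨ (x 0 ≤ 0 ∧ x 1 = -x 0)}

/-- The vertices of a regular tetrahedron. -/
def tetraVert : Fin 4 → R3 := ![![1, 1, 1], ![1, -1, -1], ![-1, 1, -1], ![-1, -1, 1]]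

/-- Local model of a vertex of a simple polyhedron: the cone over the 1-skeleton of a
tetrahedron. -/
def spineVertexModel : Set R3 :=
  {x | ∃ i j : Fin 4, i ≠ j ∧ ∃ t : ℝ, 0 ≤ t ∧
    ∃ y ∈ segment ℝ (tetraVert i) (tetraVert j), x = t • y}

/-- `P` looks like the model set `model ⊆ ℝ³` near `x`. -/
def LocalSpineModel (M : Type) [TopologicalSpace M] (P : Set M) (model : Set R3)
    (x : M) : Prop :=
  ∃ (U : Set M) (_ : IsOpen U) (hx : x ∈ U) (φ : ↥U ≃ₜ R3),
    φ ⟨x, hx⟩ = 0 ∧ (Subtype.val ⁻¹' P : Set U) = ⇑φ ⁻¹' model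

/-- A simple polyhedron: the link of every point embeds in the 1-skeleton of the
tetrahedron; equivalently every point has one of the standard local models. -/
def IsSimplePolyhedron (M : Type) [TopologicalSpace M] (P : Set M) : Prop :=
  IsClosed P ∧ P.Nonempty ∧ ∀ x ∈ P,
    LocalSpineModel M P planeModel x ∨ LocalSpineModel M P tripleLineModel x ∨
    LocalSpineModel M P spineVertexModel x ∨ LocalSpineModel M P lineModel x ∨
    LocalSpineModel M P pointModel x

/-- A simple spine of a closed manifold `M`: a simple polyhedron whose complement is
one open ball. -/
def IsSimpleSpine (M : Type) [TopologicalSpace M] (P : Set M) : Prop :=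
  IsSimplePolyhedron M P ∧ IsConnected Pᶜ ∧ ComponentsHomeo M Pᶜ R3

/-- The vertices of a simple polyhedron. -/
def spineVertices (M : Type) [TopologicalSpace M] (P : Set M) : Set M :=
  {x | x ∈ P ∧ LocalSpineModel M P spineVertexModel x}

/-- The Matveev complexity: the minimal number of vertices of a simple spine of `M`. -/
def matveevComplexity (M : Type) [TopologicalSpace M] : ℕ :=
  sInf {n | ∃ P : Set M, IsSimpleSpine M P ∧ (spineVertices M P).ncard = n}

/-! ### Dehn loops on surfaces and loop-complexity -/

/-- The union of the first `k` coordinate lines in `ℝ²`. -/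
def coordLines (k : ℕ) : Set R2 := {x | ∃ i : Fin 2, (i : ℕ) < k ∧ x i = 0}

/-- Local model of a point of a Dehn loop with `k` strands. -/
def LocalStrands (S : Type) [TopologicalSpace S] (G : Set S) (k : ℕ) (x : S) : Prop :=
  ∃ (U : Set S) (_ : IsOpen U) (hx : x ∈ U) (φ : ↥U ≃ₜ R2),
    φ ⟨x, hx⟩ = 0 ∧ (Subtype.val ⁻¹' G : Set U) = ⇑φ ⁻¹' coordLines k

/-- A Dehn loop in the surface `S`: the image of a transverse immersion of a disjoint
union of circles; every point is smooth or a crossing point. -/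
def IsDehnLoop (S : Type) [TopologicalSpace S] (G : Set S) : Prop :=
  IsClosed G ∧ G.Nonempty ∧ ∀ x ∈ G, ∃ k, 1 ≤ k ∧ k ≤ 2 ∧ LocalStrands S G k x

/-- The crossing points of a Dehn loop. -/
def crossingPoints (S : Type) [TopologicalSpace S] (G : Set S) : Set S :=
  {x | x ∈ G ∧ LocalStrands S G 2 x}

/-- A quasi-filling Dehn loop: its complement consists of open discs. -/
def QuasiFillingLoop (S : Type) [TopologicalSpace S] (G : Set S) : Prop :=
  IsDehnLoop S G ∧ ComponentsHomeo S Gᶜ R2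

/-- The loop-complexity of a surface: the minimal number of crossing points of a
quasi-filling Dehn loop. -/
def lc (S : Type) [TopologicalSpace S] : ℕ :=
  sInf {n | ∃ G : Set S, QuasiFillingLoop S G ∧ (crossingPoints S G).ncard = n}

/-- Connected sum of surfaces. -/
def IsConnSum2 (N : Type) [TopologicalSpace N] (M₁ : Type) [TopologicalSpace M₁]
    (M₂ : Type) [TopologicalSpace M₂] : Prop :=
  ∃ (B₁ : Set M₁) (B₂ : Set M₂) (A₁ A₂ : Set N),
    Nonempty (↥B₁ ≃ₜ ↥(Metric.closedBall (0 : EuclSp 2) 1)) ∧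
    Nonempty (↥B₂ ≃ₜ ↥(Metric.closedBall (0 : EuclSp 2) 1)) ∧
    IsClosed A₁ ∧ IsClosed A₂ ∧ A₁ ∪ A₂ = Set.univ ∧
    A₁ ∩ A₂ = frontier A₁ ∧ A₁ ∩ A₂ = frontier A₂ ∧
    Nonempty (↥(A₁ ∩ A₂) ≃ₜ Circle1) ∧
    Nonempty (↥A₁ ≃ₜ ↥((interior B₁)ᶜ : Set M₁)) ∧
    Nonempty (↥A₂ ≃ₜ ↥((interior B₂)ᶜ : Set M₂))

/-- The 2-torus. -/
abbrev Torus2 : Type := Circle1 × Circle1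

/-- `S` is the closed orientable surface of genus `g` (a connected sum of `g` tori). -/
def IsOrientableSurfaceOfGenus : (g : ℕ) → (S : Type) → TopologicalSpace S → Prop
  | 0, S, tS => Nonempty (@Homeomorph S Sphere2 tS _)
  | (g + 1), S, tS =>
    ∃ (P : Type) (tP : TopologicalSpace P),
      IsOrientableSurfaceOfGenus g P tP ∧ @IsConnSum2 S tS P tP Torus2 _

/-- `S` is the closed non-orientable surface of genus `g ≥ 1` (a connected sum of `g`
projective planes). -/
def IsNonorientableSurfaceOfGenus : (g : ℕ) → (S : Type) → TopologicalSpace S → Prop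
  | 0, _, _ => False
  | 1, S, tS => Nonempty (@Homeomorph S (RP 2) tS _)
  | (g + 2), S, tS =>
    ∃ (P : Type) (tP : TopologicalSpace P),
      IsNonorientableSurfaceOfGenus (g + 1) P tP ∧ @IsConnSum2 S tS P tP (RP 2) _

end
/-! ### Special quasi-filling Dehn surfaces -/

noncomputable section

/-- `Sg` is a double projective plane: two embedded projective planes intersecting
along a loop which is non-contractible in both of them. -/
def IsDoubleRP2 (M : Type) [TopologicalSpace M] (Sg : Set M) : Prop :=
  ∃ P₁ P₂ : Set M, Sg = P₁ ∪ P₂ ∧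
    Nonempty (↥P₁ ≃ₜ RP 2) ∧ Nonempty (↥P₂ ≃ₜ RP 2) ∧
    Nonempty (↥(P₁ ∩ P₂) ≃ₜ Circle1) ∧
    (¬ ∃ y : ↥P₁, (⟨Set.inclusion Set.inter_subset_left,
        continuous_inclusion Set.inter_subset_left⟩ : C(↥(P₁ ∩ P₂), ↥P₁)).Homotopic
      (ContinuousMap.const _ y)) ∧
    (¬ ∃ y : ↥P₂, (⟨Set.inclusion Set.inter_subset_right,
        continuous_inclusion Set.inter_subset_right⟩ : C(↥(P₁ ∩ P₂), ↥P₂)).Homotopic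
      (ContinuousMap.const _ y))

/-- `Sg` is a quadruple hat: the image of a disc whose boundary is glued four times
along an embedded circle. -/
def IsQuadrupleHat (M : Type) [TopologicalSpace M] (Sg : Set M) : Prop :=
  ∃ (g : C(↥(Metric.closedBall (0 : ℂ) 1), M)) (h : C(↥(Metric.sphere (0 : ℂ) 1), M)),
    Sg = Set.range g ∧ Function.Injective h ∧
    Set.InjOn g {z : ↥(Metric.closedBall (0 : ℂ) 1) | ‖(z : ℂ)‖ < 1} ∧
    ∀ (z : ℂ) (hz : z ∈ Metric.closedBall (0 : ℂ) 1) (h1 : ‖z‖ = 1),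
      g ⟨z, hz⟩ = h ⟨z ^ 4, by simp [mem_sphere_zero_iff_norm, norm_pow, h1]⟩

/-! ### Heegaard splittings -/

/-- A Heegaard splitting of `M` of genus `g`, together with systems of meridian discs
for both handlebodies: cutting the interior of each handlebody along its meridian discs
gives an open ball. -/
structure HeegaardSplitting (M : Type) [TopologicalSpace M] where
  A : Fin 2 → Set M
  g : ℕ
  D : Fin 2 → Fin g → Set M
  closedA : ∀ j, IsClosed (A j)
  coverA : A 0 ∪ A 1 = Set.univ
  interA0 : A 0 ∩ A 1 = frontier (A 0)
  interA1 : A 0 ∩ A 1 = frontier (A 1)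
  discSub : ∀ j i, D j i ⊆ A j
  discClosed : ∀ j i, IsClosed (D j i)
  discHomeo : ∀ j i, Nonempty (↥(D j i) ≃ₜ ↥(Metric.closedBall (0 : EuclSp 2) 1))
  discDisj : ∀ j, ∀ i i', i ≠ i' → Disjoint (D j i) (D j i')
  meridianCircle : ∀ j i, Nonempty (↥(D j i ∩ (A 0 ∩ A 1)) ≃ₜ Circle1)
  cutBall : ∀ j, Nonempty (↥(interior (A j) \ ⋃ i, D j i) ≃ₜ R3)

/-- The meridian curves of a Heegaard splitting. -/
def HeegaardSplitting.meridian {M : Type} [TopologicalSpace M] (H : HeegaardSplitting M)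
    (j : Fin 2) (i : Fin H.g) : Set M :=
  H.D j i ∩ (H.A 0 ∩ H.A 1)

/-! ### Link diagrams and Dehn surgery -/

/-- Projection to the first two coordinates. -/
def prj (p : R3) : R2 := fun k => p k.castSucc

/-- `u` and `v` are linearly independent in the plane. -/
def det2 (u v : R2) : ℝ := u 0 * v 1 - u 1 * v 0

/-- A link in `ℝ³ ⊆ S³` in regular position with respect to the vertical projection:
`c` components, parametrised periodically and injectively, with regular projection,
at most double points, and transverse crossings. -/
structure LinkDiagram (c : ℕ) where
  γ : Fin c → ℝ → R3
  smooth : ∀ i, ContDiff ℝ 1 (γ i)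
  periodic : ∀ i t, γ i (t + 1) = γ i t
  inj : ∀ i j s t, s ∈ Set.Ico (0 : ℝ) 1 → t ∈ Set.Ico (0 : ℝ) 1 → γ i s = γ j t →
      i = j ∧ s = t
  regular : ∀ i t, prj (deriv (γ i) t) ≠ 0
  atMostTwo : ∀ q : R2,
      {p : Fin c × ℝ | p.2 ∈ Set.Ico (0 : ℝ) 1 ∧ prj (γ p.1 p.2) = q}.ncard ≤ 2
  transverse : ∀ i s j t, s ∈ Set.Ico (0 : ℝ) 1 → t ∈ Set.Ico (0 : ℝ) 1 →
      (i, s) ≠ (j, t) → prj (γ i s) = prj (γ j t) →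
      det2 (prj (deriv (γ i) s)) (prj (deriv (γ j) t)) ≠ 0

/-- The crossing points of the projection of a link diagram. -/
def LinkDiagram.crossings {c : ℕ} (L : LinkDiagram c) : Set R2 :=
  {q | ∃ i s j t, s ∈ Set.Ico (0 : ℝ) 1 ∧ t ∈ Set.Ico (0 : ℝ) 1 ∧
    ((i, s) : Fin c × ℝ) ≠ (j, t) ∧ prj (L.γ i s) = q ∧ prj (L.γ j t) = q}

/-- The component `i` contains an overpass: at some crossing it is the over-strand. -/
def LinkDiagram.hasOverpass {c : ℕ} (L : LinkDiagram c) (i : Fin c) : Prop :=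
  ∃ s j t, s ∈ Set.Ico (0 : ℝ) 1 ∧ t ∈ Set.Ico (0 : ℝ) 1 ∧
    ((i, s) : Fin c × ℝ) ≠ (j, t) ∧ prj (L.γ i s) = prj (L.γ j t) ∧
    L.γ j t 2 < L.γ i s 2

/-- The writhe (blackboard framing) of component `i`: the algebraic count of its
self-crossings. -/
def LinkDiagram.writhe {c : ℕ} (L : LinkDiagram c) (i : Fin c) : ℤ :=
  ({st : ℝ × ℝ | st.1 ∈ Set.Ico (0 : ℝ) 1 ∧ st.2 ∈ Set.Ico (0 : ℝ) 1 ∧ st.1 ≠ st.2 ∧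
      prj (L.γ i st.1) = prj (L.γ i st.2) ∧ L.γ i st.2 2 < L.γ i st.1 2 ∧
      0 < det2 (prj (deriv (L.γ i) st.1)) (prj (deriv (L.γ i) st.2))}.ncard : ℤ) -
  ({st : ℝ × ℝ | st.1 ∈ Set.Ico (0 : ℝ) 1 ∧ st.2 ∈ Set.Ico (0 : ℝ) 1 ∧ st.1 ≠ st.2 ∧
      prj (L.γ i st.1) = prj (L.γ i st.2) ∧ L.γ i st.2 2 < L.γ i st.1 2 ∧
      det2 (prj (deriv (L.γ i) st.1)) (prj (deriv (L.γ i) st.2)) < 0}.ncard : ℤ)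

/-- A point of the boundary circle of the unit disc of `ℂ`. -/
def discBoundaryPt (z : ↥(Metric.sphere (0 : ℂ) 1)) : ↥(Metric.closedBall (0 : ℂ) 1) :=
  ⟨(z : ℂ), Metric.sphere_subset_closedBall z.2⟩

/-- `M` is obtained from `S³ = ℝ³ ∪ {∞}` by Dehn surgery along the link `L`, the
meridian of the `i`-th filling solid torus being glued to the curve `κ i` on the
boundary of a tubular neighbourhood `N i` of the `i`-th component. -/
def SurgeredManifold (M : Type) [TopologicalSpace M] {c : ℕ} (L : LinkDiagram c)
    (κ : Fin c → Set (OnePoint R3)) : Prop :=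
  ∃ N : Fin c → Set (OnePoint R3),
    (∀ i, IsClosed (N i)) ∧
    (∀ i j, i ≠ j → Disjoint (N i) (N j)) ∧
    (∀ i, Nonempty (↥(N i) ≃ₜ ↥(Metric.closedBall (0 : ℂ) 1) × ↥(Metric.sphere (0 : ℂ) 1))) ∧
    (∀ i, (Set.range fun s : ℝ => (OnePoint.some (L.γ i s))) ⊆ interior (N i)) ∧
    (∀ i, κ i ⊆ frontier (N i)) ∧
    ∃ (X : Set M) (V : Fin c → Set M)
      (φ : ↥X ≃ₜ ↥((⋃ i, interior (N i))ᶜ : Set (OnePoint R3))),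
      IsClosed X ∧ (∀ i, IsClosed (V i)) ∧ (X ∪ ⋃ i, V i) = Set.univ ∧
      (∀ i j, i ≠ j → Disjoint (V i) (V j)) ∧ (∀ i, X ∩ V i = frontier (V i)) ∧
      ∀ i, ∃ (ψ : ↥(V i) ≃ₜ ↥(Metric.closedBall (0 : ℂ) 1) × ↥(Metric.sphere (0 : ℂ) 1))
          (u : ↥(Metric.sphere (0 : ℂ) 1))
          (hmer : ∀ z, ((ψ.symm (discBoundaryPt z, u)) : M) ∈ X),
        (Subtype.val '' (⇑φ ''
          (Set.range fun z => (⟨(ψ.symm (discBoundaryPt z, u) : M), hmer z⟩ : ↥X)))) = κ i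

/-- The vertical push-off, realising the blackboard framing. -/
def vertPush (δ : ℝ) (p : R3) : R3 := fun k => if k = 2 then p k + δ else p k

/-- The push-off of the `i`-th component twisted `k` additional times with respect to the
blackboard framing. -/
def framedPush {c : ℕ} (L : LinkDiagram c) (i : Fin c) (k : ℤ) (δ : ℝ) (s : ℝ) : R3 :=
  fun j => L.γ i s j +
    δ * (Real.cos (2 * Real.pi * k * s) * (if j = 2 then 1 else 0) +
      Real.sin (2 * Real.pi * k * s) *
        (if j = 0 then
            -(prj (deriv (L.γ i) s) 1) /
              Real.sqrt (prj (deriv (L.γ i) s) 0 ^ 2 + prj (deriv (L.γ i) s) 1 ^ 2)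
          else if j = 1 then
            prj (deriv (L.γ i) s) 0 /
              Real.sqrt (prj (deriv (L.γ i) s) 0 ^ 2 + prj (deriv (L.γ i) s) 1 ^ 2)
          else 0))

end

namespace QF
open Metric (ball closedBall sphere isOpen_ball mem_ball sphere_subset_closedBall ball_subset_closedBall mem_ball_self ball_mem_nhds)

/-! ### Logarithms -/

/-- `f` has a continuous logarithm on `K`. -/
def HasLog {X : Type*} [TopologicalSpace X] (K : Set X) (f : X → ℂ) : Prop :=
  ∃ g : X → ℂ, ContinuousOn g K ∧ ∀ z ∈ K, Complex.exp (g z) = f z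

section log
variable {X : Type*} [TopologicalSpace X]

lemma HasLog.mono {K L : Set X} {f : X → ℂ} (h : HasLog K f) (hL : L ⊆ K) : HasLog L f := by
  obtain ⟨g, hg, h⟩ := h
  exact ⟨g, hg.mono hL, fun z hz => h z (hL hz)⟩

lemma HasLog.mul {K : Set X} {f f' : X → ℂ} (h : HasLog K f) (h' : HasLog K f') :
    HasLog K (fun z => f z * f' z) := by
  obtain ⟨g, hg, h⟩ := h
  obtain ⟨g', hg', h'⟩ := h'
  exact ⟨fun z => g z + g' z, hg.add hg', fun z hz => by rw [Complex.exp_add, h z hz, h' z hz]⟩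

lemma HasLog.inv {K : Set X} {f : X → ℂ} (h : HasLog K f) : HasLog K (fun z => (f z)⁻¹) := by
  obtain ⟨g, hg, h⟩ := h
  exact ⟨fun z => - g z, hg.neg, fun z hz => by rw [Complex.exp_neg, h z hz]⟩

lemma HasLog.congr {K : Set X} {f f' : X → ℂ} (h : HasLog K f) (e : ∀ z ∈ K, f' z = f z) :
    HasLog K f' := by
  obtain ⟨g, hg, h⟩ := h
  exact ⟨g, hg, fun z hz => by rw [h z hz, e z hz]⟩

lemma isDiscrete_ker : IsDiscrete {w : ℂ | Complex.exp w = 1} := by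
  rw [isDiscrete_iff_forall_mem_exists_isOpen]
  intro w hw
  refine ⟨ball w 1, isOpen_ball, ?_⟩
  ext z
  simp only [mem_inter_iff, mem_ball, mem_ofPred_eq, mem_singleton_iff]
  constructor
  · rintro ⟨hd, hz⟩
    rw [mem_ofPred_eq, Complex.exp_eq_one_iff] at hw
    rw [Complex.exp_eq_one_iff] at hz
    obtain ⟨n, rfl⟩ := hw
    obtain ⟨m, rfl⟩ := hz
    rw [dist_eq_norm, ← sub_mul, norm_mul] at hd
    have h2 : ‖(2 * (Real.pi : ℂ) * Complex.I)‖ = 2 * Real.pi := by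
      simp [abs_of_pos Real.pi_pos]
    rw [h2] at hd
    have h3 : ‖((m : ℂ) - n)‖ = |((m - n : ℤ) : ℝ)| := by
      rw [← Int.cast_sub, Complex.norm_intCast]
    rw [h3] at hd
    by_cases hmn : m = n
    · rw [hmn]
    · exfalso
      have : (1 : ℝ) ≤ |((m - n : ℤ) : ℝ)| := by
        rw [← Int.cast_abs]
        exact_mod_cast Int.one_le_abs (sub_ne_zero.2 hmn)
      nlinarith [Real.pi_gt_three]
  · rintro rfl
    exact ⟨by simp, hw⟩

/-- Two logarithms of the same function on a preconnected set differ by a constant. -/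
lemma log_unique {s : Set X} (hs : IsPreconnected s) {g₁ g₂ : X → ℂ}
    (h₁ : ContinuousOn g₁ s) (h₂ : ContinuousOn g₂ s)
    (h : ∀ z ∈ s, Complex.exp (g₁ z) = Complex.exp (g₂ z)) {z w : X} (hz : z ∈ s) (hw : w ∈ s) :
    g₁ z - g₂ z = g₁ w - g₂ w := by
  refine hs.constant_of_mapsTo isDiscrete_ker (f := fun z => g₁ z - g₂ z) (h₁.sub h₂) ?_ hz hw
  intro z hz
  simp only [mem_ofPred_eq]
  rw [Complex.exp_sub, h z hz, div_self (Complex.exp_ne_zero _)]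

/-- Lifting through `exp`. -/
lemma exists_log [SimplyConnectedSpace X] [LocallyPathConnectedSpace X] {f : X → ℂ}
    (hf : Continuous f) (h0 : ∀ x, f x ≠ 0) :
    ∃ g : X → ℂ, Continuous g ∧ ∀ x, Complex.exp (g x) = f x := by
  obtain ⟨a₀⟩ : Nonempty X := inferInstance
  obtain ⟨F, ⟨-, hF⟩, -⟩ := Complex.isCoveringMap_exp.existsUnique_continuousMap_lifts
    (⟨fun x => ⟨f x, h0 x⟩, by fun_prop⟩ : C(X, {z : ℂ // z ≠ 0})) a₀ (Complex.log (f a₀))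
    (by ext; simp [Complex.exp_log (h0 a₀)])
  refine ⟨F, F.continuous, fun x => ?_⟩
  have := congrArg Subtype.val (congrFun hF x)
  simpa using this

/-- Homotopy lifting through `exp`. -/
lemma exists_log_homotopy {H : I × X → ℂ}
    (hH : Continuous H) (h0 : ∀ x, H x ≠ 0) {g₀ : X → ℂ} (hg : Continuous g₀)
    (hg0 : ∀ x, Complex.exp (g₀ x) = H (0, x)) :
    ∃ g : X → ℂ, Continuous g ∧ ∀ x, Complex.exp (g x) = H (1, x) := by
  let H' : C(I × X, {z : ℂ // z ≠ 0}) := ⟨fun x => ⟨H x, h0 x⟩, by fun_prop⟩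
  have e : ∀ a, H' (0, a) = ⟨_, Complex.exp_ne_zero ((⟨g₀, hg⟩ : C(X, ℂ)) a)⟩ := by
    intro a; ext; simp [H', hg0]
  have := Complex.isCoveringMap_exp.liftHomotopy_lifts H' ⟨g₀, hg⟩ e
  refine ⟨fun x => Complex.isCoveringMap_exp.liftHomotopy H' ⟨g₀, hg⟩ e (1, x), by fun_prop,
    fun x => ?_⟩
  have h2 := congrArg Subtype.val (congrFun this (1, x))
  simpa [H'] using h2

end log

instance : SimplyConnectedSpace ℂ := inferInstance

lemma exists_log_convex {s : Set ℂ} (hs : Convex ℝ s) (ho : IsOpen s) {f : ℂ → ℂ}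
    (hf : ContinuousOn f s) (h0 : ∀ x ∈ s, f x ≠ 0) : HasLog s f := by
  rcases s.eq_empty_or_nonempty with rfl | hne
  · exact ⟨0, continuousOn_empty _, by simp⟩
  have : ContractibleSpace s := hs.contractibleSpace hne
  have : LocallyPathConnectedSpace s := ho.locallyPathConnectedSpace
  obtain ⟨g, hg, h⟩ := exists_log (X := s) (f := fun x => f x) (hf.domRestrict)
    (fun x => h0 x x.2)
  classical
  refine ⟨fun z => if h : z ∈ s then g ⟨z, h⟩ else 0, ?_, ?_⟩
  · rw [continuousOn_iff_continuous_domRestrict]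
    convert hg using 2 with z
    simp
  · intro z hz
    simp [hz, h]

/-- extend from subtype -/
lemma exists_continuousOn_of_subtype {X Y : Type*} [TopologicalSpace X] [TopologicalSpace Y]
    [Nonempty Y] {s : Set X} {g : s → Y} (hg : Continuous g) :
    ∃ G : X → Y, ContinuousOn G s ∧ ∀ x (h : x ∈ s), G x = g ⟨x, h⟩ := by
  classical
  refine ⟨fun z => if h : z ∈ s then g ⟨z, h⟩ else Classical.arbitrary Y, ?_, ?_⟩
  · rw [continuousOn_iff_continuous_domRestrict]
    convert hg using 2 with z
    simp
  · intro z hz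
    simp [hz]

/-- L1 -/
lemma hasLog_of_preconnected {K U : Set ℂ} (hK : IsClosed K) (hU : IsPreconnected U)
    (hd : Disjoint U K) {x y : ℂ} (hx : x ∈ U) (hy : y ∈ U) :
    HasLog K (fun z => (z - x) / (z - y)) := by
  have hne : ∀ x ∈ U, ∀ z ∈ K, z - x ≠ 0 := fun x hx z hz h => by
    rw [sub_eq_zero] at h; subst h; exact (disjoint_left.1 hd) hx hz
  refine hU.induction₂ (fun x y => HasLog K (fun z => (z - x) / (z - y))) ?_ ?_ ?_ hx hy
  · intro x hx
    have hxK : Kᶜ ∈ 𝓝 x := hK.isOpen_compl.mem_nhds (fun h => disjoint_left.1 hd hx h)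
    obtain ⟨ε, hε, hb⟩ := Metric.mem_nhds_iff.1 hxK
    have : ∀ᶠ y in 𝓝[U] x, y ∈ ball x (ε / 2) ∩ U :=
      Filter.inter_mem (mem_nhdsWithin_of_mem_nhds (ball_mem_nhds x (by positivity)))
        self_mem_nhdsWithin
    filter_upwards [this] with y hy
    have hslit : ∀ z ∈ K, (z - x) / (z - y) ∈ Complex.slitPlane := by
      intro z hz
      have h1 : z - y ≠ 0 := hne y hy.2 z hz
      have h2 : ε ≤ dist z x := by
        by_contra h; push Not at h; exact hb (mem_ball.2 h) hz
      have h3 : dist y x < ε / 2 := hy.1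
      have h4 : ε / 2 < ‖z - y‖ := by
        have := dist_triangle z y x
        rw [← dist_eq_norm]; linarith
      have : (z - x) / (z - y) = 1 + (y - x) / (z - y) := by field_simp; ring
      rw [this]
      refine Complex.mem_slitPlane_of_norm_lt_one ?_
      rw [norm_div, div_lt_one (by linarith), ← dist_eq_norm]
      linarith
    refine ⟨fun z => Complex.log ((z - x) / (z - y)), ?_, ?_⟩
    · refine ContinuousOn.clog ?_ hslit
      exact ContinuousOn.div (by fun_prop) (by fun_prop) (hne y hy.2)
    · intro z hz
      exact Complex.exp_log (Complex.slitPlane_ne_zero (hslit z hz))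
  · intro x y z hx hy hz h1 h2
    refine (h1.mul h2).congr fun w hw => ?_
    have := hne y hy w hw
    have := hne z hz w hw
    field_simp
  · intro x y hx hy h
    exact h.inv.congr fun w hw => by rw [inv_div]


lemma exists_inverse_compact {X Y : Type*} [TopologicalSpace X] [TopologicalSpace Y] [T2Space X]
    [Nonempty Y] {T : Set Y} (hT : IsCompact T) {γ : Y → X} (hc : ContinuousOn γ T)
    (hi : InjOn γ T) : ∃ r : X → Y, ContinuousOn r (γ '' T) ∧ ∀ t ∈ T, r (γ t) = t := by
  have := isCompact_iff_compactSpace.1 hT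
  have he : IsClosedEmbedding (T.domRestrict γ) :=
    (continuousOn_iff_continuous_domRestrict.1 hc).isClosedEmbedding (injOn_iff_injective.1 hi)
  let e := he.isEmbedding.toHomeomorph
  have hr : range (T.domRestrict γ) = γ '' T := range_domRestrict γ T
  obtain ⟨G, hG, h⟩ := exists_continuousOn_of_subtype (s := range (T.domRestrict γ))
    (g := fun x => ((e.symm x : T) : Y)) (by fun_prop)
  rw [hr] at hG
  refine ⟨G, hG, fun t ht => ?_⟩
  rw [h (γ t) ⟨⟨t, ht⟩, rfl⟩]
  have : e ⟨t, ht⟩ = ⟨γ t, ⟨⟨t, ht⟩, rfl⟩⟩ := rfl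
  rw [← this, e.symm_apply_apply]

/-- L2 -/
lemma hasLog_arc {γ : ℝ → ℂ} {a b : ℝ} (hc : ContinuousOn γ (Icc a b)) (hi : InjOn γ (Icc a b))
    {f : ℂ → ℂ} (hf : ContinuousOn f (γ '' Icc a b)) (h0 : ∀ z ∈ γ '' Icc a b, f z ≠ 0) :
    HasLog (γ '' Icc a b) f := by
  rcases lt_or_ge b a with hab | hab
  · rw [Icc_eq_empty (not_le.2 hab)]
    exact ⟨0, by simp, by simp⟩
  obtain ⟨r, hr, hrt⟩ := exists_inverse_compact isCompact_Icc hc hi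
  have hp : ∀ t, (projIcc a b hab t : ℝ) ∈ Icc a b := fun t => (projIcc a b hab t).2
  have hcont : Continuous (fun t : ℝ => f (γ (projIcc a b hab t))) := by
    refine (hf.comp hc (mapsTo_image _ _)).comp_continuous (by fun_prop) hp
  obtain ⟨g, hg, h⟩ := exists_log hcont (fun t => h0 _ (mem_image_of_mem _ (hp t)))
  refine ⟨fun z => g (r z), hg.comp_continuousOn hr, ?_⟩
  rintro _ ⟨t, ht, rfl⟩
  simp only []
  rw [hrt t ht, h, projIcc_of_mem hab ht]

/-- L3 : Borsuk -/
lemma borsuk {K P : Set ℂ} (hK : IsCompact K) (hP : IsOpen P) (hb : Bornology.IsBounded P)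
    (hfr : frontier P ⊆ K) (hd : Disjoint P K) {x : ℂ} (hx : x ∈ P) {m : ℤ} {h : ℂ → ℂ}
    (hh : ContinuousOn h (P ∪ K)) (h0 : ∀ z ∈ P ∪ K, h z ≠ 0)
    (hlog : HasLog K (fun z => (z - x) ^ m * h z)) : m = 0 := by
  classical
  obtain ⟨g₀, hg₀, hg₀e⟩ := hlog
  obtain ⟨g, hgr⟩ := ContinuousMap.exists_restrict_eq hK.isClosed
    (⟨K.domRestrict g₀, continuousOn_iff_continuous_domRestrict.1 hg₀⟩ : C(K, ℂ))
  have hge : ∀ z ∈ K, Complex.exp (g z) = (z - x) ^ m * h z := by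
    intro z hz
    refine Eq.trans ?_ (hg₀e z hz)
    have := congrArg (fun (q : C(K, ℂ)) => q ⟨z, hz⟩) hgr
    simp only [ContinuousMap.restrict_apply, ContinuousMap.coe_mk, domRestrict_apply] at this
    rw [this]
  -- the glued function
  let F : ℂ → ℂ := fun z => if z ∈ P ∪ K then (z - x) ^ m * h z else Complex.exp (g z)
  have hPK : IsClosed (P ∪ K) := by
    have : P ∪ K = closure P ∪ K := by
      rw [closure_eq_self_union_frontier, union_assoc, union_eq_self_of_subset_left hfr]
    rw [this]; exact isClosed_closure.union hK.isClosed
  have hF1 : ∀ z ∈ P ∪ K, F z = (z - x) ^ m * h z := fun z hz => if_pos hz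
  have hF2 : ∀ z ∉ P, F z = Complex.exp (g z) := by
    intro z hz
    by_cases hzK : z ∈ K
    · rw [hF1 z (Or.inr hzK), hge z hzK]
    · exact if_neg (by simp [hz, hzK])
  have hFc : ContinuousOn F {x}ᶜ := by
    have c1 : ContinuousOn F ({x}ᶜ ∩ (P ∪ K)) := by
      refine ContinuousOn.congr ?_ (fun z hz => hF1 z hz.2)
      refine ContinuousOn.mul (ContinuousOn.zpow₀ (by fun_prop) _ ?_) (hh.mono inter_subset_right)
      intro z hz
      exact Or.inl (sub_ne_zero.2 hz.1)
    have c2 : ContinuousOn F ({x}ᶜ ∩ Pᶜ) := by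
      refine ContinuousOn.congr ?_ (fun z hz => hF2 z hz.2)
      fun_prop
    intro z hz
    have : ({x}ᶜ : Set ℂ) = ({x}ᶜ ∩ (P ∪ K)) ∪ ({x}ᶜ ∩ Pᶜ) := by
      ext w; by_cases hw : w ∈ P <;> simp [hw]; tauto
    rw [this]
    have cl2 : IsClosed (Pᶜ) := hP.isClosed_compl
    refine ContinuousWithinAt.union ?_ ?_
    · by_cases hz1 : z ∈ P ∪ K
      · exact c1 z ⟨hz, hz1⟩
      · refine continuousWithinAt_of_notMem_closure ?_
        intro hcl
        exact hz1 (hPK.closure_subset (closure_mono inter_subset_right hcl))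
    · by_cases hz1 : z ∈ Pᶜ
      · exact c2 z ⟨hz, hz1⟩
      · refine continuousWithinAt_of_notMem_closure ?_
        intro hcl
        exact hz1 (cl2.closure_subset (closure_mono inter_subset_right hcl))
  have hF0 : ∀ z ≠ x, F z ≠ 0 := by
    intro z hz
    by_cases h1 : z ∈ P ∪ K
    · rw [hF1 z h1]
      exact mul_ne_zero (zpow_ne_zero _ (sub_ne_zero.2 hz)) (h0 z h1)
    · rw [hF2 z (fun h => h1 (Or.inl h))]; exact Complex.exp_ne_zero _
  have hex : ∀ w : ℂ, x + Complex.exp w ≠ x := fun w h => Complex.exp_ne_zero w (by simpa using h)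
  obtain ⟨Φ, hΦ, hΦe⟩ := exists_log (X := ℂ) (f := fun w => F (x + Complex.exp w))
    (hFc.comp_continuous (by fun_prop) (fun w => hex w)) (fun w => hF0 _ (hex w))
  set T : ℂ := 2 * Real.pi * Complex.I with hT
  have hper : ∀ w, Complex.exp (w + T) = Complex.exp w := fun w => Complex.exp_periodic w
  have hconst : ∀ w w', Φ (w + T) - Φ w = Φ (w' + T) - Φ w' := by
    intro w w'
    refine log_unique (X := ℂ) isPreconnected_univ (g₁ := fun w => Φ (w + T)) (g₂ := Φ)
      (by fun_prop) (by fun_prop) ?_ (mem_univ w) (mem_univ w')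
    intro z _
    rw [hΦe, hΦe, hper]
  -- vertical lines
  have hline : ∀ (R : ℝ), IsPreconnected (range fun t : ℝ => ((R : ℂ) + t * Complex.I)) :=
    fun R => isPreconnected_range (by fun_prop)
  -- far away
  have hfar : ∃ w : ℂ, Φ (w + T) - Φ w = 0 := by
    obtain ⟨R, hR0, hR⟩ := hb.subset_ball_lt 0 x
    let ρ := Real.log R
    have hout : ∀ t : ℝ, x + Complex.exp ((ρ : ℂ) + t * Complex.I) ∉ P := by
      intro t ht
      have := hR ht
      rw [mem_ball, dist_eq_norm, add_sub_cancel_left, Complex.norm_exp] at this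
      simp [ρ, Real.exp_log hR0] at this
    have := log_unique (hline ρ) (g₁ := Φ) (g₂ := fun w => g (x + Complex.exp w))
      (by fun_prop) (by fun_prop) (by
        rintro _ ⟨t, rfl⟩
        rw [hΦe, hF2 _ (hout t)]) (z := ρ + T) (w := ρ)
        ⟨2 * Real.pi, by simp [hT]⟩ ⟨0, by simp⟩
    refine ⟨ρ, ?_⟩
    simp only [hper] at this
    linear_combination this
  have hnear : ∃ w : ℂ, Φ (w + T) - Φ w = m * T := by
    have hc : ContinuousAt h x := hh.continuousAt (Filter.mem_of_superset (hP.mem_nhds hx) subset_union_left)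
    have hx0 : h x ≠ 0 := h0 x (Or.inl hx)
    have : ∀ᶠ z in 𝓝 x, z ∈ P ∧ h z / h x ∈ Complex.slitPlane := by
      refine Filter.Eventually.and (hP.mem_nhds hx) ?_
      have : ContinuousAt (fun z => h z / h x) x := hc.div_const _
      refine this.eventually_mem (Complex.isOpen_slitPlane.mem_nhds ?_)
      simp [hx0]
    obtain ⟨ε, hε, hball⟩ := Metric.eventually_nhds_iff.1 this
    let ρ := Real.log (ε / 2)
    have hin : ∀ t : ℝ, dist (x + Complex.exp ((ρ : ℂ) + t * Complex.I)) x < ε := by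
      intro t
      rw [dist_eq_norm, add_sub_cancel_left, Complex.norm_exp]
      simp [ρ, Real.exp_log (half_pos hε)]
      linarith
    have := log_unique (hline ρ) (g₁ := Φ)
      (g₂ := fun w => m * w + Complex.log (h (x + Complex.exp w) / h x) + Complex.log (h x))
      (by fun_prop) (by
        refine ContinuousOn.add (ContinuousOn.add (by fun_prop) (ContinuousOn.clog ?_ ?_)) (by fun_prop)
        · refine ContinuousOn.div_const ?_ _
          refine (hh.mono subset_union_left).comp (t := P) (by fun_prop) ?_
          rintro _ ⟨t, rfl⟩
          exact (hball (hin t)).1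
        · rintro _ ⟨t, rfl⟩
          exact (hball (hin t)).2) (by
        rintro _ ⟨t, rfl⟩
        have hb1 := hball (hin t)
        simp only []
        generalize (ρ : ℂ) + t * Complex.I = w at hb1 ⊢
        rw [hΦe, hF1 _ (Or.inl hb1.1), Complex.exp_add, Complex.exp_add, Complex.exp_log hx0,
          Complex.exp_log (Complex.slitPlane_ne_zero hb1.2), Complex.exp_int_mul]
        field_simp
        simp
        ring) (z := ρ + T) (w := ρ)
        ⟨2 * Real.pi, by simp [hT]⟩ ⟨0, by simp⟩
    refine ⟨ρ, ?_⟩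
    simp only [hper] at this
    linear_combination this
  obtain ⟨w, hw⟩ := hfar
  obtain ⟨w', hw'⟩ := hnear
  rw [hconst w w', hw'] at hw
  have : T ≠ 0 := Complex.two_pi_I_ne_zero
  simpa [this] using hw


/-- `Z` has locally exactly two sides at `a`. -/
def TwoSidedAt {X : Type*} [TopologicalSpace X] (Z : Set X) (a : X) : Prop :=
  ∀ V ∈ 𝓝 a, ∃ W, IsOpen W ∧ a ∈ W ∧ W ⊆ V ∧ ∃ Y₁ Y₂ : Set X, IsOpen Y₁ ∧ IsOpen Y₂ ∧
    Disjoint Y₁ Y₂ ∧ IsPreconnected Y₁ ∧ IsPreconnected Y₂ ∧ Y₁ ⊆ V \ Z ∧ Y₂ ⊆ V \ Z ∧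
    W \ Z ⊆ Y₁ ∪ Y₂ ∧ ∀ a' ∈ Z ∩ W, a' ∈ closure Y₁ ∧ a' ∈ closure Y₂

/-- no continuous logarithm on a punctured disc -/
lemma not_hasLog_punctured {p : ℂ} {r : ℝ} (hr : 0 < r) :
    ¬ HasLog (ball p r \ {p}) (fun z => z - p) := by
  rintro ⟨g, hg, h⟩
  let ρ := Real.log (r / 2)
  have hin : ∀ t : ℝ, p + Complex.exp ((ρ : ℂ) + t * Complex.I) ∈ ball p r \ {p} := by
    intro t
    refine ⟨?_, by simp⟩
    rw [mem_ball, dist_eq_norm, add_sub_cancel_left, Complex.norm_exp]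
    simp [ρ, Real.exp_log (half_pos hr)]
    linarith
  have := log_unique (isPreconnected_range (f := fun t : ℝ => ((ρ : ℂ) + t * Complex.I))
    (by fun_prop)) (g₁ := fun w => g (p + Complex.exp w)) (g₂ := fun w => w)
    (hg.comp (by fun_prop) (by rintro _ ⟨t, rfl⟩; exact hin t)) (by fun_prop)
    (by
      rintro _ ⟨t, rfl⟩
      simp only []
      rw [h _ (hin t)]; simp) (z := ρ + 2 * Real.pi * Complex.I) (w := ρ)
      ⟨2 * Real.pi, by simp⟩ ⟨0, by simp⟩
  simp only [Complex.exp_periodic (ρ : ℂ)] at this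
  have h2 : (2 * Real.pi * Complex.I : ℂ) = 0 := by linear_combination -this
  exact Complex.two_pi_I_ne_zero h2

/-- the point at the end of an arc coming from outside of a convex set `V` -/
lemma hasLog_end {V : Set ℂ} (hV : Convex ℝ V) (ho : IsOpen V) {γ : I → ℂ} (hγ : Continuous γ)
    (h0 : γ 0 ∉ V) : HasLog (V \ range γ) (fun z => z - γ 1) := by
  obtain ⟨g, hg, hge⟩ := exists_log_convex hV ho (f := fun z => z - γ 0) (by fun_prop)
    (fun z hz h => h0 (by rw [sub_eq_zero] at h; rwa [← h]))
  obtain ⟨G, hG, hGe⟩ := exists_log_homotopy (X := ↥(V \ range γ))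
    (H := fun x => (x.2 : ℂ) - γ x.1) (by fun_prop)
    (by
      rintro ⟨t, z, hz⟩ h
      rw [sub_eq_zero] at h
      exact hz.2 ⟨t, h.symm⟩) (g₀ := fun z => g z)
    (hg.comp_continuous (by fun_prop) (fun z => z.2.1))
    (fun z => hge z z.2.1)
  obtain ⟨G', hG', h⟩ := exists_continuousOn_of_subtype hG
  exact ⟨G', hG', fun z hz => by rw [h z hz, hGe]⟩

lemma hasLog_end' {V : Set ℂ} (hV : Convex ℝ V) (ho : IsOpen V) {γ : ℝ → ℂ} {s t : ℝ}
    (hγ : ContinuousOn γ (uIcc s t)) (h0 : γ s ∉ V) :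
    HasLog (V \ γ '' (uIcc s t)) (fun z => z - γ t) := by
  have hm : ∀ u : I, s + u * (t - s) ∈ uIcc s t := by
    intro u
    rw [← segment_eq_uIcc]
    exact ⟨1 - u, u, by linarith [u.2.2], u.2.1, by ring, by simp; ring⟩
  have := hasLog_end hV ho (γ := fun u : I => γ (s + u * (t - s)))
    (hγ.comp_continuous (by fun_prop) hm) (by simpa using h0)
  simp only [Icc.coe_one, one_mul, add_sub_cancel] at this
  refine this.mono ?_
  refine diff_subset_diff_right ?_
  rintro _ ⟨u, rfl⟩
  exact mem_image_of_mem _ (hm u)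

lemma toggle {γ : ℝ → ℂ} (hc : ContinuousOn γ (Icc 0 1)) (hi : InjOn γ (Icc 0 1))
    {V : Set ℂ} (hV : Convex ℝ V) (ho : IsOpen V) (h0 : γ 0 ∉ V) (h1 : γ 1 ∉ V)
    {t : ℝ} (ht : t ∈ Icc (0 : ℝ) 1) {r : ℝ} (hr : 0 < r) (hb : ball (γ t) r ⊆ V)
    {Y : Set ℂ} (hY : IsPreconnected Y) (hYV : Y ⊆ V \ γ '' Icc 0 1)
    (hs : ball (γ t) r \ γ '' Icc 0 1 ⊆ Y) : False := by
  classical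
  have e1 : uIcc 0 t = Icc 0 t := uIcc_of_le ht.1
  have e2 : uIcc 1 t = Icc t 1 := uIcc_of_ge ht.2
  have s1 : Icc 0 t ⊆ Icc 0 1 := Icc_subset_Icc_right ht.2
  have s2 : Icc t 1 ⊆ Icc 0 1 := Icc_subset_Icc_left ht.1
  obtain ⟨g₁, hg₁, hge₁⟩ := hasLog_end' hV ho (s := 0) (t := t)
    (by rw [e1]; exact hc.mono s1) h0
  obtain ⟨g₂, hg₂, hge₂⟩ := hasLog_end' hV ho (s := 1) (t := t)
    (by rw [e2]; exact hc.mono s2) h1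
  rw [e1] at hg₁ hge₁
  rw [e2] at hg₂ hge₂
  have hA : γ '' Icc 0 1 = γ '' Icc 0 t ∪ γ '' Icc t 1 := by
    rw [← image_union, Icc_union_Icc_eq_Icc ht.1 ht.2]
  have hcap : γ '' Icc 0 t ∩ γ '' Icc t 1 = {γ t} := by
    rw [← hi.image_inter s1 s2, Icc_inter_Icc_eq_singleton ht.1 ht.2, image_singleton]
  have hcl1 : IsClosed (γ '' Icc 0 t) := (isCompact_Icc.image_of_continuousOn (hc.mono s1)).isClosed
  have hcl2 : IsClosed (γ '' Icc t 1) := (isCompact_Icc.image_of_continuousOn (hc.mono s2)).isClosed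
  obtain ⟨c, hcexp, hcc⟩ : ∃ c : ℂ, Complex.exp c = 1 ∧ ∀ z ∈ Y, g₁ z = g₂ z + c := by
    rcases Y.eq_empty_or_nonempty with rfl | ⟨y, hy⟩
    · exact ⟨0, by simp, by simp⟩
    have m1 : ∀ z ∈ Y, z ∈ V \ γ '' Icc 0 t := fun z hz => ⟨(hYV hz).1, fun h => (hYV hz).2
      (image_mono s1 h)⟩
    have m2 : ∀ z ∈ Y, z ∈ V \ γ '' Icc t 1 := fun z hz => ⟨(hYV hz).1, fun h => (hYV hz).2
      (image_mono s2 h)⟩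
    have key : ∀ z ∈ Y, Complex.exp (g₁ z) = Complex.exp (g₂ z) := fun z hz => by
      rw [hge₁ z (m1 z hz), hge₂ z (m2 z hz)]
    refine ⟨g₁ y - g₂ y, by rw [Complex.exp_sub, key y hy, div_self (Complex.exp_ne_zero _)], ?_⟩
    intro z hz
    have := log_unique hY (hg₁.mono m1) (hg₂.mono m2) key hz hy
    rw [← this]; ring
  refine not_hasLog_punctured hr (p := γ t) ?_
  set B := ball (γ t) r
  let G : ℂ → ℂ := fun z => if z ∈ γ '' Icc 0 t then g₂ z + c else g₁ z
  have hGe : ∀ z ∈ B \ γ '' Icc t 1, G z = g₂ z + c := by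
    intro z hz
    by_cases h : z ∈ γ '' Icc 0 t
    · exact if_pos h
    · rw [show G z = g₁ z from if_neg h]
      exact hcc z (hs ⟨hz.1, by rw [hA]; rintro (h' | h'); exacts [h h', hz.2 h']⟩)
  have hGe1 : ∀ z ∈ B \ γ '' Icc 0 t, G z = g₁ z := fun z hz => if_neg hz.2
  have o1 : IsOpen (B \ γ '' Icc 0 t) := isOpen_ball.sdiff hcl1
  have o2 : IsOpen (B \ γ '' Icc t 1) := isOpen_ball.sdiff hcl2
  have hcov : B \ {γ t} = (B \ γ '' Icc 0 t) ∪ (B \ γ '' Icc t 1) := by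
    rw [← hcap, diff_inter]
  refine ⟨G, ?_, ?_⟩
  · rw [hcov]
    refine ContinuousOn.union_of_isOpen ?_ ?_ o1 o2
    · exact (hg₁.mono (diff_subset_diff_left hb)).congr hGe1
    · exact ((hg₂.mono (diff_subset_diff_left hb)).add continuousOn_const).congr hGe
  · intro z hz
    rw [hcov] at hz
    rcases hz with hz | hz
    · rw [hGe1 z hz, hge₁ z ⟨hb hz.1, hz.2⟩]
    · rw [hGe z hz, Complex.exp_add, hcexp, mul_one, hge₂ z ⟨hb hz.1, hz.2⟩]


lemma frontier_component {X : Type*} [TopologicalSpace X] [LocallyConnectedSpace X] {U : Set X}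
    (hU : IsOpen U) (x : X) : frontier (connectedComponentIn U x) ⊆ Uᶜ := by
  intro y hy hyU
  have o := hU.connectedComponentIn (x := x)
  have oy := hU.connectedComponentIn (x := y)
  have hyy : y ∈ connectedComponentIn U y := mem_connectedComponentIn hyU
  rw [o.frontier_eq] at hy
  obtain ⟨w, hw1, hw2⟩ := mem_closure_iff.1 hy.1 _ oy hyy
  have := connectedComponentIn_eq hw1
  have h2 := connectedComponentIn_eq hw2
  rw [this, ← h2] at hyy
  exact hy.2 hyy

lemma sides_le_two {γ : ℝ → ℂ} (hc : ContinuousOn γ (Icc 0 1)) (hi : InjOn γ (Icc 0 1))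
    {a : ℂ} {ρ : ℝ} {u v : ℝ} (hu : u ∈ Icc (0 : ℝ) 1) (hv : v ∈ Icc (0 : ℝ) 1) (huv : u ≤ v)
    (hin : γ '' Icc u v ⊆ ball a ρ)
    {W : Set ℂ} (hW : IsPreconnected W) (hWb : W ⊆ ball a ρ)
    (hWd : Disjoint W (γ '' Icc 0 u ∪ γ '' Icc v 1))
    (K : Set ℂ) (hK : K = γ '' Icc 0 1 ∪ sphere a ρ)
    (x : Fin 3 → ℂ) (hx : ∀ i, x i ∈ W \ γ '' Icc 0 1)
    (hne : ∀ i j, i ≠ j → x j ∉ connectedComponentIn Kᶜ (x i)) : False := by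
  classical
  set α := γ '' Icc 0 1 with hα
  set B := (γ '' Icc 0 u ∪ γ '' Icc v 1) ∪ sphere a ρ with hB
  have s1 : Icc 0 u ⊆ Icc 0 1 := Icc_subset_Icc_right hu.2
  have s2 : Icc v 1 ⊆ Icc 0 1 := Icc_subset_Icc_left hv.1
  have k0 : IsCompact α := isCompact_Icc.image_of_continuousOn hc
  have k1 : IsCompact (γ '' Icc 0 u) := isCompact_Icc.image_of_continuousOn (hc.mono s1)
  have k2 : IsCompact (γ '' Icc v 1) := isCompact_Icc.image_of_continuousOn (hc.mono s2)
  have kB : IsCompact B := (k1.union k2).union (isCompact_sphere a ρ)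
  have kK : IsCompact K := hK ▸ k0.union (isCompact_sphere a ρ)
  have hKB : K = α ∪ B := by
    have : γ '' Icc 0 u ∪ γ '' Icc v 1 ⊆ α := union_subset (image_mono s1) (image_mono s2)
    rw [hK, hB, ← union_assoc, union_eq_self_of_subset_right this]
  have hcap : α ∩ B ⊆ γ '' Icc 0 u ∪ γ '' Icc v 1 := by
    rintro z ⟨⟨t, ht, rfl⟩, hz | hz⟩
    · exact hz
    · rcases le_total t u with h | h
      · exact Or.inl ⟨t, ⟨ht.1, h⟩, rfl⟩
      · rcases le_total v t with h' | h'
        · exact Or.inr ⟨t, ⟨h', ht.2⟩, rfl⟩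
        · have := hin ⟨t, ⟨h, h'⟩, rfl⟩
          rw [mem_ball] at this; rw [Metric.mem_sphere] at hz; linarith
  have hWB : Disjoint W B := by
    rw [hB, disjoint_union_right]
    refine ⟨hWd, disjoint_left.2 fun z hz hz' => ?_⟩
    have := hWb hz
    rw [mem_ball] at this; rw [Metric.mem_sphere] at hz'; linarith
  have hxK : ∀ i, x i ∈ Kᶜ := by
    intro i h
    rw [hKB] at h
    exact h.elim (hx i).2 (fun h => disjoint_left.1 hWB (hx i).1 h)
  have hKne : ∀ i, ∀ z ∈ K, z - x i ≠ 0 := fun i z hz h => by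
    rw [sub_eq_zero] at h; exact hxK i (h ▸ hz)
  -- logarithms
  have hG : ∀ i, HasLog α (fun z => (z - x i) / (z - x 2)) := by
    intro i
    have hn : ∀ i, ∀ z ∈ α, z - x i ≠ 0 := fun i z hz => hKne i z (by rw [hKB]; exact Or.inl hz)
    exact hasLog_arc hc hi (ContinuousOn.div (by fun_prop) (by fun_prop) (hn 2))
      (fun z hz => div_ne_zero (hn i z hz) (hn 2 z hz))
  have hH : ∀ i, HasLog B (fun z => (z - x i) / (z - x 2)) :=
    fun i => hasLog_of_preconnected kB.isClosed hW hWB (hx i).1 (hx 2).1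
  choose G hGc hGe using hG
  choose H hHc hHe using hH
  have m1 : γ '' Icc 0 u ⊆ α ∩ B := fun z hz => ⟨image_mono s1 hz, Or.inl (Or.inl hz)⟩
  have m2 : γ '' Icc v 1 ⊆ α ∩ B := fun z hz => ⟨image_mono s2 hz, Or.inl (Or.inr hz)⟩
  have p1 : IsPreconnected (γ '' Icc 0 u) := isPreconnected_Icc.image _ (hc.mono s1)
  have p2 : IsPreconnected (γ '' Icc v 1) := isPreconnected_Icc.image _ (hc.mono s2)
  have z1 : γ 0 ∈ γ '' Icc 0 u := ⟨0, ⟨le_rfl, hu.1⟩, rfl⟩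
  have z2 : γ 1 ∈ γ '' Icc v 1 := ⟨1, ⟨hv.2, le_rfl⟩, rfl⟩
  have hexp : ∀ i, ∀ z ∈ α ∩ B, Complex.exp (G i z) = Complex.exp (H i z) := fun i z hz => by
    rw [hGe i z hz.1, hHe i z hz.2]
  have c1 : ∀ i, ∀ z ∈ γ '' Icc 0 u, G i z - H i z = G i (γ 0) - H i (γ 0) := fun i z hz =>
    log_unique p1 ((hGc i).mono fun z hz => (m1 hz).1) ((hHc i).mono fun z hz => (m1 hz).2)
      (fun z hz => hexp i z (m1 hz)) hz z1
  have c2 : ∀ i, ∀ z ∈ γ '' Icc v 1, G i z - H i z = G i (γ 1) - H i (γ 1) := fun i z hz =>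
    log_unique p2 ((hGc i).mono fun z hz => (m2 hz).1) ((hHc i).mono fun z hz => (m2 hz).2)
      (fun z hz => hexp i z (m2 hz)) hz z2
  have hper : ∀ i, ∀ z ∈ α ∩ B, ∃ n : ℤ, G i z - H i z = n * (2 * Real.pi * Complex.I) := by
    intro i z hz
    obtain ⟨n, hn⟩ := Complex.exp_eq_exp_iff_exists_int.1 (hexp i z hz)
    exact ⟨n, by rw [hn]; ring⟩
  choose n1 hn1 using fun i => hper i (γ 0) (m1 z1)
  choose n2 hn2 using fun i => hper i (γ 1) (m2 z2)
  obtain ⟨k, l, hkl, hkl0⟩ : ∃ k l : ℤ, k * (n1 0 - n2 0) + l * (n1 1 - n2 1) = 0 ∧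
      ¬ (k = 0 ∧ l = 0) := by
    by_cases h : n1 0 - n2 0 = 0 ∧ n1 1 - n2 1 = 0
    · exact ⟨1, 0, by simp [h.1], by simp⟩
    · exact ⟨n1 1 - n2 1, -(n1 0 - n2 0), by ring, fun h' => h ⟨neg_eq_zero.1 h'.2, h'.1⟩⟩
  set c : ℂ := (k * n1 0 + l * n1 1 : ℤ) * (2 * Real.pi * Complex.I) with hcdef
  have hcexp : Complex.exp c = 1 := Complex.exp_eq_one_iff.2 ⟨_, hcdef⟩
  have hagree : ∀ z ∈ α ∩ B, k * G 0 z + l * G 1 z = k * H 0 z + l * H 1 z + c := by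
    intro z hz
    rcases hcap hz with h | h
    · have e0 := c1 0 z h
      have e1 := c1 1 z h
      rw [hn1] at e0 e1
      rw [hcdef]; push_cast
      linear_combination k * e0 + l * e1
    · have e0 := c2 0 z h
      have e1 := c2 1 z h
      rw [hn2] at e0 e1
      have hkl' : (k : ℂ) * (n1 0 - n2 0) + l * (n1 1 - n2 1) = 0 := by exact_mod_cast hkl
      rw [hcdef]; push_cast
      linear_combination k * e0 + l * e1 - (2 * Real.pi * Complex.I) * hkl'
  have hlog : HasLog K (fun z => ((z - x 0) / (z - x 2)) ^ k * ((z - x 1) / (z - x 2)) ^ l) := by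
    let L : ℂ → ℂ := fun z => if z ∈ α then k * G 0 z + l * G 1 z
      else k * H 0 z + l * H 1 z + c
    have L1 : ∀ z ∈ α, L z = k * G 0 z + l * G 1 z := fun z hz => if_pos hz
    have L2 : ∀ z ∈ B, L z = k * H 0 z + l * H 1 z + c := fun z hz => by
      by_cases h : z ∈ α
      · rw [L1 z h, hagree z ⟨h, hz⟩]
      · exact if_neg h
    refine ⟨L, ?_, ?_⟩
    · rw [hKB]
      refine ContinuousOn.union_of_isClosed ?_ ?_ k0.isClosed kB.isClosed
      · refine ContinuousOn.congr ?_ L1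
        exact (continuousOn_const.mul (hGc 0)).add (continuousOn_const.mul (hGc 1))
      · refine ContinuousOn.congr ?_ L2
        exact ((continuousOn_const.mul (hHc 0)).add (continuousOn_const.mul (hHc 1))).add
          continuousOn_const
    · intro z hz
      rw [hKB] at hz
      rcases hz with hz | hz
      · rw [L1 z hz, Complex.exp_add, Complex.exp_int_mul, Complex.exp_int_mul, hGe 0 z hz,
          hGe 1 z hz]
      · rw [L2 z hz, Complex.exp_add, hcexp, Complex.exp_add, Complex.exp_int_mul,
          Complex.exp_int_mul, hHe 0 z hz, hHe 1 z hz, mul_one]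
  have hKo : IsOpen Kᶜ := kK.isClosed.isOpen_compl
  have hPb : ∀ i, connectedComponentIn Kᶜ (x i) ⊆ ball a ρ := by
    intro i
    refine isPreconnected_connectedComponentIn.subset_left_of_subset_union isOpen_ball
      (v := (closedBall a ρ)ᶜ) Metric.isClosed_closedBall.isOpen_compl ?_ ?_
      ⟨x i, mem_connectedComponentIn (hxK i), hWb (hx i).1⟩
    · exact disjoint_compl_right_iff_subset.2 ball_subset_closedBall
    · intro z hz
      have h1 := connectedComponentIn_subset _ _ hz
      by_contra h
      simp only [mem_union, mem_ball, mem_compl_iff, Metric.mem_closedBall, not_or, not_not,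
        not_lt] at h
      refine h1 ?_
      rw [hK]
      exact Or.inr (le_antisymm h.2 h.1)
  have main : ∀ i j : Fin 3, i ≠ j → i ≠ 2 → j ≠ 2 → ∀ m m' : ℤ,
      HasLog K (fun z => ((z - x i) / (z - x 2)) ^ m * ((z - x j) / (z - x 2)) ^ m') → m = 0 := by
    intro i j hij hi2 hj2 m m' hl
    have hnz : ∀ j, i ≠ j → ∀ z ∈ connectedComponentIn Kᶜ (x i) ∪ K, z - x j ≠ 0 := by
      intro j hj z hz h
      rcases hz with hz | hz
      · rw [sub_eq_zero] at h
        exact hne i j hj (h ▸ hz)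
      · exact hKne j z hz h
    refine borsuk kK hKo.connectedComponentIn (Metric.isBounded_ball.subset (hPb i))
      ((frontier_component hKo _).trans (by simp))
      (disjoint_left.2 fun z hz hz' => connectedComponentIn_subset _ _ hz hz')
      (mem_connectedComponentIn (hxK i)) (m := m)
      (h := fun z => (z - x j) ^ m' * (z - x 2) ^ (-m - m')) ?_ ?_ (hl.congr ?_)
    · refine ContinuousOn.mul (ContinuousOn.zpow₀ (by fun_prop) _ fun z hz => Or.inl (hnz j hij z hz))
        (ContinuousOn.zpow₀ (by fun_prop) _ fun z hz => Or.inl (hnz 2 hi2 z hz))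
    · intro z hz
      exact mul_ne_zero (zpow_ne_zero _ (hnz j hij z hz)) (zpow_ne_zero _ (hnz 2 hi2 z hz))
    · intro z hz
      have h2 := hKne 2 z hz
      rw [div_zpow, div_zpow, sub_eq_add_neg (-m) m', zpow_add₀ h2, zpow_neg, zpow_neg]
      field_simp
  refine hkl0 ⟨main 0 1 (by decide) (by decide) (by decide) k l hlog,
    main 1 0 (by decide) (by decide) (by decide) l k (hlog.congr fun z hz => mul_comm _ _)⟩

theorem arc_twoSided_plane {γ : ℝ → ℂ} (hc : ContinuousOn γ (Icc 0 1)) (hi : InjOn γ (Icc 0 1))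
    {t : ℝ} (ht : t ∈ Ioo (0 : ℝ) 1) : TwoSidedAt (γ '' Icc 0 1) (γ t) := by
  intro V₀ hV₀
  set α := γ '' Icc 0 1 with hα
  have htI : t ∈ Icc (0 : ℝ) 1 := Ioo_subset_Icc_self ht
  have n0 : γ 0 ≠ γ t := fun h => ht.1.ne (hi (by simp) htI h)
  have n1 : γ 1 ≠ γ t := fun h => ht.2.ne' (hi (by simp) htI h)
  obtain ⟨ρ, hρ, hρV⟩ : ∃ ρ > 0, ball (γ t) ρ ⊆ V₀ ∩ ({γ 0}ᶜ ∩ {γ 1}ᶜ) :=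
    Metric.mem_nhds_iff.1 (Filter.inter_mem hV₀ (Filter.inter_mem
      (isOpen_compl_singleton.mem_nhds n0.symm) (isOpen_compl_singleton.mem_nhds n1.symm)))
  set V := ball (γ t) ρ with hV
  have h0V : γ 0 ∉ V := fun h => (hρV h).2.1 rfl
  have h1V : γ 1 ∉ V := fun h => (hρV h).2.2 rfl
  have hct : ContinuousAt γ t := hc.continuousAt (Icc_mem_nhds ht.1 ht.2)
  obtain ⟨u, v, hut, hvt, huv⟩ : ∃ u v, u ∈ Ico 0 t ∧ v ∈ Ioc t 1 ∧ γ '' Icc u v ⊆ V := by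
    obtain ⟨δ, hδ, hd⟩ := Metric.continuousAt_iff.1 hct ρ hρ
    refine ⟨max 0 (t - δ / 2), min 1 (t + δ / 2), ⟨le_max_left _ _, max_lt ht.1 (by linarith)⟩,
      ⟨lt_min ht.2 (by linarith), min_le_left _ _⟩, ?_⟩
    rintro _ ⟨s, ⟨hs1, hs2⟩, rfl⟩
    refine hd ?_
    have := le_max_right 0 (t - δ / 2)
    have := min_le_right 1 (t + δ / 2)
    rw [Real.dist_eq, abs_lt]; constructor <;> linarith
  have s1 : Icc 0 u ⊆ Icc 0 1 := Icc_subset_Icc_right (by linarith [hut.2, ht.2])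
  have s2 : Icc v 1 ⊆ Icc 0 1 := Icc_subset_Icc_left (by linarith [hvt.1, ht.1])
  have kB : IsClosed (γ '' Icc 0 u ∪ γ '' Icc v 1) :=
    ((isCompact_Icc.image_of_continuousOn (hc.mono s1)).union
      (isCompact_Icc.image_of_continuousOn (hc.mono s2))).isClosed
  have htB : γ t ∉ γ '' Icc 0 u ∪ γ '' Icc v 1 := by
    rintro (⟨s, hs, h⟩ | ⟨s, hs, h⟩)
    · have := hi (s1 hs) htI h; linarith [hs.2, hut.2]
    · have := hi (s2 hs) htI h; linarith [hs.1, hvt.1]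
  obtain ⟨r, hr, hrW⟩ : ∃ r > 0, ball (γ t) r ⊆ V ∩ (γ '' Icc 0 u ∪ γ '' Icc v 1)ᶜ :=
    Metric.mem_nhds_iff.1 (Filter.inter_mem (ball_mem_nhds _ hρ) (kB.isOpen_compl.mem_nhds htB))
  set W := ball (γ t) r with hW
  have hWV : W ⊆ V := fun z hz => (hrW hz).1
  set K := α ∪ sphere (γ t) ρ with hK
  have kα : IsClosed α := (isCompact_Icc.image_of_continuousOn hc).isClosed
  have kK : IsClosed K := kα.union Metric.isClosed_sphere
  have hKo : IsOpen Kᶜ := kK.isOpen_compl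
  have hVα : ∀ z ∈ V, z ∉ α → z ∈ Kᶜ := by
    intro z hz hzα hzK
    refine hzK.elim hzα fun h => ?_
    rw [hV, mem_ball] at hz; rw [Metric.mem_sphere] at h; linarith
  have comp_sub : ∀ z ∈ V, z ∉ α → connectedComponentIn Kᶜ z ⊆ V \ α := by
    intro z hz hzα w hw
    refine ⟨?_, fun h => connectedComponentIn_subset _ _ hw (Or.inl h)⟩
    refine isPreconnected_connectedComponentIn.subset_left_of_subset_union isOpen_ball
      (v := (closedBall (γ t) ρ)ᶜ) Metric.isClosed_closedBall.isOpen_compl ?_ ?_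
      ⟨z, mem_connectedComponentIn (hVα z hz hzα), hz⟩ hw
    · exact disjoint_compl_right_iff_subset.2 ball_subset_closedBall
    · intro z hz
      have h1 := connectedComponentIn_subset _ _ hz
      by_contra h
      simp only [mem_union, mem_ball, mem_compl_iff, Metric.mem_closedBall, not_or, not_not,
        not_lt] at h
      exact h1 (Or.inr (le_antisymm h.2 h.1))
  -- the toggle property: every ball around a point of the arc meets points outside any component
  have htog : ∀ a' ∈ α ∩ W, ∀ U ∈ 𝓝 a', ∀ z ∈ V, z ∉ α →
      ∃ w ∈ (U ∩ W) \ α, w ∉ connectedComponentIn Kᶜ z := by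
    rintro a' ⟨⟨s, hs, rfl⟩, hsW⟩ U hU z hz hzα
    obtain ⟨ε, hε, hεU⟩ := Metric.mem_nhds_iff.1
      (Filter.inter_mem hU (isOpen_ball.mem_nhds hsW))
    by_contra hcon
    push Not at hcon
    exact toggle hc hi (convex_ball _ _) isOpen_ball h0V h1V hs hε
      (fun w hw => hWV (hεU hw).2) isPreconnected_connectedComponentIn (comp_sub z hz hzα)
      (fun w hw => hcon w ⟨hεU hw.1, hw.2⟩)
  have htW : γ t ∈ α ∩ W := ⟨⟨t, htI, rfl⟩, mem_ball_self hr⟩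
  obtain ⟨x1, hx1W, hx1α⟩ : ∃ x, x ∈ W ∧ x ∉ α := by
    by_contra hcon
    push Not at hcon
    exact toggle hc hi (convex_ball _ _) isOpen_ball h0V h1V htI hr hWV
      isPreconnected_empty (empty_subset _) (fun w hw => (hw.2 (hcon w hw.1)).elim)
  obtain ⟨x2, ⟨⟨-, hx2W⟩, hx2α⟩, hx2⟩ := htog (γ t) htW univ Filter.univ_mem x1 (hWV hx1W) hx1α
  have hdis : ∀ x y, y ∉ connectedComponentIn Kᶜ x → Disjoint (connectedComponentIn Kᶜ x)
      (connectedComponentIn Kᶜ y) := by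
    intro x y h
    rw [disjoint_left]
    intro w h1 h2
    have hy : y ∈ Kᶜ := by
      by_contra hy
      rw [connectedComponentIn_eq_empty hy] at h2; exact h2
    rw [connectedComponentIn_eq h1, ← connectedComponentIn_eq h2] at h
    exact h (mem_connectedComponentIn hy)
  have hcover : W \ α ⊆ connectedComponentIn Kᶜ x1 ∪ connectedComponentIn Kᶜ x2 := by
    rintro x3 ⟨hx3W, hx3α⟩
    by_contra hcon
    rw [mem_union, not_or] at hcon
    have hsym : ∀ x y, x ∈ V → x ∉ α → y ∉ connectedComponentIn Kᶜ x → x ∉ connectedComponentIn Kᶜ y := by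
      intro x y hx hxα h hx'
      exact disjoint_left.1 (hdis x y h) (mem_connectedComponentIn (hVα x hx hxα)) hx'
    refine sides_le_two hc hi (a := γ t) (ρ := ρ) (u := u) (v := v)
      ⟨hut.1, by linarith [hut.2, ht.2]⟩ ⟨by linarith [hvt.1, ht.1], hvt.2⟩
      (by linarith [hut.2, hvt.1]) huv (W := W) (convex_ball _ _).isPreconnected hWV
      (disjoint_left.2 fun z hz => (hrW hz).2) K hK ![x1, x2, x3] ?_ ?_
    · intro i; fin_cases i
      exacts [⟨hx1W, hx1α⟩, ⟨hx2W, hx2α⟩, ⟨hx3W, hx3α⟩]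
    · intro i j hij
      fin_cases i <;> fin_cases j <;> first | exact (hij rfl).elim | skip
      · exact hx2
      · exact hcon.1
      · exact hsym _ _ (hWV hx1W) hx1α hx2
      · exact hcon.2
      · exact hsym _ _ (hWV hx1W) hx1α hcon.1
      · exact hsym _ _ (hWV hx2W) hx2α hcon.2
  refine ⟨W, isOpen_ball, htW.2, fun z hz => (hρV (hWV hz)).1, connectedComponentIn Kᶜ x1,
    connectedComponentIn Kᶜ x2, hKo.connectedComponentIn, hKo.connectedComponentIn, hdis _ _ hx2,
    isPreconnected_connectedComponentIn, isPreconnected_connectedComponentIn,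
    fun z hz => ⟨(hρV (comp_sub x1 (hWV hx1W) hx1α hz).1).1, (comp_sub x1 (hWV hx1W) hx1α hz).2⟩,
    fun z hz => ⟨(hρV (comp_sub x2 (hWV hx2W) hx2α hz).1).1, (comp_sub x2 (hWV hx2W) hx2α hz).2⟩,
    hcover, ?_⟩
  intro a' ha'
  constructor
  · rw [mem_closure_iff_nhds]
    intro U hU
    obtain ⟨w, hw, hw'⟩ := htog a' ha' U hU x2 (hWV hx2W) hx2α
    exact ⟨w, hw.1.1, (hcover ⟨hw.1.2, hw.2⟩).resolve_right hw'⟩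
  · rw [mem_closure_iff_nhds]
    intro U hU
    obtain ⟨w, hw, hw'⟩ := htog a' ha' U hU x1 (hWV hx1W) hx1α
    exact ⟨w, hw.1.1, (hcover ⟨hw.1.2, hw.2⟩).resolve_left hw'⟩


/-! ### Arcs and simple closed curves -/

def IsArcParam {X : Type*} [TopologicalSpace X] (γ : ℝ → X) (A : Set X) (a b : X) : Prop :=
  ContinuousOn γ (Icc 0 1) ∧ InjOn γ (Icc 0 1) ∧ γ '' Icc 0 1 = A ∧ γ 0 = a ∧ γ 1 = b

def IsArc {X : Type*} [TopologicalSpace X] (A : Set X) (a b : X) : Prop :=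
  ∃ γ : ℝ → X, IsArcParam γ A a b

section arcs
variable {X Y : Type*} [TopologicalSpace X] [TopologicalSpace Y]

/-- arcs from parametrizations on arbitrary intervals -/
lemma isArc_of_Icc {γ : ℝ → X} {s t : ℝ} (hst : s < t) (hc : ContinuousOn γ (Icc s t))
    (hi : InjOn γ (Icc s t)) : IsArc (γ '' Icc s t) (γ s) (γ t) := by
  have him : (fun u : ℝ => s + u * (t - s)) '' Icc 0 1 = Icc s t := by
    have : (fun u : ℝ => s + u * (t - s)) = fun u => (t - s) * u + s := by ext; ring
    rw [this, image_affine_Icc' (sub_pos.2 hst)]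
    simp
  have hm : MapsTo (fun u : ℝ => s + u * (t - s)) (Icc 0 1) (Icc s t) := by
    rw [← him]; exact mapsTo_image _ _
  refine ⟨fun u => γ (s + u * (t - s)), ?_, ?_, ?_, by simp, by simp⟩
  · exact hc.comp (by fun_prop) hm
  · refine hi.comp ?_ hm
    intro u _ v _ h
    have h' : u * (t - s) = v * (t - s) := by simpa using h
    exact mul_right_cancel₀ (sub_pos.2 hst).ne' h'
  · rw [← him, image_image]

lemma isArc_of_Icc_rev {γ : ℝ → X} {s t : ℝ} (hst : s < t) (hc : ContinuousOn γ (Icc s t))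
    (hi : InjOn γ (Icc s t)) : IsArc (γ '' Icc s t) (γ t) (γ s) := by
  have hm : ∀ u ∈ Icc (-t) (-s), -u ∈ Icc s t := fun u hu => ⟨by linarith [hu.2], by linarith [hu.1]⟩
  have := isArc_of_Icc (γ := fun u => γ (-u)) (s := -t) (t := -s) (by linarith)
    (hc.comp (by fun_prop) hm) (fun u hu v hv h => neg_injective (hi (hm u hu) (hm v hv) h))
  have him : (fun u : ℝ => γ (-u)) '' Icc (-t) (-s) = γ '' Icc s t := by
    rw [show (fun u : ℝ => γ (-u)) = γ ∘ Neg.neg from rfl, image_comp]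
    simp
  rw [him] at this
  simpa using this

lemma IsArc.symm {A : Set X} {a b : X} (h : IsArc A a b) : IsArc A b a := by
  obtain ⟨γ, hc, hi, rfl, rfl, rfl⟩ := h
  exact isArc_of_Icc_rev zero_lt_one hc hi

lemma IsArc.left_mem {A : Set X} {a b : X} (h : IsArc A a b) : a ∈ A := by
  obtain ⟨γ, hc, hi, rfl, rfl, rfl⟩ := h
  exact ⟨0, by simp, rfl⟩

lemma IsArc.right_mem {A : Set X} {a b : X} (h : IsArc A a b) : b ∈ A := h.symm.left_mem

lemma IsArc.ne {A : Set X} {a b : X} (h : IsArc A a b) : a ≠ b := by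
  obtain ⟨γ, hc, hi, rfl, rfl, rfl⟩ := h
  intro h
  have := hi (by simp) (by simp) h
  norm_num at this

lemma IsArc.isCompact {A : Set X} {a b : X} (h : IsArc A a b) : IsCompact A := by
  obtain ⟨γ, hc, hi, rfl, rfl, rfl⟩ := h
  exact isCompact_Icc.image_of_continuousOn hc

lemma IsArc.isPreconnected {A : Set X} {a b : X} (h : IsArc A a b) : IsPreconnected A := by
  obtain ⟨γ, hc, hi, rfl, rfl, rfl⟩ := h
  exact isPreconnected_Icc.image _ hc

lemma IsArc.isPreconnected_diff_left {A : Set X} {a b : X} (h : IsArc A a b) :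
    IsPreconnected (A \ {a}) := by
  obtain ⟨γ, hc, hi, rfl, rfl, rfl⟩ := h
  have : γ '' Icc 0 1 \ {γ 0} = γ '' Ioc 0 1 := by
    rw [← image_singleton, ← hi.image_diff_subset (by simp), Icc_sdiff_left]
  rw [this]
  exact isPreconnected_Ioc.image _ (hc.mono Ioc_subset_Icc_self)

lemma IsArc.isPreconnected_open {A : Set X} {a b : X} (h : IsArc A a b) :
    IsPreconnected (A \ {a, b}) := by
  obtain ⟨γ, hc, hi, rfl, rfl, rfl⟩ := h
  have : γ '' Icc 0 1 \ {γ 0, γ 1} = γ '' Ioo 0 1 := by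
    rw [← image_pair, ← hi.image_diff_subset (by simp [insert_subset_iff]), Icc_sdiff_both]
  rw [this]
  exact isPreconnected_Ioo.image _ (hc.mono Ioo_subset_Icc_self)

lemma IsArc.image {A : Set X} {a b : X} (h : IsArc A a b) {f : X → Y} (hf : ContinuousOn f A)
    (hi : InjOn f A) : IsArc (f '' A) (f a) (f b) := by
  obtain ⟨γ, hc, hi', rfl, rfl, rfl⟩ := h
  refine ⟨f ∘ γ, hf.comp hc (mapsTo_image _ _), hi.comp hi' (mapsTo_image _ _), ?_, rfl, rfl⟩
  rw [image_comp]

/-- splitting an arc at an interior point -/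
lemma IsArc.split {A : Set X} {a b c : X} (h : IsArc A a b) (hc : c ∈ A) (ha : c ≠ a)
    (hb : c ≠ b) : ∃ A₁ A₂, IsArc A₁ a c ∧ IsArc A₂ c b ∧ A₁ ∪ A₂ = A ∧ A₁ ∩ A₂ = {c} := by
  obtain ⟨γ, hγ, hi, rfl, rfl, rfl⟩ := h
  obtain ⟨t, ht, rfl⟩ := hc
  have h0 : 0 < t := lt_of_le_of_ne ht.1 (fun h => ha (by rw [h]))
  have h1 : t < 1 := lt_of_le_of_ne ht.2 (fun h => hb (by rw [h]))
  have s1 : Icc 0 t ⊆ Icc 0 1 := Icc_subset_Icc_right ht.2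
  have s2 : Icc t 1 ⊆ Icc 0 1 := Icc_subset_Icc_left ht.1
  refine ⟨γ '' Icc 0 t, γ '' Icc t 1, isArc_of_Icc h0 (hγ.mono s1) (hi.mono s1),
    isArc_of_Icc h1 (hγ.mono s2) (hi.mono s2), ?_, ?_⟩
  · rw [← image_union, Icc_union_Icc_eq_Icc ht.1 ht.2]
  · rw [← hi.image_inter s1 s2, Icc_inter_Icc_eq_singleton ht.1 ht.2, image_singleton]

lemma IsArc.concat {A B : Set X} {a b c : X} (hA : IsArc A a b)
    (hB : IsArc B b c) (hAB : A ∩ B ⊆ {b}) : IsArc (A ∪ B) a c := by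
  classical
  obtain ⟨f, hf, hfi, rfl, rfl, rfl⟩ := hA
  obtain ⟨g, hg, hgi, rfl, hgf, rfl⟩ := hB
  let k : ℝ → X := fun t => if t ≤ 1 then f t else g (t - 1)
  have k1 : ∀ t ∈ Icc (0 : ℝ) 1, k t = f t := fun t ht => if_pos ht.2
  have k2 : ∀ t ∈ Icc (1 : ℝ) 2, k t = g (t - 1) := fun t ht => by
    rcases eq_or_lt_of_le ht.1 with h | h
    · rw [← h]; simp [k, hgf]
    · exact if_neg (not_le.2 h)
  have hm : MapsTo (fun t : ℝ => t - 1) (Icc 1 2) (Icc 0 1) := fun t ht =>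
    ⟨by linarith [ht.1], by linarith [ht.2]⟩
  have hU : Icc (0 : ℝ) 2 = Icc 0 1 ∪ Icc 1 2 := (Icc_union_Icc_eq_Icc (by norm_num) (by norm_num)).symm
  have hk : ContinuousOn k (Icc 0 2) := by
    rw [hU]
    exact ContinuousOn.union_of_isClosed (hf.congr k1)
      ((hg.comp (by fun_prop) hm).congr k2) isClosed_Icc isClosed_Icc
  have key : ∀ s ∈ Icc (0 : ℝ) 1, ∀ t ∈ Icc (1 : ℝ) 2, k s = k t → s = t := by
    intro s hs t ht h
    rw [k1 s hs, k2 t ht] at h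
    have hb : f s = f 1 := hAB ⟨⟨s, hs, rfl⟩, ⟨t - 1, hm ht, h.symm⟩⟩
    have e1 : s = 1 := hfi hs (by simp) hb
    have e2 : t - 1 = 0 := hgi (hm ht) (by simp) (by rw [← h, hb, hgf])
    linarith
  have hki : InjOn k (Icc 0 2) := by
    intro s hs t ht h
    rw [hU] at hs ht
    rcases hs with hs | hs <;> rcases ht with ht | ht
    · rw [k1 s hs, k1 t ht] at h; exact hfi hs ht h
    · exact key s hs t ht h
    · exact (key t ht s hs h.symm).symm
    · rw [k2 s hs, k2 t ht] at h
      have := hgi (hm hs) (hm ht) h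
      linarith
  have := isArc_of_Icc (by norm_num) hk hki
  have e : k '' Icc 0 2 = f '' Icc 0 1 ∪ g '' Icc 0 1 := by
    rw [hU, image_union]
    congr 1
    · exact image_congr k1
    · rw [image_congr k2, show (fun t : ℝ => g (t - 1)) = g ∘ (fun t => t - 1) from rfl, image_comp]
      congr 1
      rw [image_sub_const_Icc]; norm_num
  rw [e] at this
  convert this using 1
  · rw [k1 0 (by simp)]
  · rw [k2 2 (by simp)]; norm_num

/-- first hit of a closed set -/
lemma IsArc.first_hit [T2Space X] {A K : Set X} {a b : X} (h : IsArc A a b) (hK : IsClosed K)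
    (ha : a ∉ K) (hne : (A ∩ K).Nonempty) :
    ∃ A' c, A' ⊆ A ∧ IsArc A' a c ∧ A' ∩ K = {c} := by
  obtain ⟨γ, hγ, hi, rfl, rfl, rfl⟩ := h
  let T := Icc (0 : ℝ) 1 ∩ γ ⁻¹' K
  have hT : IsClosed T := hγ.preimage_isClosed_of_isClosed isClosed_Icc hK
  have hTc : IsCompact T := isCompact_Icc.of_isClosed_subset hT inter_subset_left
  have hTn : T.Nonempty := by
    obtain ⟨_, ⟨t, ht, rfl⟩, h⟩ := hne
    exact ⟨t, ht, h⟩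
  have hs := hTc.sInf_mem hTn
  set s := sInf T
  have hs0 : 0 < s := lt_of_le_of_ne hs.1.1 (fun h => ha (by rw [h]; exact hs.2))
  have ss : Icc 0 s ⊆ Icc 0 1 := Icc_subset_Icc_right hs.1.2
  refine ⟨γ '' Icc 0 s, γ s, image_mono ss, isArc_of_Icc hs0 (hγ.mono ss) (hi.mono ss), ?_⟩
  ext z
  constructor
  · rintro ⟨⟨t, ht, rfl⟩, htK⟩
    have : s ≤ t := csInf_le hTc.bddBelow ⟨ss ht, htK⟩
    rw [le_antisymm ht.2 this]; rfl
  · rintro rfl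
    exact ⟨⟨s, ⟨hs0.le, le_rfl⟩, rfl⟩, hs.2⟩

lemma IsArc.suffix {A : Set X} {a b p : X} (h : IsArc A a b) (hp : p ∈ A) (hpb : p ≠ b) :
    ∃ A', A' ⊆ A ∧ IsArc A' p b := by
  by_cases hpa : p = a
  · exact ⟨A, Subset.rfl, hpa ▸ h⟩
  · obtain ⟨A₁, A₂, h1, h2, h3, -⟩ := h.split hp hpa hpb
    exact ⟨A₂, h3 ▸ subset_union_right, h2⟩

lemma IsArc.trans [T2Space X] {A B : Set X} {a b c : X} (hA : IsArc A a b) (hB : IsArc B b c)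
    (hac : a ≠ c) : ∃ C ⊆ A ∪ B, IsArc C a c := by
  by_cases haB : a ∈ B
  · obtain ⟨B', h1, h2⟩ := hB.suffix haB hac
    exact ⟨B', h1.trans subset_union_right, h2⟩
  · obtain ⟨A', d, h1, h2, h3⟩ := hA.first_hit hB.isCompact.isClosed haB ⟨b, hA.right_mem, hB.left_mem⟩
    have hd : d ∈ A' ∩ B := h3 ▸ rfl
    by_cases hdc : d = c
    · exact ⟨A', h1.trans subset_union_left, hdc ▸ h2⟩
    · obtain ⟨B', h4, h5⟩ := hB.suffix hd.2 hdc
      refine ⟨A' ∪ B', union_subset_union h1 h4, h2.concat h5 ?_⟩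
      rw [← h3]; exact inter_subset_inter_right _ h4

/-- map between arcs -/
lemma IsArc.exists_map [T2Space X] {A : Set X} {a b : X} (h : IsArc A a b) {A' : Set Y}
    {a' b' : Y} (h' : IsArc A' a' b') : ∃ k : X → Y, ContinuousOn k A ∧ InjOn k A ∧
    k '' A = A' ∧ k a = a' ∧ k b = b' := by
  obtain ⟨γ, hγ, hi, rfl, rfl, rfl⟩ := h
  obtain ⟨δ, hδ, hdi, rfl, rfl, rfl⟩ := h'
  obtain ⟨r, hr, hrt⟩ := exists_inverse_compact isCompact_Icc hγ hi
  have hrm : MapsTo r (γ '' Icc 0 1) (Icc 0 1) := by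
    rintro _ ⟨t, ht, rfl⟩; rw [hrt t ht]; exact ht
  refine ⟨δ ∘ r, hδ.comp hr hrm, ?_, ?_, ?_, ?_⟩
  · refine hdi.comp ?_ hrm
    rintro _ ⟨s, hs, rfl⟩ _ ⟨t, ht, rfl⟩ h
    rw [hrt s hs, hrt t ht] at h; rw [h]
  · rw [image_image]
    exact image_congr fun t ht => by simp [hrt t ht]
  · simp [hrt 0 (by simp)]
  · simp [hrt 1 (by simp)]

/-- Pair of arcs forming a simple closed curve. -/
def IsSCCPair (J₁ J₂ : Set X) (a b : X) : Prop :=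
  IsArc J₁ a b ∧ IsArc J₂ a b ∧ J₁ ∩ J₂ = {a, b}

def IsSCC (J : Set X) : Prop := ∃ J₁ J₂ a b, IsSCCPair J₁ J₂ a b ∧ J = J₁ ∪ J₂

lemma IsSCCPair.swap {J₁ J₂ : Set X} {a b : X} (h : IsSCCPair J₁ J₂ a b) : IsSCCPair J₂ J₁ a b :=
  ⟨h.2.1, h.1, by rw [inter_comm, h.2.2]⟩

lemma IsSCCPair.symm {J₁ J₂ : Set X} {a b : X} (h : IsSCCPair J₁ J₂ a b) : IsSCCPair J₁ J₂ b a :=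
  ⟨h.1.symm, h.2.1.symm, by rw [h.2.2, pair_comm]⟩

lemma IsSCCPair.rebase₁ {J₁ J₂ : Set X} {a b c : X} (h : IsSCCPair J₁ J₂ a b) (hc : c ∈ J₁)
    (ha : c ≠ a) : ∃ K₁ K₂, IsSCCPair K₁ K₂ a c ∧ J₁ ∪ J₂ = K₁ ∪ K₂ := by
  by_cases hb : c = b
  · subst hb; exact ⟨J₁, J₂, h, rfl⟩
  obtain ⟨A₁, A₂, h1, h2, h3, h4⟩ := h.1.split hc ha hb
  have hcap : A₂ ∩ J₂ ⊆ {b} := by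
    rintro z ⟨hz1, hz2⟩
    have : z ∈ J₁ ∩ J₂ := ⟨h3 ▸ Or.inr hz1, hz2⟩
    rw [h.2.2] at this
    rcases this with rfl | h'
    · have : z ∈ A₁ ∩ A₂ := ⟨h1.left_mem, hz1⟩
      rw [h4] at this; exact (ha this.symm).elim
    · exact h'
  have hint1 : A₁ ∩ J₂ ⊆ {a} := by
    rintro z ⟨hz1, hz2⟩
    have : z ∈ J₁ ∩ J₂ := ⟨h3 ▸ Or.inl hz1, hz2⟩
    rw [h.2.2] at this
    rcases this with rfl | h'
    · rfl
    · rw [mem_singleton_iff] at h'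
      subst h'
      have : z ∈ A₁ ∩ A₂ := ⟨hz1, h2.right_mem⟩
      rw [h4] at this; exact (hb this.symm).elim
  refine ⟨A₁, J₂ ∪ A₂, ⟨h1, h.2.1.concat h2.symm (by rw [inter_comm]; exact hcap), ?_⟩, ?_⟩
  · apply Subset.antisymm
    · rintro z ⟨hz, hz' | hz'⟩
      · exact Or.inl (hint1 ⟨hz, hz'⟩)
      · exact Or.inr (h4 ▸ ⟨hz, hz'⟩ : z ∈ ({c} : Set X))
    · rintro z (rfl | hz)
      · exact ⟨h1.left_mem, Or.inl h.2.1.left_mem⟩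
      · rw [mem_singleton_iff] at hz; subst hz
        exact ⟨h1.right_mem, Or.inr h2.left_mem⟩
  · rw [← h3, union_assoc, union_comm A₂ J₂]

lemma IsSCCPair.rebase {J₁ J₂ : Set X} {a b c : X} (h : IsSCCPair J₁ J₂ a b) (hc : c ∈ J₁ ∪ J₂)
    (ha : c ≠ a) : ∃ K₁ K₂, IsSCCPair K₁ K₂ a c ∧ J₁ ∪ J₂ = K₁ ∪ K₂ := by
  rcases hc with hc | hc
  · exact h.rebase₁ hc ha
  · rw [union_comm]; exact h.swap.rebase₁ hc ha

lemma IsSCC.exists_pair {J : Set X} (h : IsSCC J) {c d : X} (hc : c ∈ J) (hd : d ∈ J)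
    (hcd : c ≠ d) : ∃ J₁ J₂, IsSCCPair J₁ J₂ c d ∧ J = J₁ ∪ J₂ := by
  obtain ⟨J₁, J₂, a, b, h, rfl⟩ := h
  by_cases hca : c = a
  · subst hca; exact h.rebase hd hcd.symm
  · obtain ⟨K₁, K₂, h1, h2⟩ := h.rebase hc hca
    rw [h2] at hd ⊢
    exact h1.symm.rebase hd hcd.symm

lemma IsSCC.isCompact {J : Set X} (h : IsSCC J) : IsCompact J := by
  obtain ⟨J₁, J₂, a, b, h, rfl⟩ := h
  exact h.1.isCompact.union h.2.1.isCompact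

lemma IsSCC.isPreconnected {J : Set X} (h : IsSCC J) : IsPreconnected J := by
  obtain ⟨J₁, J₂, a, b, h, rfl⟩ := h
  exact h.1.isPreconnected.union a h.1.left_mem h.2.1.left_mem h.2.1.isPreconnected

lemma IsSCC.nonempty {J : Set X} (h : IsSCC J) : J.Nonempty := by
  obtain ⟨J₁, J₂, a, b, h, rfl⟩ := h
  exact ⟨a, Or.inl h.1.left_mem⟩

lemma IsSCC.exists_ne {J : Set X} (h : IsSCC J) (c : X) : ∃ d ∈ J, d ≠ c := by
  obtain ⟨J₁, J₂, a, b, h, rfl⟩ := h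
  by_cases hc : a = c
  · exact ⟨b, Or.inl h.1.right_mem, fun h' => h.1.ne (hc.trans h'.symm)⟩
  · exact ⟨a, Or.inl h.1.left_mem, hc⟩

lemma IsSCC.isPreconnected_diff {J : Set X} (h : IsSCC J) (c : X) : IsPreconnected (J \ {c}) := by
  by_cases hc : c ∈ J
  · obtain ⟨d, hd, hdc⟩ := h.exists_ne c
    obtain ⟨J₁, J₂, hp, rfl⟩ := h.exists_pair hc hd hdc.symm
    rw [union_sdiff_distrib]
    exact hp.1.isPreconnected_diff_left.union d ⟨hp.1.right_mem, hdc⟩ ⟨hp.2.1.right_mem, hdc⟩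
      hp.2.1.isPreconnected_diff_left
  · rw [sdiff_singleton_eq_self hc]; exact h.isPreconnected

lemma IsSCC.image {J : Set X} (h : IsSCC J) {f : X → Y} (hf : ContinuousOn f J)
    (hi : InjOn f J) : IsSCC (f '' J) := by
  obtain ⟨J₁, J₂, a, b, h, rfl⟩ := h
  refine ⟨f '' J₁, f '' J₂, f a, f b, ⟨h.1.image (hf.mono subset_union_left)
    (hi.mono subset_union_left), h.2.1.image (hf.mono subset_union_right)
    (hi.mono subset_union_right), ?_⟩, image_union _ _ _⟩
  rw [← hi.image_inter subset_union_left subset_union_right, h.2.2, image_pair]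

/-- A point of an arc or of a simple closed curve is a distinguished point of a small sub-arc. -/
lemma IsSCC.exists_subarc {J : Set X} (h : IsSCC J) {c : X} (hc : c ∈ J) :
    ∃ N R p q, IsArc N p q ∧ c ∈ N ∧ c ≠ p ∧ c ≠ q ∧ J = N ∪ R ∧ c ∉ R ∧ IsCompact R := by
  obtain ⟨d, hd, hdc⟩ := h.exists_ne c
  obtain ⟨J₁, J₂, hp, rfl⟩ := h.exists_pair hc hd hdc.symm
  have mid : ∀ {A : Set X}, IsArc A c d → ∃ m ∈ A, m ≠ c ∧ m ≠ d := by
    rintro A ⟨γ, hγ, hi, rfl, rfl, rfl⟩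
    refine ⟨γ (1/2), ⟨1/2, by norm_num, rfl⟩, fun h => ?_, fun h => ?_⟩
    · have := hi (by norm_num) (by simp) h; norm_num at this
    · have := hi (by norm_num) (by simp) h; norm_num at this
  obtain ⟨m, hm, hmc, hmd⟩ := mid hp.1
  obtain ⟨n, hn, hnc, hnd⟩ := mid hp.2.1
  obtain ⟨A₁, A₂, a1, a2, a3, a4⟩ := hp.1.split hm hmc hmd
  obtain ⟨B₁, B₂, b1, b2, b3, b4⟩ := hp.2.1.split hn hnc hnd
  have hcap : A₁ ∩ B₁ ⊆ {c} := by
    rintro z ⟨hz1, hz2⟩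
    have : z ∈ J₁ ∩ J₂ := ⟨a3 ▸ Or.inl hz1, b3 ▸ Or.inl hz2⟩
    rw [hp.2.2] at this
    rcases this with h' | h'
    · exact h'
    · rw [mem_singleton_iff] at h'; subst h'
      have : z ∈ A₁ ∩ A₂ := ⟨hz1, a2.right_mem⟩
      rw [a4] at this; exact (hmd this.symm).elim
  refine ⟨A₁ ∪ B₁, A₂ ∪ B₂, m, n, a1.symm.concat b1 hcap, Or.inl a1.left_mem, hmc.symm, hnc.symm,
    ?_, ?_, a2.isCompact.union b2.isCompact⟩
  · rw [← a3, ← b3, union_union_union_comm]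
  · rintro (h' | h')
    · have : c ∈ A₁ ∩ A₂ := ⟨a1.left_mem, h'⟩
      rw [a4] at this; exact hmc this.symm
    · have : c ∈ B₁ ∩ B₂ := ⟨b1.left_mem, h'⟩
      rw [b4] at this; exact hnc this.symm

end arcs

/-! ### Surfaces -/

/-- topological surfaces: every point is the centre of a chart -/
def IsSurf (S : Type*) [TopologicalSpace S] : Prop :=
  ∀ x : S, ∃ e : ℂ → S, IsOpenEmbedding e ∧ e 0 = x

lemma TwoSidedAt.transfer {X S : Type*} [TopologicalSpace X] [TopologicalSpace S] {e : X → S}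
    (he : IsOpenEmbedding e) {Z : Set X} {Z' : Set S} {a : X} (h : TwoSidedAt Z a) {O : Set X}
    (hO : IsOpen O) (ha : a ∈ O) (hZ : ∀ z ∈ O, e z ∈ Z' ↔ z ∈ Z) : TwoSidedAt Z' (e a) := by
  intro V hV
  have hV0 : e ⁻¹' V ∩ O ∈ 𝓝 a := Filter.inter_mem (he.continuous.continuousAt hV) (hO.mem_nhds ha)
  obtain ⟨W, hW, haW, hWV, Y₁, Y₂, o1, o2, hd, p1, p2, s1, s2, hWY, hcl⟩ := h _ hV0
  refine ⟨e '' W, he.isOpenMap _ hW, mem_image_of_mem _ haW, ?_, e '' Y₁, e '' Y₂,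
    he.isOpenMap _ o1, he.isOpenMap _ o2, ?_, p1.image _ he.continuous.continuousOn,
    p2.image _ he.continuous.continuousOn, ?_, ?_, ?_, ?_⟩
  · rintro _ ⟨w, hw, rfl⟩; exact (hWV hw).1
  · exact disjoint_image_of_injective he.injective hd
  · rintro _ ⟨w, hw, rfl⟩
    exact ⟨(s1 hw).1.1, fun h => (s1 hw).2 ((hZ _ (s1 hw).1.2).1 h)⟩
  · rintro _ ⟨w, hw, rfl⟩
    exact ⟨(s2 hw).1.1, fun h => (s2 hw).2 ((hZ _ (s2 hw).1.2).1 h)⟩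
  · rintro _ ⟨⟨w, hw, rfl⟩, hwZ⟩
    rw [← image_union]
    exact mem_image_of_mem _ (hWY ⟨hw, fun h => hwZ ((hZ _ (hWV hw).2).2 h)⟩)
  · rintro _ ⟨hz, ⟨w, hw, rfl⟩⟩
    have := hcl w ⟨(hZ _ (hWV hw).2).1 hz, hw⟩
    exact ⟨image_closure_subset_closure_image he.continuous (mem_image_of_mem _ this.1),
      image_closure_subset_closure_image he.continuous (mem_image_of_mem _ this.2)⟩

section surf
variable {S : Type*} [TopologicalSpace S]

lemma IsSurf.twoSided [T2Space S] (hS : IsSurf S) {Z N R : Set S} {p q c : S} (hN : IsArc N p q)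
    (hcN : c ∈ N) (hp : c ≠ p) (hq : c ≠ q) (hZ : Z = N ∪ R) (hR : IsClosed R) (hcR : c ∉ R) :
    TwoSidedAt Z c := by
  obtain ⟨γ, hγ, hi, rfl, rfl, rfl⟩ := hN
  obtain ⟨t, ht, rfl⟩ := hcN
  have h0 : 0 < t := lt_of_le_of_ne ht.1 (fun h => hp (by rw [h]))
  have h1 : t < 1 := lt_of_le_of_ne ht.2 (fun h => hq (by rw [h]))
  obtain ⟨e, he, hex⟩ := hS (γ t)
  have hγt : ContinuousAt γ t := hγ.continuousAt (Icc_mem_nhds h0 h1)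
  have hre : range e ∈ 𝓝 (γ t) := he.isOpen_range.mem_nhds ⟨0, hex⟩
  obtain ⟨l, u, hl, hu⟩ := mem_nhds_iff_exists_Ioo_subset.1
    (Filter.inter_mem (hγt hre) (Ioo_mem_nhds h0 h1))
  obtain ⟨s, hs1, hs2⟩ := exists_between hl.1
  obtain ⟨v, hv1, hv2⟩ := exists_between hl.2
  have hsv : Icc s v ⊆ γ ⁻¹' range e ∩ Ioo 0 1 := (Icc_subset_Ioo hs1 hv2).trans hu
  have hs0 : 0 < s := (hsv ⟨le_rfl, (hs2.trans hv1).le⟩).2.1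
  have hv0 : v < 1 := (hsv ⟨(hs2.trans hv1).le, le_rfl⟩).2.2
  have hsub : Icc s v ⊆ Icc 0 1 := hsv.trans (inter_subset_right.trans Ioo_subset_Icc_self)
  let E := he.toOpenPartialHomeomorph e
  have hEr : ∀ z, E.symm (e z) = z := fun z => E.left_inv (x := z) (by simp [E])
  have hEl : ∀ y ∈ range e, e (E.symm y) = y := by rintro _ ⟨z, rfl⟩; rw [hEr]
  have hEc : ContinuousOn E.symm (range e) := by
    have := E.continuousOn_symm
    simpa [E] using this
  have hc' : ContinuousOn (E.symm ∘ γ) (Icc s v) :=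
    hEc.comp (hγ.mono hsub) fun x hx => (hsv hx).1
  have hi' : InjOn (E.symm ∘ γ) (Icc s v) := by
    intro x hx y hy h
    apply hi (hsub hx) (hsub hy)
    rw [← hEl _ (hsv hx).1, ← hEl _ (hsv hy).1]
    exact congrArg e h
  obtain ⟨η, hη, hηi, hηm, hη0, hη1⟩ := isArc_of_Icc (hs2.trans hv1) hc' hi'
  have htm : E.symm (γ t) ∈ η '' Icc 0 1 := by
    rw [hηm]; exact ⟨t, ⟨hs2.le, hv1.le⟩, rfl⟩
  obtain ⟨τ, hτ, hτt⟩ := htm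
  have hτ0 : 0 < τ := lt_of_le_of_ne hτ.1 (fun h => by
    rw [← h, hη0] at hτt
    exact hs2.ne (hi' ⟨le_rfl, (hs2.trans hv1).le⟩ ⟨hs2.le, hv1.le⟩ hτt))
  have hτ1 : τ < 1 := lt_of_le_of_ne hτ.2 (fun h => by
    rw [h, hη1] at hτt
    exact hv1.ne' (hi' ⟨(hs2.trans hv1).le, le_rfl⟩ ⟨hs2.le, hv1.le⟩ hτt))
  have h2 := arc_twoSided_plane hη hηi ⟨hτ0, hτ1⟩
  rw [hηm, hτt] at h2
  let R' := R ∪ (γ '' Icc 0 s ∪ γ '' Icc v 1)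
  have ss1 : Icc 0 s ⊆ Icc 0 1 := Icc_subset_Icc_right (hs2.le.trans h1.le)
  have ss2 : Icc v 1 ⊆ Icc 0 1 := Icc_subset_Icc_left (h0.le.trans hv1.le)
  have hR' : IsClosed R' := hR.union
    ((isCompact_Icc.image_of_continuousOn (hγ.mono ss1)).isClosed.union
      (isCompact_Icc.image_of_continuousOn (hγ.mono ss2)).isClosed)
  have := h2.transfer he (Z' := Z) (O := e ⁻¹' R'ᶜ) (hR'.isOpen_compl.preimage he.continuous) ?_ ?_
  · rwa [hEl _ (mem_of_mem_nhds hre)] at this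
  · rw [mem_preimage, hEl _ (mem_of_mem_nhds hre)]
    rintro (h | ⟨x, hx, h⟩ | ⟨x, hx, h⟩)
    · exact hcR h
    · have := hi (ss1 hx) ht h; linarith [hx.2]
    · have := hi (ss2 hx) ht h; linarith [hx.1]
  · intro z hz
    subst hZ
    constructor
    · rintro (⟨x, hx, h⟩ | h)
      · refine ⟨x, ?_, by rw [Function.comp, h, hEr]⟩
        constructor
        · by_contra hlt
          exact hz (Or.inr (Or.inl ⟨x, ⟨hx.1, (not_le.1 hlt).le⟩, h⟩))
        · by_contra hlt
          exact hz (Or.inr (Or.inr ⟨x, ⟨(not_le.1 hlt).le, hx.2⟩, h⟩))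
      · exact (hz (Or.inl h)).elim
    · rintro ⟨x, hx, h⟩
      refine Or.inl ⟨x, hsub hx, ?_⟩
      rw [← h, Function.comp, hEl _ (hsv hx).1]

lemma IsSurf.twoSided_scc [T2Space S] (hS : IsSurf S) {J : Set S} (hJ : IsSCC J) {c : S}
    (hc : c ∈ J) : TwoSidedAt J c := by
  obtain ⟨N, R, p, q, h1, h2, h3, h4, h5, h6, h7⟩ := hJ.exists_subarc hc
  exact hS.twoSided h1 h2 h3 h4 h5 h7.isClosed h6

lemma IsSurf.exists_disc (hS : IsSurf S) {x : S} {U : Set S} (hU : U ∈ 𝓝 x) :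
    ∃ e : ℂ → S, IsOpenEmbedding e ∧ e 0 = x ∧ ∃ r > 0, e '' ball 0 r ⊆ U := by
  obtain ⟨e, he, rfl⟩ := hS x
  obtain ⟨r, hr, h⟩ := Metric.mem_nhds_iff.1 (he.continuous.continuousAt hU)
  exact ⟨e, he, rfl, r, hr, image_subset_iff.2 h⟩

lemma IsSurf.locallyConnectedSpace (hS : IsSurf S) : LocallyConnectedSpace S := by
  rw [locallyConnectedSpace_iff_subsets_isOpen_isConnected]
  intro x U hU
  obtain ⟨e, he, rfl, r, hr, h⟩ := hS.exists_disc hU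
  refine ⟨_, h, he.isOpenMap _ isOpen_ball, mem_image_of_mem _ (mem_ball_self hr), ?_⟩
  exact ((convex_ball 0 r).isConnected ⟨0, mem_ball_self hr⟩).image _ he.continuous.continuousOn

lemma IsSurf.exists_arc [T2Space S] (hS : IsSurf S) {U : Set S} (hU : IsOpen U)
    (hc : IsPreconnected U) {x y : S} (hx : x ∈ U) (hy : y ∈ U) (hxy : x ≠ y) :
    ∃ A ⊆ U, IsArc A x y := by
  have := hc.induction₂ (fun x y => x = y ∨ ∃ A ⊆ U, IsArc A x y) ?_ ?_ ?_ hx hy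
  · exact this.resolve_left hxy
  · intro x hx
    obtain ⟨e, he, rfl, r, hr, h⟩ := hS.exists_disc (hU.mem_nhds hx)
    refine mem_nhdsWithin_of_mem_nhds ?_
    filter_upwards [(he.isOpenMap _ isOpen_ball).mem_nhds
      (mem_image_of_mem _ (mem_ball_self hr))]
    rintro _ ⟨z, hz, rfl⟩
    by_cases hz0 : z = 0
    · left; rw [hz0]
    right
    have hi : InjOn (fun t : ℝ => e (t * z)) (Icc 0 1) := by
      intro s _ t _ h
      have := he.injective h
      simpa [hz0] using this
    have h2 := isArc_of_Icc zero_lt_one (he.continuous.comp (by fun_prop)).continuousOn hi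
    refine ⟨_, ?_, by simpa using h2⟩
    rintro _ ⟨t, ht, rfl⟩
    refine h (mem_image_of_mem _ ?_)
    have hz' : ‖z‖ < r := by simpa using hz
    simp only [mem_ball, dist_zero_right, Complex.norm_mul, Complex.norm_real, Real.norm_eq_abs,
      abs_of_nonneg ht.1]
    nlinarith [norm_nonneg z, ht.2]
  · rintro x y z - - - (rfl | ⟨A, hA, h⟩) (rfl | ⟨B, hB, h'⟩)
    · exact Or.inl rfl
    · exact Or.inr ⟨B, hB, h'⟩
    · exact Or.inr ⟨A, hA, h⟩
    · by_cases hxz : x = z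
      · exact Or.inl hxz
      · obtain ⟨C, hC, h3⟩ := h.trans h' hxz
        exact Or.inr ⟨C, hC.trans (union_subset hA hB), h3⟩
  · rintro x y - - (rfl | ⟨A, hA, h⟩)
    · exact Or.inl rfl
    · exact Or.inr ⟨A, hA, h.symm⟩

end surf

/-! ### Complementary domains; Jordan curves in surfaces -/

/-- `G` is a component of the open set `U` -/
def IsComp {X : Type*} [TopologicalSpace X] (U G : Set X) : Prop :=
  G.Nonempty ∧ IsOpen G ∧ IsPreconnected G ∧ G ⊆ U ∧ frontier G ⊆ Uᶜ

section comp
variable {X : Type*} [TopologicalSpace X]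

lemma IsComp.subset {U G P : Set X} (h : IsComp U G) (hP : IsPreconnected P) (hPU : P ⊆ U)
    (hne : (P ∩ G).Nonempty) : P ⊆ G := by
  by_contra hn
  obtain ⟨y, hy, hyG⟩ := not_subset.1 hn
  have hfr : ∀ z ∈ P, z ∈ closure G → z ∈ G := fun z hz hzc => by
    by_contra hzG
    exact h.2.2.2.2 (h.2.1.frontier_eq ▸ ⟨hzc, hzG⟩) (hPU hz)
  obtain ⟨z, hz, hz1, hz2⟩ := hP G (closure G)ᶜ h.2.1 isClosed_closure.isOpen_compl
    (fun z hz => (em (z ∈ closure G)).imp (hfr z hz) id) hne ⟨y, hy, fun h' => hyG (hfr y hy h')⟩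
  exact hz2 (subset_closure hz1)

lemma IsComp.eq {U G H : Set X} (hG : IsComp U G) (hH : IsComp U H) (hne : (G ∩ H).Nonempty) :
    G = H :=
  Subset.antisymm (hH.subset hG.2.2.1 hG.2.2.2.1 hne)
    (hG.subset hH.2.2.1 hH.2.2.2.1 (by rwa [inter_comm]))

lemma IsComp.disjoint {U G H : Set X} (hG : IsComp U G) (hH : IsComp U H) (hne : G ≠ H) :
    Disjoint G H := by
  rw [disjoint_iff_inter_eq_empty]
  by_contra h
  exact hne (hG.eq hH (nonempty_iff_ne_empty.2 h))

lemma exists_isComp [LocallyConnectedSpace X] {U : Set X} (hU : IsOpen U) {x : X} (hx : x ∈ U) :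
    ∃ G, IsComp U G ∧ x ∈ G :=
  ⟨connectedComponentIn U x, ⟨⟨x, mem_connectedComponentIn hx⟩, hU.connectedComponentIn,
    isPreconnected_connectedComponentIn, connectedComponentIn_subset _ _,
    frontier_component hU x⟩, mem_connectedComponentIn hx⟩

lemma IsComp.closure_eq {Z G : Set X} (h : IsComp Zᶜ G) : closure G ⊆ G ∪ Z := by
  rw [closure_eq_self_union_frontier]
  exact union_subset_union_right _ (by simpa using h.2.2.2.2)

lemma IsComp.frontier_eq {U G : Set X} (h : IsComp U G) : frontier G = closure G \ G :=
  h.2.1.frontier_eq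

lemma IsComp.mem_frontier {Z G : Set X} (h : IsComp Zᶜ G) {a : X} (ha : a ∈ Z)
    (hc : a ∈ closure G) : a ∈ frontier G := by
  rw [h.frontier_eq]; exact ⟨hc, fun h' => h.2.2.2.1 h' ha⟩

/-- near a two-sided point, a component whose closure contains the point contains a side -/
lemma IsComp.side {Z G Y₁ Y₂ W : Set X} {a : X} (h : IsComp Zᶜ G) (hW : IsOpen W)
    (haW : a ∈ W) (ha : a ∈ closure G) (p1 : IsPreconnected Y₁) (p2 : IsPreconnected Y₂)
    (s1 : Y₁ ⊆ Zᶜ) (s2 : Y₂ ⊆ Zᶜ) (hWY : W \ Z ⊆ Y₁ ∪ Y₂) : Y₁ ⊆ G ∨ Y₂ ⊆ G := by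
  obtain ⟨x, hxW, hxG⟩ := mem_closure_iff.1 ha W hW haW
  rcases hWY ⟨hxW, h.2.2.2.1 hxG⟩ with hx | hx
  · exact Or.inl (h.subset p1 s1 ⟨x, hx, hxG⟩)
  · exact Or.inr (h.subset p2 s2 ⟨x, hx, hxG⟩)

lemma IsComp.spread {Z B G : Set X} (hG : IsComp Zᶜ G) (hBZ : B ⊆ Z) (hB : IsPreconnected B)
    (hts : ∀ a ∈ B, TwoSidedAt Z a) (hne : (B ∩ closure G).Nonempty) : B ⊆ closure G := by
  by_contra hn
  obtain ⟨y, hy, hyG⟩ := not_subset.1 hn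
  let O : Set X := ⋃₀ {W | IsOpen W ∧ Z ∩ W ⊆ closure G}
  have hO : IsOpen O := isOpen_sUnion fun W hW => hW.1
  have hcov : B ⊆ O ∪ (closure G)ᶜ := by
    intro a ha
    by_cases haG : a ∈ closure G
    · left
      obtain ⟨W, hW, haW, -, Y₁, Y₂, o1, o2, hd, p1, p2, s1, s2, hWY, hcl⟩ :=
        hts a ha univ Filter.univ_mem
      refine ⟨W, ⟨hW, fun z hz => ?_⟩, haW⟩
      rcases hG.side hW haW haG p1 p2 (fun z hz => (s1 hz).2) (fun z hz => (s2 hz).2) hWY with h | h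
      · exact closure_mono h (hcl z hz).1
      · exact closure_mono h (hcl z hz).2
    · exact Or.inr haG
  obtain ⟨z, hzB, ⟨W, hW, hzW⟩, hz⟩ := hB O _ hO isClosed_closure.isOpen_compl hcov
    (by
      obtain ⟨b, hb, hbG⟩ := hne
      exact ⟨b, hb, (hcov hb).resolve_right fun h => h hbG⟩) ⟨y, hy, hyG⟩
  exact hz (hW.2 ⟨hBZ hzB, hzW⟩)

lemma comp_pigeon {Z G₁ G₂ G₃ : Set X} {a : X} (ha : TwoSidedAt Z a) (h1 : IsComp Zᶜ G₁)
    (h2 : IsComp Zᶜ G₂) (h3 : IsComp Zᶜ G₃) (c1 : a ∈ closure G₁) (c2 : a ∈ closure G₂)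
    (c3 : a ∈ closure G₃) (haZ : a ∈ Z) : G₁ = G₂ ∨ G₁ = G₃ ∨ G₂ = G₃ := by
  obtain ⟨W, hW, haW, -, Y₁, Y₂, o1, o2, hd, p1, p2, s1, s2, hWY, hcl⟩ := ha univ Filter.univ_mem
  have s1' : Y₁ ⊆ Zᶜ := fun z hz => (s1 hz).2
  have s2' : Y₂ ⊆ Zᶜ := fun z hz => (s2 hz).2
  have n1 : Y₁.Nonempty := closure_nonempty_iff.1 ⟨a, (hcl a ⟨haZ, haW⟩).1⟩
  have n2 : Y₂.Nonempty := closure_nonempty_iff.1 ⟨a, (hcl a ⟨haZ, haW⟩).2⟩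
  have e1 : ∀ {G H : Set X}, IsComp Zᶜ G → IsComp Zᶜ H → Y₁ ⊆ G → Y₁ ⊆ H → G = H :=
    fun hG hH g h => hG.eq hH (n1.mono (subset_inter g h))
  have e2 : ∀ {G H : Set X}, IsComp Zᶜ G → IsComp Zᶜ H → Y₂ ⊆ G → Y₂ ⊆ H → G = H :=
    fun hG hH g h => hG.eq hH (n2.mono (subset_inter g h))
  rcases h1.side hW haW c1 p1 p2 s1' s2' hWY with g1 | g1 <;>
  rcases h2.side hW haW c2 p1 p2 s1' s2' hWY with g2 | g2 <;>
  rcases h3.side hW haW c3 p1 p2 s1' s2' hWY with g3 | g3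
  · exact Or.inl (e1 h1 h2 g1 g2)
  · exact Or.inl (e1 h1 h2 g1 g2)
  · exact Or.inr (Or.inl (e1 h1 h3 g1 g3))
  · exact Or.inr (Or.inr (e2 h2 h3 g2 g3))
  · exact Or.inr (Or.inr (e1 h2 h3 g2 g3))
  · exact Or.inr (Or.inl (e2 h1 h3 g1 g3))
  · exact Or.inl (e2 h1 h2 g1 g2)
  · exact Or.inl (e2 h1 h2 g1 g2)

end comp

/-- every simple closed curve separates -/
def SepProp (S : Type*) [TopologicalSpace S] : Prop := ∀ J : Set S, IsSCC J → ¬ IsPreconnected Jᶜ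

lemma IsArc.exists_mid {X : Type*} [TopologicalSpace X] {A : Set X} {c d : X} (h : IsArc A c d) :
    ∃ m ∈ A, m ≠ c ∧ m ≠ d := by
  obtain ⟨γ, hγ, hi, rfl, rfl, rfl⟩ := h
  refine ⟨γ (1/2), ⟨1/2, by norm_num, rfl⟩, fun h => ?_, fun h => ?_⟩
  · have := hi (by norm_num) (by simp) h; norm_num at this
  · have := hi (by norm_num) (by simp) h; norm_num at this

section jordan
variable {S : Type*} [TopologicalSpace S] [T2Space S] [PreconnectedSpace S]

lemma IsSurf.frontier_face (hS : IsSurf S) {J G : Set S} (hJ : IsSCC J) (hG : IsComp Jᶜ G) :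
    frontier G = J := by
  have hsub : frontier G ⊆ J := by simpa using hG.2.2.2.2
  refine Subset.antisymm hsub fun a ha => hG.mem_frontier ha ?_
  refine hG.spread Subset.rfl hJ.isPreconnected (fun a ha => hS.twoSided_scc hJ ha) ?_ ha
  obtain ⟨z, hz⟩ : (frontier G).Nonempty := by
    rw [nonempty_iff_ne_empty]
    intro h
    rcases frontier_eq_empty_iff.1 h with h | h
    · exact hG.1.ne_empty h
    · obtain ⟨j, hj⟩ := hJ.nonempty
      exact hG.2.2.2.1 (h ▸ mem_univ j) hj
  exact ⟨z, hsub hz, frontier_subset_closure hz⟩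

lemma IsSurf.closure_face (hS : IsSurf S) {J G : Set S} (hJ : IsSCC J) (hG : IsComp Jᶜ G) :
    closure G = G ∪ J := by
  rw [closure_eq_self_union_frontier, hS.frontier_face hJ hG]

/-- Jordan curve theorem: the other side of a face -/
lemma IsSurf.other_face (hS : IsSurf S) (hsep : SepProp S) {J F : Set S} (hJ : IsSCC J)
    (hF : IsComp Jᶜ F) : IsComp Jᶜ (closure F)ᶜ := by
  have := hS.locallyConnectedSpace
  have hJo : IsOpen Jᶜ := hJ.isCompact.isClosed.isOpen_compl
  have hne : ∃ x ∈ Jᶜ, x ∉ F := by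
    by_contra! h
    exact hsep J hJ (Subset.antisymm h hF.2.2.2.1 ▸ hF.2.2.1)
  obtain ⟨x, hxJ, hxF⟩ := hne
  obtain ⟨G, hG, hxG⟩ := exists_isComp hJo hxJ
  have hFG : F ≠ G := fun h => hxF (h ▸ hxG)
  have hGe : G = (closure F)ᶜ := by
    rw [hS.closure_face hJ hF]
    apply Subset.antisymm
    · intro z hz
      rintro (h | h)
      · exact (disjoint_left.1 (hF.disjoint hG hFG)) h hz
      · exact hG.2.2.2.1 hz h
    · intro z hz
      have hzF : z ∉ F := fun h => hz (Or.inl h)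
      obtain ⟨H, hH, hzH⟩ := exists_isComp hJo (x := z) (fun h => hz (Or.inr h))
      obtain ⟨a, ha⟩ := hJ.nonempty
      have cl : ∀ {K : Set S}, IsComp Jᶜ K → a ∈ closure K := fun hK =>
        frontier_subset_closure ((hS.frontier_face hJ hK).symm ▸ ha)
      rcases comp_pigeon (hS.twoSided_scc hJ ha) hF hG hH (cl hF) (cl hG) (cl hH) ha with h | h | h
      · exact (hFG h).elim
      · exact (hzF (h ▸ hzH)).elim
      · exact h ▸ hzH
  exact hGe ▸ hG

/-- theta-curve lemma -/
lemma IsSurf.theta (hS : IsSurf S) (hsep : SepProp S) {J₁ J₂ A F : Set S} {a b : S}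
    (hJ : IsSCCPair J₁ J₂ a b) (hF : IsComp (J₁ ∪ J₂)ᶜ F) (hA : IsArc A a b)
    (hAF : A \ {a, b} ⊆ F) : ∃ G₁ G₂, Disjoint G₁ G₂ ∧ G₁ ∪ G₂ = F \ A ∧
      IsSCCPair A J₁ a b ∧ IsSCCPair A J₂ a b ∧
      IsComp (A ∪ J₁)ᶜ G₁ ∧ IsComp (A ∪ J₂)ᶜ G₂ := by
  have := hS.locallyConnectedSpace
  have hJs : IsSCC (J₁ ∪ J₂) := ⟨_, _, _, _, hJ, rfl⟩
  have hFJ : ∀ z ∈ F, z ∉ J₁ ∪ J₂ := fun z hz => hF.2.2.2.1 hz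
  have hF' := hS.other_face hsep hJs hF
  have hclF := hS.closure_face hJs hF
  have hclF' : J₁ ∪ J₂ ⊆ closure (closure F)ᶜ := by
    rw [hS.closure_face hJs hF']; exact subset_union_right
  have main : ∀ {K₁ K₂ : Set S}, IsSCCPair K₁ K₂ a b → J₁ ∪ J₂ = K₁ ∪ K₂ →
      IsSCCPair A K₁ a b ∧ ∃ G, IsComp (A ∪ K₁)ᶜ G ∧ G ⊆ F \ A := by
    intro K₁ K₂ hK hJK
    have hp : IsSCCPair A K₁ a b := by
      refine ⟨hA, hK.1, ?_⟩
      apply Subset.antisymm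
      · rintro z ⟨hz, hz'⟩
        by_contra hn
        exact hFJ z (hAF ⟨hz, hn⟩) (hJK ▸ Or.inl hz')
      · rintro z (rfl | hz)
        · exact ⟨hA.left_mem, hK.1.left_mem⟩
        · rw [mem_singleton_iff] at hz; subst hz
          exact ⟨hA.right_mem, hK.1.right_mem⟩
    refine ⟨hp, ?_⟩
    have hL : IsSCC (A ∪ K₁) := ⟨_, _, _, _, hp, rfl⟩
    have hsub : (closure F)ᶜ ⊆ (A ∪ K₁)ᶜ := by
      apply compl_subset_compl.2
      rw [hclF]
      rintro z (hz | hz)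
      · by_cases hn : z ∈ ({a, b} : Set S)
        · right; rw [hJK]; rcases hn with rfl | hn
          · exact Or.inl hK.1.left_mem
          · rw [mem_singleton_iff] at hn; subst hn; exact Or.inl hK.1.right_mem
        · exact Or.inl (hAF ⟨hz, hn⟩)
      · right; rw [hJK]; exact Or.inl hz
    obtain ⟨x, hx⟩ := hF'.1
    obtain ⟨H, hH, hxH⟩ := exists_isComp hL.isCompact.isClosed.isOpen_compl (hsub hx)
    have hFH : (closure F)ᶜ ⊆ H := hH.subset hF'.2.2.1 hsub ⟨x, hx, hxH⟩
    refine ⟨_, hS.other_face hsep hL hH, ?_⟩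
    intro z hz
    rw [hS.closure_face hL hH] at hz
    have hzH : z ∉ H := fun h => hz (Or.inl h)
    have hzA : z ∉ A := fun h => hz (Or.inr (Or.inl h))
    refine ⟨?_, hzA⟩
    have : z ∈ closure F := by
      by_contra h; exact hzH (hFH h)
    rw [hclF] at this
    refine this.resolve_right fun h => ?_
    have := closure_mono hFH (hclF' h)
    rw [hS.closure_face hL hH] at this
    exact hz this
  obtain ⟨hp1, G₁, hG1, hs1⟩ := main hJ rfl
  obtain ⟨hp2, G₂, hG2, hs2⟩ := main hJ.swap (union_comm _ _)
  have hL1 : IsSCC (A ∪ J₁) := ⟨_, _, _, _, hp1, rfl⟩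
  have hL2 : IsSCC (A ∪ J₂) := ⟨_, _, _, _, hp2, rfl⟩
  let Z := J₁ ∪ J₂ ∪ A
  have hZ : IsClosed Z := hJs.isCompact.isClosed.union hA.isCompact.isClosed
  have up : ∀ {K G : Set S}, IsSCC (A ∪ K) → K ⊆ J₁ ∪ J₂ → IsComp (A ∪ K)ᶜ G → G ⊆ F \ A →
      IsComp Zᶜ G := by
    intro K G hL hK hG hGF
    refine ⟨hG.1, hG.2.1, hG.2.2.1, ?_, ?_⟩
    · rintro z hz (h | h)
      · exact hFJ z (hGF hz).1 h
      · exact (hGF hz).2 h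
    · rw [hS.frontier_face hL hG, compl_compl]
      exact union_subset subset_union_right (hK.trans subset_union_left)
  have g1 := up hL1 subset_union_left hG1 hs1
  have g2 := up hL2 subset_union_right hG2 hs2
  have hne : G₁ ≠ G₂ := by
    rintro rfl
    have e := (hS.frontier_face hL1 hG1).symm.trans (hS.frontier_face hL2 hG2)
    obtain ⟨m, hm, hma, hmb⟩ := hJ.1.exists_mid
    have hmm : m ∈ A ∪ J₂ := e ▸ Or.inr hm
    have : m ∉ ({a, b} : Set S) := by simp [hma, hmb]
    rcases hmm with h | h
    · exact this (hp1.2.2 ▸ ⟨h, hm⟩)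
    · exact this (hJ.2.2 ▸ ⟨hm, h⟩)
  refine ⟨G₁, G₂, g1.disjoint g2 hne, ?_, hp1, hp2, hG1, hG2⟩
  refine Subset.antisymm (union_subset hs1 hs2) ?_
  rintro x ⟨hxF, hxA⟩
  obtain ⟨G, hG, hxG⟩ := exists_isComp hZ.isOpen_compl (x := x)
    (fun h => h.elim (hFJ x hxF) hxA)
  by_contra hx
  have n1 : G₁ ≠ G := fun h => hx (Or.inl (h ▸ hxG))
  have n2 : G₂ ≠ G := fun h => hx (Or.inr (h ▸ hxG))
  have hGZ : ∀ z ∈ G, z ∉ Z := fun z hz => hG.2.2.2.1 hz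
  have hfr : frontier G ⊆ J₁ ∪ J₂ := by
    intro c hc
    have hcZ : c ∈ Z := by simpa using hG.2.2.2.2 hc
    refine hcZ.elim id fun hcA => ?_
    by_contra hcJ
    have hca : c ≠ a := fun h => hcJ (h ▸ Or.inl hJ.1.left_mem)
    have hcb : c ≠ b := fun h => hcJ (h ▸ Or.inl hJ.1.right_mem)
    have ts : TwoSidedAt Z c := hS.twoSided hA hcA hca hcb (union_comm _ _) hJs.isCompact.isClosed hcJ
    have c1 : c ∈ closure G₁ := frontier_subset_closure ((hS.frontier_face hL1 hG1).symm ▸ Or.inl hcA)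
    have c2 : c ∈ closure G₂ := frontier_subset_closure ((hS.frontier_face hL2 hG2).symm ▸ Or.inl hcA)
    rcases comp_pigeon ts g1 g2 hG c1 c2 (frontier_subset_closure hc) hcZ with h | h | h
    exacts [hne h, n1 h, n2 h]
  have hGJ : IsComp (J₁ ∪ J₂)ᶜ G :=
    ⟨hG.1, hG.2.1, hG.2.2.1, fun z hz h => hGZ z hz (Or.inl h), by rwa [compl_compl]⟩
  have := hGJ.eq hF ⟨x, hxG, hxF⟩
  subst this
  obtain ⟨m, hm, hma, hmb⟩ := hA.exists_mid
  exact hGZ m (hAF ⟨hm, by simp [hma, hmb]⟩) (Or.inr hm)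

end jordan

/-! ### Accessibility of boundary points -/

/-- Convergent sequence of consecutive arcs gives an arc. -/
lemma ray_to_arc {X : Type*} [TopologicalSpace X] {E : ℕ → Set X} {p : ℕ → X} {a : X}
    (hE : ∀ n, IsArc (E n) (p n) (p (n + 1))) (h1 : ∀ n, E n ∩ E (n + 1) ⊆ {p (n + 1)})
    (h2 : ∀ n m, n + 2 ≤ m → Disjoint (E n) (E m))
    (hlim : ∀ U ∈ 𝓝 a, ∃ N, ∀ n ≥ N, E n ⊆ U) (ha : ∀ n, a ∉ E n) :
    IsArc ((⋃ n, E n) ∪ {a}) (p 0) a := by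
  choose e hc hi him h0 h1' using hE
  let v : ℝ → X := fun u => e ⌊u⌋₊ (u - ⌊u⌋₊)
  have hfr : ∀ u : ℝ, 0 ≤ u → u - ⌊u⌋₊ ∈ Ico (0 : ℝ) 1 := fun u hu =>
    ⟨sub_nonneg.2 (Nat.floor_le hu), by linarith [Nat.lt_floor_add_one u]⟩
  have hv : ∀ n : ℕ, ∀ u ∈ Icc (n : ℝ) (n + 1), v u = e n (u - n) := by
    intro n u hu
    rcases eq_or_lt_of_le hu.2 with h | h
    · have : ⌊u⌋₊ = n + 1 := by
        rw [h]; exact_mod_cast Nat.floor_natCast (R := ℝ) (n + 1)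
      simp only [v, this]
      rw [h]
      push_cast
      simp [h0, h1']
    · have : ⌊u⌋₊ = n := (Nat.floor_eq_iff (le_trans (by positivity) hu.1)).2 ⟨hu.1, h⟩
      simp only [v, this]
  have hvE : ∀ u : ℝ, 0 ≤ u → v u ∈ E ⌊u⌋₊ := fun u hu => by
    rw [← him]; exact ⟨_, Ico_subset_Icc_self (hfr u hu), rfl⟩
  have hvc' : ∀ n : ℕ, ContinuousOn v (Icc 0 n) := by
    intro n
    induction n with
    | zero => simp
    | succ n ih =>
      have : Icc (0 : ℝ) (n + 1 : ℕ) = Icc (0 : ℝ) (n : ℝ) ∪ Icc (n : ℝ) ((n : ℝ) + 1) := by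
        push_cast
        rw [Icc_union_Icc_eq_Icc (by positivity) (by linarith)]
      rw [this]
      refine ih.union_of_isClosed ?_ isClosed_Icc isClosed_Icc
      refine ContinuousOn.congr ?_ (hv n)
      refine (hc n).comp (by fun_prop) fun u hu => ⟨by linarith [hu.1], by linarith [hu.2]⟩
  have hvc : ContinuousOn v (Ici 0) := by
    intro u hu
    refine (hvc' (⌊u⌋₊ + 1) u ⟨hu, by push_cast; exact (Nat.lt_floor_add_one u).le⟩).mono_of_mem_nhdsWithin ?_
    refine mem_nhdsWithin.2 ⟨Iio (⌊u⌋₊ + 1 : ℕ), isOpen_Iio, by push_cast; exact Nat.lt_floor_add_one u, ?_⟩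
    rintro w ⟨hw, hw'⟩
    exact ⟨hw', hw.le⟩
  have hlt : ∀ s t : ℝ, 0 ≤ s → s < t → v s ≠ v t := by
    intro s t hs hst h
    have ht := hs.trans hst.le
    have hn : ⌊s⌋₊ ≤ ⌊t⌋₊ := Nat.floor_le_floor hst.le
    rcases Nat.lt_or_ge (⌊t⌋₊) (⌊s⌋₊ + 2) with hlt | hge
    · rcases Nat.lt_or_ge (⌊s⌋₊) (⌊t⌋₊) with h3 | h3
      · have h4 : ⌊t⌋₊ = ⌊s⌋₊ + 1 := by omega
        have h5 : v s ∈ E ⌊s⌋₊ ∩ E (⌊s⌋₊ + 1) := ⟨hvE s hs, by rw [h, ← h4]; exact hvE t ht⟩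
        have h6 := h1 _ h5
        rw [mem_singleton_iff, ← h1'] at h6
        have := hi _ (Ico_subset_Icc_self (hfr s hs)) (by simp) h6
        linarith [(hfr s hs).2]
      · have h4 : ⌊t⌋₊ = ⌊s⌋₊ := le_antisymm h3 hn
        simp only [v, h4] at h
        have h5 := hfr t ht
        rw [h4] at h5
        have := hi _ (Ico_subset_Icc_self (hfr s hs)) (Ico_subset_Icc_self h5) h
        linarith
    · exact (disjoint_left.1 (h2 _ _ hge)) (hvE s hs) (h ▸ hvE t ht)
  classical
  let w : ℝ → X := fun t => if t < 1 then v (t / (1 - t)) else a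
  have hw : ∀ t, t < 1 → w t = v (t / (1 - t)) := fun t ht => if_pos ht
  have hq : ∀ t ∈ Ico (0 : ℝ) 1, 0 ≤ t / (1 - t) := fun t ht => div_nonneg ht.1 (by linarith [ht.2])
  have hw1 : w 1 = a := if_neg (lt_irrefl _)
  refine ⟨w, ?_, ?_, ?_, ?_, hw1⟩
  · intro t ht
    rcases eq_or_lt_of_le ht.2 with h | h
    · subst h
      rw [ContinuousWithinAt, hw1]
      intro U hU
      obtain ⟨N, hN⟩ := hlim U hU
      have : Ioi (1 - 1 / (N + 1 : ℝ)) ∈ 𝓝 (1 : ℝ) := Ioi_mem_nhds (by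
        have : (0 : ℝ) < 1 / (N + 1) := by positivity
        linarith)
      rw [Filter.mem_map]
      filter_upwards [mem_nhdsWithin_of_mem_nhds this, self_mem_nhdsWithin] with s hs hs1
      rcases eq_or_lt_of_le hs1.2 with h | h
      · rw [mem_preimage, h, hw1]; exact mem_of_mem_nhds hU
      · rw [mem_preimage, hw s h]
        refine hN _ ?_ (hvE _ (hq s ⟨hs1.1, h⟩))
        apply Nat.le_floor
        rw [le_div_iff₀ (by linarith)]
        have hs' : 1 - 1 / (N + 1 : ℝ) < s := hs
        have hN' : (0 : ℝ) < N + 1 := by positivity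
        have : (1 - s) * (N + 1) < 1 := by
          have : 1 - s < 1 / (N + 1 : ℝ) := by linarith
          rwa [lt_div_iff₀ hN'] at this
        nlinarith
    · have hd : ContinuousOn (fun t : ℝ => t / (1 - t)) (Ico 0 1) :=
        continuousOn_id.div (by fun_prop) fun s hs => by linarith [hs.2]
      have := (hvc.comp hd hq) t ⟨ht.1, h⟩
      have h3 : Ico (0 : ℝ) 1 ∈ 𝓝[Icc 0 1] t := by
        refine mem_nhdsWithin.2 ⟨Iio 1, isOpen_Iio, h, ?_⟩
        rintro s ⟨h, h'⟩; exact ⟨h'.1, h⟩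
      refine (this.mono_of_mem_nhdsWithin h3).congr_of_eventuallyEq ?_ (hw t h)
      filter_upwards [h3] with s hs using hw s hs.2
  · have key : ∀ s ∈ Icc (0 : ℝ) 1, ∀ t ∈ Icc (0 : ℝ) 1, s < t → w s ≠ w t := by
      intro s hs t ht hst
      have hs1 := lt_of_lt_of_le hst ht.2
      rw [hw s hs1]
      rcases eq_or_lt_of_le ht.2 with h | h
      · rw [h, hw1]; intro h'
        exact ha _ (h' ▸ hvE _ (hq s ⟨hs.1, hs1⟩))
      · rw [hw t h]
        refine hlt _ _ (hq s ⟨hs.1, hs1⟩) ?_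
        rw [div_lt_div_iff₀ (by linarith) (by linarith)]
        nlinarith
    intro s hs t ht h
    rcases lt_trichotomy s t with h' | h' | h'
    · exact (key s hs t ht h' h).elim
    · exact h'
    · exact (key t ht s hs h' h.symm).elim
  · apply Subset.antisymm
    · rintro _ ⟨t, ht, rfl⟩
      rcases eq_or_lt_of_le ht.2 with h | h
      · right; rw [h, hw1]; rfl
      · left; rw [hw t h]; exact mem_iUnion.2 ⟨_, hvE _ (hq t ⟨ht.1, h⟩)⟩
    · rintro z (hz | hz)
      · obtain ⟨n, hz⟩ := mem_iUnion.1 hz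
        rw [← him] at hz
        obtain ⟨s, hs, rfl⟩ := hz
        have hpos : (0 : ℝ) ≤ n + s := by have := hs.1; positivity
        refine ⟨(n + s) / (1 + (n + s)), ⟨by positivity, ?_⟩, ?_⟩
        · rw [div_le_one (by positivity)]; linarith
        · rw [hw _ (by rw [div_lt_one (by positivity)]; linarith)]
          have : (n + s) / (1 + (n + s)) / (1 - (n + s) / (1 + (n + s))) = n + s := by
            have : (1 + (n + s)) ≠ 0 := by positivity
            field_simp
            ring
          rw [this, hv n _ ⟨by linarith [hs.1], by linarith [hs.2]⟩]
          simp
      · rw [mem_singleton_iff] at hz; subst hz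
        exact ⟨1, by simp, hw1⟩
  · rw [hw 0 one_pos, zero_div, hv 0 0 (by simp)]
    simp [h0]

/-- local connectedness of `F` at a boundary point `a` -/
def LCAt {S : Type*} [TopologicalSpace S] (F : Set S) (a : S) : Prop :=
  ∀ V ∈ 𝓝 a, ∃ W Y, IsOpen W ∧ a ∈ W ∧ IsOpen Y ∧ IsPreconnected Y ∧ Y ⊆ F ∧ Y ⊆ V ∧ F ∩ W ⊆ Y

structure AccState {S : Type*} [TopologicalSpace S] (F : Set S) (a : S) where
  B : Set S
  d : Set S
  p : S
  x : S
  W : Set S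
  Y : Set S
  hB : IsCompact B
  hBF : B ⊆ F
  hdF : d ⊆ F
  hd : IsArc d p x
  hdB : d ∩ B ⊆ {p}
  hp : p ∈ B
  hW : IsOpen W
  haW : a ∈ W
  hYo : IsOpen Y
  hYp : IsPreconnected Y
  hYF : Y ⊆ F
  hFW : F ∩ W ⊆ Y
  hx : x ∈ Y
  hYB : Disjoint Y B

section acc
variable {S : Type*} [TopologicalSpace S] [T2Space S]

lemma AccState.step (hS : IsSurf S) {F : Set S} {a : S} (ha : a ∉ F) (hac : a ∈ closure F)
    (hlc : LCAt F a) (st : AccState F a) {U : Set S} (hU : U ∈ 𝓝 a) :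
    ∃ (st' : AccState F a) (E : Set S), IsArc E st.p st'.p ∧ E ⊆ st.d ∧ st'.B = st.B ∪ E ∧
      st'.d ⊆ st.Y ∧ st'.Y ⊆ U := by
  have hcl : IsClosed (st.B ∪ st.d) := (st.hB.union st.hd.isCompact).isClosed
  have hV : U ∩ (st.B ∪ st.d)ᶜ ∈ 𝓝 a := Filter.inter_mem hU (hcl.isOpen_compl.mem_nhds
    fun h => ha (h.elim (fun h => st.hBF h) (fun h => st.hdF h)))
  obtain ⟨W', Y', hW', haW', hYo', hYp', hYF', hYV', hFW'⟩ := hlc _ hV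
  obtain ⟨x', ⟨hx1, hx2⟩, hx3⟩ := mem_closure_iff.1 hac (W' ∩ st.W) (hW'.inter st.hW) ⟨haW', st.haW⟩
  have hx'Y' : x' ∈ Y' := hFW' ⟨hx3, hx1⟩
  have hx'Y : x' ∈ st.Y := st.hFW ⟨hx3, hx2⟩
  have hx'd : x' ∉ st.d := fun h => (hYV' hx'Y').2 (Or.inr h)
  have hxx : x' ≠ st.x := fun h => hx'd (h ▸ st.hd.right_mem)
  obtain ⟨δ, hδY, hδ⟩ := hS.exists_arc st.hYo st.hYp hx'Y st.hx hxx
  obtain ⟨A', c, hA'δ, hA', hA'd⟩ := hδ.first_hit st.hd.isCompact.isClosed hx'd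
    ⟨st.x, hδ.right_mem, st.hd.right_mem⟩
  have hc : c ∈ A' ∩ st.d := hA'd ▸ rfl
  have hcp : c ≠ st.p := fun h => disjoint_left.1 st.hYB (hδY (hA'δ hc.1)) (h ▸ st.hp)
  have hE : ∃ E, IsArc E st.p c ∧ E ⊆ st.d := by
    by_cases hcx : c = st.x
    · exact ⟨st.d, hcx ▸ st.hd, Subset.rfl⟩
    · obtain ⟨A₁, A₂, h1, h2, h3, -⟩ := st.hd.split hc.2 hcp hcx
      exact ⟨A₁, h1, h3 ▸ subset_union_left⟩
  obtain ⟨E, hE, hEd⟩ := hE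
  refine ⟨{ B := st.B ∪ E, d := A', p := c, x := x', W := W', Y := Y',
            hB := st.hB.union hE.isCompact, hBF := union_subset st.hBF (hEd.trans st.hdF)
            hdF := (hA'δ.trans hδY).trans st.hYF, hd := hA'.symm
            hdB := ?_, hp := Or.inr hE.right_mem, hW := hW', haW := haW', hYo := hYo'
            hYp := hYp', hYF := hYF', hFW := hFW', hx := hx'Y', hYB := ?_ }, E, hE, hEd, rfl,
            hA'δ.trans hδY, fun z hz => (hYV' hz).1⟩
  · rintro z ⟨hz, hz' | hz'⟩
    · exact (disjoint_left.1 st.hYB (hδY (hA'δ hz)) hz').elim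
    · rw [← hA'd]; exact ⟨hz, hEd hz'⟩
  · rw [disjoint_left]
    rintro z hz (hz' | hz')
    · exact (hYV' hz).2 (Or.inl hz')
    · exact (hYV' hz).2 (Or.inr (hEd hz'))

lemma IsSurf.accessible [FirstCountableTopology S] (hS : IsSurf S) {F : Set S} {a x₀ : S}
    (hFo : IsOpen F) (hFp : IsPreconnected F) (ha : a ∉ F) (hac : a ∈ closure F)
    (hlc : LCAt F a) (hx₀ : x₀ ∈ F) : ∃ A, IsArc A x₀ a ∧ A \ {a} ⊆ F := by
  obtain ⟨U, hU⟩ := (𝓝 a).exists_antitone_basis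
  have hU' : ∀ n, U n ∈ 𝓝 a := fun n => hU.1.mem_of_mem trivial
  obtain ⟨st₀, hst₀⟩ : ∃ st : AccState F a, st.p = x₀ := by
    have hV : ({x₀}ᶜ : Set S) ∈ 𝓝 a := isOpen_compl_singleton.mem_nhds fun h => ha (h ▸ hx₀)
    obtain ⟨W, Y, hW, haW, hYo, hYp, hYF, hYV, hFW⟩ := hlc _ hV
    obtain ⟨x, hx1, hx2⟩ := mem_closure_iff.1 hac W hW haW
    have hxY := hFW ⟨hx2, hx1⟩
    obtain ⟨d, hdF, hd⟩ := hS.exists_arc hFo hFp hx₀ hx2 (fun h => hYV hxY h.symm)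
    exact ⟨{ B := {x₀}, d := d, p := x₀, x := x, W := W, Y := Y, hB := isCompact_singleton,
             hBF := singleton_subset_iff.2 hx₀, hdF := hdF, hd := hd, hdB := inter_subset_right,
             hp := rfl, hW := hW, haW := haW, hYo := hYo, hYp := hYp, hYF := hYF, hFW := hFW,
             hx := hxY, hYB := by
              rw [disjoint_left]; intro z hz hz'
              exact hYV hz hz' }, rfl⟩
  choose f g hg using fun (n : ℕ) (st : AccState F a) => st.step hS ha hac hlc (hU' n)
  let s : ℕ → AccState F a := fun n => Nat.rec st₀ (fun n st => f n st) n
  have hs : ∀ n, s (n + 1) = f n (s n) := fun n => rfl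
  let E : ℕ → Set S := fun n => g n (s n)
  have e1 : ∀ n, IsArc (E n) (s n).p (s (n + 1)).p := fun n => (hg n (s n)).1
  have e2 : ∀ n, E n ⊆ (s n).d := fun n => (hg n (s n)).2.1
  have e3 : ∀ n, (s (n + 1)).B = (s n).B ∪ E n := fun n => (hg n (s n)).2.2.1
  have e4 : ∀ n, (s (n + 1)).d ⊆ (s n).Y := fun n => (hg n (s n)).2.2.2.1
  have e5 : ∀ n, (s (n + 1)).Y ⊆ U n := fun n => (hg n (s n)).2.2.2.2
  have hEF : ∀ n, E n ⊆ F := fun n => (e2 n).trans (s n).hdF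
  have hB : ∀ m n, m < n → E m ⊆ (s n).B := by
    intro m n hmn
    induction n, hmn using Nat.le_induction with
    | base => rw [e3]; exact subset_union_right
    | succ n hmn ih => rw [e3]; exact ih.trans subset_union_left
  have hcap : ∀ m n, m < n → E m ∩ E n ⊆ {(s n).p} := fun m n hmn z hz =>
    (s n).hdB ⟨e2 n hz.2, hB m n hmn hz.1⟩
  have := ray_to_arc (E := E) (p := fun n => (s n).p) (a := a) e1
    (fun n => hcap n (n + 1) (Nat.lt_succ_self n)) ?_ ?_ (fun n h => ha (hEF n h))
  · refine ⟨_, by rw [← hst₀]; exact this, ?_⟩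
    rintro z ⟨hz | hz, hza⟩
    · obtain ⟨n, hn⟩ := mem_iUnion.1 hz
      exact hEF n hn
    · exact (hza hz).elim
  · intro n m hnm
    rw [disjoint_left]
    intro z hz hz'
    obtain ⟨k, rfl⟩ : ∃ k, m = k + 1 := ⟨m - 1, by omega⟩
    have h1 : z = (s (k + 1)).p := hcap n (k + 1) (by omega) ⟨hz, hz'⟩
    have h2 : z = (s k).p := hcap n k (by omega) ⟨hz, h1 ▸ (e1 k).right_mem⟩
    exact (e1 k).ne (h2.symm.trans h1)
  · intro V hV
    obtain ⟨N, -, hN⟩ := hU.1.mem_iff.1 hV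
    refine ⟨N + 2, fun n hn => ?_⟩
    obtain ⟨k, rfl⟩ : ∃ k, n = k + 2 := ⟨n - 2, by omega⟩
    exact (e2 _).trans ((e4 (k + 1)).trans ((e5 k).trans ((hU.2 (by omega)).trans hN)))

variable [PreconnectedSpace S]

lemma IsSurf.lcAt_face (hS : IsSurf S) (hsep : SepProp S) {J F : Set S} (hJ : IsSCC J)
    (hF : IsComp Jᶜ F) {a : S} (ha : a ∈ J) : LCAt F a := by
  intro V hV
  obtain ⟨W, hW, haW, hWV, Y₁, Y₂, o1, o2, hd, p1, p2, s1, s2, hWY, hcl⟩ :=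
    hS.twoSided_scc hJ ha V hV
  have s1' : Y₁ ⊆ Jᶜ := fun z hz => (s1 hz).2
  have s2' : Y₂ ⊆ Jᶜ := fun z hz => (s2 hz).2
  have hF' := hS.other_face hsep hJ hF
  have cl : ∀ {K : Set S}, IsComp Jᶜ K → a ∈ closure K := fun hK =>
    frontier_subset_closure ((hS.frontier_face hJ hK).symm ▸ ha)
  have n1 : Y₁.Nonempty := closure_nonempty_iff.1 ⟨a, (hcl a ⟨ha, haW⟩).1⟩
  have n2 : Y₂.Nonempty := closure_nonempty_iff.1 ⟨a, (hcl a ⟨ha, haW⟩).2⟩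
  have dis : ∀ z, z ∈ F → z ∈ (closure F)ᶜ → False := fun z h h' => h' (subset_closure h)
  rcases hF.side hW haW (cl hF) p1 p2 s1' s2' hWY with g | g
  · refine ⟨W, Y₁, hW, haW, o1, p1, g, fun z hz => (s1 hz).1, ?_⟩
    rintro z ⟨hzF, hzW⟩
    refine (hWY ⟨hzW, hF.2.2.2.1 hzF⟩).resolve_right fun h => ?_
    rcases hF'.side hW haW (cl hF') p1 p2 s1' s2' hWY with g' | g'
    · obtain ⟨y, hy⟩ := n1; exact dis y (g hy) (g' hy)
    · exact dis z hzF (g' h)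
  · refine ⟨W, Y₂, hW, haW, o2, p2, g, fun z hz => (s2 hz).1, ?_⟩
    rintro z ⟨hzF, hzW⟩
    refine (hWY ⟨hzW, hF.2.2.2.1 hzF⟩).resolve_left fun h => ?_
    rcases hF'.side hW haW (cl hF') p1 p2 s1' s2' hWY with g' | g'
    · exact dis z hzF (g' h)
    · obtain ⟨y, hy⟩ := n2; exact dis y (g hy) (g' hy)

/-- crosscuts exist between any two boundary points of a face -/
lemma IsSurf.crosscut [FirstCountableTopology S] (hS : IsSurf S) (hsep : SepProp S) {J F : Set S}
    (hJ : IsSCC J) (hF : IsComp Jᶜ F) {a b : S} (ha : a ∈ J) (hb : b ∈ J) (hab : a ≠ b) :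
    ∃ A, IsArc A a b ∧ A \ {a, b} ⊆ F := by
  obtain ⟨x, hx⟩ := hF.1
  have acc : ∀ {c : S}, c ∈ J → ∃ A, IsArc A x c ∧ A \ {c} ⊆ F := fun {c} hc =>
    hS.accessible hF.2.1 hF.2.2.1 (fun h => hF.2.2.2.1 h hc)
      (frontier_subset_closure ((hS.frontier_face hJ hF).symm ▸ hc)) (hS.lcAt_face hsep hJ hF hc) hx
  obtain ⟨A, hA, hA'⟩ := acc ha
  obtain ⟨B, hB, hB'⟩ := acc hb
  obtain ⟨C, hC, hCa⟩ := hA.symm.trans hB hab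
  refine ⟨C, hCa, ?_⟩
  rintro z ⟨hz, hzn⟩
  rw [mem_insert_iff, mem_singleton_iff, not_or] at hzn
  rcases hC hz with h | h
  · exact hA' ⟨h, hzn.1⟩
  · exact hB' ⟨h, hzn.2⟩

end acc

/-! ### Homogeneity and crosscuts through points -/

section homog
variable {S : Type*} [TopologicalSpace S] [T2Space S]

open Classical in
/-- extension by the identity -/
noncomputable def extMap {V : Type*} (e : V → S) (f : V → V) (s : S) : S :=
  if h : s ∈ range e then e (f h.choose) else s

lemma extMap_apply {V : Type*} {e : V → S} (he : Function.Injective e) (f : V → V) (z : V) :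
    extMap e f (e z) = e (f z) := by
  have h : e z ∈ range e := ⟨z, rfl⟩
  rw [extMap, dif_pos h, he h.choose_spec]

lemma extMap_of_notMem {V : Type*} [NormedAddCommGroup V] {e : V → S} (he : Function.Injective e) {f : V → V}
    (hf : ∀ z : V, 1 ≤ ‖z‖ → f z = z) {s : S} (hs : s ∉ e '' ball 0 1) :
    extMap e f s = s := by
  by_cases h : s ∈ range e
  · obtain ⟨z, rfl⟩ := h
    rw [extMap_apply he, hf]
    by_contra hz
    exact hs ⟨z, by simpa using hz, rfl⟩
  · rw [extMap, dif_neg h]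

lemma continuous_extMap {V : Type*} [NormedAddCommGroup V] [ProperSpace V] {e : V → S} (he : IsOpenEmbedding e) {f : V → V} (hfc : Continuous f)
    (hf : ∀ z : V, 1 ≤ ‖z‖ → f z = z) : Continuous (extMap e f) := by
  rw [continuous_iff_continuousAt]
  intro s
  by_cases h : s ∈ range e
  · obtain ⟨z, rfl⟩ := h
    rw [← he.continuousAt_iff]
    have : extMap e f ∘ e = e ∘ f := funext fun z => extMap_apply he.injective f z
    rw [this]
    exact (he.continuous.comp hfc).continuousAt
  · have hK : IsClosed (e '' closedBall 0 1) :=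
      ((isCompact_closedBall 0 1).image he.continuous).isClosed
    have : extMap e f =ᶠ[𝓝 s] id := by
      filter_upwards [hK.isOpen_compl.mem_nhds (fun h' => h (image_subset_range _ _ h'))] with t ht
      exact extMap_of_notMem he.injective hf
        (fun h' => ht (image_mono ball_subset_closedBall h'))
    exact continuousAt_id.congr this.symm

lemma exists_ext_homeo {V : Type*} [NormedAddCommGroup V] [ProperSpace V] {e : V → S} (he : IsOpenEmbedding e) (f : V ≃ₜ V)
    (hf : ∀ z : V, 1 ≤ ‖z‖ → f z = z) :
    ∃ H : S ≃ₜ S, (∀ z, H (e z) = e (f z)) ∧ ∀ s, s ∉ e '' ball 0 1 → H s = s := by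
  have hf' : ∀ z : V, 1 ≤ ‖z‖ → f.symm z = z := fun z hz => by
    rw [f.symm_apply_eq, hf z hz]
  have inv : ∀ g h : V → V, (∀ z, g (h z) = z) → ∀ s, extMap e g (extMap e h s) = s := by
    intro g h hgh s
    by_cases hs : s ∈ range e
    · obtain ⟨z, rfl⟩ := hs
      rw [extMap_apply he.injective, extMap_apply he.injective, hgh]
    · have : ∀ k, extMap e k s = s := fun k => by rw [extMap, dif_neg hs]
      rw [this, this]
  exact ⟨{ toFun := extMap e f, invFun := extMap e f.symm
           left_inv := inv _ _ f.symm_apply_apply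
           right_inv := inv _ _ f.apply_symm_apply
           continuous_toFun := continuous_extMap he f.continuous hf
           continuous_invFun := continuous_extMap he f.symm.continuous hf' },
    fun z => extMap_apply he.injective f z, fun s hs => extMap_of_notMem he.injective hf hs⟩

lemma exists_push (v : ℂ) (hv : ‖v‖ < 1) :
    ∃ f : ℂ ≃ₜ ℂ, f 0 = v ∧ ∀ z : ℂ, 1 ≤ ‖z‖ → f z = z := by
  let f : ℂ → ℂ := fun z => z + (max 0 (1 - ‖z‖) : ℝ) • v
  have hlip : ApproximatesLinearOn f ((ContinuousLinearEquiv.refl ℝ ℂ : ℂ ≃L[ℝ] ℂ) : ℂ →L[ℝ] ℂ)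
      univ ‖v‖₊ := by
    intro x _ y _
    have : f x - f y - ((ContinuousLinearEquiv.refl ℝ ℂ : ℂ ≃L[ℝ] ℂ) : ℂ →L[ℝ] ℂ) (x - y) =
        (max 0 (1 - ‖x‖) - max 0 (1 - ‖y‖) : ℝ) • v := by
      simp only [f, ContinuousLinearEquiv.coe_refl, ContinuousLinearMap.coe_id', id, sub_smul]
      ring
    rw [this, norm_smul, mul_comm]
    refine mul_le_mul_of_nonneg_left ?_ (norm_nonneg v)
    have h1 := abs_max_sub_max_le_abs (1 - ‖x‖) (1 - ‖y‖) 0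
    have h2 := abs_norm_sub_norm_le x y
    rw [max_comm 0, max_comm 0, Real.norm_eq_abs]
    refine h1.trans ?_
    rw [show 1 - ‖x‖ - (1 - ‖y‖) = -(‖x‖ - ‖y‖) by ring, abs_neg]
    exact h2
  refine ⟨hlip.toHomeomorph f (Or.inr ?_), ?_, ?_⟩
  · have : ‖((ContinuousLinearEquiv.refl ℝ ℂ).symm : ℂ →L[ℝ] ℂ)‖₊ = 1 := by
      ext; simp
    rw [this]
    simpa [← NNReal.coe_lt_coe] using hv
  · change f 0 = v
    simp [f]
  · intro z hz
    change f z = z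
    simp [f, max_eq_left (sub_nonpos.2 hz)]

lemma IsSurf.homogeneous (hS : IsSurf S) {F : Set S} (hF : IsOpen F) (hFp : IsPreconnected F)
    {x y : S} (hx : x ∈ F) (hy : y ∈ F) : ∃ H : S ≃ₜ S, H x = y ∧ ∀ z ∉ F, H z = z := by
  refine hFp.induction₂ (fun x y => ∃ H : S ≃ₜ S, H x = y ∧ ∀ z ∉ F, H z = z) ?_ ?_ ?_ hx hy
  · intro x hx
    obtain ⟨e, he, rfl, r, hr, h⟩ := hS.exists_disc (hF.mem_nhds hx)
    let e' : ℂ → S := fun z => e ((r : ℂ) * z)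
    have hr' : (r : ℂ) ≠ 0 := by exact_mod_cast hr.ne'
    have he' : IsOpenEmbedding e' := he.comp (Homeomorph.mulLeft₀ (r : ℂ) hr').isOpenEmbedding
    have hsub : e' '' ball 0 1 ⊆ F := by
      rintro _ ⟨z, hz, rfl⟩
      refine h (mem_image_of_mem _ ?_)
      have hz' : ‖z‖ < 1 := by simpa using hz
      simp only [mem_ball, dist_zero_right, Complex.norm_mul, Complex.norm_real, Real.norm_eq_abs,
        abs_of_pos hr]
      nlinarith
    have hnh : e' '' ball 0 1 ∈ 𝓝 (e 0) :=
      (he'.isOpenMap _ isOpen_ball).mem_nhds ⟨0, by simp, by simp [e']⟩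
    refine mem_nhdsWithin_of_mem_nhds ?_
    filter_upwards [hnh]
    rintro _ ⟨v, hv, rfl⟩
    obtain ⟨f, hf0, hf⟩ := exists_push v (by simpa using hv)
    obtain ⟨H, hH, hH'⟩ := exists_ext_homeo he' f hf
    refine ⟨H, ?_, fun z hz => hH' z fun h => hz (hsub h)⟩
    have := hH 0
    rw [hf0] at this
    simpa [e'] using this
  · rintro x y z - - - ⟨H, hH, hH'⟩ ⟨K, hK, hK'⟩
    exact ⟨H.trans K, by simp [hH, hK], fun w hw => by simp [hH' w hw, hK' w hw]⟩
  · rintro x y - - ⟨H, hH, hH'⟩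
    exact ⟨H.symm, by rw [← hH]; simp, fun z hz => by rw [H.symm_apply_eq, hH' z hz]⟩

/-- crosscut through a given point -/
lemma IsSurf.crosscut_through [PreconnectedSpace S] [FirstCountableTopology S] (hS : IsSurf S)
    (hsep : SepProp S) {J F : Set S} (hJ : IsSCC J) (hF : IsComp Jᶜ F) {a b x : S} (ha : a ∈ J)
    (hb : b ∈ J) (hab : a ≠ b) (hx : x ∈ F) : ∃ A, IsArc A a b ∧ A \ {a, b} ⊆ F ∧ x ∈ A := by
  obtain ⟨A, hA, hAF⟩ := hS.crosscut hsep hJ hF ha hb hab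
  obtain ⟨m, hm, hma, hmb⟩ := hA.exists_mid
  have hmF : m ∈ F := hAF ⟨hm, by simp [hma, hmb]⟩
  obtain ⟨H, hH, hH'⟩ := hS.homogeneous hF.2.1 hF.2.2.1 hmF hx
  have hJF : ∀ z ∈ J, z ∉ F := fun z hz h => hF.2.2.2.1 h hz
  have h1 := hA.image (f := H) H.continuous.continuousOn H.injective.injOn
  rw [hH' a (hJF a ha), hH' b (hJF b hb)] at h1
  refine ⟨_, h1, ?_, ⟨m, hm, hH⟩⟩
  rintro _ ⟨⟨z, hz, rfl⟩, hn⟩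
  rw [mem_insert_iff, mem_singleton_iff, not_or] at hn
  have hzF : z ∈ F := by
    refine hAF ⟨hz, ?_⟩
    rintro (rfl | h)
    · exact hn.1 (hH' _ (hJF _ ha))
    · rw [mem_singleton_iff] at h; subst h
      exact hn.2 (hH' _ (hJF _ hb))
  by_contra hzn
  have := hH' _ hzn
  exact hzn (by rw [H.injective this]; exact hzF)

end homog

/-! ### Finite decompositions of a surface into faces -/

/-- A finite decomposition with skeleton `Γ` and faces `f p`, `p ∈ 𝒟`. -/
structure Dec {S α : Type*} [TopologicalSpace S] (𝒟 : Set α) (f : α → Set S) (Γ : Set S) :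
    Prop where
  scc : ∀ p ∈ 𝒟, IsSCC (frontier (f p))
  comp : ∀ p ∈ 𝒟, IsComp (frontier (f p))ᶜ (f p)
  disj : ∀ p ∈ 𝒟, ∀ q ∈ 𝒟, p ≠ q → Disjoint (f p) (f q)
  compl : ∀ x, x ∈ Γ ↔ ∀ p ∈ 𝒟, x ∉ f p
  cov : ∀ x ∈ Γ, ∃ p ∈ 𝒟, x ∈ frontier (f p)
  pre : IsPreconnected Γ
  nocut : ∀ c, IsPreconnected (Γ \ {c})

section dec
variable {S α : Type*} [TopologicalSpace S] {𝒟 : Set α} {f : α → Set S} {Γ : Set S}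

lemma Dec.isOpen (h : Dec 𝒟 f Γ) {p : α} (hp : p ∈ 𝒟) : IsOpen (f p) := (h.comp p hp).2.1

lemma Dec.not_mem_closure (h : Dec 𝒟 f Γ) {p q : α} (hp : p ∈ 𝒟) (hq : q ∈ 𝒟) (hne : p ≠ q)
    {x : S} (hx : x ∈ f p) : x ∉ closure (f q) := fun hc =>
  disjoint_left.1 ((h.disj p hp q hq hne).closure_right (h.isOpen hp)) hx hc

lemma Dec.isClosed (h : Dec 𝒟 f Γ) : IsClosed Γ := by
  have : Γ = (⋃ p ∈ 𝒟, f p)ᶜ := by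
    ext x; rw [h.compl]; simp
  rw [this]
  exact (isOpen_biUnion fun p hp => h.isOpen hp).isClosed_compl

lemma Dec.frontier_subset (h : Dec 𝒟 f Γ) {p : α} (hp : p ∈ 𝒟) : frontier (f p) ⊆ Γ := by
  intro x hx
  rw [h.compl]
  intro q hq hxq
  by_cases hqp : q = p
  · subst hqp
    rw [(h.isOpen hq).frontier_eq] at hx
    exact hx.2 hxq
  · exact h.not_mem_closure hq hp hqp hxq (frontier_subset_closure hx)

lemma Dec.face_disj (h : Dec 𝒟 f Γ) {p : α} (hp : p ∈ 𝒟) {x : S} (hx : x ∈ f p) : x ∉ Γ :=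
  fun h' => (h.compl x).1 h' p hp hx

lemma Dec.exists_face (h : Dec 𝒟 f Γ) {x : S} (hx : x ∉ Γ) : ∃ p ∈ 𝒟, x ∈ f p := by
  rw [h.compl] at hx; push Not at hx; exact hx

lemma Dec.exists_closure (h : Dec 𝒟 f Γ) (x : S) : ∃ p ∈ 𝒟, x ∈ closure (f p) := by
  by_cases hx : x ∈ Γ
  · obtain ⟨p, hp, h'⟩ := h.cov x hx
    exact ⟨p, hp, frontier_subset_closure h'⟩
  · obtain ⟨p, hp, h'⟩ := h.exists_face hx
    exact ⟨p, hp, subset_closure h'⟩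

/-- a point in two closed faces lies on both frontiers -/
lemma Dec.mem_frontier (h : Dec 𝒟 f Γ) {p q : α} (hp : p ∈ 𝒟) (hq : q ∈ 𝒟) (hne : p ≠ q)
    {x : S} (hx : x ∈ closure (f p)) (hx' : x ∈ closure (f q)) : x ∈ frontier (f p) := by
  rw [(h.isOpen hp).frontier_eq]
  exact ⟨hx, fun h' => h.not_mem_closure hp hq hne h' hx'⟩

lemma nocut_ear {A Γ : Set S} {a b : S} (hA : IsArc A a b) (ha : a ∈ Γ) (hb : b ∈ Γ)
    {c : S} (hΓ : IsPreconnected (Γ \ {c})) : IsPreconnected ((Γ ∪ A) \ {c}) := by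
  rw [union_sdiff_distrib]
  by_cases hcA : c ∈ A
  · by_cases hca : c = a
    · subst hca
      exact hΓ.union b ⟨hb, hA.ne.symm⟩ ⟨hA.right_mem, hA.ne.symm⟩ hA.isPreconnected_diff_left
    by_cases hcb : c = b
    · subst hcb
      exact hΓ.union a ⟨ha, hA.ne⟩ ⟨hA.left_mem, hA.ne⟩ hA.symm.isPreconnected_diff_left
    obtain ⟨A₁, A₂, h1, h2, h3, -⟩ := hA.split hcA hca hcb
    rw [← h3, union_sdiff_distrib, ← union_assoc]
    have ha' : a ≠ c := fun h => hca h.symm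
    have hb' : b ≠ c := fun h => hcb h.symm
    have h5 : IsPreconnected (Γ \ {c} ∪ A₁ \ {c}) :=
      hΓ.union a ⟨ha, ha'⟩ ⟨h1.left_mem, ha'⟩ h1.symm.isPreconnected_diff_left
    exact h5.union b (Or.inl ⟨hb, hb'⟩) ⟨h2.right_mem, hb'⟩ h2.isPreconnected_diff_left
  · rw [sdiff_singleton_eq_self hcA]
    have hac : a ≠ c := fun h => hcA (h ▸ hA.left_mem)
    exact hΓ.union a ⟨ha, hac⟩ hA.left_mem hA.isPreconnected

lemma Dec.ear [T2Space S] [PreconnectedSpace S] (hS : IsSurf S) (h : Dec 𝒟 f Γ) {p q₁ q₂ : α}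
    (hp : p ∈ 𝒟) {A J₁ J₂ : Set S} {a b : S} (hJ : IsSCCPair J₁ J₂ a b)
    (hfr : frontier (f p) = J₁ ∪ J₂)
    (hA : IsArc A a b) (hAF : A \ {a, b} ⊆ f p)
    (hd : Disjoint (f q₁) (f q₂)) (hu : f q₁ ∪ f q₂ = f p \ A)
    (hp1 : IsSCCPair A J₁ a b) (hp2 : IsSCCPair A J₂ a b)
    (hc1 : IsComp (A ∪ J₁)ᶜ (f q₁)) (hc2 : IsComp (A ∪ J₂)ᶜ (f q₂)) :
    Dec (𝒟 \ {p} ∪ {q₁, q₂}) f (Γ ∪ A) := by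
  have hL1 : IsSCC (A ∪ J₁) := ⟨_, _, _, _, hp1, rfl⟩
  have hL2 : IsSCC (A ∪ J₂) := ⟨_, _, _, _, hp2, rfl⟩
  have f1 := hS.frontier_face hL1 hc1
  have f2 := hS.frontier_face hL2 hc2
  have s1 : f q₁ ⊆ f p \ A := hu ▸ subset_union_left
  have s2 : f q₂ ⊆ f p \ A := hu ▸ subset_union_right
  have hfΓ := h.frontier_subset hp
  have ha : a ∈ Γ := hfΓ (hfr ▸ Or.inl hJ.1.left_mem)
  have hb : b ∈ Γ := hfΓ (hfr ▸ Or.inl hJ.1.right_mem)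
  have hmem : ∀ {P : α → Prop}, (∀ q ∈ 𝒟, q ≠ p → P q) → P q₁ → P q₂ →
      ∀ q ∈ 𝒟 \ {p} ∪ {q₁, q₂}, P q := by
    rintro P h0 h1 h2 q (hq | rfl | hq)
    · exact h0 q hq.1 hq.2
    · exact h1
    · rw [mem_singleton_iff] at hq; subst hq; exact h2
  refine ⟨hmem (fun q hq _ => h.scc q hq) (f1 ▸ hL1) (f2 ▸ hL2),
    hmem (fun q hq _ => h.comp q hq) (by rw [f1]; exact hc1) (by rw [f2]; exact hc2), ?_, ?_, ?_,
    h.pre.union a ha hA.left_mem hA.isPreconnected, fun c => nocut_ear hA ha hb (h.nocut c)⟩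
  · have d1 : ∀ q ∈ 𝒟, q ≠ p → Disjoint (f q) (f q₁) := fun q hq hqp =>
      (h.disj q hq p hp hqp).mono_right (s1.trans sdiff_subset)
    have d2 : ∀ q ∈ 𝒟, q ≠ p → Disjoint (f q) (f q₂) := fun q hq hqp =>
      (h.disj q hq p hp hqp).mono_right (s2.trans sdiff_subset)
    refine hmem (fun q hq hqp => ?_) ?_ ?_
    · exact hmem (fun r hr _ => h.disj q hq r hr) (fun _ => d1 q hq hqp) (fun _ => d2 q hq hqp)
    · exact hmem (fun r hr hrp _ => (d1 r hr hrp).symm) (fun h => (h rfl).elim) (fun _ => hd)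
    · exact hmem (fun r hr hrp _ => (d2 r hr hrp).symm) (fun _ => hd.symm) (fun h => (h rfl).elim)
  · intro x
    constructor
    · rintro (hx | hx)
      · exact hmem (fun q hq _ => (h.compl x).1 hx q hq)
          (fun h' => h.face_disj hp (s1 h').1 hx) (fun h' => h.face_disj hp (s2 h').1 hx)
      · refine hmem (fun q hq hqp hxq => ?_) (fun h' => (s1 h').2 hx) (fun h' => (s2 h').2 hx)
        by_cases hn : x ∈ ({a, b} : Set S)
        · refine h.face_disj hq hxq ?_
          rcases hn with rfl | hn
          · exact ha
          · rw [mem_singleton_iff] at hn; exact hn ▸ hb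
        · exact disjoint_left.1 (h.disj q hq p hp hqp) hxq (hAF ⟨hx, hn⟩)
    · intro hx
      by_contra hn
      rw [mem_union, not_or] at hn
      obtain ⟨q, hq, hxq⟩ := h.exists_face hn.1
      by_cases hqp : q = p
      · subst hqp
        have : x ∈ f q₁ ∪ f q₂ := hu ▸ ⟨hxq, hn.2⟩
        rcases this with h' | h'
        · exact hx q₁ (by simp) h'
        · exact hx q₂ (by simp) h'
      · exact hx q (Or.inl ⟨hq, hqp⟩) hxq
  · rintro x (hx | hx)
    · obtain ⟨q, hq, hxq⟩ := h.cov x hx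
      by_cases hqp : q = p
      · subst hqp
        rw [hfr] at hxq
        rcases hxq with h' | h'
        · exact ⟨q₁, by simp, f1 ▸ Or.inr h'⟩
        · exact ⟨q₂, by simp, f2 ▸ Or.inr h'⟩
      · exact ⟨q, Or.inl ⟨hq, hqp⟩, hxq⟩
    · exact ⟨q₁, by simp, f1 ▸ Or.inl hx⟩

/-! local connectedness of the skeleton -/

/-- pointwise local connectedness -/
def LCSet (Γ : Set S) : Prop := ∀ a ∈ Γ, ∀ V ∈ 𝓝 a, ∃ W ∈ 𝓝 a, ∀ b ∈ Γ ∩ W,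
  ∃ E, IsPreconnected E ∧ E ⊆ Γ ∩ V ∧ a ∈ E ∧ b ∈ E

lemma IsSCC.lcSet [T2Space S] {J : Set S} (hJ : IsSCC J) : LCSet J := by
  intro a ha V hV
  obtain ⟨N, R, p, q, ⟨γ, hγ, hi, rfl, rfl, rfl⟩, ⟨t, ht, rfl⟩, h3, h4, rfl, h6, h7⟩ :=
    hJ.exists_subarc ha
  have h0 : 0 < t := lt_of_le_of_ne ht.1 (fun h => h3 (by rw [h]))
  have h1 : t < 1 := lt_of_le_of_ne ht.2 (fun h => h4 (by rw [h]))
  have hγt : ContinuousAt γ t := hγ.continuousAt (Icc_mem_nhds h0 h1)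
  obtain ⟨l, u, hl, hu⟩ := mem_nhds_iff_exists_Ioo_subset.1
    (Filter.inter_mem (hγt hV) (Ioo_mem_nhds h0 h1))
  have hsub : Ioo l u ⊆ Icc 0 1 := hu.trans (inter_subset_right.trans Ioo_subset_Icc_self)
  let R' := R ∪ γ '' (Icc 0 1 \ Ioo l u)
  have hR' : IsClosed R' := h7.isClosed.union
    ((isCompact_Icc.diff isOpen_Ioo).image_of_continuousOn (hγ.mono sdiff_subset)).isClosed
  refine ⟨R'ᶜ, hR'.isOpen_compl.mem_nhds ?_, ?_⟩
  · rintro (h | ⟨s, hs, h⟩)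
    · exact h6 h
    · exact hs.2 (hi hs.1 ht h ▸ hl)
  · rintro b ⟨hb, hbW⟩
    refine ⟨γ '' Ioo l u, isPreconnected_Ioo.image _ (hγ.mono hsub), ?_, ⟨t, hl, rfl⟩, ?_⟩
    · rintro _ ⟨s, hs, rfl⟩
      exact ⟨Or.inl ⟨s, hsub hs, rfl⟩, (hu hs).1⟩
    · rcases hb with ⟨s, hs, rfl⟩ | hb
      · refine ⟨s, ?_, rfl⟩
        by_contra hn
        exact hbW (Or.inr ⟨s, ⟨hs, hn⟩, rfl⟩)
      · exact (hbW (Or.inl hb)).elim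

lemma Dec.lcSet [T2Space S] (h : Dec 𝒟 f Γ) (hfin : 𝒟.Finite) : LCSet Γ := by
  intro a ha V hV
  have : ∀ p ∈ 𝒟, ∃ W ∈ 𝓝 a, ∀ b ∈ frontier (f p) ∩ W,
      ∃ E, IsPreconnected E ∧ E ⊆ Γ ∩ V ∧ a ∈ E ∧ b ∈ E := by
    intro p hp
    by_cases hap : a ∈ frontier (f p)
    · obtain ⟨W, hW, hWE⟩ := (h.scc p hp).lcSet a hap V hV
      refine ⟨W, hW, fun b hb => ?_⟩
      obtain ⟨E, hE, hE', h3⟩ := hWE b hb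
      exact ⟨E, hE, hE'.trans (inter_subset_inter_left _ (h.frontier_subset hp)), h3⟩
    · exact ⟨(frontier (f p))ᶜ, isClosed_frontier.isOpen_compl.mem_nhds hap,
        fun b hb => (hb.2 hb.1).elim⟩
  choose! W hW hWE using this
  refine ⟨⋂ p ∈ 𝒟, W p, (Filter.biInter_mem hfin).2 hW, ?_⟩
  rintro b ⟨hb, hbW⟩
  obtain ⟨p, hp, hbp⟩ := h.cov b hb
  exact hWE p hp b ⟨hbp, mem_iInter₂.1 hbW p hp⟩

end dec

/-! ### The planar filling lemma -/

/-- the parametrised circle through `c₀` -/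
noncomputable def circ (c₀ : ℂ) (t : ℝ) : ℂ := c₀ * Complex.exp (2 * Real.pi * Complex.I * t)

lemma circ_cont (c₀ : ℂ) : Continuous (circ c₀) := by unfold circ; fun_prop

lemma circ_norm {c₀ : ℂ} (h : ‖c₀‖ = 1) (t : ℝ) : ‖circ c₀ t‖ = 1 := by
  unfold circ
  rw [norm_mul, h, one_mul, Complex.norm_exp]
  simp

lemma circ_zero (c₀ : ℂ) : circ c₀ 0 = c₀ := by simp [circ]

lemma circ_one (c₀ : ℂ) : circ c₀ 1 = c₀ := by simp [circ, Complex.exp_two_pi_mul_I]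

lemma circ_eq {c₀ : ℂ} (h : c₀ ≠ 0) {s t : ℝ} (hst : circ c₀ s = circ c₀ t) :
    ∃ n : ℤ, s = t + n := by
  have := mul_left_cancel₀ h hst
  rw [Complex.exp_eq_exp_iff_exists_int] at this
  obtain ⟨n, hn⟩ := this
  refine ⟨n, ?_⟩
  have h2 : (2 * Real.pi * Complex.I : ℂ) ≠ 0 := by simp [Real.pi_ne_zero]
  have h3 : (2 * Real.pi * Complex.I : ℂ) * s = 2 * Real.pi * Complex.I * (t + n) := by
    rw [hn]; ring
  have := mul_left_cancel₀ h2 h3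
  exact_mod_cast this

lemma circ_no_log {c₀ p q : ℂ} (hc : ‖c₀‖ = 1) (hp : ‖p‖ ≤ 1 / 2) (hq : 2 ≤ ‖q‖) {L : ℝ → ℂ}
    (hL : ContinuousOn L (Icc 0 1))
    (hLe : ∀ t ∈ Icc (0 : ℝ) 1, Complex.exp (L t) = (circ c₀ t - p) / (circ c₀ t - q)) :
    L 0 ≠ L 1 := by
  intro h01
  have hc0 : c₀ ≠ 0 := by rw [← norm_pos_iff, hc]; norm_num
  obtain ⟨l, hl, hle⟩ := exists_log_convex (s := ball (0 : ℂ) 2) (f := fun z => z - q)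
    (convex_ball _ _) isOpen_ball (by fun_prop) (by
      intro z hz h
      rw [mem_ball_zero_iff] at hz
      rw [sub_eq_zero] at h; subst h; linarith)
  have hC : ∀ t, circ c₀ t ∈ ball (0 : ℂ) 2 := fun t => by
    rw [mem_ball_zero_iff, circ_norm hc]; norm_num
  have hCn : ∀ t, circ c₀ t ≠ 0 := fun t => by
    rw [← norm_pos_iff, circ_norm hc]; norm_num
  have hsl : ∀ t, 1 - p / circ c₀ t ∈ Complex.slitPlane := by
    intro t
    left
    have : ‖p / circ c₀ t‖ ≤ 1 / 2 := by rw [norm_div, circ_norm hc]; simpa using hp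
    have := (Complex.re_le_norm (p / circ c₀ t)).trans this
    simp only [Complex.sub_re, Complex.one_re]; linarith
  have hcl : Continuous fun t : ℝ => Complex.log (1 - p / circ c₀ t) :=
    Continuous.clog (continuous_const.sub (continuous_const.div (circ_cont _) hCn)) hsl
  have key := log_unique (s := Icc (0 : ℝ) 1) (g₁ := fun t => L t + l (circ c₀ t))
    (g₂ := fun t => Complex.log c₀ + 2 * Real.pi * Complex.I * t +
      Complex.log (1 - p / circ c₀ t)) isPreconnected_Icc
    (hL.add (hl.comp (circ_cont _).continuousOn fun t _ => hC t))
    (by have := hcl.continuousOn (s := Icc (0 : ℝ) 1); fun_prop) (by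
      intro t ht
      have hqn : circ c₀ t - q ≠ 0 := by
        have := hle _ (hC t)
        intro h0
        exact Complex.exp_ne_zero _ (this.trans h0)
      rw [Complex.exp_add, Complex.exp_add, Complex.exp_add, hLe t ht, hle _ (hC t),
        Complex.exp_log (Complex.slitPlane_ne_zero (hsl t)), Complex.exp_log hc0]
      rw [div_mul_cancel₀ _ hqn, mul_sub, mul_one]
      change _ = circ c₀ t - circ c₀ t * _
      rw [mul_div_cancel₀ _ (hCn t)]) (left_mem_Icc.2 zero_le_one) (right_mem_Icc.2 zero_le_one)
  simp only [circ_zero, circ_one, h01] at key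
  have h2 : (2 * Real.pi * Complex.I : ℂ) ≠ 0 := by simp [Real.pi_ne_zero]
  apply h2
  push_cast at key
  linear_combination key

/-- Planar filling lemma. -/
lemma planar_fill {Q : Set ℂ} (hQ : IsClosed Q) (hlc : LCSet Q) {c₀ : ℂ} (hc : ‖c₀‖ = 1)
    (hcQ : c₀ ∈ Q) : ∃ δ > 0, ∀ Q' : Set ℂ, IsClosed Q' → Q ⊆ Q' →
    (∀ s s', 0 ≤ s → s' ≤ 1 → circ c₀ s ∈ Q → circ c₀ s' ∈ Q → s + δ ≤ s' →
      (∀ t ∈ Ioo s s', circ c₀ t ∉ Q) → circ c₀ '' Icc s s' ⊆ Q') →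
    ∀ P : Set ℂ, IsPreconnected P → Disjoint P Q' → ∀ p ∈ P, ∀ q ∈ P, ‖p‖ ≤ 1 / 2 → 2 ≤ ‖q‖ →
    False := by
  have hCc := circ_cont c₀
  let T := Icc (0 : ℝ) 1 ∩ circ c₀ ⁻¹' Q
  have hTc : IsClosed T := isClosed_Icc.inter (hQ.preimage hCc)
  have hTk : IsCompact T := isCompact_Icc.inter_right (hQ.preimage hCc)
  have h0T : (0 : ℝ) ∈ T := ⟨by simp, by simpa [circ_zero] using hcQ⟩
  have h1T : (1 : ℝ) ∈ T := ⟨by simp, by simpa [circ_one] using hcQ⟩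
  have hloc : ∀ a : T, ∃ r > 0, (∀ t ∈ ball (a : ℝ) r,
      circ c₀ t ∈ ball (circ c₀ a) (1 / 4)) ∧ ∀ b ∈ T ∩ ball (a : ℝ) r,
      ∃ E, IsPreconnected E ∧ E ⊆ Q ∩ ball (circ c₀ a) (1 / 4) ∧ circ c₀ a ∈ E ∧
        circ c₀ b ∈ E := by
    intro a
    have hV : ball (circ c₀ a) (1 / 4) ∈ 𝓝 (circ c₀ a) := ball_mem_nhds _ (by norm_num)
    obtain ⟨W, hW, hWE⟩ := hlc _ a.2.2 _ hV
    obtain ⟨r, hr, hrW⟩ := Metric.mem_nhds_iff.1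
      (hCc.continuousAt.preimage_mem_nhds (Filter.inter_mem hW hV))
    exact ⟨r, hr, fun t ht => (hrW ht).2, fun b hb => hWE _ ⟨hb.1.2, (hrW hb.2).1⟩⟩
  choose r hr hrV hrE using hloc
  obtain ⟨δ, hδ, hδT⟩ := lebesgue_number_lemma_of_metric (c := fun a : T => ball (a : ℝ) (r a))
    hTk (fun a => isOpen_ball) (fun t ht => mem_iUnion.2 ⟨⟨t, ht⟩, mem_ball_self (hr _)⟩)
  refine ⟨δ, hδ, fun Q' hQ' hQQ hfill P hP hPQ p hp q hq hpn hqn => ?_⟩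
  obtain ⟨g, hg, hge⟩ := hasLog_of_preconnected hQ' hP hPQ hp hq
  have hnp : ∀ z : ℂ, 3 / 4 < ‖z‖ → z - p ≠ 0 := fun z hz h => by
    rw [sub_eq_zero] at h; subst h; linarith
  have hnq : ∀ z : ℂ, ‖z‖ < 5 / 4 → z - q ≠ 0 := fun z hz h => by
    rw [sub_eq_zero] at h; subst h; linarith
  have hN := circ_norm hc
  -- log along the circle
  obtain ⟨L, hL, hLe⟩ : HasLog (Icc (0 : ℝ) 1) fun t => (circ c₀ t - p) / (circ c₀ t - q) := by
    obtain ⟨L, hL, hLe⟩ := exists_log (X := ℝ) (f := fun t => (circ c₀ t - p) / (circ c₀ t - q))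
      (Continuous.div (by fun_prop) (by fun_prop) fun t => hnq _ (by rw [hN]; norm_num))
      (fun t => div_ne_zero (hnp _ (by rw [hN]; norm_num)) (hnq _ (by rw [hN]; norm_num)))
    exact ⟨L, hL.continuousOn, fun t _ => hLe t⟩
  have hball : ∀ a : T, ∀ z ∈ ball (circ c₀ a) (1 / 4), 3 / 4 < ‖z‖ ∧ ‖z‖ < 5 / 4 := by
    intro a z hz
    rw [mem_ball, dist_eq_norm] at hz
    have h1 := norm_sub_norm_le (circ c₀ a) z
    have h2 := norm_sub_norm_le z (circ c₀ a)
    rw [norm_sub_rev] at h1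
    rw [hN] at h1 h2
    constructor <;> linarith
  have hn : ∀ a : T, ∀ b ∈ T ∩ ball (a : ℝ) (r a),
      L b - g (circ c₀ b) = L a - g (circ c₀ a) := by
    intro a b hb
    obtain ⟨E, hE, hEQ, haE, hbE⟩ := hrE a b hb
    obtain ⟨l, hl, hle⟩ := exists_log_convex (s := ball (circ c₀ a) (1 / 4))
      (f := fun z => (z - p) / (z - q)) (convex_ball _ _) isOpen_ball
      (ContinuousOn.div (by fun_prop) (by fun_prop) fun z hz => hnq z (hball a z hz).2)
      (fun z hz => div_ne_zero (hnp z (hball a z hz).1) (hnq z (hball a z hz).2))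
    have k1 := log_unique hE (hg.mono fun z hz => hQQ (hEQ hz).1) (hl.mono fun z hz => (hEQ hz).2)
      (fun z hz => by rw [hge z (hQQ (hEQ hz).1), hle z (hEQ hz).2]) haE hbE
    have hI : IsPreconnected (ball (a : ℝ) (r a) ∩ Icc 0 1) :=
      ((convex_ball _ _).inter (convex_Icc _ _)).isPreconnected
    have k2 := log_unique hI (hL.mono inter_subset_right)
      (hl.comp hCc.continuousOn fun t ht => hrV a t ht.1)
      (fun t ht => by rw [hLe t ht.2]; exact (hle _ (hrV a t ht.1)).symm)
      ⟨mem_ball_self (hr a), a.2.1⟩ ⟨hb.2, hb.1.1⟩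
    simp only [Function.comp] at k2
    linear_combination k1 - k2
  have hclose : ∀ b ∈ T, ∀ b' ∈ T, |b' - b| < δ →
      L b' - g (circ c₀ b') = L b - g (circ c₀ b) := by
    intro b hb b' hb' hbb
    obtain ⟨a, ha⟩ := hδT b hb
    rw [hn a b ⟨hb, ha (mem_ball_self hδ)⟩, hn a b' ⟨hb', ha (by
      rw [mem_ball, Real.dist_eq]; exact hbb)⟩]
  have hconst : ∀ t ∈ T, L t - g (circ c₀ t) = L 0 - g (circ c₀ 0) := by
    by_contra hcon
    push Not at hcon
    let T₀ := {t ∈ T | L t - g (circ c₀ t) ≠ L 0 - g (circ c₀ 0)}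
    have hT₀ne : T₀.Nonempty := hcon
    have hbdd : BddBelow T₀ := ⟨0, fun t ht => ht.1.1.1⟩
    set m := sInf T₀ with hm
    have hmT : m ∈ T := closure_minimal (fun t ht => ht.1) hTc (csInf_mem_closure hT₀ne hbdd)
    have hmT₀ : m ∈ T₀ := by
      obtain ⟨t, ht, htm⟩ := exists_lt_of_csInf_lt hT₀ne (show sInf T₀ < m + δ by linarith)
      refine ⟨hmT, ?_⟩
      rw [← hclose m hmT t ht.1 (by rw [abs_of_nonneg] <;> linarith [csInf_le hbdd ht])]
      exact ht.2
    have hlt : ∀ t ∈ T, t < m → L t - g (circ c₀ t) = L 0 - g (circ c₀ 0) := by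
      intro t ht htm
      by_contra hne
      exact absurd (csInf_le hbdd (show t ∈ T₀ from ⟨ht, hne⟩)) (not_le.2 htm)
    have hm0 : 0 < m := lt_of_le_of_ne hmT.1.1 fun h => hmT₀.2 (by rw [← h])
    let U := T ∩ Iio m
    have hUne : U.Nonempty := ⟨0, h0T, hm0⟩
    have hUb : BddAbove U := ⟨m, fun t ht => ht.2.le⟩
    set s := sSup U with hs
    have hsT : s ∈ T := closure_minimal (fun t ht => ht.1) hTc (csSup_mem_closure hUne hUb)
    have hsm : s ≤ m := csSup_le hUne fun t ht => ht.2.le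
    by_cases hd : m - s < δ
    · obtain ⟨t, ht, hts⟩ := exists_lt_of_lt_csSup hUne (show m - δ < sSup U by linarith)
      apply hmT₀.2
      rw [← hlt t ht.1 ht.2, hclose t ht.1 m hmT]
      have := ht.2; rw [mem_Iio] at this
      rw [abs_of_nonneg] <;> linarith
    · have hgap := hfill s m hsT.1.1 hmT.1.2 hsT.2 hmT.2 (by linarith) (fun t ht htQ => by
        have : t ∈ U := ⟨⟨⟨hsT.1.1.trans ht.1.le, ht.2.le.trans hmT.1.2⟩, htQ⟩, ht.2⟩
        exact absurd (le_csSup hUb this) (not_le.2 ht.1))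
      have k := log_unique (s := Icc s m) (g₁ := L) (g₂ := g ∘ circ c₀) isPreconnected_Icc
        (hL.mono (Icc_subset_Icc hsT.1.1 hmT.1.2))
        (hg.comp hCc.continuousOn fun t ht => hgap ⟨t, ht, rfl⟩)
        (fun t ht => by
          rw [hLe t ⟨hsT.1.1.trans ht.1, ht.2.trans hmT.1.2⟩]
          exact (hge _ (hgap ⟨t, ht, rfl⟩)).symm) (left_mem_Icc.2 hsm) (right_mem_Icc.2 hsm)
      apply hmT₀.2
      simp only [Function.comp] at k
      rw [← k]
      exact hlt s hsT (by linarith)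
  have h1 := hconst 1 h1T
  rw [circ_one, circ_zero] at h1
  exact circ_no_log hc hpn hqn hL hLe (by linear_combination -h1)


/-! ### Matched pairs of decompositions -/

/-- A matched pair of decompositions of two surfaces. -/
structure St (S S' : Type*) [TopologicalSpace S] [TopologicalSpace S'] where
  D : Set (Set S × Set S')
  fin : D.Finite
  Γ : Set S
  Γ' : Set S'
  h : S → S'
  dec : Dec D Prod.fst Γ
  dec' : Dec D Prod.snd Γ'
  hc : ContinuousOn h Γ
  hi : InjOn h Γ
  him : h '' Γ = Γ'
  hfr : ∀ p ∈ D, h '' frontier p.1 = frontier p.2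

section st
variable {S S' : Type*} [TopologicalSpace S] [TopologicalSpace S']

def St.Le (s t : St S S') : Prop :=
  (∀ q ∈ t.D, ∃ p ∈ s.D, q.1 ⊆ p.1 ∧ q.2 ⊆ p.2) ∧ s.Γ ⊆ t.Γ ∧ EqOn s.h t.h s.Γ

lemma St.Le.refl (s : St S S') : s.Le s :=
  ⟨fun q hq => ⟨q, hq, Subset.rfl, Subset.rfl⟩, Subset.rfl, fun _ _ => rfl⟩

lemma St.Le.trans {s t u : St S S'} (h : s.Le t) (h' : t.Le u) : s.Le u := by
  refine ⟨fun q hq => ?_, h.2.1.trans h'.2.1, fun x hx => (h.2.2 hx).trans (h'.2.2 (h.2.1 hx))⟩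
  obtain ⟨p, hp, h1, h2⟩ := h'.1 q hq
  obtain ⟨r, hr, h3, h4⟩ := h.1 p hp
  exact ⟨r, hr, h1.trans h3, h2.trans h4⟩

lemma St.ear [T2Space S] [PreconnectedSpace S] [T2Space S'] [PreconnectedSpace S']
    [FirstCountableTopology S'] (hS : IsSurf S) (hsep : SepProp S) (hS' : IsSurf S')
    (hsep' : SepProp S') (s : St S S') {p : Set S × Set S'} (hp : p ∈ s.D) {A : Set S} {a b : S}
    (ha : a ∈ frontier p.1) (hb : b ∈ frontier p.1) (hA : IsArc A a b) (hAF : A \ {a, b} ⊆ p.1) :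
    ∃ t : St S S', s.Le t ∧ t.Γ = s.Γ ∪ A := by
  classical
  obtain ⟨J₁, J₂, hJ, hJe⟩ := (s.dec.scc p hp).exists_pair ha hb hA.ne
  have hfΓ := s.dec.frontier_subset hp
  have hJ1 : J₁ ⊆ s.Γ := fun x hx => hfΓ (hJe ▸ Or.inl hx)
  have hJ2 : J₂ ⊆ s.Γ := fun x hx => hfΓ (hJe ▸ Or.inr hx)
  have hJ' : IsSCCPair (s.h '' J₁) (s.h '' J₂) (s.h a) (s.h b) := by
    refine ⟨hJ.1.image (s.hc.mono hJ1) (s.hi.mono hJ1), hJ.2.1.image (s.hc.mono hJ2)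
      (s.hi.mono hJ2), ?_⟩
    rw [← s.hi.image_inter hJ1 hJ2, hJ.2.2, image_pair]
  have hJe' : frontier p.2 = s.h '' J₁ ∪ s.h '' J₂ := by
    rw [← s.hfr p hp, hJe, image_union]
  have hab' : s.h a ≠ s.h b := hJ'.1.ne
  have hF := s.dec.comp p hp
  have hF' := s.dec'.comp p hp
  obtain ⟨A', hA', hAF'⟩ := hS'.crosscut hsep' (s.dec'.scc p hp) hF'
    (hJe' ▸ Or.inl hJ'.1.left_mem) (hJe' ▸ Or.inl hJ'.1.right_mem) hab'
  rw [hJe] at hF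
  rw [hJe'] at hF'
  obtain ⟨G₁, G₂, d, u, p1, p2, c1, c2⟩ := hS.theta hsep hJ hF hA hAF
  obtain ⟨G₁', G₂', d', u', p1', p2', c1', c2'⟩ := hS'.theta hsep' hJ' hF' hA' hAF'
  obtain ⟨k, hk, hki, hkim, hka, hkb⟩ := hA.exists_map hA'
  let q₁ : Set S × Set S' := (G₁, G₁')
  let q₂ : Set S × Set S' := (G₂, G₂')
  have haΓ := hfΓ ha
  have hbΓ := hfΓ hb
  have hAΓ : ∀ x ∈ A, x ∈ s.Γ → x = a ∨ x = b := by
    intro x hx hxΓ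
    by_contra hn
    exact s.dec.face_disj hp (hAF ⟨hx, hn⟩) hxΓ
  have hAΓ' : ∀ x ∈ A', x ∈ s.Γ' → x = s.h a ∨ x = s.h b := by
    intro x hx hxΓ
    by_contra hn
    exact s.dec'.face_disj hp (hAF' ⟨hx, hn⟩) hxΓ
  let h' : S → S' := fun x => if x ∈ A then k x else s.h x
  have hA_eq : EqOn h' k A := fun x hx => if_pos hx
  have hΓ_eq : EqOn s.h h' s.Γ := by
    intro x hx
    by_cases hxA : x ∈ A
    · rw [hA_eq hxA]
      rcases hAΓ x hxA hx with rfl | rfl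
      · exact hka.symm
      · exact hkb.symm
    · exact (if_neg hxA).symm
  have hL1 : IsSCC (A ∪ J₁) := ⟨_, _, _, _, p1, rfl⟩
  have hL2 : IsSCC (A ∪ J₂) := ⟨_, _, _, _, p2, rfl⟩
  have hL1' : IsSCC (A' ∪ s.h '' J₁) := ⟨_, _, _, _, p1', rfl⟩
  have hL2' : IsSCC (A' ∪ s.h '' J₂) := ⟨_, _, _, _, p2', rfl⟩
  have hmix : ∀ x ∈ s.Γ, ∀ y ∈ A, s.h x = k y → x = y := by
    intro x hx y hy hxy
    have hyA' : k y ∈ A' := hkim ▸ mem_image_of_mem _ hy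
    have : s.h x ∈ s.Γ' := s.him ▸ mem_image_of_mem _ hx
    rcases hAΓ' _ hyA' (hxy ▸ this) with h | h
    · rw [← hxy] at h
      have e1 := s.hi hx haΓ h
      rw [hxy, ← hka] at h
      rw [e1, hki hy hA.left_mem h]
    · rw [← hxy] at h
      have e1 := s.hi hx hbΓ h
      rw [hxy, ← hkb] at h
      rw [e1, hki hy hA.right_mem h]
  refine ⟨⟨s.D \ {p} ∪ {q₁, q₂}, (s.fin.subset sdiff_subset).union (by simp), s.Γ ∪ A, s.Γ' ∪ A', h',
    s.dec.ear hS hp hJ hJe hA hAF d u p1 p2 c1 c2,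
    s.dec'.ear hS' hp hJ' hJe' hA' hAF' d' u' p1' p2' c1' c2', ?_, ?_, ?_, ?_⟩, ⟨?_, ?_, ?_⟩, rfl⟩
  · exact (s.hc.congr hΓ_eq.symm).union_of_isClosed (hk.congr hA_eq) s.dec.isClosed
      hA.isCompact.isClosed
  · rintro x (hx | hx) y (hy | hy) hxy
    · rw [← hΓ_eq hx, ← hΓ_eq hy] at hxy; exact s.hi hx hy hxy
    · rw [← hΓ_eq hx, hA_eq hy] at hxy; exact hmix x hx y hy hxy
    · rw [← hΓ_eq hy, hA_eq hx] at hxy; exact (hmix y hy x hx hxy.symm).symm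
    · rw [hA_eq hx, hA_eq hy] at hxy; exact hki hx hy hxy
  · rw [image_union, hA_eq.image_eq, ← hΓ_eq.image_eq, s.him, hkim]
  · rintro q (hq | rfl | hq)
    · rw [← (hΓ_eq.mono (s.dec.frontier_subset hq.1)).image_eq, s.hfr q hq.1]
    · change h' '' frontier G₁ = frontier G₁'
      rw [hS.frontier_face hL1 c1, hS'.frontier_face hL1' c1', image_union, hA_eq.image_eq, hkim,
        ← (hΓ_eq.mono hJ1).image_eq]
    · rw [mem_singleton_iff] at hq; subst hq
      change h' '' frontier G₂ = frontier G₂'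
      rw [hS.frontier_face hL2 c2, hS'.frontier_face hL2' c2', image_union, hA_eq.image_eq, hkim,
        ← (hΓ_eq.mono hJ2).image_eq]
  · have hp1 : G₁ ⊆ p.1 := fun x hx => (u ▸ Or.inl hx : x ∈ p.1 \ A).1
    have hp2 : G₂ ⊆ p.1 := fun x hx => (u ▸ Or.inr hx : x ∈ p.1 \ A).1
    have hp1' : G₁' ⊆ p.2 := fun x hx => (u' ▸ Or.inl hx : x ∈ p.2 \ A').1
    have hp2' : G₂' ⊆ p.2 := fun x hx => (u' ▸ Or.inr hx : x ∈ p.2 \ A').1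
    rintro q (hq | rfl | hq)
    · exact ⟨q, hq.1, Subset.rfl, Subset.rfl⟩
    · exact ⟨p, hp, hp1, hp1'⟩
    · rw [mem_singleton_iff] at hq; subst hq
      exact ⟨p, hp, hp2, hp2'⟩
  · exact subset_union_left
  · exact hΓ_eq

lemma Dec.swap {T : Type*} [TopologicalSpace T] {D : Set (Set S × Set S')}
    {f : Set S × Set S' → Set T} {Γ : Set T} (h : Dec D f Γ) :
    Dec (Prod.swap '' D) (fun p => f p.swap) Γ := by
  refine ⟨?_, ?_, ?_, ?_, ?_, h.pre, h.nocut⟩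
  · rintro _ ⟨p, hp, rfl⟩; exact h.scc p hp
  · rintro _ ⟨p, hp, rfl⟩; exact h.comp p hp
  · rintro _ ⟨p, hp, rfl⟩ _ ⟨q, hq, rfl⟩ hpq
    exact h.disj p hp q hq (fun h => hpq (by rw [h]))
  · intro x
    rw [h.compl]
    exact ⟨by rintro h' _ ⟨p, hp, rfl⟩; exact h' p hp, fun h' p hp => h' _ ⟨p, hp, rfl⟩⟩
  · intro x hx
    obtain ⟨p, hp, h'⟩ := h.cov x hx
    exact ⟨_, ⟨p, hp, rfl⟩, h'⟩

/-- exchange the two surfaces -/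
lemma St.exists_swap [CompactSpace S] [T2Space S'] [Nonempty S] (s : St S S') :
    ∃ t : St S' S, t.D = Prod.swap '' s.D ∧ t.Γ = s.Γ' ∧ t.Γ' = s.Γ ∧ ∀ x ∈ s.Γ, t.h (s.h x) = x := by
  obtain ⟨r, hr, hrs⟩ := exists_inverse_compact s.dec.isClosed.isCompact s.hc s.hi
  refine ⟨⟨Prod.swap '' s.D, s.fin.image _, s.Γ', s.Γ, r, s.dec'.swap, s.dec.swap, s.him ▸ hr, ?_, ?_, ?_⟩,
    rfl, rfl, rfl, hrs⟩
  · rw [← s.him]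
    rintro _ ⟨x, hx, rfl⟩ _ ⟨y, hy, rfl⟩ hxy
    rw [hrs x hx, hrs y hy] at hxy
    rw [hxy]
  · rw [← s.him, image_image]
    exact (image_congr hrs).trans (image_id _)
  · rintro _ ⟨p, hp, rfl⟩
    change r '' frontier p.2 = frontier p.1
    rw [← s.hfr p hp, image_image]
    exact (image_congr fun x hx => hrs x (s.dec.frontier_subset hp hx)).trans (image_id _)

lemma LCSet.preimage {X : Type*} [TopologicalSpace X] {e : X → S} (he : IsOpenEmbedding e)
    {Γ : Set S} (h : LCSet Γ) : LCSet (e ⁻¹' Γ) := by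
  intro a ha V hV
  obtain ⟨W, hW, hWE⟩ := h (e a) ha (e '' V) (he.isOpenMap.image_mem_nhds hV)
  refine ⟨e ⁻¹' W, he.continuous.continuousAt hW, fun b hb => ?_⟩
  obtain ⟨E, hE, hEV, haE, hbE⟩ := hWE (e b) hb
  refine ⟨e ⁻¹' E, hE.preimage_of_isOpenMap he.injective he.isOpenMap
    fun x hx => image_subset_range _ _ (hEV hx).2, fun x hx => ⟨(hEV hx).1, ?_⟩, haE, hbE⟩
  obtain ⟨y, hy, hyx⟩ := (hEV hx).2
  exact he.injective hyx ▸ hy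

end st

section mesh
variable {S S' : Type*} [TopologicalSpace S] [TopologicalSpace S']

lemma IsSCC.inhab {J : Set S} (h : IsSCC J) : ∃ a ∈ J, ∃ b ∈ J, a ≠ b := by
  obtain ⟨a, ha⟩ := h.nonempty
  obtain ⟨b, hb, hba⟩ := h.exists_ne a
  exact ⟨a, ha, b, hb, hba.symm⟩

/-- an ear given as an arc whose open part misses the skeleton -/
lemma St.ear' [T2Space S] [PreconnectedSpace S] [T2Space S'] [PreconnectedSpace S']
    [FirstCountableTopology S'] (hS : IsSurf S) (hsep : SepProp S) (hS' : IsSurf S')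
    (hsep' : SepProp S') (s : St S S') {A : Set S} {a b : S}
    (ha : a ∈ s.Γ) (hb : b ∈ s.Γ) (hA : IsArc A a b) (hAΓ : ∀ x ∈ A \ {a, b}, x ∉ s.Γ) :
    ∃ t : St S S', s.Le t ∧ t.Γ = s.Γ ∪ A := by
  obtain ⟨m, hm, hma, hmb⟩ := hA.exists_mid
  have hm' : m ∈ A \ {a, b} := ⟨hm, by simp [hma, hmb]⟩
  obtain ⟨p, hp, hmp⟩ := s.dec.exists_face (hAΓ m hm')
  have hsub : A \ {a, b} ⊆ p.1 := (s.dec.comp p hp).subset hA.isPreconnected_open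
    (fun x hx h => hAΓ x hx (s.dec.frontier_subset hp h)) ⟨m, hm', hmp⟩
  have hcl : A ⊆ closure p.1 := by
    obtain ⟨γ, hγ, hi, rfl, rfl, rfl⟩ := hA
    have h1 : γ '' Ioo 0 1 ⊆ p.1 := by
      refine Subset.trans ?_ hsub
      rintro _ ⟨t, ht, rfl⟩
      refine ⟨⟨t, Ioo_subset_Icc_self ht, rfl⟩, ?_⟩
      rintro (h | h)
      · exact ht.1.ne' (hi (Ioo_subset_Icc_self ht) (by simp) h)
      · exact ht.2.ne (hi (Ioo_subset_Icc_self ht) (by simp) h)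
    have h2 : Icc (0 : ℝ) 1 = closure (Ioo 0 1) := (closure_Ioo (by norm_num)).symm
    rw [h2]
    refine Subset.trans (ContinuousOn.image_closure ?_) (closure_mono h1)
    rwa [← h2]
  have hfr : ∀ x ∈ A, x ∈ s.Γ → x ∈ frontier p.1 := fun x hx hxΓ => by
    rw [(s.dec.isOpen hp).frontier_eq]
    exact ⟨hcl hx, fun h => s.dec.face_disj hp h hxΓ⟩
  exact s.ear hS hsep hS' hsep' hp (hfr a hA.left_mem ha) (hfr b hA.right_mem hb) hA hsub

lemma St.through [T2Space S] [PreconnectedSpace S] [T2Space S'] [PreconnectedSpace S']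
    [FirstCountableTopology S] [FirstCountableTopology S'] (hS : IsSurf S) (hsep : SepProp S)
    (hS' : IsSurf S') (hsep' : SepProp S') (s : St S S') (x : S) :
    ∃ t : St S S', s.Le t ∧ x ∈ t.Γ := by
  by_cases hx : x ∈ s.Γ
  · exact ⟨s, .refl s, hx⟩
  obtain ⟨p, hp, hxp⟩ := s.dec.exists_face hx
  obtain ⟨a, ha, b, hb, hab⟩ := (s.dec.scc p hp).inhab
  obtain ⟨A, hA, hAF, hxA⟩ := hS.crosscut_through hsep (s.dec.scc p hp) (s.dec.comp p hp) ha hb hab hxp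
  obtain ⟨t, ht, htΓ⟩ := s.ear hS hsep hS' hsep' hp ha hb hA hAF
  exact ⟨t, ht, htΓ ▸ Or.inr hxA⟩

/-- gaps of length at least `δ` are finite in number -/
lemma finite_gaps {T : Set ℝ} {δ : ℝ} (hδ : 0 < δ) :
    {g : ℝ × ℝ | 0 ≤ g.1 ∧ g.2 ≤ 1 ∧ g.1 ∈ T ∧ g.2 ∈ T ∧ g.1 + δ ≤ g.2 ∧
      ∀ t ∈ Ioo g.1 g.2, t ∉ T}.Finite := by
  refine Set.Finite.of_injOn (f := fun g : ℝ × ℝ => ⌊g.2 / δ⌋) (t := Icc 0 ⌊1 / δ⌋) ?_ ?_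
    (finite_Icc _ _)
  · rintro g ⟨h1, h2, -, -, h5, -⟩
    refine ⟨Int.floor_nonneg.2 (div_nonneg (by linarith) hδ.le), Int.floor_le_floor ?_⟩
    gcongr
  · have key : ∀ g g' : ℝ × ℝ, g.2 ∈ T → g'.1 + δ ≤ g'.2 → (∀ t ∈ Ioo g'.1 g'.2, t ∉ T) →
        ⌊g.2 / δ⌋ = ⌊g'.2 / δ⌋ → g'.2 ≤ g.2 := by
      intro g g' h1 h2 h3 h4
      by_contra hlt
      push Not at hlt
      have h5 : g.2 ≤ g'.1 := by
        by_contra h6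
        exact h3 g.2 ⟨not_le.1 h6, hlt⟩ h1
      have h7 : g.2 / δ + 1 ≤ g'.2 / δ := by
        rw [← div_self hδ.ne', ← add_div]; gcongr; linarith
      have := Int.floor_le_floor h7
      rw [Int.floor_add_one] at this
      omega
    rintro g ⟨-, -, h3, h4, h5, h6⟩ g' ⟨-, -, h3', h4', h5', h6'⟩ hgg
    have e2 : g.2 = g'.2 := le_antisymm (key g' g h4' h5 h6 hgg.symm) (key g g' h4 h5' h6' hgg)
    have e1 : g.1 = g'.1 := by
      apply le_antisymm
      · by_contra h; push Not at h
        exact h6' g.1 ⟨h, by linarith⟩ h3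
      · by_contra h; push Not at h
        exact h6 g'.1 ⟨h, by linarith⟩ h3'
    exact Prod.ext e1 e2

lemma circ_inj {c₀ : ℂ} (hc : c₀ ≠ 0) {s t : ℝ} (h : circ c₀ s = circ c₀ t) (h1 : s - t < 1)
    (h2 : t - s < 1) : s = t := by
  obtain ⟨n, hn⟩ := circ_eq hc h
  have h3 : (n : ℝ) < 1 := by linarith
  have h4 : (-1 : ℝ) < n := by linarith
  have h5 : n < 1 := by exact_mod_cast h3
  have h6 : -1 < n := by exact_mod_cast h4
  have : n = 0 := by omega
  simp [hn, this]

lemma exists_circ {c₀ z : ℂ} (hc : ‖c₀‖ = 1) (hz : ‖z‖ = 1) : ∃ t ∈ Ico (0 : ℝ) 1, circ c₀ t = z := by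
  have hc0 : c₀ ≠ 0 := by rw [← norm_pos_iff, hc]; norm_num
  have h1 : ‖z / c₀‖ = 1 := by rw [norm_div, hc, hz]; norm_num
  have h2 := Complex.norm_mul_exp_arg_mul_I (z / c₀)
  rw [h1, Complex.ofReal_one, one_mul] at h2
  refine ⟨Int.fract (Complex.arg (z / c₀) / (2 * Real.pi)), ⟨Int.fract_nonneg _, Int.fract_lt_one _⟩, ?_⟩
  unfold circ Int.fract
  have h3 : (2 * Real.pi * Complex.I : ℂ) * ((Complex.arg (z / c₀) / (2 * Real.pi) -
      ⌊Complex.arg (z / c₀) / (2 * Real.pi)⌋ : ℝ) : ℂ) = Complex.arg (z / c₀) * Complex.I -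
      ⌊Complex.arg (z / c₀) / (2 * Real.pi)⌋ * (2 * Real.pi * Complex.I) := by
    push_cast
    have : (Real.pi : ℂ) ≠ 0 := by simp [Real.pi_ne_zero]
    field_simp
  rw [h3, Complex.exp_sub, Complex.exp_int_mul_two_pi_mul_I, div_one, h2, mul_div_cancel₀ _ hc0]

lemma St.mesh_local [T2Space S] [PreconnectedSpace S] [T2Space S'] [PreconnectedSpace S']
    [FirstCountableTopology S] [FirstCountableTopology S'] (hS : IsSurf S) (hsep : SepProp S)
    (hS' : IsSurf S') (hsep' : SepProp S') (s₀ : St S S') (x : S) {V : Set S} (hV : V ∈ 𝓝 x) :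
    ∃ N ∈ 𝓝 x, ∀ s₁ : St S S', s₀.Le s₁ →
      ∃ t : St S S', s₁.Le t ∧ ∀ q ∈ t.D, (q.1 ∩ N).Nonempty → q.1 ⊆ V := by
  obtain ⟨y, hy₀, hyx⟩ : ∃ y ∈ s₀.Γ, y ≠ x := by
    obtain ⟨p, hp, -⟩ := s₀.dec.exists_closure x
    obtain ⟨y, hy, h⟩ := (s₀.dec.scc p hp).exists_ne x
    exact ⟨y, s₀.dec.frontier_subset hp hy, h⟩
  obtain ⟨e, he, he0, heV, hey⟩ : ∃ e : ℂ → S, IsOpenEmbedding e ∧ e 0 = x ∧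
      e '' ball 0 3 ⊆ V ∧ y ∉ e '' ball 0 3 := by
    obtain ⟨e, he, he0, r, hr, h⟩ := hS.exists_disc
      (Filter.inter_mem hV (isOpen_compl_singleton.mem_nhds hyx.symm : {y}ᶜ ∈ 𝓝 x))
    have hr3 : (r / 3 : ℝ) ≠ 0 := by positivity
    let m : ℂ ≃ₜ ℂ := Homeomorph.smulOfNeZero (r / 3 : ℝ) hr3
    have hm : ∀ z ∈ ball (0 : ℂ) 3, m z ∈ ball (0 : ℂ) r := by
      intro z hz
      rw [mem_ball_zero_iff] at hz ⊢
      change ‖(r / 3 : ℝ) • z‖ < r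
      rw [norm_smul, Real.norm_of_nonneg (by positivity)]
      have : r / 3 * ‖z‖ < r / 3 * 3 := by gcongr
      linarith
    refine ⟨e ∘ m, he.comp m.isOpenEmbedding, ?_, ?_, ?_⟩
    · change e ((r / 3 : ℝ) • (0 : ℂ)) = x
      rw [smul_zero, he0]
    · rintro _ ⟨z, hz, rfl⟩; exact (h ⟨_, hm z hz, rfl⟩).1
    · rintro ⟨z, hz, hzy⟩; exact (h ⟨_, hm z hz, rfl⟩).2 hzy
  refine ⟨e '' ball 0 (1 / 2), he0 ▸ he.isOpenMap.image_mem_nhds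
    (ball_mem_nhds _ (by norm_num)), fun s₁ hs₁ => ?_⟩
  obtain ⟨s, hs, hxs⟩ := s₁.through hS hsep hS' hsep' x
  have hy : y ∈ s.Γ := hs.2.1 (hs₁.2.1 hy₀)
  have hcl : ∀ ρ, IsClosed (e '' closedBall 0 ρ) := fun ρ =>
    ((isCompact_closedBall _ _).image he.continuous).isClosed
  -- connected sets containing x and y meet the circle
  have hmeet : ∀ B : Set S, IsPreconnected B → x ∈ B → y ∈ B → ∃ z, ‖z‖ = 1 ∧ e z ∈ B := by
    intro B hB hxB hyB
    by_contra! hcon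
    have := hB (e '' ball 0 1) (e '' closedBall 0 1)ᶜ (he.isOpenMap _ isOpen_ball)
      (hcl 1).isOpen_compl (by
        intro b hb
        by_cases h : b ∈ e '' closedBall 0 1
        · obtain ⟨z, hz, rfl⟩ := h
          rw [mem_closedBall_zero_iff] at hz
          exact Or.inl ⟨z, mem_ball_zero_iff.2 (lt_of_le_of_ne hz fun h => hcon z h hb), rfl⟩
        · exact Or.inr h)
      ⟨x, hxB, 0, by simp, he0⟩ ⟨y, hyB, fun h => hey (image_mono
        (Metric.closedBall_subset_ball (by norm_num)) h)⟩
    obtain ⟨_, -, ⟨z, hz, rfl⟩, h2⟩ := this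
    exact h2 ⟨z, ball_subset_closedBall hz, rfl⟩
  obtain ⟨c₀, hc, hcΓ⟩ := hmeet s.Γ s.dec.pre hxs hy
  have hc0 : c₀ ≠ 0 := by rw [← norm_pos_iff, hc]; norm_num
  obtain ⟨u, hu, huΓ⟩ : ∃ u ∈ Ioo (0 : ℝ) 1, e (circ c₀ u) ∈ s.Γ := by
    obtain ⟨z, hz, hzB⟩ := hmeet _ (s.dec.nocut (e c₀))
      ⟨hxs, fun h => hc0 (he.injective (he0.trans h)).symm⟩
      ⟨hy, fun h => hey ⟨c₀, by rw [mem_ball_zero_iff, hc]; norm_num, h.symm⟩⟩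
    obtain ⟨t, ht, rfl⟩ := exists_circ hc hz
    refine ⟨t, ⟨lt_of_le_of_ne ht.1 ?_, ht.2⟩, hzB.1⟩
    rintro rfl
    exact hzB.2 (by rw [circ_zero]; rfl)
  obtain ⟨δ, hδ, hfill⟩ := planar_fill (s.dec.isClosed.preimage he.continuous)
    ((s.dec.lcSet s.fin).preimage he) hc hcΓ
  let T : Set ℝ := {t | e (circ c₀ t) ∈ s.Γ}
  let Gp := {g : ℝ × ℝ | 0 ≤ g.1 ∧ g.2 ≤ 1 ∧ g.1 ∈ T ∧ g.2 ∈ T ∧ g.1 + δ ≤ g.2 ∧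
      ∀ t ∈ Ioo g.1 g.2, t ∉ T}
  have hGp : Gp.Finite := finite_gaps hδ
  let B : ℝ × ℝ → Set S := fun g => (fun t => e (circ c₀ t)) '' Icc g.1 g.2
  have hlen : ∀ g ∈ Gp, g.2 - g.1 < 1 := by
    rintro g ⟨h1, h2, h3, h4, h5, h6⟩
    by_contra hn
    exact h6 u ⟨by linarith [hu.1], by linarith [hu.2]⟩ huΓ
  have hadd : ∀ F ⊆ Gp, ∃ t : St S S', s.Le t ∧ t.Γ = s.Γ ∪ ⋃ g ∈ F, B g := by
    intro F hF
    have hFf := hGp.subset hF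
    induction F, hFf using Set.Finite.induction_on with
    | empty => exact ⟨s, .refl s, by simp⟩
    | @insert g F hgF _ ih =>
      obtain ⟨t, ht, htΓ⟩ := ih ((subset_insert _ _).trans hF)
      have hg : g ∈ Gp := hF (mem_insert _ _)
      have hgl := hlen g hg
      obtain ⟨h1, h2, h3, h4, h5, h6⟩ := hF (mem_insert g F)
      have hinj : InjOn (fun t => e (circ c₀ t)) (Icc g.1 g.2) := fun t ht t' ht' h =>
        circ_inj hc0 (he.injective h) (by linarith [ht.1, ht.2, ht'.1, ht'.2])
          (by linarith [ht.1, ht.2, ht'.1, ht'.2])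
      have hA : IsArc (B g) _ _ := isArc_of_Icc (γ := fun t => e (circ c₀ t)) (by linarith)
        (he.continuous.comp (circ_cont c₀)).continuousOn hinj
      obtain ⟨t', ht', htΓ'⟩ := t.ear' hS hsep hS' hsep' (ht.2.1 h3) (ht.2.1 h4) hA (by
        rintro _ ⟨⟨r, hr, rfl⟩, hr'⟩ hrt
        have hr1 : g.1 < r := lt_of_le_of_ne hr.1 fun h => hr' (by simp [h])
        have hr2 : r < g.2 := lt_of_le_of_ne hr.2 fun h => hr' (by simp [h])
        rw [htΓ] at hrt
        rcases hrt with h | h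
        · exact h6 r ⟨hr1, hr2⟩ h
        · simp only [mem_iUnion] at h
          obtain ⟨g', hg', r', hr'', hrr⟩ := h
          obtain ⟨k1, k2, k3, k4, k5, k6⟩ := hF (mem_insert_of_mem g hg')
          have : r' = r := circ_inj hc0 (he.injective hrr) (by linarith [hr''.1, hr''.2])
            (by linarith [hr''.1, hr''.2])
          subst this
          have hne : r' ∉ T := h6 r' ⟨hr1, hr2⟩
          have hr3 : g'.1 < r' := lt_of_le_of_ne hr''.1 fun h => hne (h ▸ k3)
          have hr4 : r' < g'.2 := lt_of_le_of_ne hr''.2 fun h => hne (h ▸ k4)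
          apply hgF
          have : g = g' := by
            apply Prod.ext <;> apply le_antisymm <;> by_contra h <;> push Not at h
            · exact k6 g.1 ⟨h, by linarith⟩ h3
            · exact h6 g'.1 ⟨h, by linarith⟩ k3
            · exact h6 g'.2 ⟨by linarith, h⟩ k4
            · exact k6 g.2 ⟨by linarith, h⟩ h4
          rw [this]; exact hg')
      refine ⟨t', ht.trans ht', ?_⟩
      rw [htΓ', htΓ, biUnion_insert, union_assoc, union_comm (B g)]
  obtain ⟨t, ht, htΓ⟩ := hadd Gp Subset.rfl
  refine ⟨t, hs.trans ht, fun q hq hqN => ?_⟩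
  have hsub : q.1 ⊆ e '' ball 0 2 := by
    by_contra hn
    obtain ⟨w, hw, hwn⟩ := not_subset.1 hn
    obtain ⟨_, hvq, v, hv, rfl⟩ := hqN
    have hqc := t.dec.comp q hq
    have hKc : IsClosed (e '' ball 0 2)ᶜ := (he.isOpenMap _ isOpen_ball).isClosed_compl
    have hv2 : e v ∈ e '' ball 0 2 := ⟨v, Metric.ball_subset_ball (by norm_num) hv, rfl⟩
    obtain ⟨A, hAq, hA⟩ := hS.exists_arc hqc.2.1 hqc.2.2.1 hvq hw (fun h => hwn (h ▸ hv2))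
    obtain ⟨A', c, hA'A, hA', hA'K⟩ := hA.first_hit hKc (fun h => h hv2) ⟨w, hA.right_mem, hwn⟩
    have hcK : c ∈ A' ∩ (e '' ball 0 2)ᶜ := hA'K ▸ rfl
    have hrest : ∀ z ∈ A', z ≠ c → z ∈ e '' ball 0 2 := fun z hz hzc => by
      by_contra hn
      exact hzc (show z ∈ ({c} : Set S) from hA'K ▸ ⟨hz, hn⟩)
    have hcr : c ∈ e '' closedBall 0 2 := by
      by_contra hn
      obtain ⟨z, -, hz1, hz2⟩ := hA'.isPreconnected (e '' ball 0 2) (e '' closedBall 0 2)ᶜ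
        (he.isOpenMap _ isOpen_ball) (hcl 2).isOpen_compl (fun z hz => by
          by_cases hzc : z = c
          · exact Or.inr (hzc ▸ hn)
          · exact Or.inl (hrest z hz hzc)) ⟨e v, hA'.left_mem, hv2⟩ ⟨c, hA'.right_mem, hn⟩
      exact hz2 (image_mono ball_subset_closedBall hz1)
    obtain ⟨c', hc', rfl⟩ := hcr
    have hrange : A' ⊆ range e := fun z hz => by
      by_cases hzc : z = e c'
      · exact hzc ▸ mem_range_self _
      · exact image_subset_range _ _ (hrest z hz hzc)
    refine hfill (e ⁻¹' t.Γ) (t.dec.isClosed.preimage he.continuous) (fun z hz => ht.2.1 hz) ?_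
      (e ⁻¹' A') (hA'.isPreconnected.preimage_of_isOpenMap he.injective he.isOpenMap hrange)
      (disjoint_left.2 fun z hz hz' => t.dec.face_disj hq (hAq (hA'A hz)) hz')
      v hA'.left_mem c' hA'.right_mem ?_ ?_
    · intro a b ha hb haQ hbQ hab hgap
      rintro _ ⟨r, hr, rfl⟩
      change e (circ c₀ r) ∈ t.Γ
      rw [htΓ]
      exact Or.inr (mem_biUnion (x := (a, b)) ⟨ha, hb, haQ, hbQ, hab, hgap⟩ ⟨r, hr, rfl⟩)
    · exact (mem_ball_zero_iff.1 hv).le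
    · by_contra hlt
      exact hcK.2 ⟨c', mem_ball_zero_iff.2 (not_le.1 hlt), rfl⟩
  exact hsub.trans ((image_mono (Metric.ball_subset_ball (by norm_num))).trans heV)

end mesh

section limit
variable {S S' : Type*} [MetricSpace S] [MetricSpace S'] [CompactSpace S] [CompactSpace S']
  [PreconnectedSpace S] [PreconnectedSpace S']

lemma St.mesh (hS : IsSurf S) (hsep : SepProp S) (hS' : IsSurf S') (hsep' : SepProp S')
    (s₀ : St S S') {ε : ℝ} (hε : 0 < ε) :
    ∃ t : St S S', s₀.Le t ∧ ∀ q ∈ t.D, ∃ x, q.1 ⊆ ball x ε := by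
  have key : ∀ s : St S S', s₀.Le s → ∃ t : St S S', s.Le t ∧ ∀ q ∈ t.D, (q.1 ∩ univ).Nonempty →
      ∃ x, q.1 ⊆ ball x ε := by
    refine isCompact_univ.induction_on (p := fun K => ∀ s : St S S', s₀.Le s → ∃ t : St S S', s.Le t ∧
      ∀ q ∈ t.D, (q.1 ∩ K).Nonempty → ∃ x, q.1 ⊆ ball x ε) ?_ ?_ ?_ ?_
    · intro s _; exact ⟨s, .refl s, by simp⟩
    · intro K K' hK h s hs
      obtain ⟨t, ht, h'⟩ := h s hs
      exact ⟨t, ht, fun q hq hne => h' q hq (hne.mono (inter_subset_inter_right _ hK))⟩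
    · intro K K' h h' s hs
      obtain ⟨t, ht, h1⟩ := h s hs
      obtain ⟨u, hu, h2⟩ := h' t (hs.trans ht)
      refine ⟨u, ht.trans hu, fun q hq hne => ?_⟩
      rw [inter_union_distrib_left, union_nonempty] at hne
      rcases hne with hne | hne
      · obtain ⟨p, hp, hqp, -⟩ := hu.1 q hq
        obtain ⟨x, hx⟩ := h1 p hp (hne.mono (inter_subset_inter_left _ hqp))
        exact ⟨x, hqp.trans hx⟩
      · exact h2 q hq hne
    · intro x _
      rw [nhdsWithin_univ]
      obtain ⟨N, hN, h⟩ := s₀.mesh_local hS hsep hS' hsep' x (ball_mem_nhds x hε)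
      refine ⟨N, hN, fun s hs => ?_⟩
      obtain ⟨t, ht, h'⟩ := h s hs
      exact ⟨t, ht, fun q hq hne => ⟨x, h' q hq hne⟩⟩
  obtain ⟨t, ht, h⟩ := key s₀ (.refl _)
  refine ⟨t, ht, fun q hq => h q hq ?_⟩
  rw [inter_univ]
  exact (t.dec.comp q hq).1

lemma St.swapLe [Nonempty S] [Nonempty S'] (s : St S S') : ∃ t : St S' S, ∀ t' : St S' S, t.Le t' →
    ∃ u : St S S', s.Le u ∧ u.D = Prod.swap '' t'.D := by
  obtain ⟨t, htD, htΓ, htΓ', hth⟩ := s.exists_swap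
  refine ⟨t, fun t' ht' => ?_⟩
  obtain ⟨u, huD, huΓ, huΓ', huh⟩ := t'.exists_swap
  have hx : ∀ x ∈ s.Γ, s.h x ∈ t.Γ := fun x hx => by
    rw [htΓ, ← s.him]; exact mem_image_of_mem _ hx
  have hx' : ∀ x ∈ s.Γ, t'.h (s.h x) = x := fun x h => by
    rw [← ht'.2.2 (hx x h), hth x h]
  refine ⟨u, ⟨?_, ?_, ?_⟩, huD⟩
  · rw [huD]
    rintro _ ⟨q, hq, rfl⟩
    obtain ⟨p, hp, h1, h2⟩ := ht'.1 q hq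
    rw [htD] at hp
    obtain ⟨p, hp, rfl⟩ := hp
    exact ⟨p, hp, h2, h1⟩
  · intro x h
    rw [huΓ, ← t'.him]
    exact ⟨s.h x, ht'.2.1 (hx x h), hx' x h⟩
  · intro x h
    have := huh (s.h x) (ht'.2.1 (hx x h))
    rw [hx' x h] at this
    exact this.symm

lemma St.mesh_both [Nonempty S] [Nonempty S'] (hS : IsSurf S) (hsep : SepProp S) (hS' : IsSurf S')
    (hsep' : SepProp S') (s : St S S') {ε : ℝ} (hε : 0 < ε) :
    ∃ t : St S S', s.Le t ∧ ∀ q ∈ t.D, (∃ x, q.1 ⊆ ball x ε) ∧ ∃ x, q.2 ⊆ ball x ε := by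
  obtain ⟨t, ht, h1⟩ := s.mesh hS hsep hS' hsep' hε
  obtain ⟨w, hw⟩ := t.swapLe
  obtain ⟨w', hww, h2⟩ := w.mesh hS' hsep' hS hsep hε
  obtain ⟨u, hu, huD⟩ := hw w' hww
  refine ⟨u, ht.trans hu, fun q hq => ⟨?_, ?_⟩⟩
  · obtain ⟨p, hp, h3, -⟩ := hu.1 q hq
    obtain ⟨x, hx⟩ := h1 p hp
    exact ⟨x, h3.trans hx⟩
  · rw [huD] at hq
    obtain ⟨q, hq, rfl⟩ := hq
    exact h2 q hq

lemma St.limit [Nonempty S] [Nonempty S'] (hS : IsSurf S) (hsep : SepProp S) (hS' : IsSurf S')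
    (hsep' : SepProp S') (s₀ : St S S') :
    ∃ H : S ≃ₜ S', EqOn s₀.h H s₀.Γ ∧ ∀ p ∈ s₀.D, ∀ x, x ∈ p.1 ↔ H x ∈ p.2 := by
  have hpos : ∀ n : ℕ, (0 : ℝ) < 1 / (n + 1) := fun n => by positivity
  choose f hf hfm using fun (n : ℕ) (s : St S S') => s.mesh_both hS hsep hS' hsep' (hpos n)
  let st : ℕ → St S S' := fun n => Nat.rec s₀ (fun n s => f n s) n
  have hle1 : ∀ n, (st n).Le (st (n + 1)) := fun n => hf n _
  have hle : ∀ n m, n ≤ m → (st n).Le (st m) := by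
    intro n m h
    induction m, h using Nat.le_induction with
    | base => exact .refl _
    | succ m _ ih => exact ih.trans (hle1 m)
  have hmesh : ∀ n, ∀ q ∈ (st (n + 1)).D, (∃ x, q.1 ⊆ ball x (1 / (n + 1))) ∧
      ∃ x, q.2 ⊆ ball x (1 / (n + 1)) := fun n => hfm n _
  let R : ℕ → Set (S × S') := fun n => ⋃ p ∈ (st n).D, closure p.1 ×ˢ closure p.2
  have hRc : ∀ n, IsClosed (R n) := fun n =>
    (st n).fin.isClosed_biUnion fun p _ => isClosed_closure.prod isClosed_closure
  have hRm : ∀ n, R (n + 1) ⊆ R n := by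
    intro n z hz
    obtain ⟨q, hq, hz⟩ := mem_iUnion₂.1 hz
    obtain ⟨p, hp, h1, h2⟩ := (hle1 n).1 q hq
    exact mem_iUnion₂.2 ⟨p, hp, closure_mono h1 hz.1, closure_mono h2 hz.2⟩
  have hRanti : Antitone R := antitone_nat_of_succ_le hRm
  let RR : Set (S × S') := ⋂ n, R n
  have hRRc : IsClosed RR := isClosed_iInter hRc
  have hdist : ∀ {X : Type _} [MetricSpace X] {G : Set X} {n : ℕ} {x y : X},
      (∃ z, G ⊆ ball z (1 / (n + 1))) → x ∈ closure G → y ∈ closure G →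
      dist x y ≤ 2 * (1 / (n + 1)) := by
    rintro X _ G n x y ⟨z, hz⟩ hx hy
    have h1 := Metric.closure_ball_subset_closedBall (closure_mono hz hx)
    have h2 := Metric.closure_ball_subset_closedBall (closure_mono hz hy)
    rw [Metric.mem_closedBall] at h1 h2
    linarith [dist_triangle_right x y z]
  have hdist' : ∀ {G : Set S'} {n : ℕ} {x y : S'},
      (∃ z, G ⊆ ball z (1 / (n + 1))) → x ∈ closure G → y ∈ closure G →
      dist x y ≤ 2 * (1 / (n + 1)) := by
    rintro G n x y ⟨z, hz⟩ hx hy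
    have h1 := Metric.closure_ball_subset_closedBall (closure_mono hz hx)
    have h2 := Metric.closure_ball_subset_closedBall (closure_mono hz hy)
    rw [Metric.mem_closedBall] at h1 h2
    linarith [dist_triangle_right x y z]
  have hsmall : ∀ {d : ℝ}, (∀ n : ℕ, d ≤ 4 * (1 / (n + 1))) → d ≤ 0 := by
    intro d hd
    by_contra h
    push Not at h
    obtain ⟨n, hn⟩ := exists_nat_one_div_lt (show (0 : ℝ) < d / 4 by positivity)
    have := hd n
    linarith
  -- graph of h
  have hgraph : ∀ n, ∀ x ∈ (st n).Γ, (x, (st n).h x) ∈ RR := by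
    intro n x hx
    have h1 : ∀ m, n ≤ m → (x, (st n).h x) ∈ R m := by
      intro m hm
      obtain ⟨p, hp, hxp⟩ := (st m).dec.cov x ((hle n m hm).2.1 hx)
      refine mem_iUnion₂.2 ⟨p, hp, frontier_subset_closure hxp, ?_⟩
      rw [(hle n m hm).2.2 hx]
      exact frontier_subset_closure ((st m).hfr p hp ▸ mem_image_of_mem _ hxp)
    refine mem_iInter.2 fun m => ?_
    rcases le_total n m with h | h
    · exact h1 m h
    · exact hRanti h (h1 n le_rfl)
  -- uniqueness
  have huniq : ∀ x x' x'', (x, x') ∈ RR → (x, x'') ∈ RR → x' = x'' := by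
    intro x x' x'' h1 h2
    rw [← dist_le_zero]
    refine hsmall fun n => ?_
    obtain ⟨p, hp, hxp, hx'⟩ := mem_iUnion₂.1 (mem_iInter.1 h1 (n + 1))
    obtain ⟨q, hq, hxq, hx''⟩ := mem_iUnion₂.1 (mem_iInter.1 h2 (n + 1))
    by_cases hpq : p = q
    · subst hpq
      have := hdist' (hmesh n p hp).2 hx' hx''
      have := hpos n
      linarith
    · have f1 := (st (n + 1)).dec.mem_frontier hp hq hpq hxp hxq
      have f2 := (st (n + 1)).dec.mem_frontier hq hp (Ne.symm hpq) hxq hxp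
      have k1 := hdist' (hmesh n p hp).2 hx' (frontier_subset_closure
        ((st (n + 1)).hfr p hp ▸ mem_image_of_mem _ f1))
      have k2 := hdist' (hmesh n q hq).2 hx'' (frontier_subset_closure
        ((st (n + 1)).hfr q hq ▸ mem_image_of_mem _ f2))
      linarith [dist_triangle_right x' x'' ((st (n + 1)).h x)]
  have huniq' : ∀ x y x', (x, x') ∈ RR → (y, x') ∈ RR → x = y := by
    intro x y x' h1 h2
    rw [← dist_le_zero]
    refine hsmall fun n => ?_
    obtain ⟨p, hp, hxp, hx'⟩ := mem_iUnion₂.1 (mem_iInter.1 h1 (n + 1))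
    obtain ⟨q, hq, hyq, hx''⟩ := mem_iUnion₂.1 (mem_iInter.1 h2 (n + 1))
    by_cases hpq : p = q
    · subst hpq
      have := hdist (hmesh n p hp).1 hxp hyq
      have := hpos n
      linarith
    · have f1 := (st (n + 1)).dec'.mem_frontier hp hq hpq hx' hx''
      have f2 := (st (n + 1)).dec'.mem_frontier hq hp (Ne.symm hpq) hx'' hx'
      rw [← (st (n + 1)).hfr p hp] at f1
      rw [← (st (n + 1)).hfr q hq] at f2
      obtain ⟨z, hz, hzx⟩ := f1
      obtain ⟨w, hw, hwx⟩ := f2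
      have := (st (n + 1)).hi ((st (n + 1)).dec.frontier_subset hp hz)
        ((st (n + 1)).dec.frontier_subset hq hw) (hzx.trans hwx.symm)
      subst this
      have k1 := hdist (hmesh n p hp).1 hxp (frontier_subset_closure hz)
      have k2 := hdist (hmesh n q hq).1 hyq (frontier_subset_closure hw)
      linarith [dist_triangle_right x y z]
  -- existence
  have hex : ∀ x, ∃ x', (x, x') ∈ RR := by
    intro x
    have := IsCompact.nonempty_iInter_of_sequence_nonempty_isCompact_isClosed
      (fun n => (fun x' => (x, x')) ⁻¹' R n) (fun n => preimage_mono (hRm n)) (fun n => by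
        obtain ⟨p, hp, hx⟩ := (st n).dec.exists_closure x
        obtain ⟨y, hy⟩ := ((st n).dec'.comp p hp).1
        exact ⟨y, mem_iUnion₂.2 ⟨p, hp, hx, subset_closure hy⟩⟩)
      (((hRc 0).preimage (by fun_prop)).isCompact) (fun n => (hRc n).preimage (by fun_prop))
    obtain ⟨x', hx'⟩ := this
    exact ⟨x', mem_iInter.2 fun n => mem_iInter.1 hx' n⟩
  have hex' : ∀ x', ∃ x, (x, x') ∈ RR := by
    intro x'
    have := IsCompact.nonempty_iInter_of_sequence_nonempty_isCompact_isClosed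
      (fun n => (fun x => (x, x')) ⁻¹' R n) (fun n => preimage_mono (hRm n)) (fun n => by
        obtain ⟨p, hp, hx⟩ := (st n).dec'.exists_closure x'
        obtain ⟨y, hy⟩ := ((st n).dec.comp p hp).1
        exact ⟨y, mem_iUnion₂.2 ⟨p, hp, subset_closure hy, hx⟩⟩)
      (((hRc 0).preimage (by fun_prop)).isCompact) (fun n => (hRc n).preimage (by fun_prop))
    obtain ⟨x, hx⟩ := this
    exact ⟨x, mem_iInter.2 fun n => mem_iInter.1 hx n⟩
  have : CompactSpace RR := isCompact_iff_compactSpace.1 hRRc.isCompact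
  let e₁ : RR ≃ S := Equiv.ofBijective (fun z => z.1.1) ⟨by
    rintro ⟨⟨x, x'⟩, h⟩ ⟨⟨y, y'⟩, h'⟩ (rfl : x = y)
    rw [Subtype.mk.injEq, huniq _ _ _ h h'], fun x => by
    obtain ⟨x', h⟩ := hex x; exact ⟨⟨_, h⟩, rfl⟩⟩
  let e₂ : RR ≃ S' := Equiv.ofBijective (fun z => z.1.2) ⟨by
    rintro ⟨⟨x, x'⟩, h⟩ ⟨⟨y, y'⟩, h'⟩ (rfl : x' = y')
    rw [Subtype.mk.injEq, huniq' _ _ _ h h'], fun x => by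
    obtain ⟨x', h⟩ := hex' x; exact ⟨⟨_, h⟩, rfl⟩⟩
  let H₁ : RR ≃ₜ S := Continuous.homeoOfEquivCompactToT2 (f := e₁)
    (continuous_fst.comp continuous_subtype_val)
  let H₂ : RR ≃ₜ S' := Continuous.homeoOfEquivCompactToT2 (f := e₂)
    (continuous_snd.comp continuous_subtype_val)
  let H := H₁.symm.trans H₂
  have hH : ∀ x, (x, H x) ∈ RR := by
    intro x
    have h1 : (H₁.symm x).1.1 = x := H₁.apply_symm_apply x
    have h2 := (H₁.symm x).2
    have h3 : (H₁.symm x).1 = (x, H x) := Prod.ext h1 rfl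
    rwa [h3] at h2
  have hHh : EqOn s₀.h H s₀.Γ := fun x hx => huniq _ _ _ (hgraph 0 x hx) (hH x)
  refine ⟨H, hHh, fun p hp x => ?_⟩
  obtain ⟨q, hq, hxq, hHq⟩ := mem_iUnion₂.1 (mem_iInter.1 (hH x) 0)
  constructor
  · intro hx
    have hqp : q = p := by
      by_contra hne
      exact s₀.dec.not_mem_closure hp hq (Ne.symm hne) hx hxq
    subst hqp
    by_contra hn
    have : H x ∈ frontier q.2 := by
      rw [(s₀.dec'.isOpen hp).frontier_eq]; exact ⟨hHq, hn⟩
    rw [← s₀.hfr q hp] at this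
    obtain ⟨y, hy, hyx⟩ := this
    have hyΓ := s₀.dec.frontier_subset hp hy
    rw [hHh hyΓ] at hyx
    exact s₀.dec.face_disj hp hx (H.injective hyx ▸ hyΓ)
  · intro hx
    have hqp : q = p := by
      by_contra hne
      exact s₀.dec'.not_mem_closure hp hq (Ne.symm hne) hx hHq
    subst hqp
    by_contra hn
    have : x ∈ frontier q.1 := by
      rw [(s₀.dec.isOpen hp).frontier_eq]; exact ⟨hxq, hn⟩
    refine s₀.dec'.face_disj hp hx ?_
    rw [← hHh (s₀.dec.frontier_subset hp this), ← s₀.him]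
    exact mem_image_of_mem _ (s₀.dec.frontier_subset hp this)

end limit

lemma IsSurf.dec_start {S α : Type*} [TopologicalSpace S] [T2Space S] [PreconnectedSpace S]
    (hS : IsSurf S) (hsep : SepProp S) {J F : Set S} (hJ : IsSCC J) (hF : IsComp Jᶜ F)
    {f : α → Set S} {p q : α} (hp : f p = F) (hq : f q = (closure F)ᶜ) : Dec {p, q} f J := by
  have hF' := hS.other_face hsep hJ hF
  have e1 := hS.frontier_face hJ hF
  have e2 := hS.frontier_face hJ hF'
  have hd : Disjoint F (closure F)ᶜ := disjoint_compl_right.mono_left subset_closure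
  have hcl := hS.closure_face hJ hF
  refine ⟨?_, ?_, ?_, ?_, ?_, hJ.isPreconnected, hJ.isPreconnected_diff⟩
  · rintro r (rfl | rfl)
    · rwa [hp, e1]
    · rwa [hq, e2]
  · rintro r (rfl | rfl)
    · rwa [hp, e1]
    · rwa [hq, e2]
  · rintro r (rfl | rfl) r' (rfl | rfl) hr
    · exact (hr rfl).elim
    · rwa [hp, hq]
    · rw [hp, hq]; exact hd.symm
    · exact (hr rfl).elim
  · intro x
    constructor
    · rintro hx r (rfl | rfl)
      · rw [hp]; exact fun h => hF.2.2.2.1 h hx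
      · rw [hq]; exact fun h => hF'.2.2.2.1 h hx
    · intro h
      have h1 := h p (by simp)
      have h2 := h q (by simp)
      rw [hp] at h1
      rw [hq, mem_compl_iff, not_not, hcl] at h2
      exact h2.resolve_left h1
  · intro x hx
    exact ⟨p, by simp, by rwa [hp, e1]⟩

/-- Schoenflies / classification theorem: two compact connected surfaces with the separation
property are homeomorphic, by a homeomorphism extending a given one between two curves. -/
theorem schoenflies {S S' : Type*} [TopologicalSpace S] [TopologicalSpace S'] [CompactSpace S]
    [CompactSpace S'] [TopologicalSpace.MetrizableSpace S] [TopologicalSpace.MetrizableSpace S'] [PreconnectedSpace S]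
    [PreconnectedSpace S'] (hS : IsSurf S) (hsep : SepProp S) (hS' : IsSurf S')
    (hsep' : SepProp S') {J F : Set S} {J' F' : Set S'} (hJ : IsSCC J) (hF : IsComp Jᶜ F)
    (hJ' : IsSCC J') (hF' : IsComp J'ᶜ F') {h₀ : S → S'} (hc : ContinuousOn h₀ J)
    (hi : InjOn h₀ J) (him : h₀ '' J = J') :
    ∃ H : S ≃ₜ S', EqOn h₀ H J ∧ ∀ x, x ∈ F ↔ H x ∈ F' := by
  letI := TopologicalSpace.metrizableSpaceMetric S
  letI := TopologicalSpace.metrizableSpaceMetric S'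
  obtain ⟨x, -⟩ := hJ.nonempty
  obtain ⟨x', -⟩ := hJ'.nonempty
  have : Nonempty S := ⟨x⟩
  have : Nonempty S' := ⟨x'⟩
  let p : Set S × Set S' := (F, F')
  let q : Set S × Set S' := ((closure F)ᶜ, (closure F')ᶜ)
  let s : St S S' := ⟨{p, q}, by simp, J, J', h₀, hS.dec_start hsep hJ hF rfl rfl,
    hS'.dec_start hsep' hJ' hF' rfl rfl, hc, hi, him, by
      rintro r (rfl | rfl)
      · change h₀ '' frontier F = frontier F'
        rw [hS.frontier_face hJ hF, hS'.frontier_face hJ' hF', him]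
      · change h₀ '' frontier (closure F)ᶜ = frontier (closure F')ᶜ
        rw [hS.frontier_face hJ (hS.other_face hsep hJ hF),
          hS'.frontier_face hJ' (hS'.other_face hsep' hJ' hF'), him]⟩
  obtain ⟨H, h1, h2⟩ := s.limit hS hsep hS' hsep'
  exact ⟨H, h1, fun x => h2 p (by simp [s]) x⟩


/-- a double cover which is labelled off `Z`, the labels switching across `Z` -/
structure DCov (X : Type) [TopologicalSpace X] (Z : Set X) where
  D : Type
  top : TopologicalSpace D
  p : D → X
  cov : IsCoveringMap p
  surj : Function.Surjective p
  t : D → D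
  t_cont : Continuous t
  p_t : ∀ e, p (t e) = p e
  t_t : ∀ e, t (t e) = e
  t_ne : ∀ e, t e ≠ e
  fib : ∀ e e', p e = p e' → e' = e ∨ e' = t e
  lab : D → Bool
  lab_cont : ContinuousOn lab (p ⁻¹' Z)ᶜ
  lab_t : ∀ e, p e ∉ Z → lab (t e) = !lab e
  switch : ∀ a ∈ Z, ∀ N ∈ 𝓝 a, ∀ s : X → D, ContinuousOn s N → (∀ x ∈ N, p (s x) = x) →
    ∃ y ∈ N \ Z, ∃ y' ∈ N \ Z, lab (s y) = true ∧ lab (s y') = false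

attribute [instance] DCov.top

section mk
variable {X : Type} [TopologicalSpace X] {Z : Set X}

lemma exists_local_side (hZ : IsClosed Z) (h2 : ∀ z ∈ Z, TwoSidedAt Z z) :
    ∃ (W : X → Set X) (s : X → X → Bool), (∀ i, IsOpen (W i)) ∧ (∀ i, i ∈ W i) ∧
      (∀ i, ContinuousOn (s i) (W i \ Z)) ∧
      (∀ i, ∀ z ∈ Z ∩ W i, ∀ b : Bool, ∃ᶠ y in 𝓝 z, y ∉ Z ∧ s i y = b) := by
  classical
  have key : ∀ i : X, ∃ (W : Set X) (s : X → Bool), IsOpen W ∧ i ∈ W ∧ ContinuousOn s (W \ Z) ∧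
      ∀ z ∈ Z ∩ W, ∀ b : Bool, ∃ᶠ y in 𝓝 z, y ∉ Z ∧ s y = b := by
    intro i
    by_cases hi : i ∈ Z
    · obtain ⟨W, hW, hiW, -, Y₁, Y₂, hY₁, hY₂, hd, -, -, hs₁, hs₂, hcov, hcl⟩ :=
        h2 i hi univ Filter.univ_mem
      refine ⟨W, fun y => decide (y ∈ Y₁), hW, hiW, ?_, ?_⟩
      · intro y hy
        apply ContinuousAt.continuousWithinAt
        rcases hcov hy with h | h
        · apply (continuousAt_const (y := true)).congr
          filter_upwards [hY₁.mem_nhds h] with w hw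
          simp [hw]
        · apply (continuousAt_const (y := false)).congr
          filter_upwards [hY₂.mem_nhds h] with w hw
          have : w ∉ Y₁ := fun h' => disjoint_left.1 hd h' hw
          simp [this]
      · intro z hz b
        obtain ⟨h1, h2'⟩ := hcl z hz
        cases b
        · rw [mem_closure_iff_frequently] at h2'
          refine h2'.mono fun y hy => ⟨(hs₂ hy).2, ?_⟩
          have : y ∉ Y₁ := fun h' => disjoint_left.1 hd h' hy
          simp [this]
        · rw [mem_closure_iff_frequently] at h1
          refine h1.mono fun y hy => ⟨(hs₁ hy).2, by simp [hy]⟩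
    · exact ⟨Zᶜ, fun _ => false, hZ.isOpen_compl, hi, continuousOn_const,
        fun z hz => absurd hz.1 hz.2⟩
  choose W s h1 h2 h3 h4 using key
  exact ⟨W, s, h1, h2, h3, h4⟩

lemma side_const (hZ : IsClosed Z) (h2 : ∀ z ∈ Z, TwoSidedAt Z z) {W W' : Set X} {s s' : X → Bool}
    (hW : IsOpen W) (hW' : IsOpen W') (hs : ContinuousOn s (W \ Z)) (hs' : ContinuousOn s' (W' \ Z))
    (hf : ∀ z ∈ Z ∩ W, ∀ b : Bool, ∃ᶠ y in 𝓝 z, y ∉ Z ∧ s y = b)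
    (hf' : ∀ z ∈ Z ∩ W', ∀ b : Bool, ∃ᶠ y in 𝓝 z, y ∉ Z ∧ s' y = b) {x : X} (hx : x ∈ W ∩ W') :
    ∃ c : Bool, ∀ᶠ y in 𝓝 x, y ∉ Z → xor (s y) (s' y) = c := by
  by_cases hxZ : x ∈ Z
  · obtain ⟨N, hN, hxN, hNV, Y₁, Y₂, hY₁, hY₂, hd, hp₁, hp₂, hs₁, hs₂, hcov, hcl⟩ :=
      h2 x hxZ (W ∩ W') ((hW.inter hW').mem_nhds hx)
    have aux : ∀ {W : Set X} {s : X → Bool}, IsOpen W → ContinuousOn s (W \ Z) → x ∈ W →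
        (∀ z ∈ Z ∩ W, ∀ b : Bool, ∃ᶠ y in 𝓝 z, y ∉ Z ∧ s y = b) → Y₁ ⊆ W \ Z → Y₂ ⊆ W \ Z →
        ∃ c : Bool, (∀ y ∈ Y₁, s y = c) ∧ (∀ y ∈ Y₂, s y = !c) := by
      intro W s hW hs hxW hf hs₁ hs₂
      have c1 : ∃ c, ∀ y ∈ Y₁, s y = c := by
        rcases Y₁.eq_empty_or_nonempty with h | ⟨w, hw⟩
        · exact ⟨true, by simp [h]⟩
        · exact ⟨s w, fun y hy => hp₁.constant (hs.mono hs₁) hy hw⟩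
      have c2 : ∃ c, ∀ y ∈ Y₂, s y = c := by
        rcases Y₂.eq_empty_or_nonempty with h | ⟨w, hw⟩
        · exact ⟨true, by simp [h]⟩
        · exact ⟨s w, fun y hy => hp₂.constant (hs.mono hs₂) hy hw⟩
      obtain ⟨c, hc⟩ := c1
      obtain ⟨c', hc'⟩ := c2
      obtain ⟨y, ⟨hyZ, hy⟩, hyN⟩ := ((hf x ⟨hxZ, hxW⟩ (!c)).and_eventually (hN.mem_nhds hxN)).exists
      have : y ∈ Y₂ := by
        rcases hcov ⟨hyN, hyZ⟩ with h | h
        · rw [hc y h] at hy; simp at hy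
        · exact h
      refine ⟨c, hc, ?_⟩
      rw [← hy, hc' y this]
      exact hc'
    obtain ⟨c, hc1, hc2⟩ := aux hW hs hx.1 hf (hs₁.trans (sdiff_subset_sdiff_left inter_subset_left))
      (hs₂.trans (sdiff_subset_sdiff_left inter_subset_left))
    obtain ⟨c', hc1', hc2'⟩ := aux hW' hs' hx.2 hf'
      (hs₁.trans (sdiff_subset_sdiff_left inter_subset_right))
      (hs₂.trans (sdiff_subset_sdiff_left inter_subset_right))
    refine ⟨xor c c', ?_⟩
    filter_upwards [hN.mem_nhds hxN] with y hy hyZ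
    rcases hcov ⟨hy, hyZ⟩ with h | h
    · rw [hc1 y h, hc1' y h]
    · rw [hc2 y h, hc2' y h]; simp
  · have e1 : ∀ᶠ y in 𝓝 x, s y = s x :=
      (hs.continuousAt ((hW.sdiff hZ).mem_nhds ⟨hx.1, hxZ⟩)).eventually
        (isOpen_discrete {s x} |>.mem_nhds rfl)
    have e2 : ∀ᶠ y in 𝓝 x, s' y = s' x :=
      (hs'.continuousAt ((hW'.sdiff hZ).mem_nhds ⟨hx.2, hxZ⟩)).eventually
        (isOpen_discrete {s' x} |>.mem_nhds rfl)
    refine ⟨xor (s x) (s' x), ?_⟩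
    filter_upwards [e1, e2] with y h1 h2 _
    rw [h1, h2]

lemma frequently_compl (hZ : IsClosed Z) (h2 : ∀ z ∈ Z, TwoSidedAt Z z) (x : X) :
    ∃ᶠ y in 𝓝 x, y ∉ Z := by
  by_cases hx : x ∈ Z
  · obtain ⟨W, hW, hiW, -, Y₁, Y₂, hY₁, hY₂, hd, -, -, hs₁, hs₂, hcov, hcl⟩ :=
        h2 x hx univ Filter.univ_mem
    have := (hcl x ⟨hx, hiW⟩).1
    rw [mem_closure_iff_frequently] at this
    exact this.mono fun y hy => (hs₁ hy).2
  · have h : ∀ᶠ y in 𝓝 x, y ∉ Z := hZ.isOpen_compl.mem_nhds hx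
    exact h.frequently

theorem exists_dcov (hZ : IsClosed Z) (h2 : ∀ z ∈ Z, TwoSidedAt Z z) : Nonempty (DCov X Z) := by
  classical
  obtain ⟨W, s, hW, hmem, hs, hf⟩ := exists_local_side hZ h2
  have hg0 : ∀ i j x, ∃ c : Bool, x ∈ W i ∩ W j → ∀ᶠ y in 𝓝 x, y ∉ Z → xor (s i y) (s j y) = c := by
    intro i j x
    by_cases hx : x ∈ W i ∩ W j
    · obtain ⟨c, hc⟩ := side_const hZ h2 (hW i) (hW j) (hs i) (hs j) (hf i) (hf j) hx
      exact ⟨c, fun _ => hc⟩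
    · exact ⟨true, fun h => absurd h hx⟩
  choose g hg using hg0
  have guniq : ∀ i j x c, x ∈ W i ∩ W j → (∀ᶠ y in 𝓝 x, y ∉ Z → xor (s i y) (s j y) = c) →
      g i j x = c := by
    intro i j x c hx h
    obtain ⟨y, hy, h1, h2⟩ := ((frequently_compl hZ h2 x).and_eventually
      (h.and (hg i j x hx))).exists
    rw [← h1 hy, ← h2 hy]
  have gcont : ∀ i j, ContinuousOn (g i j) (W i ∩ W j) := by
    intro i j x hx
    apply ContinuousAt.continuousWithinAt
    apply (continuousAt_const (y := g i j x)).congr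
    filter_upwards [(hg i j x hx).eventually_nhds, ((hW i).inter (hW j)).mem_nhds hx] with y hy hyW
    exact (guniq i j y _ hyW hy).symm
  let C : FiberBundleCore X X Bool :=
    { baseSet := W
      isOpen_baseSet := hW
      indexAt := id
      mem_baseSet_at := hmem
      coordChange := fun i j x v => xor (g i j x) v
      coordChange_self := by
        intro i x hx v
        have : g i i x = false := guniq i i x _ ⟨hx, hx⟩ (Filter.Eventually.of_forall (by simp))
        simp [this]
      continuousOn_coordChange := by
        intro i j
        have h1 : ContinuousOn (fun q : X × Bool => (g i j q.1, q.2)) ((W i ∩ W j) ×ˢ univ) :=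
          ((gcont i j).comp continuousOn_fst (fun q hq => hq.1)).prodMk continuousOn_snd
        exact (continuous_of_discreteTopology (f := fun q : Bool × Bool => xor q.1 q.2)).comp_continuousOn h1
      coordChange_comp := by
        intro i j k x hx v
        have : g i k x = xor (g i j x) (g j k x) := by
          apply guniq i k x _ ⟨hx.1.1, hx.2⟩
          filter_upwards [hg i j x hx.1, hg j k x ⟨hx.1.2, hx.2⟩] with y h1 h2 hy
          rw [← h1 hy, ← h2 hy]
          cases s i y <;> cases s j y <;> cases s k y <;> rfl
        rw [this]
        cases g i j x <;> cases g j k x <;> cases v <;> rfl }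
  have bx : ∀ a b : Bool, xor a (!b) = !(xor a b) := by decide
  have bx2 : ∀ b : Bool, (!b) = b → False := by decide
  have bx3 : ∀ a b c : Bool, xor a c = xor b (xor (xor a b) c) := by decide
  let D := Bundle.TotalSpace Bool C.Fiber
  let p : D → X := Bundle.TotalSpace.proj
  have hcov : IsCoveringMap p := FiberBundle.isCoveringMap (F := Bool) (E := C.Fiber)
  have hsnd : ∀ (i : X) (e : D), (C.localTriv i e).2 = xor (g e.1 i e.1) e.2 := fun i e => rfl
  let t : D → D := fun e => ⟨e.1, !(show Bool from e.2)⟩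
  let lab : D → Bool := fun e => xor (s e.1 e.1) (show Bool from e.2)
  have hlab : ∀ (i : X) (e : D), e.1 ∈ W i → e.1 ∉ Z →
      lab e = xor (s i e.1) (C.localTriv i e).2 := by
    intro i e hi hZe
    rw [hsnd]
    have h := (hg e.1 i e.1 ⟨hmem _, hi⟩).self_of_nhds hZe
    rw [← h]
    show xor (s e.1 e.1) _ = _
    exact bx3 _ _ _
  have hsc : ∀ i : X, ContinuousOn (fun e : D => (C.localTriv i e).2) (p ⁻¹' W i) := by
    intro i
    have : ContinuousOn (C.localTriv i) (p ⁻¹' W i) := (C.localTriv i).continuousOn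
    exact continuous_snd.comp_continuousOn this
  refine ⟨⟨D, inferInstance, p, hcov, fun x => ⟨⟨x, true⟩, rfl⟩, t, ?_, fun e => rfl, ?_, ?_, ?_, lab, ?_, ?_, ?_⟩⟩
  · rw [continuous_iff_continuousAt]
    intro e
    let i := e.1
    let T := C.localTriv i
    have ho : IsOpen (p ⁻¹' W i) := (hW i).preimage hcov.continuous
    have hcT : ContinuousOn T (p ⁻¹' W i) := T.continuousOn
    have hcS : ContinuousOn T.toOpenPartialHomeomorph.symm T.target := T.toOpenPartialHomeomorph.continuousOn_symm
    have htgt : T.target = W i ×ˢ univ := T.target_eq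
    have h1 : ContinuousOn (fun e : D => T.toOpenPartialHomeomorph.symm (e.1, !(T e).2)) (p ⁻¹' W i) := by
      apply hcS.comp
      · apply hcov.continuous.continuousOn.prodMk
        exact (continuous_of_discreteTopology (f := not)).comp_continuousOn (hsc i)
      · intro e he
        rw [htgt]; exact ⟨he, mem_univ _⟩
    apply (h1.continuousAt (ho.mem_nhds (hmem i))).congr
    filter_upwards [ho.mem_nhds (hmem i)] with e he
    have he' : t e ∈ T.source := T.mem_source.2 he
    have : T (t e) = (e.1, !(T e).2) := by
      refine Prod.ext rfl ?_
      rw [hsnd, hsnd]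
      exact bx _ _
    rw [← this]
    exact T.toOpenPartialHomeomorph.left_inv he'
  · rintro ⟨x, v⟩
    cases v <;> rfl
  · rintro ⟨x, v⟩ h
    have h := eq_of_heq (Bundle.TotalSpace.mk.inj h).2
    exact bx2 _ h
  · rintro ⟨x, v⟩ ⟨x', v'⟩ h
    obtain rfl : x = x' := h
    cases v <;> cases v' <;> first | exact Or.inl rfl | exact Or.inr rfl
  · intro e he
    apply ContinuousAt.continuousWithinAt
    let i := e.1
    have ho : IsOpen (p ⁻¹' W i) := (hW i).preimage hcov.continuous
    have hoZ : IsOpen (p ⁻¹' Z)ᶜ := (hZ.preimage hcov.continuous).isOpen_compl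
    have h1 : ContinuousOn (fun e : D => (s i e.1, (C.localTriv i e).2)) (p ⁻¹' W i ∩ (p ⁻¹' Z)ᶜ) := by
      apply ContinuousOn.prodMk
      · exact (hs i).comp hcov.continuous.continuousOn (fun e he => ⟨he.1, he.2⟩)
      · exact (hsc i).mono inter_subset_left
    have h2 := (continuous_of_discreteTopology (f := fun q : Bool × Bool => xor q.1 q.2)).comp_continuousOn h1
    have hn : p ⁻¹' W i ∩ (p ⁻¹' Z)ᶜ ∈ 𝓝 e := (ho.inter hoZ).mem_nhds ⟨hmem i, he⟩
    apply (h2.continuousAt hn).congr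
    filter_upwards [hn] with e he
    exact (hlab i e he.1 he.2).symm
  · intro e he
    exact bx _ _
  · intro a ha N hN sg hsg hpsg
    have h1 : ∀ᶠ y in 𝓝 a, sg y ∈ p ⁻¹' W a ∧ (C.localTriv a (sg y)).2 = (C.localTriv a (sg a)).2 := by
      have hca : ContinuousAt sg a := hsg.continuousAt hN
      have haN := mem_of_mem_nhds hN
      have hm : sg a ∈ p ⁻¹' W a := by
        show p (sg a) ∈ W a
        rw [hpsg a haN]; exact hmem a
      have ho : IsOpen (p ⁻¹' W a) := (hW a).preimage hcov.continuous
      refine (hca.eventually (ho.mem_nhds hm)).and ?_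
      exact (((hsc a).continuousAt (ho.mem_nhds hm)).comp hca).eventually
        (isOpen_discrete {(C.localTriv a (sg a)).2} |>.mem_nhds rfl)
    have h2 : ∀ b : Bool, ∃ y ∈ N \ Z, lab (sg y) = b := by
      intro b
      obtain ⟨y, ⟨hyZ, hy⟩, ⟨hyW, hyc⟩, hyN⟩ :=
        ((hf a a ⟨ha, hmem a⟩ (xor b (C.localTriv a (sg a)).2)).and_eventually (h1.and hN)).exists
      refine ⟨y, ⟨hyN, hyZ⟩, ?_⟩
      have hp : (sg y).1 = y := hpsg y hyN
      rw [hlab a (sg y) hyW (by rw [hp]; exact hyZ), hyc, hp, hy]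
      simp
    obtain ⟨y, hy, h⟩ := h2 true
    obtain ⟨y', hy', h'⟩ := h2 false
    exact ⟨y, hy, y', hy', h, h'⟩

end mk

section api
variable {X : Type} [TopologicalSpace X] {Z : Set X}

lemma DCov.t2 [T2Space X] (C : DCov X Z) : T2Space C.D := by
  refine ⟨fun e e' hne => ?_⟩
  by_cases h : C.p e = C.p e'
  · exact C.cov.isSeparatedMap e e' h hne
  · obtain ⟨U, V, hU, hV, h1, h2, hd⟩ := t2_separation h
    exact ⟨_, _, hU.preimage C.cov.continuous, hV.preimage C.cov.continuous, h1, h2, hd.preimage _⟩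

lemma DCov.exists_section (C : DCov X Z) (e : C.D) : ∃ (U : Set X) (s : X → C.D), IsOpen U ∧
    C.p e ∈ U ∧ ContinuousOn s U ∧ s (C.p e) = e ∧ ∀ x ∈ U, C.p (s x) = x := by
  obtain ⟨φ, he, hφ⟩ := C.cov.isLocalHomeomorph e
  have h1 : C.p e = φ e := congrFun hφ e
  refine ⟨φ.target, φ.symm, φ.open_target, ?_, φ.continuousOn_symm, ?_, ?_⟩
  · rw [h1]; exact φ.map_source he
  · rw [h1]; exact φ.left_inv he
  · intro x hx
    rw [hφ]; exact φ.right_inv hx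

lemma DCov.compact [CompactSpace X] [T2Space X] (C : DCov X Z) : CompactSpace C.D := by
  have key : IsCompact (C.p ⁻¹' (univ : Set X)) := by
    refine (isCompact_univ : IsCompact (univ : Set X)).induction_on (p := fun K => ∃ K', K ⊆ K' ∧ IsCompact (C.p ⁻¹' K'))
      ⟨∅, Subset.rfl, by simp⟩ ?_ ?_ ?_ |>.elim ?_
    · rintro s t hst ⟨K, hK, h⟩
      exact ⟨K, hst.trans hK, h⟩
    · rintro s t ⟨K, hK, h⟩ ⟨K', hK', h'⟩
      exact ⟨K ∪ K', union_subset_union hK hK', by rw [preimage_union]; exact h.union h'⟩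
    · intro x _
      obtain ⟨e, rfl⟩ := C.surj x
      obtain ⟨U, s, hU, heU, hs, -, hps⟩ := C.exists_section e
      obtain ⟨K, hK, hKU, hKc⟩ := local_compact_nhds (hU.mem_nhds heU)
      refine ⟨K, mem_nhdsWithin_of_mem_nhds hK, K, Subset.rfl, ?_⟩
      have : C.p ⁻¹' K = s '' K ∪ C.t '' (s '' K) := by
        ext e'
        constructor
        · intro he'
          rcases C.fib (s (C.p e')) e' (hps _ (hKU he')) with h | h
          · exact Or.inl ⟨_, he', h.symm⟩
          · exact Or.inr ⟨_, ⟨_, he', rfl⟩, h.symm⟩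
        · rintro (⟨x, hx, rfl⟩ | ⟨_, ⟨x, hx, rfl⟩, rfl⟩)
          · simpa [hps x (hKU hx)] using hx
          · simpa [C.p_t, hps x (hKU hx)] using hx
      rw [this]
      have h1 := hKc.image_of_continuousOn (hs.mono hKU)
      exact h1.union (h1.image C.t_cont)
    · rintro K ⟨hK, h⟩
      rwa [univ_subset_iff.1 hK] at h
  exact ⟨by simpa using key⟩

lemma DCov.lift (C : DCov X Z) {T : Type} [TopologicalSpace T] [LocallyPathConnectedSpace T]
    {A : Set T} (hA : IsOpen A) [SimplyConnectedSpace A] {f : T → X} (hf : ContinuousOn f A) {a : T} (ha : a ∈ A)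
    {e : C.D} (he : C.p e = f a) :
    ∃ F : T → C.D, ContinuousOn F A ∧ F a = e ∧ ∀ x ∈ A, C.p (F x) = f x := by
  classical
  have := hA.locallyPathConnectedSpace
  obtain ⟨F, ⟨h1, h2⟩, -⟩ := C.cov.existsUnique_continuousMap_lifts
    ⟨A.domRestrict f, continuousOn_iff_continuous_domRestrict.1 hf⟩ ⟨a, ha⟩ e he
  refine ⟨fun x => if h : x ∈ A then F ⟨x, h⟩ else e, ?_, ?_, ?_⟩
  · rw [continuousOn_iff_continuous_domRestrict]
    convert F.continuous using 1
    ext ⟨x, hx⟩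
    simp [hx]
  · simpa [ha] using h1
  · intro x hx
    simpa [hx] using congrFun h2 ⟨x, hx⟩
end api

/-- exterior of a cube -/
def Ext (r : ℝ) : Set (Fin 3 → ℝ) := {x | r < |x 0| ∨ r < |x 1| ∨ r < |x 2|}

/-- `Ext` minus a lower (`ε = 1`) or upper (`ε = -1`) beam -/
def ExtH (ε r : ℝ) : Set (Fin 3 → ℝ) := {x | r < |x 0| ∨ r < |x 1| ∨ r < ε * x 2}

lemma isOpen_extH (ε r : ℝ) : IsOpen (ExtH ε r) := by
  unfold ExtH
  have h1 : IsOpen {x : Fin 3 → ℝ | r < |x 0|} := isOpen_lt (by fun_prop) (by fun_prop)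
  have h2 : IsOpen {x : Fin 3 → ℝ | r < |x 1|} := isOpen_lt (by fun_prop) (by fun_prop)
  have h3 : IsOpen {x : Fin 3 → ℝ | r < ε * x 2} := isOpen_lt (by fun_prop) (by fun_prop)
  exact h1.union (h2.union h3)

lemma extH_simply {ε : ℝ} (hε : ε * ε = 1) (r : ℝ) : SimplyConnectedSpace (ExtH ε r) := by
  have : ContractibleSpace (ExtH ε r) := by
    rw [contractible_iff_id_nullhomotopic]
    let b : (Fin 3 → ℝ) := fun i => if i = 2 then ε * (r + 1) else 0
    have hb2 : ε * b 2 = r + 1 := by simp [b, ← mul_assoc, hε]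
    let g : (Fin 3 → ℝ) → ℝ → (Fin 3 → ℝ) := fun x t i => x i + if i = 2 then ε * (t * (|x 2| + |r| + 1)) else 0
    have g2 : ∀ x t, ε * g x t 2 = ε * x 2 + t * (|x 2| + |r| + 1) := by
      intro x t
      simp only [g, if_true, mul_add, ← mul_assoc, hε]
      ring
    have g0 : ∀ x t, g x t 0 = x 0 := by intro x t; simp [g]
    have g1 : ∀ x t, g x t 1 = x 1 := by intro x t; simp [g]
    have habs : ∀ y : ℝ, |ε * y| = |y| := by
      intro y
      have : |ε| = 1 := by
        have h := abs_mul_abs_self ε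
        nlinarith [abs_nonneg ε]
      rw [abs_mul, this, one_mul]
    have hg : ∀ x ∈ ExtH ε r, ∀ t : I, g x t ∈ ExtH ε r := by
      intro x hx t
      have ht := t.2.1
      rcases hx with h | h | h
      · exact Or.inl (by rw [g0]; exact h)
      · exact Or.inr (Or.inl (by rw [g1]; exact h))
      · refine Or.inr (Or.inr ?_)
        rw [g2]
        have : 0 ≤ (t : ℝ) * (|x 2| + |r| + 1) := by positivity
        linarith
    have hg' : ∀ x, r < ε * g x 1 2 := by
      intro x
      rw [g2]
      have h1 := neg_abs_le (ε * x 2)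
      rw [habs] at h1
      have := le_abs_self r
      linarith
    have hgc : Continuous (fun q : (Fin 3 → ℝ) × ℝ => g q.1 q.2) := by
      refine continuous_pi fun i => ?_
      by_cases h : i = 2 <;> simp only [g, h, if_true, if_false] <;> fun_prop
    let G : C(ExtH ε r, ExtH ε r) := ⟨fun x => ⟨g x 1, by simpa using hg x x.2 1⟩, by
      apply Continuous.subtype_mk
      exact hgc.comp (continuous_subtype_val.prodMk continuous_const)⟩
    have hbm : b ∈ ExtH ε r := Or.inr (Or.inr (by rw [hb2]; linarith))
    refine ⟨⟨b, hbm⟩, ContinuousMap.Homotopic.trans (g := G) ⟨⟨⟨fun q => ⟨g q.2 q.1, hg q.2 q.2.2 q.1⟩, ?_⟩, ?_, ?_⟩⟩ ⟨⟨⟨fun q => ⟨(1 - (q.1 : ℝ)) • g q.2 1 + (q.1 : ℝ) • b, ?_⟩, ?_⟩, ?_, ?_⟩⟩⟩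
    · apply Continuous.subtype_mk
      exact hgc.comp ((continuous_subtype_val.comp continuous_snd).prodMk (continuous_subtype_val.comp continuous_fst))
    · intro x
      apply Subtype.ext
      funext i
      simp [g]
    · intro x
      apply Subtype.ext
      simp [G]
    · refine Or.inr (Or.inr ?_)
      have h1 := hg' q.2
      have h2 := q.1.2.1
      have h3 := q.1.2.2
      have : ε * ((1 - (q.1 : ℝ)) • g q.2 1 + (q.1 : ℝ) • b) 2 = (1 - (q.1 : ℝ)) * (ε * g q.2 1 2) + q.1 * (r + 1) := by
        rw [← hb2]
        simp only [Pi.add_apply, Pi.smul_apply, smul_eq_mul]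
        ring
      rw [this]
      rcases h2.eq_or_lt with h | h
      · rw [← h]; linarith
      · nlinarith
    · apply Continuous.subtype_mk
      have h1 : Continuous fun q : I × ExtH ε r => g q.2 1 :=
        hgc.comp ((continuous_subtype_val.comp continuous_snd).prodMk continuous_const)
      have h2 : Continuous fun q : I × ExtH ε r => (q.1 : ℝ) := continuous_subtype_val.comp continuous_fst
      exact ((continuous_const.sub h2).smul h1).add (h2.smul continuous_const)
    · intro x
      apply Subtype.ext
      simp [G]
    · intro x
      apply Subtype.ext
      simp
  infer_instance

lemma ext_eq {r : ℝ} : ExtH 1 r ∪ ExtH (-1) r = Ext r := by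
  ext x
  simp only [ExtH, Ext, mem_union, mem_ofPred_eq, one_mul, neg_one_mul, lt_abs (b := x 2)]
  tauto

lemma ext_inter {r : ℝ} (hr : 0 ≤ r) : IsPreconnected (ExtH 1 r ∩ ExtH (-1) r) := by
  have hc : ∀ (i : Fin 3) (ε : ℝ), IsPreconnected {x : Fin 3 → ℝ | r < ε * x i} := by
    intro i ε
    apply Convex.isPreconnected
    apply convex_halfSpace_gt
    constructor
    · intro x y; simp [mul_add]
    · intro c x; simp; ring
  have heq : ExtH 1 r ∩ ExtH (-1) r = (({x : Fin 3 → ℝ | r < 1 * x 0} ∪ {x | r < 1 * x 1}) ∪ {x | r < (-1) * x 0}) ∪ {x | r < (-1) * x 1} := by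
    ext x
    simp only [ExtH, mem_inter_iff, mem_union, mem_ofPred_eq, one_mul, neg_one_mul, lt_abs]
    constructor
    · rintro ⟨h1, h2⟩
      by_contra hcon
      push Not at hcon
      rcases h1 with h | h | h <;> rcases h2 with h' | h' | h' <;> grind
    · grind
  rw [heq]
  have m1 : (fun i : Fin 3 => if i = 0 then r + 1 else if i = 1 then r + 1 else 0 : Fin 3 → ℝ) ∈ {x : Fin 3 → ℝ | r < 1 * x 0} ∩ {x | r < 1 * x 1} := by
    constructor <;> simp [mem_ofPred_eq]
  have m2 : (fun i : Fin 3 => if i = 0 then -(r + 1) else if i = 1 then r + 1 else 0 : Fin 3 → ℝ) ∈ {x : Fin 3 → ℝ | r < (-1) * x 0} ∩ {x | r < 1 * x 1} := by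
    constructor <;> simp [mem_ofPred_eq]
  have m3 : (fun i : Fin 3 => if i = 0 then -(r + 1) else if i = 1 then -(r + 1) else 0 : Fin 3 → ℝ) ∈ {x : Fin 3 → ℝ | r < (-1) * x 0} ∩ {x | r < (-1) * x 1} := by
    constructor <;> simp [mem_ofPred_eq] <;> linarith
  have u1 := IsPreconnected.union _ m1.1 m1.2 (hc 0 1) (hc 1 1)
  have u2 := IsPreconnected.union _ (mem_union_right _ m2.2) m2.1 u1 (hc 0 (-1))
  exact IsPreconnected.union _ (mem_union_right _ m3.1) m3.2 u2 (hc 1 (-1))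

lemma DCov.lift_ext {X : Type} [TopologicalSpace X] {Z : Set X} (C : DCov X Z) {r : ℝ} (hr : 0 ≤ r)
    {f : (Fin 3 → ℝ) → X} (hf : ContinuousOn f (Ext r)) :
    ∃ F : (Fin 3 → ℝ) → C.D, ContinuousOn F (Ext r) ∧ ∀ x ∈ Ext r, C.p (F x) = f x := by
  classical
  have := extH_simply (ε := 1) (by norm_num) r
  have := extH_simply (ε := -1) (by norm_num) r
  let a : Fin 3 → ℝ := fun _ => r + 1
  have ha' : r < |a 0| := by simp only [a]; rw [lt_abs]; left; linarith
  have ha1 : a ∈ ExtH 1 r := Or.inl ha'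
  have ha2 : a ∈ ExtH (-1) r := Or.inl ha'
  obtain ⟨e, he⟩ := C.surj (f a)
  have hs1 : ExtH 1 r ⊆ Ext r := by rw [← ext_eq]; exact subset_union_left
  have hs2 : ExtH (-1) r ⊆ Ext r := by rw [← ext_eq]; exact subset_union_right
  obtain ⟨F₁, hF₁, h1a, h1⟩ := C.lift (isOpen_extH 1 r) (hf.mono hs1) ha1 he
  obtain ⟨F₂, hF₂, h2a, h2⟩ := C.lift (isOpen_extH (-1) r) (hf.mono hs2) ha2 he
  have hagree : EqOn F₁ F₂ (ExtH 1 r ∩ ExtH (-1) r) :=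
    C.cov.eqOn_of_comp_eqOn (ext_inter hr) (hF₁.mono inter_subset_left) (hF₂.mono inter_subset_right)
      (fun x hx => by simp [h1 x hx.1, h2 x hx.2]) ⟨ha1, ha2⟩ (h1a.trans h2a.symm)
  refine ⟨fun x => if x ∈ ExtH 1 r then F₁ x else F₂ x, ?_, ?_⟩
  · rw [← ext_eq]
    apply ContinuousOn.union_of_isOpen _ _ (isOpen_extH _ _) (isOpen_extH _ _)
    · exact hF₁.congr fun x hx => by simp [hx]
    · refine hF₂.congr fun x hx => ?_
      by_cases h : x ∈ ExtH 1 r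
      · simp [h, hagree ⟨h, hx⟩]
      · simp [h]
  · intro x hx
    by_cases h : x ∈ ExtH 1 r
    · simp [h, h1 x h]
    · have : x ∈ ExtH (-1) r := by
        rw [← ext_eq] at hx; exact hx.resolve_left h
      simp [h, h2 x this]

/-- retracts of the exterior satisfy the separation property -/
theorem sepProp_of_retract {S : Type} [TopologicalSpace S] [T2Space S] (hS : IsSurf S) {r : ℝ} (hr : 0 ≤ r)
    {i : S → (Fin 3 → ℝ)} (hi : Continuous i) (hiE : ∀ x, i x ∈ Ext r) {ρ : (Fin 3 → ℝ) → S}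
    (hρ : ContinuousOn ρ (Ext r)) (hρi : ∀ x, ρ (i x) = x) : SepProp S := by
  intro J hJ hpre
  obtain ⟨C⟩ := exists_dcov hJ.isCompact.isClosed (fun z hz => hS.twoSided_scc hJ hz)
  obtain ⟨F, hF, hpF⟩ := C.lift_ext hr hρ
  have hc : Continuous (F ∘ i) := hF.comp_continuous hi hiE
  have hp : ∀ x, C.p ((F ∘ i) x) = x := fun x => by simp [hpF _ (hiE x), hρi]
  obtain ⟨a, ha⟩ := hJ.nonempty
  obtain ⟨y, hy, y', hy', h, h'⟩ := C.switch a ha univ Filter.univ_mem (F ∘ i) hc.continuousOn (fun x _ => hp x)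
  have hl : ContinuousOn (C.lab ∘ (F ∘ i)) Jᶜ :=
    C.lab_cont.comp hc.continuousOn (fun x hx => by
      show ¬ (C.p _ ∈ J)
      rw [hp]; exact hx)
  have := hpre.constant hl hy.2 hy'.2
  simp only [Function.comp_apply] at this h h'
  rw [h, h'] at this
  exact absurd this (by decide)

section collar
variable {X : Type} [TopologicalSpace X]

/-- `X` with the variable collar `{(x,t) : x ∈ S, t ≤ f x}` attached -/
def XC (S : Set X) (f : X → ℝ) : Set (X × ℝ) := {z | z.2 = 0 ∨ (z.1 ∈ S ∧ 0 ≤ z.2 ∧ z.2 ≤ f z.1)}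

/-- local collar at a point of `S` -/
def LocCol (S : Set X) (a : X) : Prop :=
  ∃ (W : Set X) (c : X × ℝ → X), IsOpen W ∧ a ∈ W ∧ ContinuousOn c ((S ∩ W) ×ˢ Icc 0 1) ∧
    InjOn c ((S ∩ W) ×ˢ Icc 0 1) ∧ (∀ y ∈ S ∩ W, c (y, 0) = y) ∧
    (∀ y ∈ S ∩ W, ∀ t ∈ Ioc (0 : ℝ) 1, c (y, t) ∉ S) ∧
    ∀ O, IsOpen O → O ⊆ W → IsOpen (c '' ((S ∩ O) ×ˢ Ico 0 1))

lemma isClosed_XC {S : Set X} (hS : IsClosed S) {f : X → ℝ} (hf : Continuous f) : IsClosed (XC S f) := by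
  have h1 : IsClosed {z : X × ℝ | z.2 = 0} := isClosed_eq continuous_snd continuous_const
  have h2 : IsClosed {z : X × ℝ | z.1 ∈ S} := hS.preimage continuous_fst
  have h3 : IsClosed {z : X × ℝ | 0 ≤ z.2} := isClosed_le continuous_const continuous_snd
  have h4 : IsClosed {z : X × ℝ | z.2 ≤ f z.1} := isClosed_le continuous_snd (hf.comp continuous_fst)
  exact h1.union (h2.inter (h3.inter h4))

lemma stretch_ident {u a b : ℝ} (ha : 0 ≤ a) (hb : 0 ≤ b) :
    -1 + ((-1 + (u + 1) * (b + 1) / (a + 1)) + 1) * (a + 1) / (b + 1) = u := by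
  have : a + 1 ≠ 0 := by positivity
  have : b + 1 ≠ 0 := by positivity
  field_simp
  ring

lemma collar_step [CompactSpace X] [T2Space X] {S : Set X} (hS : IsClosed S) {a : X}
    (ha : LocCol S a) : ∃ l : X → ℝ, Continuous l ∧ (∀ x, 0 ≤ l x) ∧ 0 < l a ∧
      ∀ f f' : X → ℝ, Continuous f → Continuous f' → (∀ x, 0 ≤ f x) → (∀ x, 0 ≤ f' x) →
        (∀ x, l x = 0 → f x = f' x) →
        ∃ Ψ : X × ℝ → X × ℝ, ContinuousOn Ψ (XC S f) ∧ BijOn Ψ (XC S f) (XC S f') ∧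
          ∀ x ∈ S, Ψ (x, f x) = (x, f' x) := by
  classical
  obtain ⟨W, c, hW, haW, hc, hi, hc0, hcS, hop⟩ := ha
  obtain ⟨W', hW'n, hW'c, hW'W⟩ := exists_mem_nhds_isClosed_subset (hW.mem_nhds haW)
  obtain ⟨l, hl0, hl1, hl⟩ := exists_continuous_zero_one_of_isClosed (s := (interior W')ᶜ) (t := {a})
    isOpen_interior.isClosed_compl isClosed_singleton
    (by rw [disjoint_singleton_right]; simpa using mem_interior_iff_mem_nhds.2 hW'n)
  have hlW : ∀ x, l x ≠ 0 → x ∈ W' := fun x hx => by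
    by_contra h
    exact hx (hl0 (fun h' => h (interior_subset h')))
  refine ⟨l, l.continuous, fun x => (hl x).1, by have := hl1 rfl; simp at this; linarith, ?_⟩
  set K : Set X := S ∩ W' with hK
  have hKW : K ⊆ S ∩ W := inter_subset_inter_right _ hW'W
  have hKc : IsCompact K := (hS.inter hW'c).isCompact
  have hKK : IsCompact (K ×ˢ Icc (0 : ℝ) 1) := hKc.prod isCompact_Icc
  have hsub : K ×ˢ Icc (0 : ℝ) 1 ⊆ (S ∩ W) ×ˢ Icc 0 1 := prod_mono hKW Subset.rfl
  have : Nonempty (X × ℝ) := ⟨(a, 0)⟩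
  obtain ⟨κ, hκc, hκ⟩ := exists_inverse_compact hKK (hc.mono hsub) (hi.mono hsub)
  set Cc : Set X := c '' (K ×ˢ Icc (0 : ℝ) 1) with hCc
  have hCcc : IsCompact Cc := hKK.image_of_continuousOn (hc.mono hsub)
  -- the stretch
  let E : X → ℝ → X × ℝ := fun y u => (c (y, max (-u) 0), max u 0)
  let st : (X → ℝ) → (X → ℝ) → X → ℝ → ℝ := fun f f' y u => -1 + (u + 1) * (f' y + 1) / (f y + 1)
  let Ψ : (X → ℝ) → (X → ℝ) → X × ℝ → X × ℝ := fun f f' z =>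
    if z.1 ∈ Cc then E (κ z.1).1 (st f f' (κ z.1).1 (z.2 - (κ z.1).2)) else z
  -- coordinates
  have hKmem : ∀ x ∈ K, x ∈ Cc := fun x hx => ⟨(x, 0), ⟨hx, by simp⟩, hc0 x (hKW hx)⟩
  have hκS : ∀ x ∈ S, x ∈ Cc → κ x = (x, 0) := by
    rintro x hx ⟨⟨y, t⟩, ⟨hy, ht⟩, rfl⟩
    rw [hκ _ ⟨hy, ht⟩]
    have ht0 : t = 0 := by
      by_contra h
      exact hcS y (hKW hy) t ⟨lt_of_le_of_ne ht.1 (Ne.symm h), ht.2⟩ hx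
    subst ht0
    rw [hc0 y (hKW hy)]
  have coord : ∀ f : X → ℝ, (∀ x, 0 ≤ f x) → ∀ z ∈ XC S f, z.1 ∈ Cc → (κ z.1).1 ∈ K ∧ -1 ≤ z.2 - (κ z.1).2 ∧
      z.2 - (κ z.1).2 ≤ f (κ z.1).1 ∧ E (κ z.1).1 (z.2 - (κ z.1).2) = z := by
    rintro f hf ⟨x, t⟩ hz hx
    rcases hz with hz | ⟨hxS, h0, h1⟩
    · simp only at hz hx ⊢
      subst hz
      obtain ⟨⟨y, t⟩, ⟨hy, ht⟩, rfl⟩ := hx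
      rw [hκ _ ⟨hy, ht⟩]
      simp only at ht hy ⊢
      refine ⟨hy, by linarith [ht.2], by linarith [hf y, ht.1], ?_⟩
      simp only [E]
      rw [max_eq_left (by linarith [ht.1]), max_eq_right (by linarith [ht.1])]
      simp
    · simp only at hx hxS h0 h1 ⊢
      rw [hκS x hxS hx]
      have hxK : x ∈ K := by
        obtain ⟨⟨y, t⟩, ⟨hy, ht⟩, rfl⟩ := hx
        have := hκS _ hxS ⟨⟨y, t⟩, ⟨hy, ht⟩, rfl⟩
        rw [hκ _ ⟨hy, ht⟩] at this
        have h := congrArg Prod.fst this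
        simp only at h
        rw [← h]; exact hy
      refine ⟨hxK, by simp; linarith, by simpa using h1, ?_⟩
      simp only [E, sub_zero]
      rw [max_eq_right (by linarith), max_eq_left h0, hc0 x (hKW hxK)]
  have Ecoord : ∀ f : X → ℝ, ∀ y ∈ K, ∀ u, -1 ≤ u → u ≤ f y → E y u ∈ XC S f ∧ (E y u).1 ∈ Cc ∧
      (κ (E y u).1).1 = y ∧ (E y u).2 - (κ (E y u).1).2 = u := by
    intro f y hy u hu hu'
    have hm : max (-u) 0 ∈ Icc (0 : ℝ) 1 := ⟨le_max_right _ _, max_le (by linarith) (by norm_num)⟩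
    refine ⟨?_, ⟨_, ⟨hy, hm⟩, rfl⟩, ?_, ?_⟩
    · rcases le_total u 0 with h | h
      · left; exact max_eq_right h
      · right
        simp only [E]
        rw [max_eq_right (by linarith), max_eq_left h, hc0 y (hKW hy)]
        exact ⟨hy.1, h, hu'⟩
    · simp only [E]; rw [hκ _ ⟨hy, hm⟩]
    · simp only [E]; rw [hκ _ ⟨hy, hm⟩]
      simp only
      rcases le_total u 0 with h | h
      · rw [max_eq_right h, max_eq_left (by linarith)]; ring
      · rw [max_eq_left h, max_eq_right (by linarith)]; ring
  have stb : ∀ f f' : X → ℝ, (∀ x, 0 ≤ f x) → (∀ x, 0 ≤ f' x) → ∀ y u, -1 ≤ u → u ≤ f y →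
      -1 ≤ st f f' y u ∧ st f f' y u ≤ f' y := by
    intro f f' hf hf' y u hu hu'
    have h1 := hf y
    have h2 := hf' y
    simp only [st]
    constructor
    · have : 0 ≤ (u + 1) * (f' y + 1) / (f y + 1) := by
        apply div_nonneg (mul_nonneg (by linarith) (by linarith)) (by linarith)
      linarith
    · have : (u + 1) * (f' y + 1) / (f y + 1) ≤ f' y + 1 := by
        rw [div_le_iff₀ (by linarith)]
        nlinarith
      linarith
  have maps : ∀ f f' : X → ℝ, (∀ x, 0 ≤ f x) → (∀ x, 0 ≤ f' x) → (∀ x, l x = 0 → f x = f' x) →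
      MapsTo (Ψ f f') (XC S f) (XC S f') ∧ LeftInvOn (Ψ f' f) (Ψ f f') (XC S f) := by
    intro f f' hf hf' hff
    constructor
    · intro z hz
      by_cases hx : z.1 ∈ Cc
      · simp only [Ψ, hx, if_true]
        obtain ⟨h1, h2, h3, -⟩ := coord f hf z hz hx
        have := stb f f' hf hf' _ _ h2 h3
        exact (Ecoord f' _ h1 _ this.1 this.2).1
      · simp only [Ψ, hx, if_false]
        rcases hz with h | h
        · exact Or.inl h
        · right
          rwa [← hff z.1 (by
            by_contra h'
            exact hx (hKmem _ ⟨h.1, hlW _ h'⟩))]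
    · intro z hz
      by_cases hx : z.1 ∈ Cc
      · obtain ⟨h1, h2, h3, h4⟩ := coord f hf z hz hx
        have hb := stb f f' hf hf' _ _ h2 h3
        obtain ⟨g1, g2, g3, g4⟩ := Ecoord f' _ h1 _ hb.1 hb.2
        have e1 : Ψ f f' z = E (κ z.1).1 (st f f' (κ z.1).1 (z.2 - (κ z.1).2)) := by
          simp only [Ψ, hx, if_true]
        rw [e1]
        generalize hw : E (κ z.1).1 (st f f' (κ z.1).1 (z.2 - (κ z.1).2)) = w at *
        simp only [Ψ, g2, if_true, g3, g4]
        rw [show st f' f (κ z.1).1 (st f f' (κ z.1).1 (z.2 - (κ z.1).2)) = z.2 - (κ z.1).2 from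
          stretch_ident (hf _) (hf' _)]
        exact h4
      · simp only [Ψ, hx, if_false]
  intro f f' hfc hfc' hf hf' hff
  refine ⟨Ψ f f', ?_, ?_, ?_⟩
  · set B : Set (X × ℝ) := XC S f ∩ {z | z.1 ∉ c '' ((S ∩ {x | 0 < l x}) ×ˢ Ico 0 1)} with hB
    set A : Set (X × ℝ) := XC S f ∩ {z | z.1 ∈ Cc} with hA
    have hBc : IsClosed B := by
      refine (isClosed_XC hS hfc).inter ?_
      have : IsOpen (c '' ((S ∩ {x | 0 < l x}) ×ˢ Ico 0 1)) :=
        hop _ (isOpen_lt continuous_const l.continuous) (fun x hx => hW'W (hlW x (ne_of_gt hx)))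
      exact this.isClosed_compl.preimage continuous_fst
    have hAc : IsClosed A := (isClosed_XC hS hfc).inter (hCcc.isClosed.preimage continuous_fst)
    have hAB : XC S f = A ∪ B := by
      apply Subset.antisymm
      · intro z hz
        by_cases hx : z.1 ∈ Cc
        · exact Or.inl ⟨hz, hx⟩
        · refine Or.inr ⟨hz, fun h => hx ?_⟩
          obtain ⟨⟨y, t⟩, ⟨hy, ht⟩, h⟩ := h
          exact ⟨(y, t), ⟨⟨hy.1, hlW y (ne_of_gt hy.2)⟩, ⟨ht.1, ht.2.le⟩⟩, h⟩
      · exact union_subset inter_subset_left inter_subset_left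
    rw [hAB]
    refine ContinuousOn.union_of_isClosed ?_ ?_ hAc hBc
    · have c1 : ContinuousOn (fun z : X × ℝ => κ z.1) A := hκc.comp continuousOn_fst (fun z hz => hz.2)
      have c2 : ContinuousOn (fun z : X × ℝ => st f f' (κ z.1).1 (z.2 - (κ z.1).2)) A := by
        have cy : ContinuousOn (fun z : X × ℝ => (κ z.1).1) A := continuous_fst.comp_continuousOn c1
        have ct : ContinuousOn (fun z : X × ℝ => (κ z.1).2) A := continuous_snd.comp_continuousOn c1
        refine continuousOn_const.add (ContinuousOn.div ?_ ((hfc.comp_continuousOn cy).add continuousOn_const) ?_)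
        · exact ((continuousOn_snd.sub ct).add continuousOn_const).mul ((hfc'.comp_continuousOn cy).add continuousOn_const)
        · intro z hz
          have := hf (κ z.1).1
          positivity
      have c3 : ContinuousOn (fun z : X × ℝ => E (κ z.1).1 (st f f' (κ z.1).1 (z.2 - (κ z.1).2))) A := by
        refine ContinuousOn.prodMk ?_ (c2.sup continuousOn_const)
        refine hc.comp ((continuous_fst.comp_continuousOn c1).prodMk (c2.neg.sup continuousOn_const)) ?_
        intro z hz
        obtain ⟨h1, h2, h3, h4⟩ := coord f hf z hz.1 hz.2
        have hb := stb f f' hf hf' _ _ h2 h3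
        exact ⟨hKW h1, le_max_right _ _, max_le (by linarith) (by norm_num)⟩
      exact c3.congr fun z hz => by
        have : z.1 ∈ Cc := hz.2
        simp only [Ψ, this, if_true]
    · refine continuousOn_id.congr fun z hz => ?_
      by_cases hx : z.1 ∈ Cc
      · simp only [Ψ, hx, if_true, id]
        obtain ⟨h1, h2, h3, h4⟩ := coord f hf z hz.1 hx
        have : st f f' (κ z.1).1 (z.2 - (κ z.1).2) = z.2 - (κ z.1).2 := by
          by_cases h : l (κ z.1).1 = 0
          · simp only [st]
            rw [hff _ h, mul_div_assoc, div_self (by have := hf' (κ z.1).1; positivity)]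
            ring
          · have hu : z.2 - (κ z.1).2 = -1 := by
              obtain ⟨⟨y, t⟩, ⟨hy, ht⟩, hyt⟩ := hx
              have hk := hκ _ ⟨hy, ht⟩
              rw [hyt] at hk
              have ht1 : t = 1 := by
                by_contra h'
                refine hz.2 ⟨(y, t), ⟨⟨hy.1, ?_⟩, ht.1, lt_of_le_of_ne ht.2 h'⟩, hyt⟩
                rw [hk] at h
                exact lt_of_le_of_ne (hl _).1 (Ne.symm h)
              subst ht1
              rw [hk]
              rcases hz.1 with h0 | h0
              · rw [h0]; norm_num
              · have := hκS _ h0.1 ⟨_, ⟨hy, ht⟩, hyt⟩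
                rw [hk] at this
                have := congrArg Prod.snd this
                simp at this
            rw [hu]
            simp [st]
        rw [this, h4]
      · simp only [Ψ, hx, if_false, id]
  · obtain ⟨m1, l1⟩ := maps f f' hf hf' hff
    obtain ⟨m2, l2⟩ := maps f' f hf' hf (fun x hx => (hff x hx).symm)
    exact ⟨m1, l1.injOn, fun z hz => ⟨_, m2 hz, l2 hz⟩⟩
  · intro x hx
    by_cases hxC : x ∈ Cc
    · simp only [Ψ, hxC, if_true, hκS x hx hxC]
      have : st f f' x (f x - 0) = f' x := by
        simp only [st, sub_zero]
        have := hf x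
        field_simp
        ring
      rw [this]
      simp only [E]
      have hxK : x ∈ K := by
        have := (coord f hf (x, f x) (Or.inr ⟨hx, hf x, le_rfl⟩) hxC).1
        rwa [hκS x hx hxC] at this
      rw [max_eq_right (by linarith [hf' x]), max_eq_left (hf' x), hc0 x (hKW hxK)]
    · simp only [Ψ, hxC, if_false]
      rw [hff x]
      by_contra h'
      exact hxC (hKmem _ ⟨hx, hlW _ h'⟩)

theorem exists_collar [CompactSpace X] [T2Space X] {S : Set X} (hS : IsClosed S)
    (hloc : ∀ a ∈ S, LocCol S a) :
    ∃ c : X × ℝ → X, ContinuousOn c (S ×ˢ Icc 0 1) ∧ InjOn c (S ×ˢ Icc 0 1) ∧ (∀ y ∈ S, c (y, 0) = y) ∧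
      IsOpen (c '' (S ×ˢ Ico 0 1)) := by
  let Good : (X → ℝ) → Prop := fun f => Continuous f ∧ (∀ x, 0 ≤ f x) ∧ ∃ Φ : X → X × ℝ, Continuous Φ ∧
    Function.Injective Φ ∧ range Φ = XC S f ∧ ∀ x ∈ S, Φ x = (x, f x)
  have h0 : Good (fun _ => 0) := by
    refine ⟨continuous_const, fun _ => le_rfl, fun x => (x, 0), by fun_prop, fun x y h => congrArg Prod.fst h, ?_, fun _ _ => rfl⟩
    ext ⟨x, t⟩
    constructor
    · rintro ⟨y, h⟩
      exact Or.inl (congrArg Prod.snd h).symm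
    · rintro (h | h)
      · exact ⟨x, by rw [show t = 0 from h]⟩
      · exact ⟨x, by rw [show t = 0 from le_antisymm h.2.2 h.2.1]⟩
  have key : ∀ f, Good f → ∃ f', Good f' ∧ (∀ x, f x ≤ f' x) ∧ ∀ x ∈ S, 0 < f' x := by
    refine hS.isCompact.induction_on (p := fun s => ∀ f, Good f → ∃ f', Good f' ∧ (∀ x, f x ≤ f' x) ∧ ∀ x ∈ s, 0 < f' x) ?_ ?_ ?_ ?_
    · exact fun f hf => ⟨f, hf, fun _ => le_rfl, by simp⟩
    · intro s t hst h f hf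
      obtain ⟨f', h1, h2, h3⟩ := h f hf
      exact ⟨f', h1, h2, fun x hx => h3 x (hst hx)⟩
    · intro s t hs ht f hf
      obtain ⟨f', h1, h2, h3⟩ := hs f hf
      obtain ⟨f'', h1', h2', h3'⟩ := ht f' h1
      exact ⟨f'', h1', fun x => (h2 x).trans (h2' x), fun x hx => hx.elim (fun h => (h3 x h).trans_le (h2' x)) (h3' x)⟩
    · intro a ha
      obtain ⟨l, hlc, hl0, hla, hl⟩ := collar_step hS (hloc a ha)
      refine ⟨{x | 0 < l x}, mem_nhdsWithin_of_mem_nhds ((isOpen_lt continuous_const hlc).mem_nhds hla), ?_⟩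
      rintro f ⟨hfc, hf0, Φ, hΦ, hΦi, hΦr, hΦS⟩
      obtain ⟨Ψ, h1, h2, h3⟩ := hl f (fun x => f x + l x) hfc (hfc.add hlc) hf0 (fun x => add_nonneg (hf0 x) (hl0 x))
        (fun x hx => by simp [hx])
      have hm : ∀ x, Φ x ∈ XC S f := fun x => hΦr ▸ mem_range_self x
      refine ⟨fun x => f x + l x, ⟨hfc.add hlc, fun x => add_nonneg (hf0 x) (hl0 x), Ψ ∘ Φ, h1.comp_continuous hΦ hm, ?_, ?_, ?_⟩,
        fun x => by linarith [hl0 x], fun x hx => add_pos_of_nonneg_of_pos (hf0 x) hx⟩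
      · intro x y hxy
        exact hΦi (h2.injOn (hm x) (hm y) hxy)
      · rw [range_comp, hΦr, h2.image_eq]
      · intro x hx
        simp [hΦS x hx, h3 x hx]
  obtain ⟨f, ⟨hfc, hf0, Φ, hΦ, hΦi, hΦr, hΦS⟩, -, hpos⟩ := key _ h0
  have hemb := hΦ.isClosedEmbedding hΦi
  by_cases hX : Nonempty X
  swap
  · exact ⟨fun z => z.1, continuousOn_fst, fun z => (hX ⟨z.1⟩).elim, fun y => (hX ⟨y⟩).elim, by
      convert isOpen_empty
      rw [image_eq_empty]
      ext z; exact (hX ⟨z.1⟩).elim⟩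
  obtain ⟨G, hG, hGe⟩ := exists_inverse_compact (T := univ) isCompact_univ hΦ.continuousOn hΦi.injOn
  rw [image_univ, hΦr] at hG
  have hGr : ∀ z ∈ XC S f, Φ (G z) = z := by
    intro z hz
    rw [← hΦr] at hz
    obtain ⟨x, rfl⟩ := hz
    rw [hGe x (mem_univ _)]
  let q : X × ℝ → X × ℝ := fun z => (z.1, (1 - z.2) * f z.1)
  have hqm : ∀ z ∈ S ×ˢ Icc (0 : ℝ) 1, q z ∈ XC S f := by
    rintro ⟨x, t⟩ ⟨hx, ht⟩
    simp only at hx ht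
    have := hf0 x
    exact Or.inr ⟨hx, mul_nonneg (by linarith [ht.2]) this, by
      show (1 - t) * f x ≤ f x
      nlinarith [ht.1]⟩
  have hqc : Continuous q := by
    have := hfc.comp (continuous_fst (X := X) (Y := ℝ))
    exact continuous_fst.prodMk ((continuous_const.sub continuous_snd).mul this)
  refine ⟨G ∘ q, hG.comp hqc.continuousOn hqm, ?_, ?_, ?_⟩
  · intro z hz w hw h
    have h' := congrArg Φ h
    simp only [Function.comp_apply] at h'
    rw [hGr _ (hqm z hz), hGr _ (hqm w hw)] at h'
    have e1 : (q z).1 = (q w).1 := congrArg Prod.fst h'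
    have e2 : (q z).2 = (q w).2 := congrArg Prod.snd h'
    change z.1 = w.1 at e1
    change (1 - z.2) * f z.1 = (1 - w.2) * f w.1 at e2
    rw [← e1] at e2
    have := mul_right_cancel₀ (ne_of_gt (hpos z.1 hz.1)) e2
    exact Prod.ext e1 (by linarith)
  · intro y hy
    have : q (y, 0) = Φ y := by simp [q, hΦS y hy]
    simp only [Function.comp_apply]
    rw [this, hGe y (mem_univ _)]
  · have : G ∘ q '' (S ×ˢ Ico 0 1) = Φ ⁻¹' {z | 0 < z.2} := by
      ext x
      constructor
      · rintro ⟨z, ⟨hz, ht⟩, rfl⟩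
        show 0 < (Φ (G (q z))).2
        rw [hGr _ (hqm z ⟨hz, ht.1, ht.2.le⟩)]
        exact mul_pos (by linarith [ht.2]) (hpos _ hz)
      · intro hx
        have hm : Φ x ∈ XC S f := hΦr ▸ mem_range_self x
        have hx' : 0 < (Φ x).2 := hx
        rcases hm with h | ⟨h1, h2, h3⟩
        · exact absurd h (ne_of_gt hx')
        · have hp := hpos _ h1
          refine ⟨((Φ x).1, 1 - (Φ x).2 / f (Φ x).1), ⟨h1, ?_, ?_⟩, ?_⟩
          · have : (Φ x).2 / f (Φ x).1 ≤ 1 := by rwa [div_le_one hp]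
            show 0 ≤ 1 - (Φ x).2 / f (Φ x).1
            linarith
          · have : 0 < (Φ x).2 / f (Φ x).1 := div_pos hx' hp
            show 1 - (Φ x).2 / f (Φ x).1 < 1
            linarith
          · have : q ((Φ x).1, 1 - (Φ x).2 / f (Φ x).1) = Φ x := by
              refine Prod.ext rfl ?_
              show (1 - (1 - (Φ x).2 / f (Φ x).1)) * f (Φ x).1 = (Φ x).2
              field_simp
              ring
            simp only [Function.comp_apply]
            rw [this, hGe x (mem_univ _)]
    rw [this]
    exact (isOpen_lt continuous_const continuous_snd).preimage hΦ
end collar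

/-- a piecewise linear reparametrisation and its inverse -/
lemma exists_reparam {r δ : ℝ} (hr : 0 ≤ r) (hr1 : r < 1) (hδ : 0 < δ) (hδ1 : δ < 1) :
    ∃ a b : ℝ → ℝ, Continuous a ∧ Continuous b ∧ (∀ s, b (a s) = s) ∧ (∀ s, a (b s) = s) ∧
      Monotone a ∧ Monotone b ∧ a 0 = 0 ∧ b 0 = 0 ∧ (∀ s, 1 ≤ s → a s = s) ∧ (∀ s, 1 ≤ s → b s = s) ∧
      (∀ s, 0 ≤ s → s ≤ r → a s ≤ δ) := by
  set M := 1 / (1 - r) with hM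
  have h1r : 0 < 1 - r := by linarith
  have hM1 : 1 ≤ M := by rw [hM, le_div_iff₀ h1r]; linarith
  have hM0 : 0 < M := by linarith
  have hMr : M * (1 - r) = 1 := by rw [hM]; field_simp
  let a : ℝ → ℝ := fun s => min s (max (δ * s) (1 - M * (1 - s)))
  let b : ℝ → ℝ := fun u => max u (min (u / δ) (1 - (1 - u) / M))
  have g1 : ∀ u s, b u ≤ s ↔ u ≤ a s := by
    intro u s
    simp only [a, b, max_le_iff, min_le_iff, le_min_iff, le_max_iff]
    have e1 : u / δ ≤ s ↔ u ≤ δ * s := by rw [div_le_iff₀ hδ, mul_comm]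
    have e2 : 1 - (1 - u) / M ≤ s ↔ u ≤ 1 - M * (1 - s) := by
      rw [sub_le_comm, le_div_iff₀ hM0]
      constructor <;> intro h <;> nlinarith
    rw [e1, e2]
  have g2 : ∀ u s, s ≤ b u ↔ a s ≤ u := by
    intro u s
    simp only [a, b, max_le_iff, min_le_iff, le_min_iff, le_max_iff]
    have e1 : s ≤ u / δ ↔ δ * s ≤ u := by rw [le_div_iff₀ hδ, mul_comm]
    have e2 : s ≤ 1 - (1 - u) / M ↔ 1 - M * (1 - s) ≤ u := by
      rw [le_sub_comm, div_le_iff₀ hM0]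
      constructor <;> intro h <;> nlinarith
    rw [e1, e2]
  have ba : ∀ s, b (a s) = s := fun s => le_antisymm ((g1 _ _).2 le_rfl) ((g2 _ _).2 le_rfl)
  have ab : ∀ s, a (b s) = s := fun s => le_antisymm ((g2 _ _).1 le_rfl) ((g1 _ _).1 le_rfl)
  have a0 : a 0 = 0 := by
    simp only [a, mul_zero, sub_zero, mul_one]
    rw [max_eq_left (by linarith), min_self]
  have a1 : ∀ s, 1 ≤ s → a s = s := by
    intro s hs
    exact min_eq_left (le_max_of_le_right (by nlinarith))
  refine ⟨a, b, by fun_prop, by fun_prop, ba, ab, ?_, ?_, a0, ?_, a1, ?_, ?_⟩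
  · intro s t hst
    rw [← g2, ba]; exact hst
  · intro s t hst
    rw [g1, ab]; exact hst
  · rw [← a0, ba, a0]
  · intro s hs
    conv_lhs => rw [← a1 s hs]
    exact ba s
  · intro s h0 hs
    refine (min_le_right _ _).trans (max_le (by nlinarith) ?_)
    have : M * (1 - r) ≤ M * (1 - s) := by nlinarith
    linarith

lemma exists_radial (V : Type*) [NormedAddCommGroup V] [NormedSpace ℝ V] {r δ : ℝ} (hr : 0 ≤ r) (hr1 : r < 1)
    (hδ : 0 < δ) (hδ1 : δ < 1) :
    ∃ k : V ≃ₜ V, (∀ z, 1 ≤ ‖z‖ → k z = z) ∧ ∀ z, ‖z‖ ≤ r → ‖k z‖ ≤ δ := by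
  obtain ⟨a, b, ha, hb, hba, hab, hma, hmb, ha0, hb0, ha1, hb1, har⟩ := exists_reparam hr hr1 hδ hδ1
  let R : (ℝ → ℝ) → V → V := fun a z => (a ‖z‖ / ‖z‖) • z
  have Rn : ∀ a : ℝ → ℝ, a 0 = 0 → Monotone a → ∀ z, ‖R a z‖ = a ‖z‖ := by
    intro a h0 hm z
    have hnn : 0 ≤ a ‖z‖ := by rw [← h0]; exact hm (norm_nonneg z)
    simp only [R]
    rw [norm_smul, Real.norm_of_nonneg (by positivity)]
    by_cases hz : ‖z‖ = 0
    · simp [hz, h0]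
    · field_simp
  have Rc : ∀ a : ℝ → ℝ, a 0 = 0 → Monotone a → Continuous a → Continuous (R a) := by
    intro a h0 hm hc
    rw [continuous_iff_continuousAt]
    intro z
    by_cases hz : z = 0
    · subst hz
      have : R a 0 = 0 := by simp [R]
      rw [ContinuousAt, this, tendsto_zero_iff_norm_tendsto_zero]
      simp only [Rn a h0 hm]
      have : Continuous fun z : V => a ‖z‖ := hc.comp continuous_norm
      have h := this.tendsto 0
      simpa [h0] using h
    · have : ContinuousAt (fun z : V => a ‖z‖ / ‖z‖) z :=
        (hc.comp continuous_norm).continuousAt.div continuous_norm.continuousAt (norm_ne_zero_iff.2 hz)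
      exact this.smul continuousAt_id
  have Rinv : ∀ a b : ℝ → ℝ, a 0 = 0 → Monotone a → b 0 = 0 → (∀ s, b (a s) = s) → ∀ z, R b (R a z) = z := by
    intro a b h0 hm hb0 hba z
    by_cases hz : z = 0
    · subst hz; simp [R]
    · show (b ‖R a z‖ / ‖R a z‖) • (a ‖z‖ / ‖z‖) • z = z
      rw [Rn a h0 hm, hba, smul_smul]
      have hz' : ‖z‖ ≠ 0 := norm_ne_zero_iff.2 hz
      have : a ‖z‖ ≠ 0 := by
        intro h
        have := hba ‖z‖
        rw [h, hb0] at this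
        exact hz' this.symm
      have : ‖z‖ / a ‖z‖ * (a ‖z‖ / ‖z‖) = 1 := by field_simp
      rw [this, one_smul]
  refine ⟨⟨⟨R a, R b, Rinv a b ha0 hma hb0 hba, Rinv b a hb0 hmb ha0 hab⟩, Rc a ha0 hma ha, Rc b hb0 hmb hb⟩, ?_, ?_⟩
  · intro z hz
    show (a ‖z‖ / ‖z‖) • z = z
    rw [ha1 _ hz, div_self (by linarith), one_smul]
  · intro z hz
    show ‖R a z‖ ≤ δ
    rw [Rn a ha0 hma]
    exact har _ (norm_nonneg z) hz

section shrink
variable {X : Type} [MetricSpace X] [CompactSpace X] {V : Type} [NormedAddCommGroup V] [NormedSpace ℝ V]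
  [ProperSpace V]

lemma shrink_step {C : Set X} (hne : C.Nonempty)
    (hcell : ∀ O, IsOpen O → C ⊆ O → ∃ η : V → X, IsOpenEmbedding η ∧ C ⊆ η '' ball 0 1 ∧
      η '' closedBall 0 1 ⊆ O) (G : X ≃ₜ X) {η : V → X} (hη : IsOpenEmbedding η)
      (hCη : C ⊆ η '' ball 0 1) {ε : ℝ} (hε : 0 < ε) :
    ∃ (G' : X ≃ₜ X) (η' : V → X), IsOpenEmbedding η' ∧ C ⊆ η' '' ball 0 1 ∧
      η' '' closedBall 0 1 ⊆ η '' ball 0 1 ∧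
      η' '' closedBall 0 1 ⊆ Metric.thickening ε C ∧
      (∀ x, x ∉ η '' ball 0 1 → G' x = G x) ∧
      ∀ x ∈ η' '' closedBall 0 1, ∀ y ∈ η' '' closedBall 0 1, dist (G' x) (G' y) ≤ ε := by
  obtain ⟨η', hη', hC', hsub⟩ := hcell (η '' ball 0 1 ∩ Metric.thickening ε C)
    ((hη.isOpenMap _ isOpen_ball).inter Metric.isOpen_thickening)
    (subset_inter hCη (Metric.self_subset_thickening hε C))
  set Q := η' '' closedBall 0 1
  have hQ : IsCompact Q := (isCompact_closedBall 0 1).image hη'.continuous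
  set A := η ⁻¹' Q
  have hAb : A ⊆ ball 0 1 := by
    intro v hv
    obtain ⟨w, hw, h⟩ := (hsub hv).1
    rwa [← hη.injective h]
  have hA : IsCompact A := (isCompact_closedBall (0 : V) 1).of_isClosed_subset
    (hQ.isClosed.preimage hη.continuous) (hAb.trans ball_subset_closedBall)
  have hAne : A.Nonempty := by
    obtain ⟨x, hx⟩ := hne
    obtain ⟨v, hv, rfl⟩ := hC' hx
    obtain ⟨w, hw, h⟩ := (hsub ⟨v, ball_subset_closedBall hv, rfl⟩).1
    exact ⟨w, v, ball_subset_closedBall hv, h.symm⟩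
  obtain ⟨v₀, hv₀, hmax⟩ := hA.exists_isMaxOn hAne continuous_norm.continuousOn
  have hr1 : ‖v₀‖ < 1 := by simpa using hAb hv₀
  have hcont : ContinuousAt (G ∘ η) 0 := (G.continuous.comp hη.continuous).continuousAt
  obtain ⟨δ, hδ, hδb⟩ := Metric.continuousAt_iff.1 hcont (ε / 2) (by linarith)
  obtain ⟨k, hk1, hkr⟩ := exists_radial V (norm_nonneg v₀) hr1 (δ := min (δ / 2) (1 / 2))
    (by positivity) (lt_of_le_of_lt (min_le_right _ _) (by norm_num))
  obtain ⟨H, hH, hHid⟩ := exists_ext_homeo hη k hk1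
  have hQball : ∀ x ∈ Q, dist (G (H x)) (G (η 0)) < ε / 2 := by
    intro x hx
    obtain ⟨v, hv, rfl⟩ := (hsub hx).1
    rw [hH]
    apply hδb
    rw [dist_zero_right]
    have := hkr v (hmax (a := v) hx)
    exact lt_of_le_of_lt (this.trans (min_le_left _ _)) (by linarith)
  refine ⟨H.trans G, η', hη', hC', hsub.trans inter_subset_left, hsub.trans inter_subset_right, ?_, ?_⟩
  · intro x hx
    simp [hHid x hx]
  · intro x hx y hy
    have h1 := hQball x hx
    have h2 := hQball y hy
    have := dist_triangle_right (G (H x)) (G (H y)) (G (η 0))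
    simp only [Homeomorph.trans_apply]
    linarith

theorem exists_shrink {C : Set X} (hC : IsCompact C) (hne : C.Nonempty)
    (hcell : ∀ O, IsOpen O → C ⊆ O → ∃ η : V → X, IsOpenEmbedding η ∧ C ⊆ η '' ball 0 1 ∧
      η '' closedBall 0 1 ⊆ O) {O : Set X} (hO : IsOpen O) (hCO : C ⊆ O) :
    ∃ g : X → X, Continuous g ∧ Function.Surjective g ∧
      (∀ x y, g x = g y ↔ x = y ∨ (x ∈ C ∧ y ∈ C)) ∧ ∀ x ∉ O, g x = x := by
  classical
  let St := {s : (X ≃ₜ X) × (V → X) // IsOpenEmbedding s.2 ∧ C ⊆ s.2 '' ball 0 1}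
  have hstep : ∀ (n : ℕ) (s : St), ∃ s' : St,
      s'.1.2 '' closedBall 0 1 ⊆ s.1.2 '' ball 0 1 ∧
      s'.1.2 '' closedBall 0 1 ⊆ Metric.thickening (1 / ((n : ℝ) + 1)) C ∧
      (∀ x, x ∉ s.1.2 '' ball 0 1 → s'.1.1 x = s.1.1 x) ∧
      ∀ x ∈ s'.1.2 '' closedBall 0 1, ∀ y ∈ s'.1.2 '' closedBall 0 1,
        dist (s'.1.1 x) (s'.1.1 y) ≤ 1 / ((n : ℝ) + 1) := by
    rintro n ⟨⟨G, η⟩, h1, h2⟩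
    obtain ⟨G', η', a1, a2, a3, a4, a5, a6⟩ := shrink_step hne hcell G h1 h2 (ε := 1 / ((n : ℝ) + 1)) (by positivity)
    exact ⟨⟨⟨G', η'⟩, a1, a2⟩, a3, a4, a5, a6⟩
  choose nxt n1 n2 n3 n4 using hstep
  obtain ⟨η₀, hη₀, hCη₀, hη₀O⟩ := hcell O hO hCO
  let s : ℕ → St := fun n => Nat.rec ⟨⟨Homeomorph.refl X, η₀⟩, hη₀, hCη₀⟩ (fun n s => nxt n s) n
  have hs : ∀ n, s (n + 1) = nxt n (s n) := fun n => rfl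
  let G : ℕ → X ≃ₜ X := fun n => (s n).1.1
  let Dd : ℕ → Set X := fun n => (s n).1.2 '' closedBall 0 1
  let Bb : ℕ → Set X := fun n => (s n).1.2 '' ball 0 1
  have hBo : ∀ n, IsOpen (Bb n) := fun n => (s n).2.1.isOpenMap _ isOpen_ball
  have hBD : ∀ n, Bb n ⊆ Dd n := fun n => image_mono ball_subset_closedBall
  have hDc : ∀ n, IsClosed (Dd n) := fun n => ((isCompact_closedBall 0 1).image (s n).2.1.continuous).isClosed
  have hCB : ∀ n, C ⊆ Bb n := fun n => (s n).2.2
  have hDB : ∀ n, Dd (n + 1) ⊆ Bb n := fun n => n1 n (s n)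
  have hDth : ∀ n, Dd (n + 1) ⊆ Metric.thickening (1 / ((n : ℝ) + 1)) C := fun n => n2 n (s n)
  have hGG : ∀ n x, x ∉ Dd n → G (n + 1) x = G n x := fun n x hx => n3 n (s n) x (fun h => hx (hBD n h))
  have hdiam : ∀ n, ∀ x ∈ Dd (n + 1), ∀ y ∈ Dd (n + 1), dist (G (n + 1) x) (G (n + 1) y) ≤ 1 / ((n : ℝ) + 1) :=
    fun n => n4 n (s n)
  have hDanti : ∀ m n, m ≤ n → Dd n ⊆ Dd m := by
    intro m n h
    induction n, h using Nat.le_induction with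
    | base => exact Subset.rfl
    | succ n _ ih => exact ((hDB n).trans (hBD n)).trans ih
  have hGm : ∀ n m, n ≤ m → ∀ x, x ∉ Dd n → G m x = G n x := by
    intro n m h x hx
    induction m, h using Nat.le_induction with
    | base => rfl
    | succ m hm ih => rw [hGG m x (fun h' => hx (hDanti n m hm h')), ih]
  have hGimg : ∀ n m, n ≤ m → ∀ x ∈ Dd n, ∃ y ∈ Dd n, G m x = G n y := by
    intro n m h x hx
    refine ⟨(G n).symm (G m x), ?_, by simp⟩
    by_contra hcon
    have := hGm n m h _ hcon
    rw [Homeomorph.apply_symm_apply] at this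
    have := (G m).injective this
    rw [this] at hcon
    exact hcon hx
  have hexit : ∀ x, x ∉ C → ∃ n, x ∉ Dd n := by
    intro x hx
    have hcl : IsClosed C := hC.isClosed
    have hpos : 0 < Metric.infDist x C := (hcl.notMem_iff_infDist_pos hne).1 hx
    obtain ⟨n, hn⟩ := exists_nat_one_div_lt hpos
    refine ⟨n + 1, fun h => ?_⟩
    have := hDth n h
    rw [Metric.mem_thickening_iff_infDist_lt hne] at this
    linarith
  obtain ⟨p, hpC⟩ := hne
  -- the limit point
  have hpn : ∀ n, p ∈ Dd n := fun n => hBD n (hCB n hpC)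
  have hQ : ∃ q, ∀ n, q ∈ G n '' Dd n := by
    have := IsCompact.nonempty_iInter_of_sequence_nonempty_isCompact_isClosed (fun n => G n '' Dd n) ?_ ?_ ?_ ?_
    · obtain ⟨q, hq⟩ := this
      exact ⟨q, mem_iInter.1 hq⟩
    · rintro n _ ⟨x, hx, rfl⟩
      obtain ⟨y, hy, h⟩ := hGimg n (n + 1) (Nat.le_succ n) x (hDanti n (n + 1) (Nat.le_succ n) hx)
      exact ⟨y, hy, h.symm⟩
    · exact fun n => ⟨_, p, hpn n, rfl⟩
    · exact ((hDc 0).isCompact).image (G 0).continuous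
    · exact fun n => ((hDc n).isCompact.image (G n).continuous).isClosed
  obtain ⟨q, hq⟩ := hQ
  let g : X → X := fun x => if h : ∃ n, x ∉ Dd n then G (Nat.find h) x else q
  have gout : ∀ n x, x ∉ Dd n → g x = G n x := by
    intro n x hx
    have h : ∃ n, x ∉ Dd n := ⟨n, hx⟩
    simp only [g, h, dif_pos]
    exact (hGm _ n (Nat.find_min' h hx) x (Nat.find_spec h)).symm
  have gC : ∀ x ∈ C, g x = q := by
    intro x hx
    have h : ¬ ∃ n, x ∉ Dd n := by
      push Not
      exact fun n => hBD n (hCB n hx)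
    simp only [g, h, dif_neg, not_false_eq_true]
  have gin : ∀ n x, x ∈ Dd n → g x ∈ G n '' Dd n := by
    intro n x hx
    by_cases hxC : x ∈ C
    · rw [gC x hxC]; exact hq n
    · obtain ⟨m, hm⟩ := hexit x hxC
      have hm' : x ∉ Dd (max m n) := fun h => hm (hDanti m _ (le_max_left _ _) h)
      rw [gout _ x hm']
      obtain ⟨y, hy, h⟩ := hGimg n (max m n) (le_max_right _ _) x hx
      exact ⟨y, hy, h.symm⟩
  have hqC : ∀ x, x ∉ C → g x ≠ q := by
    intro x hx h
    obtain ⟨n, hn⟩ := hexit x hx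
    rw [gout n x hn] at h
    obtain ⟨y, hy, h'⟩ := hq n
    rw [← h'] at h
    rw [(G n).injective h] at hn
    exact hn hy
  refine ⟨g, ?_, ?_, ?_, ?_⟩
  · rw [continuous_iff_continuousAt]
    intro x
    by_cases hx : x ∈ C
    · rw [Metric.continuousAt_iff']
      intro ε hε
      obtain ⟨n, hn⟩ := exists_nat_one_div_lt hε
      filter_upwards [(hBo (n + 1)).mem_nhds (hCB (n + 1) hx)] with y hy
      have hy0 : y ∈ Dd (n + 1) := hBD (n + 1) hy
      have hx0 : x ∈ Dd (n + 1) := hBD (n + 1) (hCB (n + 1) hx)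
      obtain ⟨y', hy', h1⟩ := gin (n + 1) y hy0
      obtain ⟨x', hx', h2⟩ := gin (n + 1) x hx0
      rw [← h1, ← h2]
      exact lt_of_le_of_lt (hdiam n y' hy' x' hx') hn
    · obtain ⟨n, hn⟩ := hexit x hx
      apply ((G n).continuous.continuousAt).congr
      filter_upwards [(hDc n).isOpen_compl.mem_nhds hn] with y hy
      exact (gout n y hy).symm
  · intro w
    by_cases hw : ∃ n, w ∉ G n '' Dd n
    · obtain ⟨n, hn⟩ := hw
      refine ⟨(G n).symm w, ?_⟩
      rw [gout n]
      · simp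
      · intro h
        exact hn ⟨_, h, by simp⟩
    · push Not at hw
      refine ⟨p, ?_⟩
      rw [gC p hpC]
      by_contra hne'
      have hd : 0 < dist q w := dist_pos.2 hne'
      obtain ⟨n, hn⟩ := exists_nat_one_div_lt hd
      obtain ⟨x, hx, h1⟩ := hq (n + 1)
      obtain ⟨y, hy, h2⟩ := hw (n + 1)
      rw [← h1, ← h2] at hn
      linarith [hdiam n x hx y hy]
  · intro x y
    constructor
    · intro h
      by_cases hx : x ∈ C
      · by_cases hy : y ∈ C
        · exact Or.inr ⟨hx, hy⟩
        · rw [gC x hx] at h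
          exact absurd h.symm (hqC y hy)
      · left
        obtain ⟨n, hn⟩ := hexit x hx
        have hyn : y ∉ Dd n := by
          intro hy
          obtain ⟨z, hz, h'⟩ := gin n y hy
          rw [← h, gout n x hn] at h'
          rw [(G n).injective h'] at hz
          exact hn hz
        rw [gout n x hn, gout n y hyn] at h
        exact (G n).injective h
    · rintro (rfl | ⟨hx, hy⟩)
      · rfl
      · rw [gC x hx, gC y hy]
  · intro x hx
    rw [gout 0 x (fun h => hx (hη₀O h))]
    rfl
end shrink

/-- A compact space with collared boundary sphere and interior a cell is a ball. -/
theorem ball_of_collar {X : Type} [TopologicalSpace X] [CompactSpace X]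
    [TopologicalSpace.MetrizableSpace X]
    {V : Type} [NormedAddCommGroup V] [NormedSpace ℝ V] [ProperSpace V] {S : Set X}
    (hS : IsClosed S) (hSne : S.Nonempty) {c : X × ℝ → X}
    (hc : ContinuousOn c (S ×ˢ Icc 0 1)) (hi : InjOn c (S ×ˢ Icc 0 1))
    (h0 : ∀ y ∈ S, c (y, 0) = y) (hop : IsOpen (c '' (S ×ˢ Ico 0 1)))
    {j : V → X} (hj : IsOpenEmbedding j) (hjr : range j = Sᶜ)
    {ψ : X → V} (hψ : ContinuousOn ψ S) (hψi : InjOn ψ S) (hψr : ψ '' S = sphere 0 1) :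
    ∃ Ψ : X → V, Continuous Ψ ∧ Function.Injective Ψ ∧ range Ψ = closedBall 0 1 ∧
      EqOn Ψ ψ S := by
  classical
  letI : MetricSpace X := TopologicalSpace.metrizableSpaceMetric X
  obtain ⟨y₀, hy₀⟩ := hSne
  set T : Set (X × ℝ) := S ×ˢ Icc 0 1 with hT
  set C : Set X := (c '' (S ×ˢ Ico 0 1))ᶜ with hCdef
  have hTc : IsCompact T := hS.isCompact.prod isCompact_Icc
  have hCcl : IsClosed C := hop.isClosed_compl
  have hcT : IsClosed (c '' T) := (hTc.image_of_continuousOn hc).isClosed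
  have hcov : c '' T ∪ C = univ := by
    apply eq_univ_of_forall
    intro x
    by_cases hx : x ∈ C
    · exact Or.inr hx
    · have hx' : x ∈ c '' (S ×ˢ Ico 0 1) := not_not.1 hx
      exact Or.inl (image_mono (prod_mono le_rfl Ico_subset_Icc_self) hx')
  have : Nonempty (X × ℝ) := ⟨(y₀, 0)⟩
  obtain ⟨r, hr, hrc⟩ := exists_inverse_compact hTc hc hi
  have rep : ∀ x, x ∉ C → ∃ y ∈ S, ∃ t ∈ Ico (0:ℝ) 1, c (y, t) = x := by
    intro x hx
    obtain ⟨⟨y, t⟩, ⟨hy, ht⟩, h⟩ := not_not.1 hx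
    exact ⟨y, hy, t, ht, h⟩
  have hC1 : ∀ y ∈ S, ∀ t ∈ Icc (0:ℝ) 1, (c (y, t) ∈ C ↔ t = 1) := by
    intro y hy t ht
    constructor
    · intro h
      by_contra h1
      exact h ⟨(y, t), ⟨hy, ht.1, lt_of_le_of_ne ht.2 h1⟩, rfl⟩
    · rintro rfl ⟨⟨y', t'⟩, ⟨hy', ht'⟩, h⟩
      have := hi (⟨hy', Ico_subset_Icc_self ht'⟩ : (y', t') ∈ T) (⟨hy, ht⟩ : (y, (1:ℝ)) ∈ T) h
      have h2 : t' = 1 := congrArg Prod.snd this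
      exact absurd ht'.2 (by simp [h2])
  -- gluing principle
  have glue : ∀ {W : Type} [TopologicalSpace W] (f : X × ℝ → W) (k : X → W),
      ContinuousOn f T → Continuous k → (∀ y ∈ S, f (y, 1) = k (c (y, 1))) →
      Continuous (fun x => if x ∈ C then k x else f (r x)) := by
    intro W _ f k hf hk hfk
    rw [← continuousOn_univ, ← hcov]
    apply ContinuousOn.union_of_isClosed _ _ hcT hCcl
    · have : ContinuousOn (fun x => f (r x)) (c '' T) := by
        apply hf.comp hr
        rintro _ ⟨p, hp, rfl⟩
        rw [hrc p hp]; exact hp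
      apply this.congr
      rintro _ ⟨⟨y, t⟩, hp, rfl⟩
      have h1 := hC1 y hp.1 t hp.2
      dsimp only
      by_cases hx : c (y, t) ∈ C
      · rw [if_pos hx, hrc _ hp]
        obtain rfl := h1.1 hx
        exact (hfk y hp.1).symm
      · rw [if_neg hx]
    · apply hk.continuousOn.congr
      intro x hx
      simp [hx]
  have ev : ∀ {W : Type} (f : X × ℝ → W) (k : X → W), ∀ y ∈ S, ∀ t ∈ Icc (0:ℝ) 1,
      (f (y, 1) = k (c (y, 1))) → (if c (y, t) ∈ C then k (c (y, t)) else f (r (c (y, t)))) = f (y, t) := by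
    intro W f k y hy t ht hfk
    by_cases hx : c (y, t) ∈ C
    · rw [if_pos hx]
      obtain rfl := (hC1 y hy t ht).1 hx
      exact hfk.symm
    · rw [if_neg hx, hrc _ ⟨hy, ht⟩]
  have h01 : (1:ℝ) ∈ Icc (0:ℝ) 1 := ⟨zero_le_one, le_rfl⟩
  have h00 : (0:ℝ) ∈ Icc (0:ℝ) 1 := ⟨le_rfl, zero_le_one⟩
  have hCne : C.Nonempty := ⟨c (y₀, 1), (hC1 y₀ hy₀ 1 h01).2 rfl⟩
  have hCS : ∀ y ∈ S, y ∉ C := by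
    intro y hy h
    rw [← h0 y hy, hC1 y hy 0 h00] at h
    exact zero_ne_one h
  -- height
  set ht : X → ℝ := fun x => if x ∈ C then (1:ℝ) else (r x).2 with hht
  have ht_cont : Continuous ht :=
    glue (fun p => p.2) (fun _ => 1) continuous_snd.continuousOn continuous_const (fun _ _ => rfl)
  have ht_c : ∀ y ∈ S, ∀ t ∈ Icc (0:ℝ) 1, ht (c (y, t)) = t := fun y hy t h =>
    ev (fun p => p.2) (fun _ => 1) y hy t h rfl
  have ht_C : ∀ x ∈ C, ht x = 1 := fun x hx => by simp [hht, hx]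
  have ht_lt : ∀ x, x ∉ C → ht x < 1 := by
    intro x hx
    obtain ⟨y, hy, t, h, rfl⟩ := rep x hx
    rw [ht_c y hy t (Ico_subset_Icc_self h)]; exact h.2
  have ht_pos : ∀ x, x ∉ S → 0 < ht x := by
    intro x hx
    by_cases hxC : x ∈ C
    · rw [ht_C x hxC]; norm_num
    · obtain ⟨y, hy, t, h, rfl⟩ := rep x hxC
      rw [ht_c y hy t (Ico_subset_Icc_self h)]
      apply lt_of_le_of_ne h.1
      rintro rfl
      rw [h0 y hy] at hx
      exact hx hy
  -- cone coordinate
  set q : X → V := fun x => if x ∈ C then (0:V) else (1 - (r x).2) • ψ (r x).1 with hq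
  have q_cont : Continuous q := by
    apply glue (fun p => (1 - p.2) • ψ p.1) (fun _ => 0) _ continuous_const (fun _ _ => by simp)
    apply ContinuousOn.smul (continuous_const.sub continuous_snd).continuousOn
    exact hψ.comp continuous_fst.continuousOn (fun p hp => hp.1)
  have q_c : ∀ y ∈ S, ∀ t ∈ Icc (0:ℝ) 1, q (c (y, t)) = (1 - t) • ψ y := fun y hy t h =>
    ev (fun p => (1 - p.2) • ψ p.1) (fun _ => 0) y hy t h (by simp)
  have q_C : ∀ x ∈ C, q x = 0 := fun x hx => by simp [hq, hx]
  have nψ : ∀ y ∈ S, ‖ψ y‖ = 1 := by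
    intro y hy
    have : ψ y ∈ sphere (0:V) 1 := hψr ▸ mem_image_of_mem ψ hy
    simpa using this
  have nq : ∀ y ∈ S, ∀ t ∈ Icc (0:ℝ) 1, ‖q (c (y, t))‖ = 1 - t := by
    intro y hy t h
    rw [q_c y hy t h, norm_smul, nψ y hy, mul_one, Real.norm_of_nonneg (by linarith [h.2])]
  have q0 : ∀ x, x ∉ C → q x ≠ 0 := by
    intro x hx
    obtain ⟨y, hy, t, h, rfl⟩ := rep x hx
    have := nq y hy t (Ico_subset_Icc_self h)
    intro h'
    rw [h', norm_zero] at this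
    linarith [h.2]
  have q_inj : ∀ x y, q x = q y → x = y ∨ (x ∈ C ∧ y ∈ C) := by
    intro x y hxy
    by_cases hx : x ∈ C
    · right
      refine ⟨hx, ?_⟩
      by_contra hy
      exact q0 y hy (by rw [← hxy, q_C x hx])
    · by_cases hy : y ∈ C
      · exact absurd (by rw [hxy, q_C y hy]) (q0 x hx)
      · left
        obtain ⟨u, hu, t, h, rfl⟩ := rep x hx
        obtain ⟨u', hu', t', h', rfl⟩ := rep y hy
        have e1 := nq u hu t (Ico_subset_Icc_self h)
        have e2 := nq u' hu' t' (Ico_subset_Icc_self h')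
        rw [hxy, e2] at e1
        obtain rfl : t = t' := by linarith
        rw [q_c u hu t (Ico_subset_Icc_self h), q_c u' hu' t (Ico_subset_Icc_self h)] at hxy
        have h1 : (1 - t) ≠ 0 := by linarith [h.2]
        rw [hψi hu hu' (smul_right_injective V h1 hxy)]
  have hcell : ∀ O, IsOpen O → C ⊆ O → ∃ η : V → X, IsOpenEmbedding η ∧
      C ⊆ η '' ball 0 1 ∧ η '' closedBall 0 1 ⊆ O := by
    intro O hO hCO
    have hCr : C ⊆ range j := by
      rw [hjr]; exact fun x hx hxS => hCS x hxS hx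
    have hjC : IsCompact (j ⁻¹' C) := (hj.isInducing.isCompact_preimage_iff hCr).2 hCcl.isCompact
    obtain ⟨R, hR0, hR⟩ := hjC.isBounded.subset_ball_lt 0 0
    set K : Set X := j '' closedBall 0 R with hK
    have hKc : IsCompact K := (isCompact_closedBall 0 R).image hj.continuous
    have hCB : C ⊆ j '' ball 0 R := by
      intro x hx
      obtain ⟨v, rfl⟩ := hCr hx
      exact ⟨v, hR hx, rfl⟩
    have hCK : C ⊆ K := hCB.trans (image_mono ball_subset_closedBall)
    obtain ⟨x₀, hx₀, hmin⟩ := hKc.exists_isMinOn (hCne.mono hCK) ht_cont.continuousOn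
    have hmin' : ∀ x ∈ K, ht x₀ ≤ ht x := fun x hx => hmin hx
    have hx₀p : 0 < ht x₀ := by
      apply ht_pos
      obtain ⟨v, _, rfl⟩ := hx₀
      have : j v ∈ Sᶜ := hjr ▸ mem_range_self v
      exact this
    have hx₀1 : ht x₀ ≤ 1 := by
      obtain ⟨z, hz⟩ := hCne
      have := hmin' z (hCK hz)
      rwa [ht_C z hz] at this
    obtain ⟨s, hs0, hs1, hs⟩ : ∃ s : ℝ, 0 ≤ s ∧ s < 1 ∧ ∀ x, x ∉ O → ht x ≤ s := by
      rcases (Oᶜ).eq_empty_or_nonempty with he | hne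
      · refine ⟨0, le_rfl, one_pos, fun x hx => ?_⟩
        have : x ∈ Oᶜ := hx
        rw [he] at this
        exact this.elim
      · obtain ⟨z, hz, hm⟩ := hO.isClosed_compl.isCompact.exists_isMaxOn hne ht_cont.continuousOn
        exact ⟨max 0 (ht z), le_max_left _ _, max_lt one_pos (ht_lt z (fun h => hz (hCO h))),
          fun x hx => le_max_of_le_right (hm hx)⟩
    obtain ⟨a, b, ha, hb, hba, hab, hma, hmb, a0, b0, a1, b1, hsm⟩ :=
      exists_reparam hs0 hs1 (show 0 < ht x₀ / 2 by linarith) (show ht x₀ / 2 < 1 by linarith)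
    have maps : ∀ (α : ℝ → ℝ), Monotone α → α 0 = 0 → α 1 = 1 → ∀ t ∈ Icc (0:ℝ) 1, α t ∈ Icc (0:ℝ) 1 := by
      intro α hm h0 h1 t h
      exact ⟨h0 ▸ hm h.1, h1 ▸ hm h.2⟩
    let Θ : (ℝ → ℝ) → X → X := fun α x => if x ∈ C then x else c ((r x).1, α (r x).2)
    have Θcont : ∀ α, Continuous α → Monotone α → α 0 = 0 → α 1 = 1 → Continuous (Θ α) := by
      intro α hα hm h0 h1
      apply glue (fun p => c (p.1, α p.2)) (fun x => x) _ continuous_id (fun y _ => by simp [h1])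
      apply hc.comp (continuous_fst.prodMk (hα.comp continuous_snd)).continuousOn
      exact fun p hp => ⟨hp.1, maps α hm h0 h1 _ hp.2⟩
    have Θc : ∀ α, α 1 = 1 → ∀ y ∈ S, ∀ t ∈ Icc (0:ℝ) 1, Θ α (c (y, t)) = c (y, α t) := by
      intro α h1 y hy t h
      exact ev (fun p => c (p.1, α p.2)) (fun x => x) y hy t h (by simp [h1])
    have ΘC : ∀ α, ∀ x ∈ C, Θ α x = x := fun α x hx => by simp [Θ, hx]
    have Θinv : ∀ α β : ℝ → ℝ, Monotone α → α 0 = 0 → α 1 = 1 → β 1 = 1 → (∀ s, β (α s) = s) →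
        ∀ x, Θ β (Θ α x) = x := by
      intro α β hm h0 h1 h1' hβα x
      by_cases hx : x ∈ C
      · rw [ΘC α x hx, ΘC β x hx]
      · obtain ⟨y, hy, t, h, rfl⟩ := rep x hx
        have h := Ico_subset_Icc_self h
        rw [Θc α h1 y hy t h, Θc β h1' y hy _ (maps α hm h0 h1 t h), hβα]
    have a1' := a1 1 le_rfl
    have b1' := b1 1 le_rfl
    let H : X ≃ₜ X :=
      { toFun := Θ b
        invFun := Θ a
        left_inv := Θinv b a hmb b0 b1' a1' hab
        right_inv := Θinv a b hma a0 a1' b1' hba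
        continuous_toFun := Θcont b hb hmb b0 b1'
        continuous_invFun := Θcont a ha hma a0 a1' }
    refine ⟨fun v => H (j (R • v)), ?_, ?_, ?_⟩
    · exact H.isOpenEmbedding.comp (hj.comp (Homeomorph.smulOfNeZero R hR0.ne').isOpenEmbedding)
    · intro x hx
      obtain ⟨v, hv, rfl⟩ := hCB hx
      refine ⟨R⁻¹ • v, ?_, ?_⟩
      · rw [mem_ball_zero_iff] at hv ⊢
        rw [norm_smul, norm_inv, Real.norm_of_nonneg hR0.le, inv_mul_lt_iff₀ hR0, mul_one]
        exact hv
      · dsimp only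
        rw [smul_inv_smul₀ hR0.ne']
        exact ΘC b _ hx
    · rintro _ ⟨v, hv, rfl⟩
      have hw : j (R • v) ∈ K := by
        refine ⟨R • v, ?_, rfl⟩
        rw [mem_closedBall_zero_iff] at hv ⊢
        rw [norm_smul, Real.norm_of_nonneg hR0.le]
        nlinarith
      dsimp only
      generalize j (R • v) = x at hw
      show Θ b x ∈ O
      by_cases hx : x ∈ C
      · rw [ΘC b x hx]; exact hCO hx
      · by_contra hno
        have hle := hs _ hno
        have hxm := hmin' x hw
        obtain ⟨y, hy, t, h, rfl⟩ := rep x hx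
        have h := Ico_subset_Icc_self h
        rw [Θc b b1' y hy t h, ht_c y hy _ (maps b hmb b0 b1' t h)] at hle
        have := hsm (b t) (maps b hmb b0 b1' t h).1 hle
        rw [hab] at this
        rw [ht_c y hy t h] at hxm
        linarith
  obtain ⟨g, gc, gs, gf, gid⟩ := exists_shrink hCcl.isCompact hCne hcell hS.isOpen_compl
    (fun x hx hxS => hCS x hxS hx)
  have hgq : IsQuotientMap g := IsQuotientMap.of_surjective_continuous gs gc
  let Ψ : X → V := fun x => q (Function.surjInv gs x)
  have hΨg : ∀ x, Ψ (g x) = q x := by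
    intro x
    have := (gf (Function.surjInv gs (g x)) x).1 (Function.surjInv_eq gs (g x))
    rcases this with h | h
    · show q _ = q x
      rw [h]
    · show q _ = q x
      rw [q_C _ h.1, q_C _ h.2]
  refine ⟨Ψ, ?_, ?_, ?_, ?_⟩
  · rw [hgq.continuous_iff]
    have : Ψ ∘ g = q := funext hΨg
    rw [this]; exact q_cont
  · intro x y hxy
    obtain ⟨x, rfl⟩ := gs x
    obtain ⟨y, rfl⟩ := gs y
    rw [hΨg, hΨg] at hxy
    exact (gf x y).2 (q_inj x y hxy)
  · apply Subset.antisymm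
    · rintro _ ⟨x, rfl⟩
      obtain ⟨x, rfl⟩ := gs x
      rw [hΨg, mem_closedBall_zero_iff]
      by_cases hx : x ∈ C
      · rw [q_C x hx]; simp
      · obtain ⟨y, hy, t, h, rfl⟩ := rep x hx
        rw [nq y hy t (Ico_subset_Icc_self h)]
        linarith [h.1]
    · intro v hv
      rw [mem_closedBall_zero_iff] at hv
      by_cases hv0 : v = 0
      · obtain ⟨z, hz⟩ := hCne
        exact ⟨g z, by rw [hΨg, q_C z hz, hv0]⟩
      · have hn : 0 < ‖v‖ := norm_pos_iff.2 hv0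
        have : ‖v‖⁻¹ • v ∈ ψ '' S := by
          rw [hψr, mem_sphere_zero_iff_norm, norm_smul, norm_inv, norm_norm, inv_mul_cancel₀ hn.ne']
        obtain ⟨y, hy, hyv⟩ := this
        refine ⟨g (c (y, 1 - ‖v‖)), ?_⟩
        rw [hΨg, q_c y hy _ ⟨by linarith, by linarith⟩, hyv]
        simp [smul_inv_smul₀ hn.ne']
  · intro x hx
    have h1 : g x = x := gid x (fun h => h hx)
    have h2 := hΨg x
    rw [h1] at h2
    rw [h2]
    have := q_c x hx 0 h00
    rw [h0 x hx] at this
    rw [this]; simp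

/-- closed half space -/
abbrev H3 : Type := {v : Fin 3 → ℝ // 0 ≤ v 0}

def HChart {X : Type} [TopologicalSpace X] (B : Set X) (a : X) : Prop :=
  ∃ F : H3 → X, IsOpenEmbedding F ∧ (∃ v, F v = a) ∧ ∀ v, F v ∈ B ↔ v.1 0 = 0

lemma H3.cont (i : Fin 3) : Continuous (fun v : H3 => v.1 i) :=
  (continuous_apply i).comp continuous_subtype_val

def H3.up (v : H3) (t : ℝ) : H3 :=
  ⟨fun i => v.1 i + if i = 0 then |t| else 0, by
    have := v.2
    simp only [if_true]
    positivity⟩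

lemma H3.up_cont : Continuous (fun q : H3 × ℝ => H3.up q.1 q.2) := by
  apply Continuous.subtype_mk
  refine continuous_pi fun i => ?_
  have h1 : Continuous (fun q : H3 × ℝ => q.1.1 i) := (H3.cont i).comp continuous_fst
  by_cases h : i = 0
  · subst h
    simp only [if_true]
    exact h1.add continuous_snd.abs
  · simpa [h] using h1

def H3.dn (v : H3) : H3 := ⟨fun i => if i = 0 then 0 else v.1 i, by simp⟩

lemma H3.dn_cont : Continuous H3.dn := by
  apply Continuous.subtype_mk
  refine continuous_pi fun i => ?_
  by_cases h : i = 0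
  · simpa [h] using continuous_const
  · simpa [h] using H3.cont i

lemma openEmb_inv {Y X : Type*} [TopologicalSpace Y] [TopologicalSpace X] [Nonempty Y] {F : Y → X}
    (hF : IsOpenEmbedding F) : ∃ G : X → Y, ContinuousOn G (range F) ∧ ∀ v, G (F v) = v := by
  obtain ⟨G, hG, h⟩ := exists_continuousOn_of_subtype hF.isEmbedding.toHomeomorph.symm.continuous
  refine ⟨G, hG, fun v => ?_⟩
  rw [h _ (mem_range_self v)]
  exact hF.isEmbedding.toHomeomorph.symm_apply_apply v

variable {X : Type} [TopologicalSpace X] {B : Set X}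

lemma HChart.locCol {a : X} (h : HChart B a) : LocCol B a := by
  obtain ⟨F, hF, ⟨v₀, hv₀⟩, hB⟩ := h
  have : Nonempty H3 := ⟨v₀⟩
  obtain ⟨G, hG, hGF⟩ := openEmb_inv hF
  have key : ∀ y ∈ B ∩ range F, ∃ v : H3, v.1 0 = 0 ∧ F v = y := by
    rintro _ ⟨hb, v, rfl⟩
    exact ⟨v, (hB v).1 hb, rfl⟩
  refine ⟨range F, fun q => F (H3.up (G q.1) q.2), hF.isOpen_range, ⟨v₀, hv₀⟩, ?_, ?_, ?_, ?_, ?_⟩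
  · apply hF.continuous.comp_continuousOn
    refine H3.up_cont.comp_continuousOn (f := fun q : X × ℝ => (G q.1, q.2)) ?_
    exact (hG.comp continuous_fst.continuousOn (fun q hq => hq.1.2)).prodMk continuous_snd.continuousOn
  · rintro ⟨y, t⟩ ⟨hy, ht⟩ ⟨y', t'⟩ ⟨hy', ht'⟩ h
    obtain ⟨v, hv, rfl⟩ := key y hy
    obtain ⟨v', hv', rfl⟩ := key y' hy'
    dsimp only at h
    rw [hGF, hGF] at h
    have h := congrArg Subtype.val (hF.injective h)
    have h0 := congrFun h 0
    simp only [H3.up, if_true, hv, hv', zero_add] at h0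
    rw [abs_of_nonneg ht.1, abs_of_nonneg ht'.1] at h0
    dsimp only at h0
    have : v = v' := by
      apply Subtype.ext
      funext i
      by_cases hi : i = 0
      · rw [hi, hv, hv']
      · have := congrFun h i
        simpa [H3.up, hi] using this
    rw [this, h0]
  · intro y hy
    obtain ⟨v, hv, rfl⟩ := key y hy
    dsimp only
    rw [hGF]
    congr 1
    apply Subtype.ext
    funext i
    simp [H3.up]
  · intro y hy t ht h
    obtain ⟨v, hv, rfl⟩ := key y hy
    dsimp only at h
    rw [hGF, hB] at h
    simp only [H3.up, if_true, hv, zero_add, abs_eq_zero] at h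
    exact ht.1.ne' h
  · intro O hO hOW
    have : (fun q : X × ℝ => F (H3.up (G q.1) q.2)) '' ((B ∩ O) ×ˢ Ico 0 1) =
        F '' {v | v.1 0 < 1 ∧ F v.dn ∈ O} := by
      apply Subset.antisymm
      · rintro _ ⟨⟨y, t⟩, ⟨hy, ht⟩, rfl⟩
        obtain ⟨v, hv, rfl⟩ := key y ⟨hy.1, hOW hy.2⟩
        refine ⟨H3.up v t, ⟨?_, ?_⟩, by dsimp only; rw [hGF]⟩
        · simp only [H3.up, if_true, hv, zero_add]
          rw [abs_of_nonneg ht.1]; exact ht.2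
        · have : H3.dn (H3.up v t) = v := by
            apply Subtype.ext
            funext i
            by_cases hi : i = 0 <;> simp [H3.dn, H3.up, hi, hv]
          rw [this]; exact hy.2
      · rintro _ ⟨v, ⟨hv1, hv2⟩, rfl⟩
        refine ⟨(F v.dn, v.1 0), ⟨⟨(hB _).2 (by simp [H3.dn]), hv2⟩, v.2, hv1⟩, ?_⟩
        dsimp only
        rw [hGF]
        congr 1
        apply Subtype.ext
        funext i
        by_cases hi : i = 0
        · simp [H3.dn, H3.up, hi, abs_of_nonneg v.2]
        · simp [H3.dn, H3.up, hi]
    rw [this]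
    apply hF.isOpenMap
    exact (isOpen_lt (H3.cont 0) continuous_const).inter
      (hO.preimage (hF.continuous.comp H3.dn_cont))

lemma isSurf_of_hchart (h : ∀ a ∈ B, HChart B a) : IsSurf B := by
  rintro ⟨x, hx⟩
  obtain ⟨F, hF, ⟨v₀, rfl⟩, hB⟩ := h x hx
  have hv₀ := (hB v₀).1 hx
  let k : ℂ → H3 := fun z => ⟨![0, z.re + v₀.1 1, z.im + v₀.1 2], by simp⟩
  have hk : Continuous k := by
    apply Continuous.subtype_mk
    refine continuous_pi fun i => ?_
    fin_cases i <;> simp <;> fun_prop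
  have hkB : ∀ z, F (k z) ∈ B := fun z => (hB _).2 (by simp [k])
  refine ⟨fun z => ⟨F (k z), hkB z⟩, ?_, ?_⟩
  · apply IsOpenEmbedding.of_continuous_injective_isOpenMap
    · exact (hF.continuous.comp hk).subtype_mk _
    · intro z z' h
      have h := congrArg Subtype.val (hF.injective (congrArg Subtype.val h))
      apply Complex.ext
      · simpa [k] using congrFun h 1
      · simpa [k] using congrFun h 2
    · intro O hO
      have : IsOpen (F '' {v : H3 | (⟨v.1 1 - v₀.1 1, v.1 2 - v₀.1 2⟩ : ℂ) ∈ O}) := by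
        apply hF.isOpenMap
        apply hO.preimage
        have : Continuous (fun v : H3 => Complex.equivRealProdCLM.symm (v.1 1 - v₀.1 1, v.1 2 - v₀.1 2)) := by
          apply Complex.equivRealProdCLM.symm.continuous.comp
          exact ((H3.cont 1).sub continuous_const).prodMk ((H3.cont 2).sub continuous_const)
        exact this
      convert this.preimage (continuous_subtype_val (p := (· ∈ B))) using 1
      ext ⟨y, hy⟩
      constructor
      · rintro ⟨z, hz, h⟩
        refine ⟨k z, ?_, congrArg Subtype.val h⟩
        simpa [k] using hz
      · rintro ⟨v, hv, h⟩
        refine ⟨_, hv, ?_⟩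
        apply Subtype.ext
        show F _ = y
        have h' : F v = y := h
        refine Eq.trans ?_ h'
        congr 1
        apply Subtype.ext
        have hv0 := (hB v).1 (by rw [h']; exact hy)
        funext i
        fin_cases i <;> simp [k, hv0]
  · apply Subtype.ext
    show F _ = F _
    congr 1
    apply Subtype.ext
    funext i
    fin_cases i <;> simp [k, hv₀]

lemma ext_preconnected (r : ℝ) : IsPreconnected (Ext r) := by
  rw [← ext_eq]
  have := extH_simply (show (1:ℝ) * 1 = 1 by norm_num) r
  have := extH_simply (show (-1:ℝ) * (-1) = 1 by norm_num) r
  have h1 : IsPreconnected (ExtH 1 r) := isPreconnected_iff_preconnectedSpace.2 inferInstance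
  have h2 : IsPreconnected (ExtH (-1) r) := isPreconnected_iff_preconnectedSpace.2 inferInstance
  have hp : r < |(fun _ : Fin 3 => |r| + 1) 0| := by
    rw [abs_of_nonneg (by positivity)]
    linarith [le_abs_self r]
  have m1 : (fun _ : Fin 3 => |r| + 1) ∈ ExtH 1 r := Or.inl hp
  have m2 : (fun _ : Fin 3 => |r| + 1) ∈ ExtH (-1) r := Or.inl hp
  exact IsPreconnected.union _ m1 m2 h1 h2

/-- The boundary of a compactified cell is a sphere-like surface. -/
theorem boundary_props [CompactSpace X] [T2Space X] (hBc : IsClosed B) (hch : ∀ a ∈ B, HChart B a)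
    {j : (Fin 3 → ℝ) → X} (hj : IsOpenEmbedding j) (hjr : range j = Bᶜ) :
    B.Nonempty ∧ IsPreconnected B ∧ SepProp B := by
  classical
  have hne : B.Nonempty := by
    by_contra h
    rw [not_nonempty_iff_eq_empty] at h
    rw [h, compl_empty] at hjr
    have : IsCompact (j ⁻¹' univ) := (hj.isInducing.isCompact_preimage_iff (by rw [hjr])).2 isCompact_univ
    rw [preimage_univ] at this
    exact noncompact_univ (Fin 3 → ℝ) this
  obtain ⟨c, hc, hi, h0, hop⟩ := exists_collar hBc (fun a ha => (hch a ha).locCol)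
  obtain ⟨b₀, hb₀⟩ := hne
  set T : Set (X × ℝ) := B ×ˢ Icc 0 1 with hT
  have hTc : IsCompact T := hBc.isCompact.prod isCompact_Icc
  have : Nonempty (X × ℝ) := ⟨(b₀, 0)⟩
  obtain ⟨κ, hκ, hκc⟩ := exists_inverse_compact hTc hc hi
  have hCr : (c '' (B ×ˢ Ico 0 1))ᶜ ⊆ range j := by
    rw [hjr, compl_subset_compl]
    exact fun y hy => ⟨(y, 0), ⟨hy, le_rfl, one_pos⟩, h0 y hy⟩
  have hjC := ((hj.isInducing.isCompact_preimage_iff hCr).2 hop.isClosed_compl.isCompact)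
  obtain ⟨r, hr0, hr⟩ := hjC.isBounded.subset_closedBall_lt 0 0
  have hE : ∀ x ∈ Ext r, ∃ y ∈ B, ∃ t ∈ Ico (0:ℝ) 1, c (y, t) = j x := by
    intro x hx
    by_contra hno
    have : j x ∈ (c '' (B ×ˢ Ico 0 1))ᶜ := by
      rintro ⟨⟨y, t⟩, ⟨hy, ht⟩, h⟩
      exact hno ⟨y, hy, t, ht, h⟩
    have h1 := hr this
    rw [mem_closedBall_zero_iff] at h1
    have h2 : ∀ i, |x i| ≤ r := fun i => (norm_le_pi_norm x i).trans h1
    rcases hx with h | h | h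
    · exact absurd (h2 0) (not_le.2 h)
    · exact absurd (h2 1) (not_le.2 h)
    · exact absurd (h2 2) (not_le.2 h)
  have sub : (B ×ˢ Ico (0:ℝ) 1) ⊆ T := prod_mono le_rfl Ico_subset_Icc_self
  let ρ : (Fin 3 → ℝ) → B := fun x => if h : (κ (j x)).1 ∈ B then ⟨_, h⟩ else ⟨b₀, hb₀⟩
  have hκB : ∀ x ∈ Ext r, (κ (j x)).1 ∈ B := by
    intro x hx
    obtain ⟨y, hy, t, ht, h⟩ := hE x hx
    rw [← h, hκc _ (sub ⟨hy, ht⟩)]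
    exact hy
  have hρ : ContinuousOn ρ (Ext r) := by
    rw [IsInducing.subtypeVal.continuousOn_iff]
    have : ContinuousOn (fun x => (κ (j x)).1) (Ext r) := by
      apply continuous_fst.comp_continuousOn
      apply hκ.comp hj.continuous.continuousOn
      intro x hx
      obtain ⟨y, hy, t, ht, h⟩ := hE x hx
      exact ⟨_, sub ⟨hy, ht⟩, h⟩
    apply this.congr
    intro x hx
    simp [ρ, hκB x hx]
  -- push in a little
  set K : Set X := j '' closedBall 0 r with hK
  have hKc : IsCompact K := (isCompact_closedBall 0 r).image hj.continuous
  have hKB : ∀ x ∈ K, x ∉ B := by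
    rintro _ ⟨v, _, rfl⟩
    have : j v ∈ Bᶜ := hjr ▸ mem_range_self v
    exact this
  have hcT : IsCompact (c '' T) := hTc.image_of_continuousOn hc
  obtain ⟨τ, hτ0, hτ1, hτ⟩ : ∃ τ : ℝ, 0 < τ ∧ τ < 1 ∧ ∀ y ∈ B, c (y, τ) ∉ K := by
    rcases (K ∩ c '' T).eq_empty_or_nonempty with he | hne
    · refine ⟨1/2, by norm_num, by norm_num, fun y hy h => ?_⟩
      have : c (y, 1/2) ∈ K ∩ c '' T := ⟨h, _, ⟨hy, by norm_num, by norm_num⟩, rfl⟩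
      rw [he] at this
      exact this
    · obtain ⟨z, ⟨hz1, ⟨y, t⟩, hyt, hz⟩, hm⟩ := (hKc.inter hcT).exists_isMinOn hne
        (continuous_snd.comp_continuousOn (hκ.mono inter_subset_right))
      have hκz : κ z = (y, t) := by rw [← hz, hκc _ hyt]
      have htp : 0 < t := by
        apply lt_of_le_of_ne hyt.2.1
        rintro rfl
        rw [h0 y hyt.1] at hz
        exact hKB z hz1 (hz ▸ hyt.1)
      have ht1 : t ≤ 1 := hyt.2.2
      refine ⟨t / 2, by linarith, by linarith, fun y' hy' h => ?_⟩
      have hmem : (y', t / 2) ∈ T := ⟨hy', by constructor <;> simp <;> linarith⟩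
      have := hm (show c (y', t / 2) ∈ K ∩ c '' T from ⟨h, _, hmem, rfl⟩)
      simp only [mem_ofPred_eq, Function.comp, hκz, hκc _ hmem] at this
      linarith
  have hτI : τ ∈ Icc (0:ℝ) 1 := ⟨hτ0.le, hτ1.le⟩
  have hcj : ∀ y ∈ B, c (y, τ) ∈ range j := by
    intro y hy
    rw [hjr]
    intro h
    have := hi (⟨hy, hτI⟩ : (y, τ) ∈ T) (⟨h, le_rfl, zero_le_one⟩ : (c (y, τ), (0:ℝ)) ∈ T) (h0 _ h).symm
    exact hτ0.ne' (congrArg Prod.snd this)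
  obtain ⟨G, hG, hGj⟩ := openEmb_inv hj
  let i : B → (Fin 3 → ℝ) := fun y => G (c (y, τ))
  have hji : ∀ y, j (i y) = c (y, τ) := by
    intro y
    obtain ⟨v, hv⟩ := hcj y y.2
    show j (G (c (y, τ))) = _
    rw [← hv, hGj]
  have hic : Continuous i := by
    refine hG.comp_continuous (f := fun y : B => c (y.1, τ)) ?_ (fun y => hcj y y.2)
    apply hc.comp_continuous (by fun_prop) (fun y => ⟨y.2, hτI⟩)
  have hiE : ∀ y, i y ∈ Ext r := by
    intro y
    by_contra h
    apply hτ y y.2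
    rw [← hji]
    refine ⟨_, ?_, rfl⟩
    simp only [Ext, mem_ofPred_eq, not_or, not_lt] at h
    rw [mem_closedBall_zero_iff, pi_norm_le_iff_of_nonneg hr0.le]
    intro k
    fin_cases k
    · exact h.1
    · exact h.2.1
    · exact h.2.2
  have hρi : ∀ y, ρ (i y) = y := by
    intro y
    apply Subtype.ext
    have : κ (j (i y)) = (y.1, τ) := by rw [hji, hκc _ ⟨y.2, hτI⟩]
    have h2 : (κ (j (i y))).1 ∈ B := by rw [this]; exact y.2
    simp only [ρ, this, y.2, dif_pos]
  refine ⟨⟨b₀, hb₀⟩, ?_, sepProp_of_retract (isSurf_of_hchart hch) hr0.le hic hiE hρ hρi⟩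
  have : B = Subtype.val '' (ρ '' Ext r) := by
    apply Subset.antisymm
    · intro y hy
      exact ⟨⟨y, hy⟩, ⟨i ⟨y, hy⟩, hiE _, hρi _⟩, rfl⟩
    · rintro _ ⟨y, _, rfl⟩
      exact y.2
  rw [this]
  exact ((ext_preconnected r).image _ hρ).image _ continuous_subtype_val.continuousOn
end QF

namespace QF
open Metric (ball closedBall sphere isOpen_ball mem_ball sphere_subset_closedBall ball_subset_closedBall mem_ball_self ball_mem_nhds)


def PlaneChart {X : Type} [TopologicalSpace X] (Z : Set X) (x : X) : Prop :=
  ∃ ε : (Fin 3 → ℝ) → X, IsOpenEmbedding ε ∧ ε 0 = x ∧ ∀ v, ε v ∈ Z ↔ v 0 = 0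

lemma half_pos_pre : IsPreconnected {v : Fin 3 → ℝ | 0 < v 0} :=
  (convex_halfSpace_gt (LinearMap.proj (R := ℝ) (φ := fun _ : Fin 3 => ℝ) 0).isLinear 0).isPreconnected

lemma half_neg_pre : IsPreconnected {v : Fin 3 → ℝ | v 0 < 0} :=
  (convex_halfSpace_lt (LinearMap.proj (R := ℝ) (φ := fun _ : Fin 3 => ℝ) 0).isLinear 0).isPreconnected

lemma push_tendsto (a : Fin 3 → ℝ) (k : ℝ) :
    Filter.Tendsto (fun t : ℝ => fun i : Fin 3 => a i + if i = 0 then k * t else 0) (𝓝[>] 0) (𝓝 a) := by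
  have : Continuous (fun t : ℝ => fun i : Fin 3 => a i + if i = 0 then k * t else 0) := by
    refine continuous_pi fun i => ?_
    by_cases h : i = 0 <;> simp only [h, if_true, if_false] <;> fun_prop
  have h := (this.tendsto 0).mono_left (nhdsWithin_le_nhds (s := Ioi 0))
  convert h using 2
  funext i
  simp

lemma plane_twoSided : TwoSidedAt {v : Fin 3 → ℝ | v 0 = 0} 0 := by
  intro V hV
  obtain ⟨r, hr, hrV⟩ := Metric.mem_nhds_iff.1 hV
  have c1 := convex_halfSpace_gt (LinearMap.proj (R := ℝ) (φ := fun _ : Fin 3 => ℝ) 0).isLinear 0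
  have c2 := convex_halfSpace_lt (LinearMap.proj (R := ℝ) (φ := fun _ : Fin 3 => ℝ) 0).isLinear 0
  refine ⟨ball 0 r, isOpen_ball, mem_ball_self hr, hrV,
    ball 0 r ∩ {v | 0 < v 0}, ball 0 r ∩ {v | v 0 < 0}, ?_, ?_, ?_, ?_, ?_, ?_, ?_, ?_, ?_⟩
  · exact isOpen_ball.inter (isOpen_lt continuous_const (continuous_apply 0))
  · exact isOpen_ball.inter (isOpen_lt (continuous_apply 0) continuous_const)
  · rw [disjoint_left]
    rintro v ⟨_, h⟩ ⟨_, h'⟩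
    exact lt_asymm (show 0 < v 0 from h) (show v 0 < 0 from h')
  · exact ((convex_ball _ _).inter c1).isPreconnected
  · exact ((convex_ball _ _).inter c2).isPreconnected
  · exact fun v hv => ⟨hrV hv.1, fun h => (ne_of_gt hv.2) h⟩
  · exact fun v hv => ⟨hrV hv.1, fun h => (ne_of_lt hv.2) h⟩
  · rintro v ⟨h1, h2⟩
    rcases lt_or_gt_of_ne (show v 0 ≠ 0 from h2) with h | h
    · exact Or.inr ⟨h1, h⟩
    · exact Or.inl ⟨h1, h⟩
  · rintro a ⟨ha0, har⟩
    have ha0 : a 0 = 0 := ha0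
    constructor
    · apply mem_closure_of_tendsto (push_tendsto a 1)
      filter_upwards [(push_tendsto a 1) (isOpen_ball.mem_nhds har), self_mem_nhdsWithin] with t h1 h2
      exact ⟨h1, by simpa [ha0] using h2⟩
    · apply mem_closure_of_tendsto (push_tendsto a (-1))
      filter_upwards [(push_tendsto a (-1)) (isOpen_ball.mem_nhds har), self_mem_nhdsWithin] with t h1 h2
      exact ⟨h1, by simpa [ha0] using h2⟩

lemma PlaneChart.twoSided {X : Type} [TopologicalSpace X] {Z : Set X} {x : X} (h : PlaneChart Z x) :
    TwoSidedAt Z x := by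
  obtain ⟨ε, hε, rfl, hZ⟩ := h
  exact plane_twoSided.transfer hε isOpen_univ (mem_univ _) (fun z _ => hZ z)

section dc
variable {M : Type} [TopologicalSpace M] {Z : Set M}

lemma DCov.uniq (C : DCov M Z) {e e' : C.D} (h : C.p e = C.p e') (hz : C.p e ∉ Z)
    (hl : C.lab e = C.lab e') : e = e' := by
  rcases C.fib e e' h with h1 | h1
  · exact h1.symm
  · rw [h1, C.lab_t e hz] at hl
    cases hb : C.lab e <;> simp [hb] at hl

/-- two sided chart in the double cover -/
def BChart (C : DCov M Z) (F : (Fin 3 → ℝ) → C.D) (e : C.D) : Prop :=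
  IsOpenEmbedding F ∧ F 0 = e ∧ (∀ v, C.p (F v) ∈ Z ↔ v 0 = 0) ∧
    ∀ v, v 0 ≠ 0 → (C.lab (F v) = false ↔ 0 < v 0)

lemma DCov.bchart (C : DCov M Z) {e : C.D} (he : C.p e ∈ Z) (hl : PlaneChart Z (C.p e)) :
    ∃ F, BChart C F e := by
  obtain ⟨ε, hε, h0, hZ⟩ := hl
  have : ContractibleSpace (univ : Set (Fin 3 → ℝ)) := convex_univ.contractibleSpace ⟨0, trivial⟩
  obtain ⟨F, hF, F0, hpF⟩ := C.lift (T := Fin 3 → ℝ) isOpen_univ hε.continuous.continuousOn (mem_univ 0) h0.symm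
  rw [continuousOn_univ] at hF
  replace hpF : ∀ v, C.p (F v) = ε v := fun v => hpF v trivial
  have hcomp : C.p ∘ F = ε := funext hpF
  have hFo : IsOpenEmbedding F := by
    apply IsLocalHomeomorph.isOpenEmbedding_of_injective
    · exact IsLocalHomeomorph.of_comp (g := C.p) (f := F)
        (by rw [hcomp]; exact hε.isLocalHomeomorph) C.cov.isLocalHomeomorph hF
    · intro v w h
      apply hε.injective
      rw [← hpF, ← hpF, h]
  have hlab : ContinuousOn (C.lab ∘ F) {v | v 0 ≠ 0} := by
    apply C.lab_cont.comp hF.continuousOn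
    intro v hv h
    have : C.p (F v) ∈ Z := h
    rw [hpF, hZ] at this
    exact hv this
  have cst : ∀ s : Set (Fin 3 → ℝ), IsPreconnected s → s ⊆ {v | v 0 ≠ 0} → ∀ v ∈ s, ∀ w ∈ s,
      C.lab (F v) = C.lab (F w) := by
    intro s hs hss v hv w hw
    exact (hs.image _ (hlab.mono hss)).subsingleton ⟨v, hv, rfl⟩ ⟨w, hw, rfl⟩
  have cp := cst _ half_pos_pre (fun v hv => ne_of_gt hv)
  have cn := cst _ half_neg_pre (fun v hv => ne_of_lt hv)
  obtain ⟨G, hG, hGε⟩ := openEmb_inv hε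
  obtain ⟨y, ⟨⟨v, hv⟩, hyZ⟩, y', ⟨⟨v', hv'⟩, hyZ'⟩, h1, h2⟩ := C.switch (C.p e) he (range ε)
    (hε.isOpen_range.mem_nhds ⟨0, h0⟩) (F ∘ G) (hF.comp_continuousOn hG) (by
      rintro _ ⟨v, rfl⟩
      show C.p (F (G (ε v))) = _
      rw [hGε, hpF])
  subst hv hv'
  simp only [Function.comp, hGε] at h1 h2
  rw [hZ] at hyZ hyZ'
  rcases lt_or_gt_of_ne hyZ' with hn | hp
  · -- reflect
    let R : (Fin 3 → ℝ) → (Fin 3 → ℝ) := fun v i => if i = 0 then -v i else v i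
    have hR : Continuous R := by
      refine continuous_pi fun i => ?_
      by_cases h : i = 0 <;> simp only [R, h, if_true, if_false] <;> fun_prop
    have hRR : ∀ v, R (R v) = v := by
      intro v; funext i
      by_cases h : i = 0 <;> simp [R, h]
    let RH : (Fin 3 → ℝ) ≃ₜ (Fin 3 → ℝ) := ⟨⟨R, R, hRR, hRR⟩, hR, hR⟩
    have hR0 : ∀ v, R v 0 = - v 0 := fun v => by simp [R]
    refine ⟨F ∘ R, hFo.comp RH.isOpenEmbedding, ?_, ?_, ?_⟩
    · show F (R 0) = e
      have : R 0 = 0 := by funext i; simp [R]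
      rw [this, F0]
    · intro v
      show C.p (F (R v)) ∈ Z ↔ _
      rw [hpF, hZ, hR0, neg_eq_zero]
    · intro v hv0
      show C.lab (F (R v)) = false ↔ _
      constructor
      · intro h
        by_contra hneg
        have hv1 : v 0 < 0 := lt_of_le_of_ne (not_lt.1 hneg) hv0
        rcases lt_or_gt_of_ne hyZ with a | a
        · have := cn _ a _ hn
          rw [h1, h2] at this
          exact absurd this (by simp)
        · have := cp (R v) (by show 0 < R v 0; rw [hR0]; linarith) _ a
          rw [h1, h] at this
          exact absurd this (by simp)
      · intro h
        rw [cn (R v) (by show R v 0 < 0; rw [hR0]; linarith) _ hn, h2]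
  · refine ⟨F, hFo, F0, fun v => by rw [hpF, hZ], ?_⟩
    intro v hv0
    constructor
    · intro h
      by_contra hneg
      have hv1 : v 0 < 0 := lt_of_le_of_ne (not_lt.1 hneg) hv0
      rcases lt_or_gt_of_ne hyZ with a | a
      · have := cn v hv1 _ a
        rw [h1, h] at this
        exact absurd this (by simp)
      · have := cp _ a _ hp
        rw [h1, h2] at this
        exact absurd this (by simp)
    · intro h
      rw [cp v h _ hp, h2]

lemma DCov.exists_s0 (C : DCov M Z) (hZ : IsClosed Z) : ∃ s : M → C.D, ContinuousOn s Zᶜ ∧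
    ∀ x ∉ Z, C.p (s x) = x ∧ C.lab (s x) = false := by
  have key : ∀ x, ∃ e : C.D, x ∉ Z → C.p e = x ∧ C.lab e = false := by
    intro x
    obtain ⟨e, rfl⟩ := C.surj x
    by_cases h : C.lab e = false
    · exact ⟨e, fun _ => ⟨rfl, h⟩⟩
    · refine ⟨C.t e, fun hx => ⟨C.p_t e, ?_⟩⟩
      rw [C.lab_t e hx]
      simpa using h
  choose s hs using key
  refine ⟨s, ?_, hs⟩
  intro x hx
  apply ContinuousAt.continuousWithinAt
  obtain ⟨U, g, hU, hxU, hg, hgx, hpg⟩ := C.exists_section (s x)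
  rw [(hs x hx).1] at hxU hgx
  have hopen : IsOpen (C.p ⁻¹' Z)ᶜ := (hZ.preimage C.cov.continuous).isOpen_compl
  have hsx : s x ∈ (C.p ⁻¹' Z)ᶜ := by
    show C.p (s x) ∉ Z
    rw [(hs x hx).1]; exact hx
  have hgc : ContinuousAt g x := hg.continuousAt (hU.mem_nhds hxU)
  have hlab : ContinuousAt (fun y => C.lab (g y)) x := by
    apply ContinuousAt.comp _ hgc
    rw [hgx]
    exact C.lab_cont.continuousAt (hopen.mem_nhds hsx)
  have ev : ∀ᶠ y in 𝓝 x, C.lab (g y) = false := by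
    have := hlab.eventually_mem (IsOpen.mem_nhds (isOpen_discrete {false}) (by
      show C.lab (g x) ∈ _
      rw [hgx, (hs x hx).2]; rfl))
    exact this
  apply hgc.congr
  filter_upwards [ev, hU.mem_nhds hxU, hZ.isOpen_compl.mem_nhds hx] with y h1 h2 h3
  apply C.uniq
  · rw [hpg y h2, (hs y h3).1]
  · rw [hpg y h2]; exact h3
  · rw [h1, (hs y h3).2]

def DCov.L (C : DCov M Z) (P : Set M) : Set C.D := {e | C.p e ∈ P ∧ C.lab e = false}
def DCov.Hat (C : DCov M Z) (P : Set M) : Set C.D := closure (C.L P)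

lemma DCov.lab_open (C : DCov M Z) (hZ : IsClosed Z) (b : Bool) {O : Set M} (hO : IsOpen O) (hOZ : O ⊆ Zᶜ) :
    IsOpen {e | C.p e ∈ O ∧ C.lab e = b} := by
  have hopen : IsOpen (C.p ⁻¹' Z)ᶜ := (hZ.preimage C.cov.continuous).isOpen_compl
  have h1 := C.lab_cont.isOpen_inter_preimage hopen (isOpen_discrete {b})
  have h2 := h1.inter (hO.preimage C.cov.continuous)
  convert h2 using 1
  ext e
  constructor
  · rintro ⟨h3, h4⟩
    exact ⟨⟨fun h => hOZ h3 h, h4⟩, h3⟩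
  · rintro ⟨⟨_, h4⟩, h3⟩
    exact ⟨h3, h4⟩

lemma DCov.hat_off (C : DCov M Z) (hZ : IsClosed Z) {P : Set M} (hP : IsComp Zᶜ P) {e : C.D}
    (he : e ∈ C.Hat P) (hpe : C.p e ∉ Z) : e ∈ C.L P := by
  have h1 : C.p e ∈ closure P :=
    map_mem_closure C.cov.continuous he (fun x hx => hx.1)
  have h2 : C.p e ∈ P := (hP.closure_eq h1).resolve_right hpe
  refine ⟨h2, ?_⟩
  by_contra hl
  have hl : C.lab e = true := by simpa using hl
  obtain ⟨x, hx1, hx2⟩ := mem_closure_iff.1 he _ (C.lab_open hZ true hP.2.1 hP.2.2.2.1) ⟨h2, hl⟩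
  have := hx1.2
  rw [hx2.2] at this
  exact absurd this (by simp)

lemma BChart.hat_iff {C : DCov M Z} {F : (Fin 3 → ℝ) → C.D} {e : C.D} (hF : BChart C F e) (hZ : IsClosed Z)
    {P : Set M} (hP : IsComp Zᶜ P) {v₁ : Fin 3 → ℝ} (hv₁ : F v₁ ∈ C.L P) (v : Fin 3 → ℝ) :
    F v ∈ C.Hat P ↔ 0 ≤ v 0 := by
  obtain ⟨hFo, F0, hFZ, hFl⟩ := hF
  have hv₁0 : v₁ 0 ≠ 0 := fun h => hP.2.2.2.1 hv₁.1 ((hFZ v₁).2 h)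
  have hpos := (hFl v₁ hv₁0).1 hv₁.2
  have hsub : (fun v => C.p (F v)) '' {v | 0 < v 0} ⊆ P := by
    apply hP.subset (half_pos_pre.image _ (C.cov.continuous.comp hFo.continuous).continuousOn)
    · rintro _ ⟨w, hw, rfl⟩ h
      exact (ne_of_gt hw) ((hFZ w).1 h)
    · exact ⟨_, ⟨v₁, hpos, rfl⟩, hv₁.1⟩
  have hL : ∀ w, 0 < w 0 → F w ∈ C.L P := fun w hw => ⟨hsub ⟨w, hw, rfl⟩, (hFl w (ne_of_gt hw)).2 hw⟩
  constructor
  · intro h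
    by_contra hneg
    have hneg := not_le.1 hneg
    have := C.hat_off hZ hP h (fun h' => (ne_of_lt hneg) ((hFZ v).1 h'))
    exact lt_asymm hneg ((hFl v (ne_of_lt hneg)).1 this.2)
  · intro h
    apply mem_closure_of_tendsto ((hFo.continuous.tendsto v).comp (push_tendsto v 1))
    filter_upwards [self_mem_nhdsWithin] with t ht
    apply hL
    have ht : 0 < t := ht
    simp only [if_true, one_mul]
    linarith

lemma BChart.hat_iff' {C : DCov M Z} {F : (Fin 3 → ℝ) → C.D} {e : C.D} (hF : BChart C F e) (hZ : IsClosed Z)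
    {P : Set M} (hP : IsComp Zᶜ P) (he : e ∈ C.Hat P) (v : Fin 3 → ℝ) :
    F v ∈ C.Hat P ↔ 0 ≤ v 0 := by
  obtain ⟨_, ⟨v₁, rfl⟩, hv₁⟩ := mem_closure_iff.1 he _ hF.1.isOpen_range ⟨0, hF.2.1⟩
  exact hF.hat_iff hZ hP hv₁ v

lemma BChart.base {C : DCov M Z} {F : (Fin 3 → ℝ) → C.D} {e : C.D} (hF : BChart C F e) :
    C.p (F (fun _ => 1)) ∉ Z ∧ C.lab (F (fun _ => 1)) = false := by
  constructor
  · rw [hF.2.2.1]; norm_num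
  · rw [hF.2.2.2 _ (by norm_num)]; norm_num

lemma DCov.exists_hat [LocallyConnectedSpace M] (C : DCov M Z) (hZ : IsClosed Z) (hl : ∀ x ∈ Z, PlaneChart Z x)
    {e : C.D} (he : C.p e ∈ Z) : ∃ P, IsComp Zᶜ P ∧ e ∈ C.Hat P := by
  obtain ⟨F, hF⟩ := C.bchart he (hl _ he)
  obtain ⟨P, hP, hxP⟩ := exists_isComp hZ.isOpen_compl (show C.p (F (fun _ => 1)) ∈ Zᶜ from hF.base.1)
  refine ⟨P, hP, ?_⟩
  rw [← hF.2.1, hF.hat_iff hZ hP ⟨hxP, hF.base.2⟩]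
  simp

lemma DCov.hat_unique (C : DCov M Z) (hZ : IsClosed Z) (hl : ∀ x ∈ Z, PlaneChart Z x)
    {e : C.D} (he : C.p e ∈ Z) {P P' : Set M} (hP : IsComp Zᶜ P) (hP' : IsComp Zᶜ P')
    (h : e ∈ C.Hat P) (h' : e ∈ C.Hat P') : P = P' := by
  obtain ⟨F, hF⟩ := C.bchart he (hl _ he)
  have key : ∀ Q, IsComp Zᶜ Q → e ∈ C.Hat Q → C.p (F (fun _ => 1)) ∈ Q := by
    intro Q hQ hq
    have h1 := (hF.hat_iff' hZ hQ hq (fun _ => 1)).2 (by norm_num)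
    exact (C.hat_off hZ hQ h1 hF.base.1).1
  exact hP.eq hP' ⟨_, key P hP h, key P' hP' h'⟩

lemma DCov.hat_nhds (C : DCov M Z) (hZ : IsClosed Z) (hl : ∀ x ∈ Z, PlaneChart Z x)
    {e : C.D} (he : C.p e ∈ Z) {P : Set M} (hP : IsComp Zᶜ P) (h : e ∈ C.Hat P) :
    ∀ᶠ e' in 𝓝 e, (C.p e' ∈ Z ∨ C.lab e' = false) → e' ∈ C.Hat P := by
  obtain ⟨F, hF⟩ := C.bchart he (hl _ he)
  filter_upwards [hF.1.isOpen_range.mem_nhds ⟨0, hF.2.1⟩]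
  rintro _ ⟨v, rfl⟩ hv
  rw [hF.hat_iff' hZ hP h]
  by_cases h0 : v 0 = 0
  · exact h0.ge
  · rcases hv with hv | hv
    · exact ((hF.2.2.1 v).1 hv).ge
    · exact ((hF.2.2.2 v h0).1 hv).le
end dc

lemma IsSurf.homeo {A B : Type*} [TopologicalSpace A] [TopologicalSpace B] (h : IsSurf A) (f : A ≃ₜ B) :
    IsSurf B := by
  intro x
  obtain ⟨e, he, h0⟩ := h (f.symm x)
  exact ⟨f ∘ e, f.isOpenEmbedding.comp he, by simp [h0]⟩

lemma SepProp.homeo {A B : Type*} [TopologicalSpace A] [TopologicalSpace B] (h : SepProp A) (f : A ≃ₜ B) :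
    SepProp B := by
  intro J hJ hpre
  apply h (f.symm '' J) (hJ.image f.symm.continuous.continuousOn f.symm.injective.injOn)
  have := hpre.image f.symm f.symm.continuous.continuousOn
  rwa [image_compl_eq f.symm.bijective] at this

section dc
variable {M : Type} [TopologicalSpace M] {Z : Set M}

lemma DCov.metrizable [CompactSpace M] [T2Space M] [SecondCountableTopology M] (C : DCov M Z) :
    TopologicalSpace.MetrizableSpace C.D := by
  have := C.t2
  have := C.compact
  have hloc : ∀ e : C.D, ∃ U : Set C.D, IsOpen U ∧ e ∈ U ∧ SecondCountableTopology U := by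
    intro e
    obtain ⟨φ, he, hφ⟩ := C.cov.isLocalHomeomorph e
    exact ⟨φ.source, φ.open_source, he, φ.secondCountableTopology_source⟩
  choose U hU heU h2 using hloc
  obtain ⟨s, hs⟩ := isCompact_univ.elim_finite_subcover U hU (fun e _ => mem_iUnion.2 ⟨e, heU e⟩)
  have : SecondCountableTopology C.D := by
    have : ∀ i : s, SecondCountableTopology (U i) := fun i => h2 i
    apply TopologicalSpace.secondCountableTopology_of_countable_cover (U := fun i : s => U i) (fun i => hU i)
    apply eq_univ_of_univ_subset
    refine hs.trans ?_
    intro x hx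
    simp only [mem_iUnion] at hx ⊢
    obtain ⟨i, hi, h⟩ := hx
    exact ⟨⟨i, hi⟩, h⟩
  exact TopologicalSpace.metrizableSpace_of_t3_secondCountable C.D

def DCov.Bd (C : DCov M Z) (P : Set M) : Set C.D := C.Hat P ∩ C.p ⁻¹' Z

theorem DCov.hat_main [CompactSpace M] [T2Space M] [SecondCountableTopology M] (C : DCov M Z)
    (hZ : IsClosed Z) (hl : ∀ x ∈ Z, PlaneChart Z x) {P : Set M} (hP : IsComp Zᶜ P)
    {j : (Fin 3 → ℝ) → M} (hj : IsOpenEmbedding j) (hjr : range j = P) :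
    (C.Bd P).Nonempty ∧ IsPreconnected (C.Bd P) ∧ IsSurf (C.Bd P) ∧ SepProp (C.Bd P) ∧
    ∀ ψ : C.D → EuclideanSpace ℝ (Fin 3), ContinuousOn ψ (C.Bd P) → InjOn ψ (C.Bd P) →
      ψ '' (C.Bd P) = sphere 0 1 →
      ∃ Φ : EuclideanSpace ℝ (Fin 3) → C.D, ContinuousOn Φ (closedBall 0 1) ∧
        InjOn Φ (closedBall 0 1) ∧ Φ '' closedBall 0 1 = C.Hat P ∧
        ∀ x ∈ C.Bd P, Φ (ψ x) = x := by
  have := C.t2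
  have := C.compact
  have := C.metrizable
  have hclosed : IsClosed (C.Hat P) := isClosed_closure
  have : CompactSpace (C.Hat P) := isCompact_iff_compactSpace.1 hclosed.isCompact
  let B : Set (C.Hat P) := {x | C.p x ∈ Z}
  have hBc : IsClosed B := hZ.preimage (C.cov.continuous.comp continuous_subtype_val)
  have hch : ∀ a ∈ B, HChart B a := by
    rintro ⟨e, he⟩ ha
    have ha : C.p e ∈ Z := ha
    obtain ⟨F, hF⟩ := C.bchart ha (hl _ ha)
    have hi := hF.hat_iff' hZ hP he
    refine ⟨fun v => ⟨F v.1, (hi v.1).2 v.2⟩, ?_, ⟨⟨0, le_rfl⟩, Subtype.ext hF.2.1⟩, fun v => hF.2.2.1 v.1⟩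
    apply IsOpenEmbedding.of_continuous_injective_isOpenMap
    · exact (hF.1.continuous.comp continuous_subtype_val).subtype_mk _
    · intro v w h
      exact Subtype.ext (hF.1.injective (congrArg Subtype.val h))
    · intro O hO
      obtain ⟨O', hO', rfl⟩ := isOpen_induced_iff.1 hO
      convert (hF.1.isOpenMap _ hO').preimage (continuous_subtype_val (p := (· ∈ C.Hat P))) using 1
      ext ⟨x, hx⟩
      constructor
      · rintro ⟨v, hv, h⟩
        exact ⟨v.1, hv, congrArg Subtype.val h⟩
      · rintro ⟨v, hv, h⟩
        have h : F v = x := h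
        refine ⟨⟨v, (hi v).1 (by rw [h]; exact hx)⟩, hv, Subtype.ext h⟩
  obtain ⟨s, hs, hs'⟩ := C.exists_s0 hZ
  have hjZ : ∀ v, j v ∉ Z := fun v => hP.2.2.2.1 (hjr ▸ mem_range_self v)
  have hsL : ∀ v, s (j v) ∈ C.L P := by
    intro v
    refine ⟨?_, (hs' _ (hjZ v)).2⟩
    rw [(hs' _ (hjZ v)).1, ← hjr]
    exact mem_range_self v
  let jj : (Fin 3 → ℝ) → C.Hat P := fun v => ⟨s (j v), subset_closure (hsL v)⟩
  have hjj : IsOpenEmbedding jj := by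
    apply IsOpenEmbedding.of_continuous_injective_isOpenMap
    · exact (hs.comp_continuous hj.continuous hjZ).subtype_mk _
    · intro v w h
      have h := congrArg C.p (congrArg Subtype.val h)
      apply hj.injective
      change C.p (s (j v)) = C.p (s (j w)) at h
      rwa [(hs' _ (hjZ v)).1, (hs' _ (hjZ w)).1] at h
    · intro O hO
      have h1 := C.lab_open hZ false (hj.isOpenMap O hO) (by rintro _ ⟨v, _, rfl⟩; exact hjZ v)
      convert h1.preimage (continuous_subtype_val (p := (· ∈ C.Hat P))) using 1
      ext ⟨x, hx⟩
      constructor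
      · rintro ⟨v, hv, h⟩
        have h : s (j v) = x := congrArg Subtype.val h
        show C.p x ∈ j '' O ∧ C.lab x = false
        rw [← h, (hs' _ (hjZ v)).1]
        exact ⟨mem_image_of_mem _ hv, (hs' _ (hjZ v)).2⟩
      · rintro ⟨⟨v, hv, h⟩, h2⟩
        have h : j v = C.p x := h
        have h2 : C.lab x = false := h2
        refine ⟨v, hv, Subtype.ext ?_⟩
        apply C.uniq
        · rw [(hs' _ (hjZ v)).1, h]
        · rw [(hs' _ (hjZ v)).1]; exact hjZ v
        · rw [h2]; exact (hs' _ (hjZ v)).2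
  have hjjr : range jj = Bᶜ := by
    apply Subset.antisymm
    · rintro _ ⟨v, rfl⟩ h
      have h : C.p (s (j v)) ∈ Z := h
      rw [(hs' _ (hjZ v)).1] at h
      exact hjZ v h
    · rintro ⟨x, hx⟩ h
      have hpx : C.p x ∉ Z := h
      have := C.hat_off hZ hP hx hpx
      have h3 := this.1
      rw [← hjr] at h3
      obtain ⟨v, hv⟩ := h3
      refine ⟨v, Subtype.ext ?_⟩
      apply C.uniq
      · rw [(hs' _ (hjZ v)).1, hv]
      · rw [(hs' _ (hjZ v)).1]; exact hjZ v
      · rw [this.2]; exact (hs' _ (hjZ v)).2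
  obtain ⟨hne, hpre, hsep⟩ := boundary_props hBc hch hjj hjjr
  have hsurf := isSurf_of_hchart hch
  let f : B ≃ₜ C.Bd P :=
    { toFun := fun x => ⟨x.1.1, x.1.2, x.2⟩
      invFun := fun x => ⟨⟨x.1, x.2.1⟩, x.2.2⟩
      left_inv := fun x => rfl
      right_inv := fun x => rfl
      continuous_toFun := (continuous_subtype_val.comp continuous_subtype_val).subtype_mk _
      continuous_invFun := (continuous_subtype_val.subtype_mk _).subtype_mk _ }
  have hBB : Subtype.val '' B = C.Bd P := by
    ext x
    constructor
    · rintro ⟨y, hy, rfl⟩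
      exact ⟨y.2, hy⟩
    · rintro ⟨h1, h2⟩
      exact ⟨⟨x, h1⟩, h2, rfl⟩
  refine ⟨?_, ?_, hsurf.homeo f, hsep.homeo f, ?_⟩
  · rw [← hBB]; exact hne.image _
  · rw [← hBB]; exact hpre.image _ continuous_subtype_val.continuousOn
  · intro ψ hψ hψi hψr
    obtain ⟨c, hc, hi, h0, hop⟩ := exists_collar hBc (fun a ha => (hch a ha).locCol)
    let E : EuclideanSpace ℝ (Fin 3) ≃ₜ (Fin 3 → ℝ) := (EuclideanSpace.equiv (Fin 3) ℝ).toHomeomorph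
    have hmaps : MapsTo Subtype.val B (C.Bd P) := fun x hx => hBB ▸ mem_image_of_mem _ hx
    obtain ⟨Ψ, h1, h2, h3, h4⟩ := ball_of_collar (V := EuclideanSpace ℝ (Fin 3)) hBc hne hc hi h0 hop
      (j := jj ∘ E) (hjj.comp E.isOpenEmbedding) (by rw [E.surjective.range_comp, hjjr])
      (ψ := fun x => ψ x.1) (hψ.comp continuous_subtype_val.continuousOn hmaps)
      (fun x hx y hy h => Subtype.ext (hψi (hmaps hx) (hmaps hy) h))
      (by rw [← hψr, ← hBB, image_image])
    have : Nonempty (C.Hat P) := ⟨hne.some⟩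
    obtain ⟨r, hr, hrΨ⟩ := exists_inverse_compact isCompact_univ h1.continuousOn h2.injOn
    rw [image_univ, h3] at hr
    refine ⟨fun v => (r v).1, continuous_subtype_val.comp_continuousOn hr, ?_, ?_, ?_⟩
    · rw [← h3]
      rintro _ ⟨x, rfl⟩ _ ⟨y, rfl⟩ h
      have h := Subtype.ext h
      rw [hrΨ x trivial, hrΨ y trivial] at h
      rw [h]
    · rw [← h3, ← image_univ, image_image]
      ext x
      constructor
      · rintro ⟨y, _, rfl⟩
        exact (r (Ψ y)).2
      · intro hx
        refine ⟨⟨x, hx⟩, trivial, ?_⟩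
        dsimp only
        rw [hrΨ _ trivial]
    · intro x hx
      have := h4 (show (⟨x, hx.1⟩ : C.Hat P) ∈ B from hx.2)
      dsimp only at this
      show (r (ψ x)).1 = x
      rw [← this, hrΨ _ trivial]
end dc

section dc
variable {M : Type} [TopologicalSpace M] {Z : Set M}

lemma DCov.t_bd_subset (C : DCov M Z) (hZ : IsClosed Z) (hl : ∀ x ∈ Z, PlaneChart Z x) {P P' : Set M}
    (hP' : IsComp Zᶜ P') (hpre : IsPreconnected (C.Bd P)) {e : C.D}
    (he : e ∈ C.Bd P) (hte : C.t e ∈ C.Bd P') : C.t '' C.Bd P ⊆ C.Bd P' := by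
  have hA : IsPreconnected (C.t '' C.Bd P) := hpre.image _ C.t_cont.continuousOn
  have hAZ : ∀ a ∈ C.t '' C.Bd P, C.p a ∈ Z := by
    rintro _ ⟨a, ha, rfl⟩
    rw [C.p_t]; exact ha.2
  have hcl : IsClosed (C.Bd P') := isClosed_closure.inter (hZ.preimage C.cov.continuous)
  let O : Set C.D := {e | ∀ᶠ e' in 𝓝 e, C.p e' ∈ Z → e' ∈ C.Bd P'}
  have hO : IsOpen O := isOpen_setOf_eventually_nhds
  have hBO : C.Bd P' ⊆ O := by
    intro x hx
    filter_upwards [C.hat_nhds hZ hl hx.2 hP' hx.1] with y hy hyZ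
    exact ⟨hy (Or.inl hyZ), hyZ⟩
  by_contra hn
  obtain ⟨y, hy, hyB⟩ := not_subset.1 hn
  obtain ⟨z, hz, hz1, hz2⟩ := hA O (C.Bd P')ᶜ hO hcl.isOpen_compl
    (fun z _ => (em (z ∈ C.Bd P')).imp (fun h => hBO h) id) ⟨_, mem_image_of_mem _ he, hBO hte⟩ ⟨y, hy, hyB⟩
  exact hz2 (hz1.self_of_nhds (hAZ z hz))

lemma DCov.p_L (C : DCov M Z) {P : Set M} (hP : P ⊆ Zᶜ) : C.p '' C.L P = P := by
  apply Subset.antisymm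
  · rintro _ ⟨e, he, rfl⟩
    exact he.1
  · intro x hx
    obtain ⟨e, rfl⟩ := C.surj x
    by_cases h : C.lab e = false
    · exact ⟨e, ⟨hx, h⟩, rfl⟩
    · refine ⟨C.t e, ⟨by rw [C.p_t]; exact hx, ?_⟩, C.p_t e⟩
      rw [C.lab_t e (hP hx)]
      simpa using h

lemma DCov.p_hat_nhds (C : DCov M Z) (hZ : IsClosed Z) (hl : ∀ x ∈ Z, PlaneChart Z x) {P P' : Set M}
    (hP : IsComp Zᶜ P) (hP' : IsComp Zᶜ P') (ht : C.t '' C.Bd P ⊆ C.Bd P') {e : C.D} (he : e ∈ C.Hat P) :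
    C.p '' (C.Hat P ∪ C.Hat P') ∈ 𝓝 (C.p e) := by
  by_cases hpe : C.p e ∈ Z
  · have h1 := C.hat_nhds hZ hl hpe hP he
    have hte := ht (mem_image_of_mem _ (⟨he, hpe⟩ : e ∈ C.Bd P))
    have h2 := C.t_cont.continuousAt.eventually (C.hat_nhds hZ hl hte.2 hP' hte.1)
    have hopen : IsOpenMap C.p := C.cov.isLocalHomeomorph.isOpenMap
    refine Filter.mem_of_superset (hopen.image_mem_nhds (h1.and h2)) ?_
    rintro _ ⟨x, ⟨hx1, hx2⟩, rfl⟩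
    by_cases hxZ : C.p x ∈ Z
    · exact ⟨x, Or.inl (hx1 (Or.inl hxZ)), rfl⟩
    · by_cases hxl : C.lab x = false
      · exact ⟨x, Or.inl (hx1 (Or.inr hxl)), rfl⟩
      · refine ⟨C.t x, Or.inr (hx2 (Or.inr ?_)), C.p_t x⟩
        rw [C.lab_t x hxZ]
        simpa using hxl
  · have h := (C.hat_off hZ hP he hpe).1
    refine Filter.mem_of_superset (hP.2.1.mem_nhds h) ?_
    intro x hx
    rw [← C.p_L hP.2.2.2.1] at hx
    exact image_mono (fun y hy => Or.inl (subset_closure hy)) hx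

theorem DCov.pair [CompactSpace M] [T2Space M] [SecondCountableTopology M] [LocallyConnectedSpace M]
    [PreconnectedSpace M] (C : DCov M Z) (hZ : IsClosed Z) (hl : ∀ x ∈ Z, PlaneChart Z x) (hne : Z.Nonempty)
    (hpre : ∀ P, IsComp Zᶜ P → IsPreconnected (C.Bd P)) :
    ∃ P P', IsComp Zᶜ P ∧ IsComp Zᶜ P' ∧ C.t '' C.Bd P = C.Bd P' ∧
      C.p '' (C.Hat P ∪ C.Hat P') = univ := by
  have := C.t2
  have := C.compact
  obtain ⟨x, hx⟩ := hne
  obtain ⟨e, rfl⟩ := C.surj x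
  obtain ⟨P, hP, he⟩ := C.exists_hat hZ hl hx
  have htx : C.p (C.t e) ∈ Z := by rw [C.p_t]; exact hx
  obtain ⟨P', hP', he'⟩ := C.exists_hat hZ hl htx
  have s1 := C.t_bd_subset hZ hl hP' (hpre P hP) ⟨he, hx⟩ ⟨he', htx⟩
  have s2 := C.t_bd_subset hZ hl hP (hpre P' hP') (e := C.t e) ⟨he', htx⟩ (by rw [C.t_t]; exact ⟨he, hx⟩)
  refine ⟨P, P', hP, hP', Subset.antisymm s1 ?_, ?_⟩
  · intro y hy
    exact ⟨C.t y, s2 (mem_image_of_mem _ hy), C.t_t y⟩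
  · refine IsClopen.eq_univ (s := C.p '' (C.Hat P ∪ C.Hat P')) ?_ ⟨C.p e, e, Or.inl he, rfl⟩
    constructor
    · exact (((isClosed_closure.union isClosed_closure).isCompact).image C.cov.continuous).isClosed
    · rw [isOpen_iff_mem_nhds]
      rintro _ ⟨y, hy | hy, rfl⟩
      · exact C.p_hat_nhds hZ hl hP hP' s1 hy
      · rw [union_comm]
        exact C.p_hat_nhds hZ hl hP' hP s2 hy
end dc

/-! ### Gluing two balls to a 3-sphere -/

abbrev E3 := EuclideanSpace ℝ (Fin 3)
abbrev E4 := EuclideanSpace ℝ (Fin 4)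

noncomputable def pr (w : E4) : E3 := !₂[w 0, w 1, w 2]
noncomputable def hemi (v : E3) (t : ℝ) : E4 := !₂[v 0, v 1, v 2, t]

lemma pr_cont : Continuous pr := by
  unfold pr
  apply (PiLp.continuous_toLp 2 _).comp
  refine continuous_pi fun i => ?_
  fin_cases i <;> simp <;> fun_prop

lemma pr_norm (w : E4) : ‖pr w‖ ^ 2 + w 3 ^ 2 = ‖w‖ ^ 2 := by
  rw [EuclideanSpace.real_norm_sq_eq, EuclideanSpace.real_norm_sq_eq, Fin.sum_univ_three, Fin.sum_univ_four]
  simp [pr]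

lemma pr_hemi (v : E3) (t : ℝ) : pr (hemi v t) = v := by
  ext i
  fin_cases i <;> simp [pr, hemi]

lemma hemi_three (v : E3) (t : ℝ) : hemi v t 3 = t := by simp [hemi]

lemma hemi_mem {v : E3} {t : ℝ} (h : ‖v‖ ^ 2 + t ^ 2 = 1) : hemi v t ∈ sphere (0 : E4) 1 := by
  rw [mem_sphere_zero_iff_norm]
  have := pr_norm (hemi v t)
  rw [pr_hemi, hemi_three, h] at this
  nlinarith [norm_nonneg (hemi v t)]

lemma pr_mem {w : E4} (hw : w ∈ sphere (0 : E4) 1) : ‖pr w‖ ^ 2 + w 3 ^ 2 = 1 := by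
  rw [pr_norm, mem_sphere_zero_iff_norm.1 hw, one_pow]

lemma pr_ball {w : E4} (hw : w ∈ sphere (0 : E4) 1) : pr w ∈ closedBall (0 : E3) 1 := by
  rw [mem_closedBall_zero_iff]
  nlinarith [pr_mem hw, norm_nonneg (pr w), sq_nonneg (w 3)]

lemma pr_ext {w w' : E4} (h : pr w = pr w') (h3 : w 3 = w' 3) : w = w' := by
  have h0 := congrArg (fun v : E3 => v 0) h
  have h1 := congrArg (fun v : E3 => v 1) h
  have h2 := congrArg (fun v : E3 => v 2) h
  simp [pr] at h0 h1 h2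
  ext i
  fin_cases i <;> simp [h0, h1, h2, h3]

lemma pr_neg (w : E4) : pr (-w) = - pr w := by
  ext i
  fin_cases i <;> simp [pr]

lemma glue3 {Y : Type*} [TopologicalSpace Y] {f g : E3 → Y} (hf : ContinuousOn f (closedBall 0 1))
    (hg : ContinuousOn g (closedBall 0 1)) (h : ∀ v : E3, ‖v‖ = 1 → f v = g v) :
    ∃ N : sphere (0 : E4) 1 → Y, Continuous N ∧ (∀ w, 0 ≤ w.1 3 → N w = f (pr w)) ∧
      ∀ w, w.1 3 ≤ 0 → N w = g (pr w) := by
  classical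
  have h3 : Continuous (fun w : sphere (0 : E4) 1 => w.1 3) := by fun_prop
  have hpr : Continuous (fun w : sphere (0 : E4) 1 => pr w.1) := pr_cont.comp continuous_subtype_val
  have e0 : ∀ w : sphere (0 : E4) 1, w.1 3 = 0 → f (pr w) = g (pr w) := by
    intro w hw
    apply h
    have := pr_mem w.2
    rw [hw] at this
    nlinarith [norm_nonneg (pr w)]
  refine ⟨fun w => if 0 ≤ w.1 3 then f (pr w) else g (pr w), ?_, ?_, ?_⟩
  · apply Continuous.if_le (hf.comp_continuous hpr (fun w => pr_ball w.2))
      (hg.comp_continuous hpr (fun w => pr_ball w.2)) continuous_const h3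
    intro w hw
    exact e0 w hw.symm
  · intro w hw
    simp [hw]
  · intro w hw
    by_cases h0 : 0 ≤ w.1 3
    · simp only [h0, if_true]
      exact e0 w (le_antisymm hw h0)
    · simp [h0]

lemma quot_homeo {X Y : Type*} [TopologicalSpace X] [TopologicalSpace Y] [CompactSpace X] [T2Space Y]
    {r : X → X → Prop} {N : X → Y} (hN : Continuous N) (hs : Function.Surjective N)
    (hr : ∀ x y, r x y → N x = N y) (hi : ∀ x y, N x = N y → x = y ∨ r x y) : Nonempty (Y ≃ₜ Quot r) := by
  have hc : Continuous (Quot.lift N hr) := continuous_quot_lift hr hN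
  have hb : Function.Bijective (Quot.lift N hr) := by
    constructor
    · rintro ⟨x⟩ ⟨y⟩ h
      rcases hi x y h with h | h
      · rw [h]
      · exact Quot.sound h
    · intro y
      obtain ⟨x, rfl⟩ := hs y
      exact ⟨Quot.mk _ x, rfl⟩
  exact ⟨(Continuous.homeoOfEquivCompactToT2 (f := Equiv.ofBijective _ hb) hc).symm⟩

lemma bij_homeo {X Y : Type*} [TopologicalSpace X] [TopologicalSpace Y] [CompactSpace X] [T2Space Y]
    {N : X → Y} (hN : Continuous N) (hs : Function.Surjective N)
    (hi : Function.Injective N) : Nonempty (Y ≃ₜ X) :=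
  ⟨(Continuous.homeoOfEquivCompactToT2 (f := Equiv.ofBijective N ⟨hi, hs⟩) hN).symm⟩

lemma hemi_sqrt {v : E3} (hv : v ∈ closedBall (0 : E3) 1) :
    ‖v‖ ^ 2 + (Real.sqrt (1 - ‖v‖ ^ 2)) ^ 2 = 1 := by
  rw [mem_closedBall_zero_iff] at hv
  rw [Real.sq_sqrt]
  · ring
  · nlinarith [norm_nonneg v]

lemma three_eq {w w' : E4} (hw : w ∈ sphere (0 : E4) 1) (hw' : w' ∈ sphere (0 : E4) 1)
    (h : ‖pr w‖ = ‖pr w'‖) : w 3 ^ 2 = w' 3 ^ 2 := by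
  have h1 := pr_mem hw
  have h2 := pr_mem hw'
  rw [h] at h1
  linarith

lemma three_zero {w : E4} (hw : w ∈ sphere (0 : E4) 1) (h : ‖pr w‖ = 1) : w 3 = 0 := by
  have h1 := pr_mem hw
  rw [h] at h1
  nlinarith

lemma glueB {Y : Type*} [TopologicalSpace Y] [T2Space Y] {f g : E3 → Y}
    (hf : ContinuousOn f (closedBall 0 1)) (hg : ContinuousOn g (closedBall 0 1))
    (fi : InjOn f (closedBall 0 1)) (gi : InjOn g (closedBall 0 1))
    (h : ∀ v : E3, ‖v‖ = 1 → f v = g v)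
    (hfg : ∀ v ∈ closedBall (0 : E3) 1, ∀ v' ∈ closedBall (0 : E3) 1, f v = g v' → ‖v‖ = 1 ∧ v' = v)
    (hs : ∀ y, ∃ v ∈ closedBall (0 : E3) 1, f v = y ∨ g v = y) :
    Nonempty (Y ≃ₜ sphere (0 : E4) 1) := by
  obtain ⟨N, hN, hp, hn⟩ := glue3 hf hg h
  apply bij_homeo hN
  · intro y
    obtain ⟨v, hv, rfl | rfl⟩ := hs y
    · refine ⟨⟨hemi v (Real.sqrt (1 - ‖v‖ ^ 2)), hemi_mem (hemi_sqrt hv)⟩, ?_⟩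
      rw [hp _ (by simp only [hemi_three]; positivity), pr_hemi]
    · refine ⟨⟨hemi v (-Real.sqrt (1 - ‖v‖ ^ 2)), hemi_mem (by rw [neg_sq]; exact hemi_sqrt hv)⟩, ?_⟩
      rw [hn _ (by simp only [hemi_three]; simp), pr_hemi]
  · have mix : ∀ w w' : sphere (0 : E4) 1, 0 ≤ w.1 3 → w'.1 3 ≤ 0 → N w = N w' → w = w' := by
      intro w w' h1 h2 he
      rw [hp w h1, hn w' h2] at he
      obtain ⟨a, b⟩ := hfg _ (pr_ball w.2) _ (pr_ball w'.2) he
      apply Subtype.ext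
      apply pr_ext b.symm
      rw [three_zero w.2 a, three_zero w'.2 (by rw [b, a])]
    intro w w' he
    rcases le_total 0 (w.1 3) with h1 | h1 <;> rcases le_total 0 (w'.1 3) with h2 | h2
    · rw [hp w h1, hp w' h2] at he
      have e := fi (pr_ball w.2) (pr_ball w'.2) he
      apply Subtype.ext
      apply pr_ext e
      have := three_eq w.2 w'.2 (by rw [e])
      nlinarith
    · exact mix w w' h1 h2 he
    · exact (mix w' w h2 h1 he.symm).symm
    · rw [hn w h1, hn w' h2] at he
      have e := gi (pr_ball w.2) (pr_ball w'.2) he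
      apply Subtype.ext
      apply pr_ext e
      have := three_eq w.2 w'.2 (by rw [e])
      nlinarith

lemma glueA {Y : Type*} [TopologicalSpace Y] [T2Space Y] {f : E3 → Y}
    (hf : ContinuousOn f (closedBall 0 1))
    (h : ∀ v : E3, ‖v‖ = 1 → f (-v) = f v)
    (hff : ∀ v ∈ closedBall (0 : E3) 1, ∀ v' ∈ closedBall (0 : E3) 1, f v = f v' →
      v' = v ∨ (‖v‖ = 1 ∧ v' = -v))
    (hs : ∀ y, ∃ v ∈ closedBall (0 : E3) 1, f v = y) :
    Nonempty (Y ≃ₜ Quot (fun x y : sphere (0 : E4) 1 => (y : E4) = -(x : E4))) := by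
  have hg : ContinuousOn (fun v => f (-v)) (closedBall 0 1) := by
    apply hf.comp continuous_neg.continuousOn
    intro v hv
    simpa using hv
  obtain ⟨N, hN, hp, hn⟩ := glue3 hf hg (fun v hv => (h v hv).symm)
  have neg : ∀ w w' : sphere (0 : E4) 1, (w' : E4) = - (w : E4) → N w = N w' := by
    intro w w' he
    have e3 : w'.1 3 = - w.1 3 := by rw [he]; simp
    have ep : pr w' = - pr w := by rw [he, pr_neg]
    rcases le_total 0 (w.1 3) with h1 | h1
    · rw [hp w h1, hn w' (by linarith), ep, neg_neg]
    · rw [hn w h1, hp w' (by linarith), ep]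
  have pos : ∀ w w' : sphere (0 : E4) 1, 0 ≤ w.1 3 → 0 ≤ w'.1 3 → N w = N w' → w = w' ∨ (w' : E4) = - (w : E4) := by
    intro w w' h1 h2 he
    rw [hp w h1, hp w' h2] at he
    rcases hff _ (pr_ball w.2) _ (pr_ball w'.2) he with e | ⟨a, e⟩
    · left
      apply Subtype.ext
      apply pr_ext e.symm
      have := three_eq w.2 w'.2 (by rw [e])
      nlinarith
    · right
      apply pr_ext
      · rw [e, pr_neg]
      · rw [PiLp.neg_apply, three_zero w.2 a, three_zero w'.2 (by rw [e, norm_neg, a]), neg_zero]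
  apply quot_homeo hN
  · intro y
    obtain ⟨v, hv, rfl⟩ := hs y
    refine ⟨⟨hemi v (Real.sqrt (1 - ‖v‖ ^ 2)), hemi_mem (hemi_sqrt hv)⟩, ?_⟩
    rw [hp _ (by simp only [hemi_three]; positivity), pr_hemi]
  · exact neg
  · have key : ∀ w : sphere (0 : E4) 1, ∃ w' : sphere (0 : E4) 1, 0 ≤ w'.1 3 ∧ N w' = N w ∧
        ((w' : E4) = (w : E4) ∨ (w' : E4) = - (w : E4)) := by
      intro w
      rcases le_total 0 (w.1 3) with h1 | h1
      · exact ⟨w, h1, rfl, Or.inl rfl⟩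
      · exact ⟨-w, by simpa using h1, (neg w (-w) rfl).symm, Or.inr rfl⟩
    intro w w' he
    obtain ⟨a, a3, ha, ea⟩ := key w
    obtain ⟨b, b3, hb, eb⟩ := key w'
    have hab : (b : E4) = a ∨ (b : E4) = - (a : E4) := by
      rcases pos a b a3 b3 (by rw [ha, hb, he]) with h | h
      · left; rw [h]
      · right; exact h
    have fin : (w' : E4) = w ∨ (w' : E4) = - (w : E4) := by
      rcases ea with ea | ea <;> rcases eb with eb | eb <;> rcases hab with h | h <;> rw [ea, eb] at h <;>
        (try simp only [neg_neg, neg_inj] at h) <;>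
        first
        | exact Or.inl h
        | exact Or.inr h
        | exact Or.inr (by rw [← h, neg_neg])
    rcases fin with h | h
    · exact Or.inl (Subtype.ext h.symm)
    · exact Or.inr h

section main
variable {M : Type} [TopologicalSpace M] {Z : Set M}

lemma DCov.hat_inj (C : DCov M Z) (hZ : IsClosed Z) {P : Set M} (hP : IsComp Zᶜ P) {e e' : C.D}
    (he : e ∈ C.Hat P) (he' : e' ∈ C.Hat P) (h : C.p e = C.p e') :
    e' = e ∨ (e ∈ C.Bd P ∧ e' ∈ C.Bd P ∧ e' = C.t e) := by
  by_cases hz : C.p e ∈ Z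
  · rcases C.fib e e' h with h1 | h1
    · exact Or.inl h1
    · exact Or.inr ⟨⟨he, hz⟩, ⟨he', by rw [mem_preimage, ← h]; exact hz⟩, h1⟩
  · have h1 := C.hat_off hZ hP he hz
    have h2 := C.hat_off hZ hP he' (by rw [← h]; exact hz)
    exact Or.inl (C.uniq h hz (by rw [h1.2, h2.2])).symm

/-- the parametrisation of a hat compatible with `ψ` -/
lemma DCov.hat_par (C : DCov M Z) {P : Set M} {ψ : C.D → E3} {Φ : E3 → C.D}
    (him : ψ '' (C.Bd P) = sphere 0 1)
    (hi : InjOn Φ (closedBall 0 1)) (hr : Φ '' closedBall 0 1 = C.Hat P)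
    (hψ : ∀ x ∈ C.Bd P, Φ (ψ x) = x) :
    (∀ v, ‖v‖ = 1 → Φ v ∈ C.Bd P ∧ ψ (Φ v) = v) ∧
    ∀ v ∈ closedBall (0 : E3) 1, Φ v ∈ C.Bd P → ‖v‖ = 1 := by
  constructor
  · intro v hv
    have : v ∈ ψ '' C.Bd P := by rw [him]; simpa using hv
    obtain ⟨x, hx, rfl⟩ := this
    rw [hψ x hx]
    exact ⟨hx, rfl⟩
  · intro v hv hb
    have h1 : ψ (Φ v) ∈ sphere (0 : E3) 1 := by rw [← him]; exact mem_image_of_mem _ hb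
    have h2 := hi (sphere_subset_closedBall h1) hv (hψ _ hb)
    rw [← h2]
    simpa using h1

theorem DCov.main_B [CompactSpace M] [T2Space M] [SecondCountableTopology M] (C : DCov M Z)
    (hZ : IsClosed Z) (hl : ∀ x ∈ Z, PlaneChart Z x) {P P' : Set M} (hP : IsComp Zᶜ P) (hP' : IsComp Zᶜ P')
    {j j' : (Fin 3 → ℝ) → M} (hj : IsOpenEmbedding j) (hjr : range j = P)
    (hj' : IsOpenEmbedding j') (hjr' : range j' = P') (hne : P ≠ P')
    (ht : C.t '' C.Bd P = C.Bd P') (hu : C.p '' (C.Hat P ∪ C.Hat P') = univ)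
    (ψ : C.D → E3) (hψc : ContinuousOn ψ (C.Bd P)) (hψi : InjOn ψ (C.Bd P))
    (hψ : ψ '' C.Bd P = sphere 0 1) :
    Nonempty (Z ≃ₜ sphere (0 : E3) 1) ∧ Nonempty (M ≃ₜ sphere (0 : E4) 1) := by
  obtain ⟨-, -, -, -, h5⟩ := C.hat_main hZ hl hP hj hjr
  obtain ⟨-, -, -, -, h5'⟩ := C.hat_main hZ hl hP' hj' hjr'
  obtain ⟨Φ, Φc, Φi, Φr, hΦ⟩ := h5 ψ hψc hψi hψ
  have tm : MapsTo C.t (C.Bd P') (C.Bd P) := by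
    intro x hx
    rw [← ht] at hx
    obtain ⟨y, hy, rfl⟩ := hx
    rw [C.t_t]; exact hy
  have tm' : MapsTo C.t (C.Bd P) (C.Bd P') := by
    intro x hx
    rw [← ht]; exact mem_image_of_mem _ hx
  have him' : (ψ ∘ C.t) '' C.Bd P' = sphere 0 1 := by
    rw [← ht, ← hψ, ← image_comp]
    apply image_congr
    intro x _
    simp [C.t_t]
  obtain ⟨Φ', Φc', Φi', Φr', hΦ'⟩ := h5' (ψ ∘ C.t) (hψc.comp C.t_cont.continuousOn tm)
    (by
      intro x hx y hy h
      have := hψi (tm hx) (tm hy) h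
      rw [← C.t_t x, this, C.t_t]) him'
  obtain ⟨a1, a2⟩ := C.hat_par hψ Φi Φr hΦ
  obtain ⟨b1, b2⟩ := C.hat_par him' Φi' Φr' hΦ'
  have nb : ∀ e, e ∈ C.Bd P → e ∈ C.Bd P' → False := fun e h h' =>
    hne (C.hat_unique hZ hl h.2 hP hP' h.1 h'.1)
  have mΦ : ∀ v ∈ closedBall (0 : E3) 1, Φ v ∈ C.Hat P := fun v hv => by
    rw [← Φr]; exact mem_image_of_mem _ hv
  have mΦ' : ∀ v ∈ closedBall (0 : E3) 1, Φ' v ∈ C.Hat P' := fun v hv => by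
    rw [← Φr']; exact mem_image_of_mem _ hv
  have fi : InjOn (C.p ∘ Φ) (closedBall 0 1) := by
    intro v hv v' hv' h
    rcases C.hat_inj hZ hP (mΦ v hv) (mΦ v' hv') h with h1 | ⟨h1, h2, h3⟩
    · exact Φi hv hv' h1.symm
    · exact (nb _ h2 (by rw [h3]; exact tm' h1)).elim
  have gi : InjOn (C.p ∘ Φ') (closedBall 0 1) := by
    intro v hv v' hv' h
    rcases C.hat_inj hZ hP' (mΦ' v hv) (mΦ' v' hv') h with h1 | ⟨h1, h2, h3⟩
    · exact Φi' hv hv' h1.symm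
    · exact (nb _ (by rw [h3]; exact tm h1) h2).elim
  have fg : ∀ v : E3, ‖v‖ = 1 → C.p (Φ v) = C.p (Φ' v) := by
    intro v hv
    obtain ⟨x1, x2⟩ := a1 v hv
    have := hΦ' (C.t (Φ v)) (tm' x1)
    rw [Function.comp, C.t_t, x2] at this
    rw [this, C.p_t]
  have fc := C.cov.continuous.comp_continuousOn Φc
  have gc := C.cov.continuous.comp_continuousOn Φc'
  have hs : ∀ y, ∃ v ∈ closedBall (0 : E3) 1, C.p (Φ v) = y ∨ C.p (Φ' v) = y := by
    intro y
    have : y ∈ C.p '' (C.Hat P ∪ C.Hat P') := by rw [hu]; trivial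
    obtain ⟨e, he | he, rfl⟩ := this
    · rw [← Φr] at he
      obtain ⟨v, hv, rfl⟩ := he
      exact ⟨v, hv, Or.inl rfl⟩
    · rw [← Φr'] at he
      obtain ⟨v, hv, rfl⟩ := he
      exact ⟨v, hv, Or.inr rfl⟩
  constructor
  · have mz : ∀ v : sphere (0 : E3) 1, C.p (Φ v) ∈ Z := fun v => (a1 v (by simpa using v.2)).1.2
    apply bij_homeo (N := fun v : sphere (0 : E3) 1 => (⟨C.p (Φ v), mz v⟩ : Z))
    · exact (fc.comp_continuous continuous_subtype_val
        (fun v => sphere_subset_closedBall v.2)).subtype_mk _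
    · rintro ⟨y, hy⟩
      obtain ⟨v, hv, rfl | rfl⟩ := hs y
      · exact ⟨⟨v, by simpa using a2 v hv ⟨mΦ v hv, hy⟩⟩, rfl⟩
      · have n1 := b2 v hv ⟨mΦ' v hv, hy⟩
        exact ⟨⟨v, by simpa using n1⟩, Subtype.ext (fg v n1)⟩
    · intro v v' h
      exact Subtype.ext (fi (sphere_subset_closedBall v.2) (sphere_subset_closedBall v'.2)
        (congrArg Subtype.val h))
  · apply glueB fc gc fi gi fg _ hs
    intro v hv v' hv' h
    have h : C.p (Φ v) = C.p (Φ' v') := h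
    by_cases hz : C.p (Φ v) ∈ Z
    · have n1 := a2 v hv ⟨mΦ v hv, hz⟩
      have n2 := b2 v' hv' ⟨mΦ' v' hv', by rw [mem_preimage, ← h]; exact hz⟩
      refine ⟨n1, ?_⟩
      rw [← fg v' n2] at h
      exact (fi hv hv' h).symm
    · have q1 := (C.hat_off hZ hP (mΦ v hv) hz).1
      have q2 := (C.hat_off hZ hP' (mΦ' v' hv') (by rw [← h]; exact hz)).1
      rw [← h] at q2
      exact (hne (hP.eq hP' ⟨_, q1, q2⟩)).elim

theorem DCov.main_A [CompactSpace M] [T2Space M] [SecondCountableTopology M] (C : DCov M Z)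
    (hZ : IsClosed Z) (hl : ∀ x ∈ Z, PlaneChart Z x) {P : Set M} (hP : IsComp Zᶜ P)
    {j : (Fin 3 → ℝ) → M} (hj : IsOpenEmbedding j) (hjr : range j = P)
    (ht : C.t '' C.Bd P = C.Bd P) (hu : C.p '' (C.Hat P) = univ)
    (ψ : C.D → E3) (hψc : ContinuousOn ψ (C.Bd P)) (hψi : InjOn ψ (C.Bd P))
    (hψ : ψ '' C.Bd P = sphere 0 1) (hψt : ∀ x ∈ C.Bd P, ψ (C.t x) = - ψ x) :
    Nonempty (Z ≃ₜ Quot (fun x y : sphere (0 : E3) 1 => (y : E3) = -(x : E3))) ∧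
    Nonempty (M ≃ₜ Quot (fun x y : sphere (0 : E4) 1 => (y : E4) = -(x : E4))) := by
  obtain ⟨-, -, -, -, h5⟩ := C.hat_main hZ hl hP hj hjr
  obtain ⟨Φ, Φc, Φi, Φr, hΦ⟩ := h5 ψ hψc hψi hψ
  have tm : MapsTo C.t (C.Bd P) (C.Bd P) := by
    intro x hx
    rw [← ht]; exact mem_image_of_mem _ hx
  obtain ⟨a1, a2⟩ := C.hat_par hψ Φi Φr hΦ
  have mΦ : ∀ v ∈ closedBall (0 : E3) 1, Φ v ∈ C.Hat P := fun v hv => by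
    rw [← Φr]; exact mem_image_of_mem _ hv
  have neg : ∀ v : E3, ‖v‖ = 1 → Φ (-v) = C.t (Φ v) := by
    intro v hv
    obtain ⟨x1, x2⟩ := a1 v hv
    have := hΦ _ (tm x1)
    rwa [hψt _ x1, x2] at this
  have pneg : ∀ v : E3, ‖v‖ = 1 → C.p (Φ (-v)) = C.p (Φ v) := fun v hv => by rw [neg v hv, C.p_t]
  have ff : ∀ v ∈ closedBall (0 : E3) 1, ∀ v' ∈ closedBall (0 : E3) 1, C.p (Φ v) = C.p (Φ v') →
      v' = v ∨ (‖v‖ = 1 ∧ v' = -v) := by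
    intro v hv v' hv' h
    rcases C.hat_inj hZ hP (mΦ v hv) (mΦ v' hv') h with h1 | ⟨h1, h2, h3⟩
    · exact Or.inl (Φi hv' hv h1)
    · have n1 := a2 v hv h1
      refine Or.inr ⟨n1, ?_⟩
      rw [← neg v n1] at h3
      exact Φi hv' (by simpa using hv) h3
  have hs : ∀ y, ∃ v ∈ closedBall (0 : E3) 1, C.p (Φ v) = y := by
    intro y
    have : y ∈ C.p '' (C.Hat P) := by rw [hu]; trivial
    obtain ⟨e, he, rfl⟩ := this
    rw [← Φr] at he
    obtain ⟨v, hv, rfl⟩ := he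
    exact ⟨v, hv, rfl⟩
  have fc := C.cov.continuous.comp_continuousOn Φc
  constructor
  · have mz : ∀ v : sphere (0 : E3) 1, C.p (Φ v) ∈ Z := fun v => (a1 v (by simpa using v.2)).1.2
    apply quot_homeo (N := fun v : sphere (0 : E3) 1 => (⟨C.p (Φ v), mz v⟩ : Z))
    · exact (fc.comp_continuous continuous_subtype_val
        (fun v => sphere_subset_closedBall v.2)).subtype_mk _
    · rintro ⟨y, hy⟩
      obtain ⟨v, hv, rfl⟩ := hs y
      exact ⟨⟨v, by simpa using a2 v hv ⟨mΦ v hv, hy⟩⟩, rfl⟩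
    · intro v v' h
      apply Subtype.ext
      show C.p (Φ v) = C.p (Φ v')
      rw [h, pneg v (by simpa using v.2)]
    · intro v v' h
      rcases ff _ (sphere_subset_closedBall v.2) _ (sphere_subset_closedBall v'.2)
        (congrArg Subtype.val h) with h | ⟨-, h⟩
      · exact Or.inl (Subtype.ext h.symm)
      · exact Or.inr h
  · exact glueA fc pneg ff hs
end main

/-! ### The round two-sphere -/

abbrev SS := sphere (0 : E3) 1

noncomputable def ret (z : ℂ) : ℂ := (((max 1 ‖z‖)⁻¹ : ℝ) : ℂ) * z

lemma ret_cont : Continuous ret := by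
  have h : Continuous (fun z : ℂ => (max 1 ‖z‖)⁻¹) :=
    (continuous_const.max continuous_norm).inv₀ (fun z => by positivity)
  exact (Complex.continuous_ofReal.comp h).mul continuous_id

lemma ret_le (z : ℂ) : ‖ret z‖ ≤ 1 := by
  rw [ret, norm_mul, Complex.norm_real, norm_inv, Real.norm_of_nonneg (by positivity), inv_mul_le_iff₀ (by positivity)]
  simp

lemma ret_eq {z : ℂ} (hz : ‖z‖ ≤ 1) : ret z = z := by
  simp [ret, max_eq_left hz]

lemma norm_sq_three (w : E3) : ‖w‖ ^ 2 = w 0 ^ 2 + w 1 ^ 2 + w 2 ^ 2 := by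
  rw [EuclideanSpace.real_norm_sq_eq, Fin.sum_univ_three]

lemma cnorm_sq (z : ℂ) : ‖z‖ ^ 2 = z.re ^ 2 + z.im ^ 2 := by
  rw [Complex.sq_norm, Complex.normSq_apply]; ring

noncomputable def up (z : ℂ) : SS := ⟨!₂[(ret z).re, (ret z).im, Real.sqrt (1 - ‖ret z‖ ^ 2)], by
  have h := ret_le z
  have h0 : 0 ≤ 1 - ‖ret z‖ ^ 2 := by nlinarith [norm_nonneg (ret z)]
  rw [mem_sphere_zero_iff_norm]
  have : ‖(!₂[(ret z).re, (ret z).im, Real.sqrt (1 - ‖ret z‖ ^ 2)] : E3)‖ ^ 2 = 1 := by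
    rw [norm_sq_three]
    have h1 := Real.sq_sqrt h0
    have h2 := cnorm_sq (ret z)
    simp
    linarith
  nlinarith [norm_nonneg (!₂[(ret z).re, (ret z).im, Real.sqrt (1 - ‖ret z‖ ^ 2)] : E3)]⟩

def cmp (w : SS) : ℂ := ⟨w.1 0, w.1 1⟩

lemma up_cont : Continuous up := by
  refine Continuous.subtype_mk ?_ _
  apply (PiLp.continuous_toLp 2 _).comp
  have := ret_cont
  refine continuous_pi fun i => ?_
  fin_cases i
  · exact Complex.continuous_re.comp ret_cont
  · exact Complex.continuous_im.comp ret_cont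
  · show Continuous (fun z => Real.sqrt (1 - ‖ret z‖ ^ 2))
    fun_prop

lemma cmp_cont : Continuous cmp := by
  have : cmp = fun w : SS => ((w.1 0 : ℝ) : ℂ) + ((w.1 1 : ℝ) : ℂ) * Complex.I := by
    ext w
    apply Complex.ext <;> simp [cmp]
  rw [this]
  fun_prop

lemma cmp_up {z : ℂ} (hz : ‖z‖ ≤ 1) : cmp (up z) = z := by
  apply Complex.ext <;> simp [cmp, up, ret_eq hz]

lemma cmp_norm (w : SS) : ‖cmp w‖ ^ 2 + w.1 2 ^ 2 = 1 := by
  have := norm_sq_three w.1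
  rw [mem_sphere_zero_iff_norm.1 w.2] at this
  rw [cnorm_sq]
  simp only [cmp]
  linarith

lemma cmp_le (w : SS) : ‖cmp w‖ ≤ 1 := by
  nlinarith [cmp_norm w, norm_nonneg (cmp w), sq_nonneg (w.1 2)]

lemma up_nonneg (z : ℂ) : 0 ≤ (up z).1 2 := by
  simp [up]

lemma cmp_ext {w w' : SS} (h : cmp w = cmp w') (h2 : w.1 2 = w'.1 2) : w = w' := by
  have h0 := congrArg Complex.re h
  have h1 := congrArg Complex.im h
  simp only [cmp] at h0 h1
  apply Subtype.ext
  ext i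
  fin_cases i <;> simp [h0, h1, h2]

lemma cmp_ext' {w w' : SS} (h : cmp w = cmp w') (h1 : 0 ≤ w.1 2) (h2 : 0 ≤ w'.1 2) : w = w' := by
  apply cmp_ext h
  have a := cmp_norm w
  have b := cmp_norm w'
  rw [h] at a
  nlinarith

lemma up_cmp {w : SS} (hw : 0 ≤ w.1 2) : up (cmp w) = w :=
  cmp_ext' (cmp_up (cmp_le w)) (up_nonneg _) hw

lemma cmp_neg (w : SS) : cmp (-w) = - cmp w := by
  apply Complex.ext <;> simp [cmp]

def Eq2 : Set SS := {w | w.1 2 = 0}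
def Upper : Set SS := {w | 0 < w.1 2}

lemma cmp_eq_one {w : SS} : w ∈ Eq2 ↔ ‖cmp w‖ = 1 := by
  have := cmp_norm w
  constructor
  · intro h
    have h : w.1 2 = 0 := h
    rw [h] at this
    nlinarith [norm_nonneg (cmp w)]
  · intro h
    rw [h] at this
    show w.1 2 = 0
    nlinarith

lemma up_circle : up '' sphere 0 1 = Eq2 := by
  ext w
  constructor
  · rintro ⟨z, hz, rfl⟩
    rw [mem_sphere_zero_iff_norm] at hz
    rw [cmp_eq_one, cmp_up hz.le, hz]
  · intro h
    refine ⟨cmp w, by simpa using cmp_eq_one.1 h, up_cmp (le_of_eq (Eq.symm h))⟩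

lemma up_ball : up '' ball 0 1 = Upper := by
  ext w
  constructor
  · rintro ⟨z, hz, rfl⟩
    rw [mem_ball_zero_iff] at hz
    refine lt_of_le_of_ne (up_nonneg _) fun h => ?_
    have : up z ∈ Eq2 := h.symm
    rw [cmp_eq_one, cmp_up hz.le] at this
    exact hz.ne this
  · intro h
    have h : 0 < w.1 2 := h
    refine ⟨cmp w, ?_, up_cmp h.le⟩
    rw [mem_ball_zero_iff]
    nlinarith [cmp_norm w, norm_nonneg (cmp w)]

lemma circ_half (t : ℝ) : circ 1 (t + 1 / 2) = - circ 1 t := by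
  unfold circ
  have : 2 * (Real.pi : ℂ) * Complex.I * ((t + 1 / 2 : ℝ) : ℂ) = 2 * Real.pi * Complex.I * t + Real.pi * Complex.I := by
    push_cast; ring
  rw [this, Complex.exp_add, Complex.exp_pi_mul_I]; ring

lemma circ_pair : IsSCCPair (circ 1 '' Icc 0 (1 / 2)) (circ 1 '' Icc (1 / 2) 1) 1 (-1) := by
  have hc := circ_cont 1
  have hh : circ 1 (1 / 2) = -1 := by
    have := circ_half 0
    rwa [zero_add, circ_zero] at this
  have i1 : InjOn (circ 1) (Icc 0 (1 / 2)) := fun s hs t ht h =>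
    circ_inj one_ne_zero h (by linarith [hs.2, ht.1]) (by linarith [hs.1, ht.2])
  have i2 : InjOn (circ 1) (Icc (1 / 2) 1) := fun s hs t ht h =>
    circ_inj one_ne_zero h (by linarith [hs.2, ht.1]) (by linarith [hs.1, ht.2])
  refine ⟨?_, ?_, ?_⟩
  · have := isArc_of_Icc (by norm_num) hc.continuousOn i1
    rwa [circ_zero, hh] at this
  · have := isArc_of_Icc_rev (by norm_num) hc.continuousOn i2
    rwa [circ_one, hh] at this
  · ext z
    constructor
    · rintro ⟨⟨s, hs, rfl⟩, ⟨t, ht, h⟩⟩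
      by_cases h1 : t - s < 1
      · have := circ_inj one_ne_zero h h1 (by linarith [hs.2, ht.1])
        have e : s = 1 / 2 := by linarith [hs.2, ht.1]
        rw [e, hh]; simp
      · have e : s = 0 := by linarith [hs.1, ht.2]
        rw [e, circ_zero]; simp
    · rintro (rfl | rfl)
      · exact ⟨⟨0, by norm_num, circ_zero 1⟩, ⟨1, by norm_num, circ_one 1⟩⟩
      · exact ⟨⟨1 / 2, by norm_num, hh⟩, ⟨1 / 2, by norm_num, hh⟩⟩

lemma circ_union : circ 1 '' Icc 0 (1 / 2) ∪ circ 1 '' Icc (1 / 2) 1 = sphere 0 1 := by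
  rw [← image_union, Icc_union_Icc_eq_Icc (by norm_num) (by norm_num)]
  ext z
  constructor
  · rintro ⟨t, -, rfl⟩
    simpa using circ_norm (by simp) t
  · intro h
    obtain ⟨t, ht, rfl⟩ := exists_circ (c₀ := 1) (z := z) (by simp) (by simpa using h)
    exact ⟨t, ⟨ht.1, ht.2.le⟩, rfl⟩

lemma circle_scc : IsSCC (sphere (0 : ℂ) 1) := ⟨_, _, _, _, circ_pair, circ_union.symm⟩

lemma up_inj : InjOn up (closedBall 0 1) := by
  intro z hz z' hz' h
  rw [mem_closedBall_zero_iff] at hz hz'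
  rw [← cmp_up hz, h, cmp_up hz']

lemma eq2_scc : IsSCC Eq2 := by
  rw [← up_circle]
  exact circle_scc.image up_cont.continuousOn (up_inj.mono sphere_subset_closedBall)

lemma two_cont : Continuous (fun w : SS => w.1 2) := by fun_prop

lemma upper_comp : IsComp Eq2ᶜ Upper := by
  have ho : IsOpen Upper := isOpen_lt continuous_const two_cont
  refine ⟨?_, ho, ?_, ?_, ?_⟩
  · rw [← up_ball]; exact ⟨_, mem_image_of_mem _ (mem_ball_self one_pos)⟩
  · rw [← up_ball]
    exact (convex_ball _ _).isPreconnected.image _ up_cont.continuousOn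
  · intro w (h : 0 < w.1 2) (h' : w.1 2 = 0)
    exact h.ne' h'
  · rw [ho.frontier_eq, compl_compl]
    rintro w ⟨h1, h2⟩
    have h3 : w ∈ {w : SS | 0 ≤ w.1 2} :=
      closure_minimal (s := Upper) (fun w h => le_of_lt h) (isClosed_le continuous_const two_cont) h1
    exact le_antisymm (not_lt.1 h2) h3

lemma ss_surf : IsSurf SS := by
  intro x
  have : Fact (Module.finrank ℝ E3 = 2 + 1) := ⟨by simp⟩
  let φ := (stereographic' (E := E3) 2 (-x)).symm
  have hs : φ.source = univ := by simp [φ]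
  have hφ : IsOpenEmbedding φ := φ.to_isOpenEmbedding hs
  have hx : x ∈ φ.target := by
    simp only [φ, OpenPartialHomeomorph.symm_target, stereographic'_source, mem_compl_iff, mem_singleton_iff]
    intro h
    have h : (x : E3) = -(x : E3) := congrArg Subtype.val h
    have h2 : (x : E3) = 0 := by
      have h3 : (2 : ℝ) • (x : E3) = 0 := by rw [two_smul]; nth_rewrite 2 [h]; simp
      simpa using h3
    have := mem_sphere_zero_iff_norm.1 x.2
    rw [h2] at this
    simp at this
  let c := φ.symm x
  have hc : φ c = x := φ.right_inv hx
  let g : ℂ ≃ₜ EuclideanSpace ℝ (Fin 2) :=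
    Complex.orthonormalBasisOneI.repr.toHomeomorph.trans (Homeomorph.addRight c)
  refine ⟨φ ∘ g, hφ.comp g.isOpenEmbedding, ?_⟩
  simp [g, hc]

lemma ss_sep : SepProp SS := by
  have hne : ∀ y ∈ Ext 0, (WithLp.toLp 2 y : E3) ≠ 0 := by
    intro y hy h
    have h' : ∀ i, y i = 0 := fun i => congrArg (fun v : E3 => v i) h
    rcases hy with hy | hy | hy <;> simp [h'] at hy
  let N : (Fin 3 → ℝ) → E3 := fun y => (‖(WithLp.toLp 2 y : E3)‖)⁻¹ • (WithLp.toLp 2 y : E3)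
  have hN : ∀ y ∈ Ext 0, N y ∈ sphere (0 : E3) 1 := by
    intro y hy
    rw [mem_sphere_zero_iff_norm, norm_smul, norm_inv, norm_norm, inv_mul_cancel₀ (norm_ne_zero_iff.2 (hne y hy))]
  have hNc : ContinuousOn N (Ext 0) := by
    have h1 : Continuous (fun y : Fin 3 → ℝ => (WithLp.toLp 2 y : E3)) := PiLp.continuous_toLp 2 _
    exact (h1.norm.continuousOn.inv₀ (fun y hy => norm_ne_zero_iff.2 (hne y hy))).smul h1.continuousOn
  have : Nonempty SS := ⟨up 0⟩
  obtain ⟨ρ, hρ, hρ'⟩ := exists_continuousOn_of_subtype (s := Ext 0) (Y := SS)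
    (g := fun y => ⟨N y, hN y y.2⟩) (hNc.domRestrict.subtype_mk _)
  have hiE : ∀ x : SS, (WithLp.ofLp x.1) ∈ Ext 0 := by
    intro x
    by_contra h
    simp only [Ext, mem_ofPred_eq, not_or, not_lt, abs_nonpos_iff] at h
    have h1 := norm_sq_three x.1
    rw [mem_sphere_zero_iff_norm.1 x.2] at h1
    rw [h.1, h.2.1, h.2.2] at h1
    norm_num at h1
  refine sepProp_of_retract ss_surf le_rfl (i := fun x : SS => WithLp.ofLp x.1) ?_ hiE hρ ?_
  · exact (PiLp.continuous_ofLp 2 _).comp continuous_subtype_val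
  · intro x
    rw [hρ' _ (hiE x)]
    apply Subtype.ext
    simp [N]

instance : PreconnectedSpace SS := by
  rw [← isPreconnected_iff_preconnectedSpace]
  apply isPreconnected_sphere
  rw [← Module.finrank_eq_rank]
  simp

/-- a compact connected surface with the separation property is a sphere -/
theorem sphere_of_sep {S : Type} [TopologicalSpace S] [CompactSpace S] [TopologicalSpace.MetrizableSpace S]
    [PreconnectedSpace S] [Nonempty S] (hS : IsSurf S) (hsep : SepProp S) : Nonempty (S ≃ₜ SS) := by
  have := hS.locallyConnectedSpace
  obtain ⟨x⟩ := ‹Nonempty S›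
  obtain ⟨e, he, -⟩ := hS x
  obtain ⟨G, hG, hGe⟩ := openEmb_inv he
  have hJ : IsSCC (e '' sphere 0 1) := circle_scc.image he.continuous.continuousOn he.injective.injOn
  have h0 : e 0 ∈ (e '' sphere 0 1)ᶜ := by
    rintro ⟨z, hz, h⟩
    rw [he.injective h] at hz
    simp at hz
  obtain ⟨F, hF, -⟩ := exists_isComp hJ.isCompact.isClosed.isOpen_compl h0
  obtain ⟨H, -⟩ := schoenflies hS hsep ss_surf ss_sep hJ hF eq2_scc upper_comp (h₀ := up ∘ G)
    (up_cont.comp_continuousOn (hG.mono (image_subset_range _ _)))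
    (by
      rintro _ ⟨z, hz, rfl⟩ _ ⟨z', hz', rfl⟩ h
      simp only [Function.comp, hGe] at h
      rw [up_inj (sphere_subset_closedBall hz) (sphere_subset_closedBall hz') h])
    (by
      rw [← up_circle, ← image_comp]
      apply image_congr
      intro z _
      simp [hGe])
  exact ⟨H⟩

lemma disc_no {f : ℂ → ℂ} (hf : Continuous f) (h1 : ∀ z, ‖z‖ ≤ 1 → f z ≠ z)
    (h2 : ∀ z, ‖z‖ = 1 → f z = -z) : False := by
  have hg : Continuous (fun z => ret z - f (ret z)) := ret_cont.sub (hf.comp ret_cont)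
  obtain ⟨L, hL, hLe⟩ := exists_log_convex convex_univ isOpen_univ hg.continuousOn
    (fun z _ => sub_ne_zero.2 (h1 _ (ret_le z)).symm)
  apply not_hasLog_punctured (p := 0) (r := 1) one_pos
  rw [continuousOn_univ] at hL
  have nz : ∀ z ∈ ball (0 : ℂ) 1 \ {0}, ‖z‖ ≠ 0 := fun z hz => norm_ne_zero_iff.2 hz.2
  refine ⟨fun z => ((Real.log ‖z‖ : ℝ) : ℂ) + L (((‖z‖⁻¹ : ℝ) : ℂ) * z) - ((Real.log 2 : ℝ) : ℂ), ?_, ?_⟩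
  · apply ContinuousOn.sub _ continuousOn_const
    apply ContinuousOn.add
    · exact Complex.continuous_ofReal.comp_continuousOn (continuous_norm.continuousOn.log nz)
    · apply hL.comp_continuousOn
      exact (Complex.continuous_ofReal.comp_continuousOn (continuous_norm.continuousOn.inv₀ nz)).mul continuousOn_id
  · intro z hz
    have hz' := nz z hz
    have hn : ‖((‖z‖⁻¹ : ℝ) : ℂ) * z‖ = 1 := by
      rw [norm_mul, Complex.norm_real, norm_inv, norm_norm, inv_mul_cancel₀ hz']
    rw [Complex.exp_sub, Complex.exp_add, hLe _ trivial, ← Complex.ofReal_exp, ← Complex.ofReal_exp,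
      Real.exp_log (by positivity), Real.exp_log (by positivity)]
    simp only [ret_eq hn.le, h2 _ hn, sub_zero]
    have hzc : ((‖z‖ : ℝ) : ℂ) ≠ 0 := by exact_mod_cast hz'
    push_cast
    field_simp
    ring

section inv
variable {S : Type} [TopologicalSpace S]

lemma inv_arc [T2Space S] [PreconnectedSpace S] [Nonempty S] (hS : IsSurf S) {τ : S → S} (τc : Continuous τ)
    (ττ : ∀ x, τ (τ x) = x) (τn : ∀ x, τ x ≠ x) :
    ∃ A a, IsArc A a (τ a) ∧ A ∩ τ '' A = {a, τ a} := by
  obtain ⟨x⟩ := ‹Nonempty S›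
  obtain ⟨B, -, γ, hc, hi, -, h0, h1⟩ := hS.exists_arc isOpen_univ isPreconnected_univ (mem_univ x) (mem_univ (τ x)) (τn x).symm
  let T : Set (ℝ × ℝ) := {q | q ∈ Icc (0 : ℝ) 1 ×ˢ Icc (0 : ℝ) 1 ∧ q.1 ≤ q.2 ∧ γ q.2 = τ (γ q.1)}
  have hK : IsCompact (Icc (0 : ℝ) 1 ×ˢ Icc (0 : ℝ) 1) := isCompact_Icc.prod isCompact_Icc
  have c1 : ContinuousOn (fun q : ℝ × ℝ => γ q.2) (Icc (0 : ℝ) 1 ×ˢ Icc (0 : ℝ) 1) :=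
    hc.comp continuousOn_snd (fun q hq => hq.2)
  have c2 : ContinuousOn (fun q : ℝ × ℝ => τ (γ q.1)) (Icc (0 : ℝ) 1 ×ˢ Icc (0 : ℝ) 1) :=
    τc.comp_continuousOn (hc.comp continuousOn_fst (fun q hq => hq.1))
  have hT : IsCompact T := by
    have h3 : IsClosed ((Icc (0 : ℝ) 1 ×ˢ Icc (0 : ℝ) 1) ∩ (fun q : ℝ × ℝ => (γ q.2, τ (γ q.1))) ⁻¹' (diagonal S)) :=
      (c1.prodMk c2).preimage_isClosed_of_isClosed hK.isClosed isClosed_diagonal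
    have h4 : IsClosed {q : ℝ × ℝ | q.1 ≤ q.2} := isClosed_le continuous_fst continuous_snd
    refine (hK.inter_right (h4.inter h3)).of_isClosed_subset ?_ ?_
    · have : T = {q : ℝ × ℝ | q.1 ≤ q.2} ∩ ((Icc (0 : ℝ) 1 ×ˢ Icc (0 : ℝ) 1) ∩ (fun q : ℝ × ℝ => (γ q.2, τ (γ q.1))) ⁻¹' (diagonal S)) := by
        ext q
        constructor
        · rintro ⟨a, b, c⟩; exact ⟨b, a, c⟩
        · rintro ⟨b, a, c⟩; exact ⟨a, b, c⟩
      rw [this]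
      exact h4.inter h3
    · rintro q ⟨a, b, c⟩
      exact ⟨a, b, a, c⟩
  have hTne : T.Nonempty := ⟨(0, 1), by simp, by simp, by simp [h0, h1]⟩
  obtain ⟨⟨s, t⟩, ⟨⟨hs, ht⟩, hst, he⟩, hmin⟩ := hT.exists_isMinOn hTne
    (f := fun q => q.2 - q.1) (by fun_prop)
  simp only at hs ht hst he
  have hmin' : ∀ u ∈ Icc (0 : ℝ) 1, ∀ v ∈ Icc (0 : ℝ) 1, u ≤ v → γ v = τ (γ u) → t - s ≤ v - u := by
    intro u hu v hv huv h
    exact hmin (show ((u, v) : ℝ × ℝ) ∈ T from ⟨⟨hu, hv⟩, huv, h⟩)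
  have hlt : s < t := lt_of_le_of_ne hst (fun h => by rw [h] at he; exact τn _ he.symm)
  have hsub : Icc s t ⊆ Icc 0 1 := Icc_subset_Icc hs.1 ht.2
  have hA := isArc_of_Icc hlt (hc.mono hsub) (hi.mono hsub)
  rw [he] at hA
  refine ⟨_, _, hA, ?_⟩
  apply Subset.antisymm
  · rintro _ ⟨⟨u, hu, rfl⟩, ⟨_, ⟨v, hv, rfl⟩, h⟩⟩
    rcases le_total v u with h3 | h3
    · have := hmin' v (hsub hv) u (hsub hu) h3 h.symm
      have e : v = s := by linarith [hu.2, hv.1]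
      rw [← h, e]; simp
    · have := hmin' u (hsub hu) v (hsub hv) h3 (by rw [← h, ττ])
      have e : u = s := by linarith [hu.1, hv.2]
      rw [e]; simp
  · rintro _ (rfl | rfl)
    · exact ⟨hA.left_mem, _, hA.right_mem, ττ _⟩
    · exact ⟨hA.right_mem, _, hA.left_mem, rfl⟩

lemma neg_half : circ 1 '' Icc (1 / 2) 1 = (fun z => -z) '' (circ 1 '' Icc 0 (1 / 2)) := by
  rw [← image_comp]
  ext z
  constructor
  · rintro ⟨t, ht, rfl⟩
    refine ⟨t - 1 / 2, ⟨by linarith [ht.1], by linarith [ht.2]⟩, ?_⟩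
    have := circ_half (t - 1 / 2)
    rw [sub_add_cancel] at this
    exact this.symm
  · rintro ⟨t, ht, rfl⟩
    exact ⟨t + 1 / 2, ⟨by linarith [ht.1], by linarith [ht.2]⟩, circ_half t⟩

lemma inv_circle [T2Space S] {τ : S → S} (τc : Continuous τ)
    (ττ : ∀ x, τ (τ x) = x) {A : Set S} {a : S} (hA : IsArc A a (τ a)) (hAA : A ∩ τ '' A = {a, τ a}) :
    IsSCC (A ∪ τ '' A) ∧ ∃ k : S → ℂ, ContinuousOn k (A ∪ τ '' A) ∧ InjOn k (A ∪ τ '' A) ∧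
      k '' (A ∪ τ '' A) = sphere 0 1 ∧ ∀ x ∈ A ∪ τ '' A, k (τ x) = - k x := by
  classical
  have τi : Function.Injective τ := fun x y h => by rw [← ττ x, h, ττ]
  have hA2 : IsArc (τ '' A) a (τ a) := by
    have := (hA.image τc.continuousOn τi.injOn).symm
    rwa [ττ] at this
  refine ⟨⟨A, τ '' A, a, τ a, ⟨hA, hA2, hAA⟩, rfl⟩, ?_⟩
  obtain ⟨k, kc, ki, kim, ka, kb⟩ := hA.exists_map circ_pair.1
  have mem2 : ∀ x, x ∈ τ '' A ↔ τ x ∈ A := fun x =>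
    ⟨by rintro ⟨y, hy, rfl⟩; rwa [ττ], fun h => ⟨_, h, ττ x⟩⟩
  let k' : S → ℂ := fun x => if x ∈ A then k x else - k (τ x)
  have e1 : ∀ x ∈ A, k' x = k x := fun x hx => by simp [k', hx]
  have e2 : ∀ x ∈ τ '' A, k' x = - k (τ x) := by
    intro x hx
    by_cases hxA : x ∈ A
    · have : x ∈ ({a, τ a} : Set S) := hAA ▸ ⟨hxA, hx⟩
      rw [e1 x hxA]
      rcases this with rfl | rfl
      · rw [ka, kb, neg_neg]
      · rw [ττ, ka, kb]
    · simp [k', hxA]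
  have hneg : ∀ x ∈ A, ∀ y ∈ A, k x = - k y → (x = a ∧ y = τ a) ∨ (x = τ a ∧ y = a) := by
    intro x hx y hy h
    have h1 : k x ∈ circ 1 '' Icc 0 (1 / 2) ∩ circ 1 '' Icc (1 / 2) 1 := by
      rw [neg_half, ← kim]
      exact ⟨mem_image_of_mem _ hx, ⟨_, mem_image_of_mem _ hy, h.symm⟩⟩
    rw [circ_pair.2.2] at h1
    rcases h1 with h1 | h1
    · left
      refine ⟨ki hx hA.left_mem (by rw [h1, ka]), ki hy hA.right_mem ?_⟩
      rw [kb, ← h1, h, neg_neg]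
    · right
      have h1 : k x = -1 := h1
      refine ⟨ki hx hA.right_mem (by rw [h1, kb]), ki hy hA.left_mem ?_⟩
      rw [ka]
      rw [h1] at h
      exact (neg_inj.1 h).symm
  have mix : ∀ x ∈ A, ∀ y ∈ τ '' A, k' x = k' y → x = y := by
    intro x hx y hy h
    rw [e1 x hx, e2 y hy] at h
    rcases hneg x hx (τ y) ((mem2 y).1 hy) h with ⟨h1, h2⟩ | ⟨h1, h2⟩
    · rw [h1, τi h2]
    · rw [h1, ← h2, ττ]
  refine ⟨k', ?_, ?_, ?_, ?_⟩
  · apply ContinuousOn.union_of_isClosed _ _ hA.isCompact.isClosed hA2.isCompact.isClosed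
    · exact kc.congr e1
    · refine ContinuousOn.congr ?_ e2
      exact (kc.comp τc.continuousOn (fun x hx => (mem2 x).1 hx)).neg
  · rintro x (hx | hx) y (hy | hy) h
    · rw [e1 x hx, e1 y hy] at h
      exact ki hx hy h
    · exact mix x hx y hy h
    · exact (mix y hy x hx h.symm).symm
    · rw [e2 x hx, e2 y hy] at h
      exact τi (ki ((mem2 x).1 hx) ((mem2 y).1 hy) (neg_inj.1 h))
  · rw [image_union, ← circ_union, neg_half, ← kim]
    congr 1
    · exact image_congr e1
    · rw [← image_comp, ← image_comp]
      apply image_congr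
      intro x hx
      rw [Function.comp, e2 _ (mem_image_of_mem _ hx), ττ]; rfl
  · rintro x (hx | hx)
    · rw [e1 x hx, e2 _ (mem_image_of_mem _ hx), ττ]
    · rw [e1 _ ((mem2 x).1 hx), e2 x hx, neg_neg]

/-- a free involution on a compact connected surface with the separation property is the antipode -/
theorem sphere_of_inv [CompactSpace S] [TopologicalSpace.MetrizableSpace S]
    [PreconnectedSpace S] [Nonempty S] (hS : IsSurf S) (hsep : SepProp S) {τ : S → S} (τc : Continuous τ)
    (ττ : ∀ x, τ (τ x) = x) (τn : ∀ x, τ x ≠ x) :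
    ∃ ψ : S → SS, Continuous ψ ∧ Function.Injective ψ ∧ Function.Surjective ψ ∧ ∀ x, ψ (τ x) = - ψ x := by
  classical
  have := hS.locallyConnectedSpace
  have τi : Function.Injective τ := fun x y h => by rw [← ττ x, h, ττ]
  obtain ⟨A, a, hA, hAA⟩ := inv_arc hS τc ττ τn
  obtain ⟨hJ, k, kc, ki, kim, kτ⟩ := inv_circle τc ττ hA hAA
  have Jτ : ∀ x ∈ A ∪ τ '' A, τ x ∈ A ∪ τ '' A := by
    rintro x (hx | ⟨y, hy, rfl⟩)
    · exact Or.inr (mem_image_of_mem _ hx)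
    · left; rwa [ττ]
  revert hJ kc ki kim kτ Jτ
  generalize A ∪ τ '' A = J
  intro hJ kc ki kim kτ Jτ
  have hJc : IsClosed J := hJ.isCompact.isClosed
  obtain ⟨x₀, hx₀⟩ : (Jᶜ).Nonempty := by
    rw [nonempty_iff_ne_empty]
    intro h
    apply hsep J hJ
    rw [h]; exact isPreconnected_empty
  obtain ⟨F, hF, -⟩ := exists_isComp hJc.isOpen_compl hx₀
  have kn : ∀ x ∈ J, ‖k x‖ = 1 := fun x hx => by
    have : k x ∈ sphere (0 : ℂ) 1 := kim ▸ mem_image_of_mem _ hx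
    simpa using this
  obtain ⟨H, hH, hHF⟩ := schoenflies hS hsep ss_surf ss_sep hJ hF eq2_scc upper_comp (h₀ := up ∘ k)
    (up_cont.comp_continuousOn kc)
    (by
      intro x hx y hy h
      exact ki hx hy (up_inj (by simpa using (kn x hx).le) (by simpa using (kn y hy).le) h))
    (by rw [image_comp, kim, up_circle])
  have hHJ : ∀ x, x ∈ J ↔ H x ∈ Eq2 := by
    intro x
    constructor
    · intro hx
      rw [← hH hx, ← up_circle]
      exact mem_image_of_mem _ (by simpa using kn x hx)
    · intro h
      rw [← up_circle, ← kim, ← image_comp] at h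
      obtain ⟨y, hy, h⟩ := h
      rw [← H.injective ((hH hy).symm.trans h)]
      exact hy
  have hHc : ∀ x, x ∈ F ∪ J ↔ 0 ≤ (H x).1 2 := by
    intro x
    rw [mem_union, hHF, hHJ, le_iff_lt_or_eq]
    exact or_congr Iff.rfl eq_comm
  have cH : ∀ x ∈ J, cmp (H x) = k x := fun x hx => by
    rw [← hH hx]; exact cmp_up (kn x hx).le
  have negJ : ∀ x ∈ J, H (τ x) = - H x := by
    intro x hx
    apply cmp_ext
    · rw [cH _ (Jτ x hx), kτ x hx, cmp_neg, cH x hx]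
    · have h1 : (H x).1 2 = 0 := (hHJ x).1 hx
      have h2 : (H (τ x)).1 2 = 0 := (hHJ _).1 (Jτ x hx)
      rw [h2]; simp [h1]
  have Jτ' : ∀ x, τ x ∈ J ↔ x ∈ J := fun x => ⟨fun h => by simpa [ττ] using Jτ _ h, Jτ x⟩
  have hτF : IsComp Jᶜ (τ ⁻¹' F) := by
    let T : S ≃ₜ S := ⟨⟨τ, τ, ττ, ττ⟩, τc, τc⟩
    have : τ ⁻¹' F = T '' F := by
      ext x
      exact ⟨fun h => ⟨τ x, h, ττ x⟩, by rintro ⟨y, hy, rfl⟩; show τ (τ y) ∈ F; rwa [ττ]⟩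
    refine ⟨?_, hF.2.1.preimage τc, ?_, ?_, ?_⟩
    · rw [this]; exact hF.1.image _
    · rw [this]; exact hF.2.2.1.image _ T.continuous.continuousOn
    · intro x hx hxJ
      exact hF.2.2.2.1 hx (Jτ x hxJ)
    · have h1 : frontier (τ ⁻¹' F) = τ ⁻¹' frontier F := (T.preimage_frontier F).symm
      rw [h1, compl_compl]
      intro x hx
      exact (Jτ' x).1 (by simpa using hF.2.2.2.2 hx)
  have hne : τ ⁻¹' F ≠ F := by
    intro heq
    have hm : ∀ x, x ∈ F ∪ J → τ x ∈ F ∪ J := by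
      rintro x (hx | hx)
      · rw [← heq] at hx; exact Or.inl hx
      · exact Or.inr (Jτ x hx)
    have hu : ∀ z, H.symm (up z) ∈ F ∪ J := fun z => by
      rw [hHc, H.apply_symm_apply]; exact up_nonneg z
    refine disc_no (f := fun z => cmp (H (τ (H.symm (up z))))) ?_ ?_ ?_
    · exact cmp_cont.comp (H.continuous.comp (τc.comp (H.symm.continuous.comp up_cont)))
    · intro z hz h
      have h1 : H (τ (H.symm (up z))) = up z := by
        apply cmp_ext' _ ((hHc _).1 (hm _ (hu z))) (up_nonneg z)
        rw [cmp_up hz]; exact h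
      have h2 : τ (H.symm (up z)) = H.symm (up z) := by
        rw [← H.symm_apply_apply (τ (H.symm (up z))), h1]
      exact τn _ h2
    · intro z hz
      have hzJ : H.symm (up z) ∈ J := by
        rw [hHJ, H.apply_symm_apply, ← up_circle]
        exact mem_image_of_mem _ (by simpa using hz)
      show cmp (H (τ (H.symm (up z)))) = -z
      rw [negJ _ hzJ, H.apply_symm_apply, cmp_neg, cmp_up hz.le]
  have hτF2 : τ ⁻¹' F = (closure F)ᶜ := by
    have ho := hS.other_face hsep hJ hF
    apply hτF.eq ho
    obtain ⟨y, hy⟩ := hτF.1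
    refine ⟨y, hy, ?_⟩
    rw [hS.closure_face hJ hF]
    rintro (h | h)
    · exact disjoint_left.1 (hτF.disjoint hF hne) hy h
    · exact hτF.2.2.2.1 hy h
  have hcl := hS.closure_face hJ hF
  have tri : ∀ x, x ∈ F ∪ J ∨ τ x ∈ F ∪ J := by
    intro x
    by_cases h : x ∈ F ∪ J
    · exact Or.inl h
    · right; left
      have : x ∈ τ ⁻¹' F := by rw [hτF2, hcl]; exact h
      exact this
  have both : ∀ x, x ∈ F ∪ J → τ x ∈ F ∪ J → x ∈ J := by
    intro x h1 h2
    rcases h2 with h2 | h2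
    · have : x ∈ (closure F)ᶜ := hτF2 ▸ h2
      rw [hcl] at this
      exact (this h1).elim
    · exact (Jτ' x).1 h2
  have hFJ : IsClosed (F ∪ J) := hcl ▸ isClosed_closure
  let ψ : S → SS := fun x => if x ∈ F ∪ J then H x else - H (τ x)
  have e1 : ∀ x ∈ F ∪ J, ψ x = H x := fun x hx => if_pos hx
  have e2 : ∀ x, τ x ∈ F ∪ J → ψ x = - H (τ x) := by
    intro x hx
    by_cases h : x ∈ F ∪ J
    · rw [e1 x h, negJ x (both x h hx), neg_neg]
    · exact if_neg h
  have eqv : ∀ x, ψ (τ x) = - ψ x := by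
    intro x
    rcases tri x with h | h
    · rw [e1 x h, e2 (τ x) (by rwa [ττ]), ττ]
    · rw [e1 _ h, e2 x h, neg_neg]
  have neg2 : ∀ w : SS, (-w).1 2 = - w.1 2 := fun w => by simp
  refine ⟨ψ, ?_, ?_, ?_, eqv⟩
  · rw [← continuousOn_univ]
    have hun : (univ : Set S) = (F ∪ J) ∪ τ ⁻¹' (F ∪ J) := by
      ext x; simpa using tri x
    rw [hun]
    apply ContinuousOn.union_of_isClosed _ _ hFJ (hFJ.preimage τc)
    · exact H.continuous.continuousOn.congr e1
    · exact (continuous_neg.comp (H.continuous.comp τc)).continuousOn.congr e2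
  · have pos : ∀ x y, x ∈ F ∪ J → ψ x = ψ y → x = y := by
      intro x y hx h
      by_cases hy : y ∈ F ∪ J
      · rw [e1 x hx, e1 y hy] at h
        exact H.injective h
      · have hy' := (tri y).resolve_left hy
        rw [e1 x hx, e2 y hy'] at h
        have h1 := (hHc _).1 hx
        have h2 := (hHc _).1 hy'
        have h3 := neg2 (H (τ y))
        rw [← h] at h3
        have h4 : (H (τ y)).1 2 = 0 := by linarith
        exact (hy (Or.inr ((Jτ' y).1 ((hHJ _).2 h4)))).elim
    intro x y h
    rcases tri x with hx | hx
    · exact pos x y hx h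
    · apply τi
      exact pos (τ x) (τ y) hx (by rw [eqv, eqv, h])
  · have pos : ∀ w : SS, 0 ≤ w.1 2 → ∃ x, ψ x = w := by
      intro w hw
      refine ⟨H.symm w, ?_⟩
      rw [e1 _ (by rw [hHc, H.apply_symm_apply]; exact hw), H.apply_symm_apply]
    intro w
    rcases le_total 0 (w.1 2) with h | h
    · exact pos w h
    · obtain ⟨x, hx⟩ := pos (-w) (by rw [neg2]; linarith)
      exact ⟨τ x, by rw [eqv, hx, neg_neg]⟩
end inv

theorem core {M : Type} [TopologicalSpace M] [CompactSpace M] [T2Space M] [SecondCountableTopology M]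
    [LocallyConnectedSpace M] [PreconnectedSpace M] {Z : Set M} (hZ : IsClosed Z) (hne : Z.Nonempty)
    (hl : ∀ x ∈ Z, PlaneChart Z x)
    (hcomp : ∀ P, IsComp Zᶜ P → ∃ j : (Fin 3 → ℝ) → M, IsOpenEmbedding j ∧ range j = P) :
    (Nonempty (Z ≃ₜ sphere (0 : E3) 1) ∧ Nonempty (M ≃ₜ sphere (0 : E4) 1)) ∨
    (Nonempty (Z ≃ₜ Quot (fun x y : sphere (0 : E3) 1 => (y : E3) = -(x : E3))) ∧
    Nonempty (M ≃ₜ Quot (fun x y : sphere (0 : E4) 1 => (y : E4) = -(x : E4)))) := by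
  obtain ⟨C⟩ := exists_dcov hZ (fun z hz => (hl z hz).twoSided)
  have := C.t2
  have := C.compact
  have := C.metrizable
  have hpre : ∀ P, IsComp Zᶜ P → IsPreconnected (C.Bd P) := by
    intro P hP
    obtain ⟨j, hj, hjr⟩ := hcomp P hP
    exact (C.hat_main hZ hl hP hj hjr).2.1
  obtain ⟨P, P', hP, hP', ht, hu⟩ := C.pair hZ hl hne hpre
  obtain ⟨j, hj, hjr⟩ := hcomp P hP
  obtain ⟨b1, b2, b3, b4, -⟩ := C.hat_main hZ hl hP hj hjr
  have hBc : IsClosed (C.Bd P) := isClosed_closure.inter (hZ.preimage C.cov.continuous)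
  have : CompactSpace (C.Bd P) := isCompact_iff_compactSpace.1 hBc.isCompact
  have : Nonempty (C.Bd P) := b1.to_subtype
  have : PreconnectedSpace (C.Bd P) := isPreconnected_iff_preconnectedSpace.1 b2
  -- turning a homeomorphism of subtypes into a map on the ambient space
  have conv : ∀ f : C.Bd P → SS, Continuous f → Function.Injective f → Function.Surjective f →
      ∃ ψ : C.D → E3, ContinuousOn ψ (C.Bd P) ∧ InjOn ψ (C.Bd P) ∧ ψ '' C.Bd P = sphere 0 1 ∧
        ∀ x (hx : x ∈ C.Bd P), ψ x = f ⟨x, hx⟩ := by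
    intro f fc fi fs
    obtain ⟨ψ, hψ, hψf⟩ := exists_continuousOn_of_subtype (g := fun x => (f x : E3)) (continuous_subtype_val.comp fc)
    refine ⟨ψ, hψ, ?_, ?_, hψf⟩
    · intro x hx y hy h
      rw [hψf x hx, hψf y hy] at h
      exact congrArg Subtype.val (fi (Subtype.ext h))
    · ext w
      constructor
      · rintro ⟨x, hx, rfl⟩
        rw [hψf x hx]; exact (f _).2
      · intro hw
        obtain ⟨x, hx⟩ := fs ⟨w, hw⟩
        refine ⟨x, x.2, ?_⟩
        rw [hψf x x.2, hx]
  by_cases hPP : P = P'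
  · right
    subst hPP
    have tm : ∀ x ∈ C.Bd P, C.t x ∈ C.Bd P := fun x hx => by
      have := mem_image_of_mem C.t hx
      rwa [ht] at this
    obtain ⟨f, fc, fi, fs, fe⟩ := sphere_of_inv b3 b4 (τ := fun x => ⟨C.t x, tm x x.2⟩)
      ((C.t_cont.comp continuous_subtype_val).subtype_mk _)
      (fun x => Subtype.ext (C.t_t x)) (fun x h => C.t_ne x (congrArg Subtype.val h))
    obtain ⟨ψ, p1, p2, p3, p4⟩ := conv f fc fi fs
    rw [union_self] at hu
    refine C.main_A hZ hl hP hj hjr ht hu ψ p1 p2 p3 ?_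
    intro x hx
    rw [p4 _ (tm x hx), p4 x hx]
    exact congrArg Subtype.val (fe ⟨x, hx⟩)
  · left
    obtain ⟨j', hj', hjr'⟩ := hcomp P' hP'
    obtain ⟨f⟩ := sphere_of_sep b3 b4
    obtain ⟨ψ, p1, p2, p3, p4⟩ := conv f f.continuous f.injective f.surjective
    exact C.main_B hZ hl hP hP' hj hjr hj' hjr' hPP ht hu ψ p1 p2 p3
end QF

/-- If a quasi-filling Dehn surface of `M` is an embedded surface
(no singular points), then it is a sphere or a projective plane, and correspondingly
`M` is `S³` or `ℝP³`. -/
theorem quasiFilling_surface_sphere_or_rp2 (M : Type) [TopologicalSpace M] [T2Space M]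
    [CompactSpace M] [ConnectedSpace M] [ChartedSpace (EuclSp 3) M]
    (Sg : Set M) (h : QuasiFilling M Sg) (hs : singularSet M Sg = ∅) :
    (Nonempty (↥Sg ≃ₜ Sphere2) ∧ Nonempty (M ≃ₜ Sphere3)) ∨
    (Nonempty (↥Sg ≃ₜ RP 2) ∧ Nonempty (M ≃ₜ RP 3)) := by
  obtain ⟨⟨hZ, hne, -⟩, hc⟩ := h
  haveI : LocallyConnectedSpace M := ChartedSpace.locallyConnectedSpace (EuclSp 3) M
  haveI : SecondCountableTopology M := ChartedSpace.secondCountable_of_sigmaCompact (EuclSp 3) M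
  have hl : ∀ x ∈ Sg, QF.PlaneChart Sg x := by
    intro x hx
    have h1 : x ∈ simplePoints M Sg := by
      by_contra h2
      have : x ∈ singularSet M Sg := ⟨hx, h2⟩
      rw [hs] at this
      exact this
    obtain ⟨-, U, hU, hxU, φ, h0, hφ⟩ := h1
    refine ⟨fun v => (φ.symm v : M), hU.isOpenEmbedding_subtypeVal.comp φ.symm.isOpenEmbedding, ?_, ?_⟩
    · show (φ.symm 0 : M) = x
      rw [← h0, φ.symm_apply_apply]
    · intro v
      have h3 : φ.symm v ∈ (Subtype.val ⁻¹' Sg : Set U) ↔ φ.symm v ∈ ⇑φ ⁻¹' coordPlanes 1 := by rw [hφ]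
      rw [mem_preimage, mem_preimage, φ.apply_symm_apply] at h3
      show (φ.symm v : M) ∈ Sg ↔ v 0 = 0
      rw [h3]
      constructor
      · rintro ⟨i, hi, hv⟩
        have : i = 0 := Fin.ext (by simpa using hi)
        rwa [this] at hv
      · intro hv
        exact ⟨0, by simp, hv⟩
  have hcomp : ∀ P, QF.IsComp Sgᶜ P → ∃ j : (Fin 3 → ℝ) → M, IsOpenEmbedding j ∧ range j = P := by
    intro P hP
    obtain ⟨x, hx⟩ := hP.1
    have hxS : x ∈ Sgᶜ := hP.2.2.2.1 hx
    have hPe : connectedComponentIn Sgᶜ x = P := by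
      apply Subset.antisymm
      · exact hP.subset isPreconnected_connectedComponentIn (connectedComponentIn_subset _ _)
          ⟨x, mem_connectedComponentIn hxS, hx⟩
      · exact hP.2.2.1.subset_connectedComponentIn hx hP.2.2.2.1
    obtain ⟨g⟩ := hc x hxS
    rw [hPe] at g
    refine ⟨fun v => (g.symm v : M), hP.2.1.isOpenEmbedding_subtypeVal.comp g.symm.isOpenEmbedding, ?_⟩
    ext y
    constructor
    · rintro ⟨v, rfl⟩
      exact (g.symm v).2
    · intro hy
      exact ⟨g ⟨y, hy⟩, by simp⟩
  exact QF.core hZ hne hl hcomp
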